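/- Consider the linear hyperbolic system ∂_t u + a(x,t)∂_x u + b(x,t)u = 0 on (0,1)×ℝ with the reflection boundary conditions, where a = diag(a₁,…,aₙ) and b = (b_{jk}) have bounded continuous partial derivatives up to first order on [0,1]×ℝ and a satisfies the Λ₀-condition; assume (H3). Let {U(t,s)}_{t≥s} be the evolution family on L²((0,1);ℝⁿ) generated by this problem, and assume it has an exponential dichotomy on ℝ with exponent α > 0 and bound M ≥ 1. Then there exists ε₀ > 0 such that for all ã = diag(ã₁,…,ãₙ) and b̃ = (b̃_{jk}) whose entries have bounded continuous partial derivatives up to second order on [0,1]×ℝ with ‖ã‖_{BC¹} ≤ ε₀ and ‖b̃‖_{BC} ≤ ε₀, the evolution family {Ũ(t,s)}_{t≥s} on L²((0,1);ℝⁿ) generated by the perturbed problem ∂_t v + (a+ã)(x,t)∂_x v + (b+b̃)(x,t)v = 0 with the same reflection boundary conditions has an exponential dichotomy on ℝ with some exponent α₁ ≤ α and bound M₁ ≥ M depending on ε₀ but not on ã and b̃. -/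

import Mathlib

noncomputable section

open MeasureTheory Set Filter

/-- `ℝⁿ` with the Euclidean norm. -/
abbrev Vn (n : ℕ) : Type := EuclideanSpace ℝ (Fin n)

/-- The strip `[0,1] × ℝ`. -/
def strip : Set (ℝ × ℝ) := Set.Icc (0:ℝ) 1 ×ˢ (Set.univ : Set ℝ)

/-- `g` is `C^k` on the strip `[0,1] × ℝ` with the function and all its partial
derivatives up to order `k` bounded by `C` there (the `BC^k`-norm is `≤ C`). -/
def BCle (k : ℕ) (g : ℝ → ℝ → ℝ) (C : ℝ) : Prop :=
  ContDiffOn ℝ k (fun q : ℝ × ℝ => g q.1 q.2) strip ∧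
  ∀ i : ℕ, i ≤ k → ∀ q ∈ strip,
    ‖iteratedFDerivWithin ℝ i (fun q : ℝ × ℝ => g q.1 q.2) strip q‖ ≤ C

/-- The reflection boundary conditions relating the boundary values
`w0 = u(0,t)` and `w1 = u(1,t)`. -/
def BCrel (n m : ℕ) (p : Fin n → Fin n → ℝ) (w0 w1 : Vn n) : Prop :=
  ∀ j : Fin n,
    ((j : ℕ) < m →
      w0 j = ∑ k : Fin n, if m ≤ (k : ℕ) then p j k * w0 k else p j k * w1 k) ∧
    (m ≤ (j : ℕ) →
      w1 j = ∑ k : Fin n, if m ≤ (k : ℕ) then p j k * w0 k else p j k * w1 k)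

/-- Assumption (H3). -/
def H3cond (n : ℕ) (p : Fin n → Fin n → ℝ) : Prop :=
  ∀ i : Fin (n + 1) → Fin n, ∏ l : Fin n, p (i l.castSucc) (i l.succ) = 0

/-- The `Λ₀`-condition on the diagonal coefficients `a`. -/
def LamCond (n m : ℕ) (Λ₀ : ℝ) (a : ℝ → ℝ → Fin n → ℝ) : Prop :=
  ∀ x ∈ Set.Icc (0:ℝ) 1, ∀ t : ℝ,
    (∀ j : Fin n, ((j : ℕ) < m → Λ₀ ≤ a x t j) ∧ (m ≤ (j : ℕ) → a x t j ≤ -Λ₀)) ∧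
    ∀ j k : Fin n, j ≠ k → Λ₀ ≤ |a x t j - a x t k|

/-- A classical solution `u` (with partial derivatives `ux`, `ut`) of the linear
problem `∂ₜu + a ∂ₓu + b u = f` on `[0,1] × [s,∞)` with the reflection boundary
conditions and initial datum `φ` at time `s`. -/
def IsLinSol (n m : ℕ) (p : Fin n → Fin n → ℝ)
    (a : ℝ → ℝ → Fin n → ℝ) (b : ℝ → ℝ → Fin n → Fin n → ℝ)
    (f : ℝ → ℝ → Fin n → ℝ) (s : ℝ) (φ : ℝ → Vn n)
    (u ux ut : ℝ → ℝ → Vn n) : Prop :=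
  ContinuousOn (fun q : ℝ × ℝ => u q.1 q.2) (Set.Icc 0 1 ×ˢ Set.Ici s) ∧
  ContinuousOn (fun q : ℝ × ℝ => ux q.1 q.2) (Set.Icc 0 1 ×ˢ Set.Ici s) ∧
  ContinuousOn (fun q : ℝ × ℝ => ut q.1 q.2) (Set.Icc 0 1 ×ˢ Set.Ici s) ∧
  (∀ x ∈ Set.Icc (0:ℝ) 1, ∀ t ∈ Set.Ici s, ∀ j : Fin n,
    HasDerivWithinAt (fun y => u y t j) (ux x t j) (Set.Icc 0 1) x ∧
    HasDerivWithinAt (fun τ => u x τ j) (ut x t j) (Set.Ici s) t) ∧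
  (∀ x ∈ Set.Icc (0:ℝ) 1, ∀ t ∈ Set.Ici s, ∀ j : Fin n,
    ut x t j + a x t j * ux x t j + ∑ k : Fin n, b x t j k * u x t k = f x t j) ∧
  (∀ t ∈ Set.Ici s, BCrel n m p (u 0 t) (u 1 t)) ∧
  (∀ x ∈ Set.Icc (0:ℝ) 1, u x s = φ x)

/-- Lebesgue measure restricted to `(0,1)`. -/
abbrev μ01 : Measure ℝ := volume.restrict (Set.Ioo (0:ℝ) 1)

/-- The space `L²((0,1); ℝⁿ)`. -/
abbrev L2 (n : ℕ) := Lp (Vn n) 2 μ01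

/-- An evolution family of bounded linear operators. -/
def IsEvoFam {X : Type*} [NormedAddCommGroup X] [NormedSpace ℝ X]
    (U : ℝ → ℝ → X →L[ℝ] X) : Prop :=
  (∀ t : ℝ, U t t = ContinuousLinearMap.id ℝ X) ∧
  (∀ s r t : ℝ, s ≤ r → r ≤ t → ∀ x : X, U t r (U r s x) = U t s x)

/-- `U` is the evolution family on `L²((0,1);ℝⁿ)` generated by the linear
problem with coefficients `a`, `b`: it is a strongly continuous, exponentially
bounded evolution family which, on `C¹` data with compact support in `(0,1)`,
is given by the classical solutions. -/
def GeneratedBy (n m : ℕ) (p : Fin n → Fin n → ℝ)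
    (a : ℝ → ℝ → Fin n → ℝ) (b : ℝ → ℝ → Fin n → Fin n → ℝ)
    (U : ℝ → ℝ → L2 n →L[ℝ] L2 n) : Prop :=
  IsEvoFam U ∧
  (∀ φ : L2 n, ContinuousOn (fun q : ℝ × ℝ => U q.1 q.2 φ) {q : ℝ × ℝ | q.2 ≤ q.1}) ∧
  (∃ K : ℝ, 1 ≤ K ∧ ∃ ν : ℝ, ∀ s t : ℝ, s ≤ t →
    ‖U t s‖ ≤ K * Real.exp (ν * (t - s))) ∧
  ∀ s : ℝ, ∀ φ : ℝ → Vn n, ContDiff ℝ 1 φ → tsupport φ ⊆ Set.Ioo 0 1 →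
    ∀ φh : L2 n, (∀ᵐ x ∂μ01, φh x = φ x) →
    ∀ u ux ut : ℝ → ℝ → Vn n,
      IsLinSol n m p a b (fun _ _ _ => 0) s φ u ux ut →
      ∀ t : ℝ, s ≤ t → ∀ᵐ x ∂μ01, (U t s φh) x = u x t

/-- Exponential dichotomy on `ℝ` with exponent `α` and bound `M`. -/
def HasExpDichotomy {X : Type*} [NormedAddCommGroup X] [NormedSpace ℝ X]
    (U : ℝ → ℝ → X →L[ℝ] X) (α M : ℝ) : Prop :=
  ∃ P : ℝ → X →L[ℝ] X, ∃ W : ℝ → ℝ → X →L[ℝ] X,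
    (∀ t, (P t).comp (P t) = P t) ∧
    (∀ x : X, Continuous fun t => P t x) ∧
    (∀ x : X, ∃ C : ℝ, ∀ t, ‖P t x‖ ≤ C) ∧
    (∀ s t : ℝ, s ≤ t → (U t s).comp (P s) = (P t).comp (U t s)) ∧
    (∀ s t : ℝ, s ≤ t → ∀ x : X, W s t (U t s (x - P s x)) = x - P s x) ∧
    (∀ s t : ℝ, s ≤ t → ∀ x : X, U t s (W s t (x - P t x)) = x - P t x) ∧
    (∀ s t : ℝ, s ≤ t → ∀ x : X, P s (W s t (x - P t x)) = 0) ∧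
    (∀ s t : ℝ, s ≤ t → ‖(U t s).comp (P s)‖ ≤ M * Real.exp (-α * (t - s))) ∧
    (∀ s t : ℝ, s ≤ t →
      ‖(W s t).comp (ContinuousLinearMap.id ℝ X - P t)‖ ≤ M * Real.exp (-α * (t - s)))


section AbstractRobust

/-- geometric sum over the integers -/
def gS (ρ : ℝ) : ℝ := ∑' i : ℤ, ρ ^ i.natAbs

lemma gS_summable {ρ : ℝ} (h0 : 0 ≤ ρ) (h1 : ρ < 1) : Summable (fun i : ℤ => ρ ^ i.natAbs) := by
  apply Summable.of_nat_of_neg <;> simpa using summable_geometric_of_lt_one h0 h1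

lemma gS_shift_summable {ρ : ℝ} (h0 : 0 ≤ ρ) (h1 : ρ < 1) (k : ℤ) :
    Summable (fun i : ℤ => ρ ^ (k - i).natAbs) :=
  ((Equiv.subLeft k).summable_iff (f := fun i : ℤ => ρ ^ i.natAbs)).mpr (gS_summable h0 h1)

lemma gS_shift {ρ : ℝ} (k : ℤ) : ∑' i : ℤ, ρ ^ (k - i).natAbs = gS ρ :=
  (Equiv.subLeft k).tsum_eq (fun i : ℤ => ρ ^ i.natAbs)

lemma gS_pos {ρ : ℝ} (h0 : 0 ≤ ρ) (h1 : ρ < 1) : 1 ≤ gS ρ := by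
  have := (gS_summable h0 h1).le_tsum (0:ℤ) (fun i _ => by positivity)
  simpa [gS] using this

/-- Fixed point for a small infinite linear system. -/
lemma fix_seq {E : Type*} [NormedAddCommGroup E] [NormedSpace ℝ E] [CompleteSpace E]
    (T : ℤ → ℤ → E →L[ℝ] E) (c : ℤ → ℤ → ℝ) (hT : ∀ k i, ‖T k i‖ ≤ c k i)
    (hc : ∀ k, Summable (c k)) (hc2 : ∀ k, ∑' i, c k i ≤ 1/2)
    (f : ℤ → E) (B : ℝ) (hf : ∀ k, ‖f k‖ ≤ B) :
    ∃ Z : ℤ → E, (∀ k, ‖Z k‖ ≤ 2 * B) ∧ (∀ k, Summable fun i => T k i (Z i)) ∧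
      ∀ k, Z k = f k + ∑' i, T k i (Z i) := by
  have hB : 0 ≤ B := (norm_nonneg _).trans (hf 0)
  have hc0 : ∀ k i, 0 ≤ c k i := fun k i => (norm_nonneg _).trans (hT k i)
  have key : ∀ (Z : ℤ → E) (b : ℝ), (∀ k, ‖Z k‖ ≤ b) → ∀ k,
      Summable (fun i => T k i (Z i)) ∧ ‖∑' i, T k i (Z i)‖ ≤ b / 2 := by
    intro Z b hZ k
    have hb : 0 ≤ b := (norm_nonneg _).trans (hZ 0)
    have h1 : ∀ i, ‖T k i (Z i)‖ ≤ c k i * b := fun i =>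
      ((T k i).le_opNorm _).trans (mul_le_mul (hT k i) (hZ i) (norm_nonneg _) (hc0 k i))
    have hs : Summable (fun i => c k i * b) := (hc k).mul_right b
    refine ⟨Summable.of_norm_bounded hs h1, ?_⟩
    refine (tsum_of_norm_bounded hs.hasSum h1).trans ?_
    rw [tsum_mul_right]
    nlinarith [hc2 k]
  let Φ : BoundedContinuousFunction ℤ E → BoundedContinuousFunction ℤ E := fun Z =>
    BoundedContinuousFunction.ofNormedAddCommGroup (fun k => f k + ∑' i, T k i (Z i))
      continuous_of_discreteTopology (B + ‖Z‖ / 2) (fun k =>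
        (norm_add_le _ _).trans (add_le_add (hf k) (key Z ‖Z‖ Z.norm_coe_le_norm k).2))
  have hΦ : ContractingWith (1/2) Φ := by
    refine ⟨by rw [← NNReal.coe_lt_coe]; push_cast; norm_num, ?_⟩
    refine LipschitzWith.of_dist_le_mul fun Z Z' => ?_
    rw [BoundedContinuousFunction.dist_le (by positivity)]
    intro k
    have h1 := (key Z _ Z.norm_coe_le_norm k).1
    have h2 := (key Z' _ Z'.norm_coe_le_norm k).1
    have h3 := (key (fun k => Z k - Z' k) (dist Z Z')
      (fun k => by rw [← dist_eq_norm]; exact BoundedContinuousFunction.dist_coe_le_dist k) k).2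
    have : Φ Z k - Φ Z' k = ∑' i, T k i (Z i - Z' i) := by
      change (f k + ∑' i, T k i (Z i)) - (f k + ∑' i, T k i (Z' i)) = _
      rw [add_sub_add_left_eq_sub, ← h1.tsum_sub h2]
      simp
    rw [dist_eq_norm, this]
    push_cast
    linarith
  obtain ⟨Z, hZ⟩ : ∃ Z, Φ Z = Z := ⟨_, hΦ.fixedPoint_isFixedPt⟩
  have hZk : ∀ k, Z k = f k + ∑' i, T k i (Z i) := fun k => by
    conv_lhs => rw [← hZ]
    rfl
  refine ⟨Z, fun k => ?_, fun k => (key Z _ Z.norm_coe_le_norm k).1, hZk⟩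
  have : ‖Z‖ ≤ B + ‖Z‖ / 2 := by
    conv_lhs => rw [← hZ]
    exact BoundedContinuousFunction.norm_ofNormedAddCommGroup_le _ (by positivity) _
  linarith [Z.norm_coe_le_norm k]

variable {X : Type*} [NormedAddCommGroup X] [NormedSpace ℝ X]

/-- Discrete Green function data. -/
structure Green (V : ℤ → X →L[ℝ] X) (G : ℤ → ℤ → X →L[ℝ] X) (M q : ℝ) : Prop where
  bd : ∀ k i, ‖G k i‖ ≤ M * q ^ (k - i).natAbs
  rc : ∀ k i x, G (k+1) i x = V k (G k i x) + if i = k + 1 then x else 0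
  un : ∀ d : ℤ → X, (∃ B, ∀ k, ‖d k‖ ≤ B) → (∀ k, d (k+1) = V k (d k)) → ∀ k, d k = 0

/-- smallness in two steps -/
structure Close (V Vt : ℤ → X →L[ℝ] X) (K δ : ℝ) : Prop where
  bV : ∀ k, ‖V k‖ ≤ K
  bVt : ∀ k, ‖Vt k‖ ≤ K
  c1 : ∀ k, ‖(Vt (k+1) - V (k+1)).comp (Vt k)‖ ≤ δ
  c2 : ∀ k, ‖(Vt (k+1) - V (k+1)).comp (V k)‖ ≤ δ

lemma apriori [CompleteSpace X] {V Vt : ℤ → X →L[ℝ] X} {G : ℤ → ℤ → X →L[ℝ] X} {M q K δ : ℝ}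
    (hq0 : 0 < q) (hq1 : q < 1) (hM : 0 < M)
    (hG : Green V G M q) (hC : Close V Vt K δ) (hδ : M * gS q * δ ≤ 1/2)
    (d h : ℤ → X) (hd : ∃ B, ∀ k, ‖d k‖ ≤ B) (η : ℝ) (hh : ∀ k, ‖h k‖ ≤ η)
    (hrec : ∀ k, d (k+1) = Vt k (d k) + h (k+1)) :
    ∀ k, ‖d k‖ ≤ 2 * (M * gS q * (2 * K + 1) * η) := by
  have hη : 0 ≤ η := (norm_nonneg _).trans (hh 0)
  have hK : 0 ≤ K := (norm_nonneg _).trans (hC.bV 0)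
  have hδ0 : 0 ≤ δ := (norm_nonneg _).trans (hC.c1 0)
  obtain ⟨B0, hB0⟩ := hd
  have hbdd : BddAbove (Set.range fun k => ‖d k‖) := ⟨B0, by rintro _ ⟨k, rfl⟩; exact hB0 k⟩
  set B := ⨆ k, ‖d k‖
  have hB : ∀ k, ‖d k‖ ≤ B := fun k => le_ciSup hbdd k
  let g : ℤ → X := fun k => d k - V (k-1) (d (k-1))
  have hg : ∀ k, ‖g k‖ ≤ δ * B + (2 * K + 1) * η := by
    intro k
    have e1 := hrec (k-1)
    have e2 := hrec (k-1-1)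
    simp only [sub_add_cancel] at e1 e2
    have c1 := hC.c1 (k-1-1)
    simp only [sub_add_cancel] at c1
    have : g k = ((Vt (k-1) - V (k-1)).comp (Vt (k-1-1))) (d (k-1-1))
        + ((Vt (k-1) - V (k-1)) (h (k-1)) + h k) := by
      simp only [g]
      rw [e1]
      conv_lhs => rw [e2]
      simp
      abel
    rw [this]
    refine (norm_add_le _ _).trans (add_le_add ?_ ?_)
    · exact (ContinuousLinearMap.le_opNorm _ _).trans
        (mul_le_mul c1 (hB _) (norm_nonneg _) hδ0)
    · refine (norm_add_le _ _).trans ?_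
      have h2 : ‖(Vt (k-1) - V (k-1)) (h (k-1))‖ ≤ (2 * K) * η :=
        (ContinuousLinearMap.le_opNorm _ _).trans (mul_le_mul
          ((norm_sub_le _ _).trans (by linarith [hC.bV (k-1), hC.bVt (k-1)]))
          (hh _) (norm_nonneg _) (by positivity))
      linarith [hh k]
  set bg := δ * B + (2 * K + 1) * η
  have hbg : 0 ≤ bg := (norm_nonneg _).trans (hg 0)
  have hb : ∀ k i, ‖G k i (g i)‖ ≤ q ^ (k-i).natAbs * (M * bg) := fun k i =>
    ((G k i).le_opNorm _).trans (by
      calc ‖G k i‖ * ‖g i‖ ≤ (M * q ^ (k-i).natAbs) * bg :=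
            mul_le_mul (hG.bd k i) (hg i) (norm_nonneg _) (by positivity)
        _ = _ := by ring)
  have hsm : ∀ k, Summable (fun i : ℤ => q ^ (k-i).natAbs * (M * bg)) := fun k =>
    (gS_shift_summable hq0.le hq1 k).mul_right _
  have hs : ∀ k, Summable (fun i => G k i (g i)) := fun k =>
    Summable.of_norm_bounded (hsm k) (hb k)
  have hyb : ∀ k, ‖∑' i, G k i (g i)‖ ≤ M * gS q * bg := fun k => by
    refine (tsum_of_norm_bounded (hsm k).hasSum (hb k)).trans ?_
    rw [tsum_mul_right, gS_shift]
    apply le_of_eq; ring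
  have hy : ∀ k, ∑' i, G (k+1) i (g i) = V k (∑' i, G k i (g i)) + g (k+1) := by
    intro k
    rw [ContinuousLinearMap.map_tsum _ (hs k)]
    have : ∀ i, G (k+1) i (g i) = V k (G k i (g i)) + if i = k+1 then g i else 0 :=
      fun i => hG.rc k i (g i)
    simp_rw [this]
    have hs1 : Summable (fun i => V k (G k i (g i))) := (hs k).map (V k) (V k).continuous
    rw [Summable.tsum_add hs1]
    · congr 1
      simp
    · exact (hasSum_ite_eq (k+1) (g (k+1))).summable.congr (fun i => by
        by_cases hi : i = k+1 <;> simp [hi])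
  have hz := hG.un (fun k => d k - ∑' i, G k i (g i))
    ⟨B + M * gS q * bg, fun k => (norm_sub_le _ _).trans (add_le_add (hB k) (hyb k))⟩
    (fun k => by
      rw [hy, map_sub]
      simp only [g, add_sub_cancel_right]
      abel)
  have hdk : ∀ k, ‖d k‖ ≤ M * gS q * bg := fun k => by
    rw [sub_eq_zero.mp (hz k)]; exact hyb k
  have hBle : B ≤ M * gS q * bg := ciSup_le hdk
  have hB0' : 0 ≤ B := (norm_nonneg _).trans (hB 0)
  intro k
  refine (hB k).trans ?_
  have : M * gS q * bg = (M * gS q * δ) * B + M * gS q * (2 * K + 1) * η := by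
    simp only [bg]; ring
  nlinarith

end AbstractRobust



section AbstractRobust2
variable {X : Type*} [NormedAddCommGroup X] [NormedSpace ℝ X]

lemma solveY [CompleteSpace X] {V Vt : ℤ → X →L[ℝ] X} {G : ℤ → ℤ → X →L[ℝ] X} {M r K δ : ℝ}
    (hr0 : 0 < r) (hr1 : r < 1) (hM : 0 < M)
    (hG : Green V G M (r^2)) (hC : Close V Vt K δ) (hδ : M * δ / r^2 * gS r ≤ 1/2)
    (hδ2 : 2 * δ ≤ 1/2) :
    ∃ Y : ℤ → X →L[ℝ] X, (∀ k, ‖Y k‖ ≤ 2 * (M * (1 + 2 * K / r)) * r ^ k.natAbs) ∧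
      ∀ k x, Y (k+1) x = Vt k (Y k x) + if k + 1 = 0 then x else 0 := by
  have hK : 0 ≤ K := (norm_nonneg _).trans (hC.bV 0)
  have hδ0 : 0 ≤ δ := (norm_nonneg _).trans (hC.c1 0)
  let D : ℤ → X →L[ℝ] X := fun k => Vt k - V k
  have hD : ∀ k, ‖D k‖ ≤ 2 * K := fun k => (norm_sub_le _ _).trans
    (by linarith [hC.bV k, hC.bVt k])
  let A : ℤ → ℤ → X →L[ℝ] X := fun k j => (G k (j+2)).comp ((D (j+1)).comp (Vt j))
  have hA : ∀ k j, ‖A k j‖ ≤ M * (r^2) ^ (k - (j+2)).natAbs * δ := fun k j =>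
    (ContinuousLinearMap.opNorm_comp_le _ _).trans
      (mul_le_mul (hG.bd _ _) (hC.c1 j) (norm_nonneg _) (by positivity))
  let T : ℤ → ℤ → (X →L[ℝ] X) →L[ℝ] (X →L[ℝ] X) := fun k j =>
    (r ^ j.natAbs / r ^ k.natAbs) • (ContinuousLinearMap.compL ℝ X X X (A k j))
  have hTa : ∀ k j Z, T k j Z = (r ^ j.natAbs / r ^ k.natAbs) • (A k j).comp Z := fun k j Z => rfl
  have hT : ∀ k j, ‖T k j‖ ≤ M * δ / r^2 * r ^ ((k-2) - j).natAbs := by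
    intro k j
    refine ContinuousLinearMap.opNorm_le_bound _ (by positivity) fun Z => ?_
    rw [hTa, norm_smul, Real.norm_of_nonneg (by positivity)]
    have e : r ^ j.natAbs / r ^ k.natAbs * (r^2) ^ (k - (j+2)).natAbs ≤
        r ^ ((k-2) - j).natAbs / r^2 := by
      rw [div_mul_eq_mul_div, div_le_div_iff₀ (by positivity) (by positivity)]
      have : ((k-2) - j).natAbs = (k - (j+2)).natAbs := by congr 1; ring
      rw [this, ← pow_mul, ← pow_add, ← pow_add, ← pow_add]
      apply pow_le_pow_of_le_one hr0.le hr1.le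
      omega
    calc r ^ j.natAbs / r ^ k.natAbs * ‖(A k j).comp Z‖
        ≤ r ^ j.natAbs / r ^ k.natAbs * ((M * (r^2) ^ (k - (j+2)).natAbs * δ) * ‖Z‖) := by
          gcongr
          exact (ContinuousLinearMap.opNorm_comp_le _ _).trans (by gcongr; exact hA k j)
      _ = (r ^ j.natAbs / r ^ k.natAbs * (r^2) ^ (k - (j+2)).natAbs) * (M * δ * ‖Z‖) := by ring
      _ ≤ (r ^ ((k-2) - j).natAbs / r^2) * (M * δ * ‖Z‖) := by gcongr
      _ = _ := by ring
  let f0 : ℤ → X →L[ℝ] X := fun k => G k 0 + (G k 1).comp (D 0)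
  have hf : ∀ k, ‖(1 / r ^ k.natAbs) • f0 k‖ ≤ M * (1 + 2 * K / r) := by
    intro k
    rw [norm_smul, Real.norm_of_nonneg (by positivity)]
    have h0 : ‖f0 k‖ ≤ M * (r^2) ^ (k - 0).natAbs + M * (r^2) ^ (k - 1).natAbs * (2 * K) :=
      (norm_add_le _ _).trans (add_le_add (hG.bd _ _)
        ((ContinuousLinearMap.opNorm_comp_le _ _).trans
          (mul_le_mul (hG.bd _ _) (hD 0) (norm_nonneg _) (by positivity))))
    have e1 : 1 / r ^ k.natAbs * (r^2) ^ (k - 0).natAbs ≤ 1 := by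
      rw [one_div_mul_eq_div, div_le_one (by positivity), ← pow_mul]
      apply pow_le_pow_of_le_one hr0.le hr1.le
      omega
    have e2 : 1 / r ^ k.natAbs * (r^2) ^ (k - 1).natAbs ≤ 1 / r := by
      rw [one_div_mul_eq_div, div_le_div_iff₀ (by positivity) hr0, ← pow_mul, one_mul, ← pow_succ]
      apply pow_le_pow_of_le_one hr0.le hr1.le
      omega
    calc 1 / r ^ k.natAbs * ‖f0 k‖
        ≤ 1 / r ^ k.natAbs * (M * (r^2) ^ (k - 0).natAbs + M * (r^2) ^ (k - 1).natAbs * (2 * K)) :=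
          by gcongr
      _ = M * (1 / r ^ k.natAbs * (r^2) ^ (k - 0).natAbs) +
            (M * (2 * K)) * (1 / r ^ k.natAbs * (r^2) ^ (k - 1).natAbs) := by ring
      _ ≤ M * 1 + (M * (2 * K)) * (1 / r) := by gcongr
      _ = _ := by ring
  obtain ⟨Z, hZb, hZs, hZ⟩ := fix_seq T (fun k j => M * δ / r^2 * r ^ ((k-2) - j).natAbs) hT
    (fun k => (gS_shift_summable hr0.le hr1 (k-2)).mul_left _)
    (fun k => by rw [tsum_mul_left, gS_shift]; exact hδ) (fun k => (1 / r ^ k.natAbs) • f0 k) _ hf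
  let Y : ℤ → X →L[ℝ] X := fun k => r ^ k.natAbs • Z k
  have hYb : ∀ k, ‖Y k‖ ≤ 2 * (M * (1 + 2 * K / r)) * r ^ k.natAbs := by
    intro k
    simp only [Y]
    rw [norm_smul, Real.norm_of_nonneg (by positivity), mul_comm]
    gcongr
    exact hZb k
  have hYs : ∀ k, Summable fun j => (A k j).comp (Y j) := by
    intro k
    refine ((hZs k).const_smul (r ^ k.natAbs)).congr fun j => ?_
    rw [hTa, smul_smul, mul_div_cancel₀ _ (by positivity)]
    simp [Y]
  have hY : ∀ k, Y k = f0 k + ∑' j, (A k j).comp (Y j) := by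
    intro k
    simp only [Y]
    conv_lhs => rw [hZ k, smul_add, smul_smul, mul_one_div_cancel (by positivity), one_smul]
    congr 1
    rw [← (hZs k).tsum_const_smul]
    congr 1
    ext1 j
    rw [hTa, smul_smul, mul_div_cancel₀ _ (by positivity)]
    simp
  have happ : ∀ k x, Summable (fun j => A k j (Y j x)) ∧
      Y k x = f0 k x + ∑' j, A k j (Y j x) := by
    intro k x
    let ev := ContinuousLinearMap.apply ℝ X x
    have h1 : Summable (fun j => ev ((A k j).comp (Y j))) := (hYs k).map ev ev.continuous
    have h2 : ev (∑' j, (A k j).comp (Y j)) = ∑' j, ev ((A k j).comp (Y j)) :=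
      ev.map_tsum (hYs k)
    refine ⟨h1, ?_⟩
    conv_lhs => rw [hY k]
    rw [add_apply]
    congr 1
  have hstep : ∀ k x, Y (k+1) x = V k (Y k x) + ((if k + 1 = 0 then x else 0) +
      (if k + 1 = 1 then D 0 x else 0) + D k (Vt (k-1) (Y (k-1) x))) := by
    intro k x
    rw [(happ (k+1) x).2, (happ k x).2, map_add, (V k).map_tsum (happ k x).1]
    have hs1 : Summable (fun j => V k (A k j (Y j x))) :=
      (happ k x).1.map (V k) (V k).continuous
    have e1 : ∀ j, A (k+1) j (Y j x) = V k (A k j (Y j x)) +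
        if j = k - 1 then D k (Vt (k-1) (Y (k-1) x)) else 0 := by
      intro j
      simp only [A, ContinuousLinearMap.comp_apply]
      rw [hG.rc k (j+2)]
      congr 1
      by_cases hj : j = k - 1
      · subst hj
        rw [if_pos (by ring), if_pos rfl]
        congr 2; ring
      · rw [if_neg (by omega), if_neg hj]
    simp_rw [e1]
    rw [Summable.tsum_add hs1 (hasSum_ite_eq (k-1) _).summable, tsum_ite_eq]
    have e2 : f0 (k+1) x = V k (f0 k x) + ((if k + 1 = 0 then x else 0) +
      (if k + 1 = 1 then D 0 x else 0)) := by
      simp only [f0, add_apply, ContinuousLinearMap.comp_apply]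
      rw [hG.rc k 0, hG.rc k 1, map_add]
      simp only [eq_comm (a := (0:ℤ)) (b := k+1), eq_comm (a := (1:ℤ)) (b := k+1)]
      abel
    rw [e2]
    abel
  refine ⟨Y, hYb, ?_⟩
  -- the error
  let e : ℤ → X → X := fun k x => Y k x - Vt (k-1) (Y (k-1) x) - if k = 0 then x else 0
  have he : ∀ k x, e (k+1) x = - D k (e k x) := by
    intro k x
    simp only [e, add_sub_cancel_right]
    rw [hstep]
    simp only [D]
    by_cases hk : k = 0
    · subst hk
      simp
      abel
    · rw [if_neg (c := k + 1 = 1) (by omega), if_neg (c := k = 0) hk]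
      simp
      abel
  have heb : ∀ x, ∃ B, ∀ k, ‖e k x‖ ≤ B := by
    intro x
    have hYx : ∀ k, ‖Y k x‖ ≤ 2 * (M * (1 + 2 * K / r)) * ‖x‖ := fun k => by
      refine ((Y k).le_opNorm x).trans ?_
      gcongr
      refine (hYb k).trans ?_
      have : r ^ k.natAbs ≤ 1 := pow_le_one₀ hr0.le hr1.le
      have : 0 ≤ 2 * (M * (1 + 2 * K / r)) := by positivity
      nlinarith
    refine ⟨2 * (M * (1 + 2 * K / r)) * ‖x‖ + K * (2 * (M * (1 + 2 * K / r)) * ‖x‖) + ‖x‖,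
      fun k => ?_⟩
    refine (norm_sub_le _ _).trans (add_le_add ((norm_sub_le _ _).trans
      (add_le_add (hYx k) ?_)) ?_)
    · exact ((Vt (k-1)).le_opNorm _).trans
        (mul_le_mul (hC.bVt _) (hYx _) (norm_nonneg _) hK)
    · split_ifs
      · exact le_rfl
      · simp
  have hee : ∀ k x, ‖e (k+2) x‖ ≤ 1/2 * ‖e k x‖ := by
    intro k x
    have : e (k+2) x = ((D (k+1)).comp (D k)) (e k x) := by
      have := he (k+1) x
      rw [show k+1+1 = k+2 by ring] at this
      rw [this, he]
      simp
    rw [this]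
    have hn : ‖(D (k+1)).comp (D k)‖ ≤ 1/2 := by
      have : (D (k+1)).comp (D k) = (Vt (k+1) - V (k+1)).comp (Vt k) -
        (Vt (k+1) - V (k+1)).comp (V k) := by simp [D]
      rw [this]
      refine (norm_sub_le _ _).trans ?_
      linarith [hC.c1 k, hC.c2 k]
    exact (ContinuousLinearMap.le_opNorm _ _).trans (by gcongr)
  have he0 : ∀ k x, e k x = 0 := by
    intro k x
    obtain ⟨B, hB⟩ := heb x
    have hN : ∀ N : ℕ, ∀ k, ‖e k x‖ ≤ (1/2)^N * B := by
      intro N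
      induction N with
      | zero => intro k; simpa using hB k
      | succ N ih =>
        intro k
        have h1 := hee (k-2) x
        rw [sub_add_cancel] at h1
        have h2 := ih (k-2)
        rw [pow_succ]
        linarith
    have hl : Tendsto (fun N : ℕ => ((1:ℝ)/2)^N * B) atTop (nhds (0 * B)) :=
      (tendsto_pow_atTop_nhds_zero_of_lt_one (by norm_num) (by norm_num)).mul_const B
    rw [zero_mul] at hl
    have := ge_of_tendsto' hl (fun N => hN N k)
    exact norm_le_zero_iff.mp this
  intro k x
  have := he0 (k+1) x
  simp only [e, add_sub_cancel_right] at this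
  rw [sub_sub, sub_eq_zero] at this
  exact this

lemma green_of_dich {U : ℝ → ℝ → X →L[ℝ] X} (hU : IsEvoFam U) {α M : ℝ} (hα : 0 < α)
    (hM : 1 ≤ M)
    (hd : HasExpDichotomy U α M) {T : ℝ} (hT : 0 < T) (s : ℝ) :
    ∃ G : ℤ → ℤ → X →L[ℝ] X,
      Green (fun k : ℤ => U (s + (k+1) * T) (s + k * T)) G M (Real.exp (-(α * T))) := by
  obtain ⟨P, W, hPP, -, -, hcom, hW1, hW2, hW3, hb1, hb2⟩ := hd
  have hs : ∀ i k : ℤ, i ≤ k → s + i * T ≤ s + k * T := fun i k h => by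
    have : (i:ℝ) ≤ k := by exact_mod_cast h
    nlinarith
  have hs1 : ∀ k : ℤ, s + k * T ≤ s + (k+1) * T := fun k => by nlinarith
  have hPk : ∀ k : ℤ, P (s + ((k+1 : ℤ):ℝ) * T) = P (s + (k+1) * T) := fun k => by push_cast; rfl
  refine ⟨fun k i => if i ≤ k then (U (s + k * T) (s + i * T)).comp (P (s + i * T))
    else -((W (s + k * T) (s + i * T)).comp (ContinuousLinearMap.id ℝ X - P (s + i * T))), ?_, ?_, ?_⟩
  · intro k i
    have hexp : ∀ N : ℕ, Real.exp (-(α * T)) ^ N = Real.exp (-α * (N * T)) := fun N => by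
      rw [← Real.exp_nat_mul]; congr 1; ring
    rw [hexp]
    split_ifs with h
    · refine (hb1 _ _ (hs i k h)).trans (le_of_eq ?_)
      congr 3
      have : ((k - i).natAbs : ℝ) = (k - i : ℤ) := by
        rw [Nat.cast_natAbs, abs_of_nonneg (by omega)]
      rw [this]; push_cast; ring
    · rw [norm_neg]
      refine (hb2 _ _ (hs k i (by omega))).trans (le_of_eq ?_)
      congr 3
      have : ((k - i).natAbs : ℝ) = (i - k : ℤ) := by
        rw [Nat.cast_natAbs, abs_of_nonpos (by omega)]; push_cast; ring
      rw [this]; push_cast; ring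
  · intro k i x
    by_cases h1 : i ≤ k
    · rw [if_pos h1, if_pos (by omega), if_neg (by omega), add_zero]
      simp only [ContinuousLinearMap.comp_apply]
      push_cast
      rw [hU.2 _ _ _ (hs i k h1) (hs1 k)]
    · by_cases h2 : i = k + 1
      · subst h2
        rw [if_pos le_rfl, if_neg h1, if_pos rfl]
        simp only [ContinuousLinearMap.comp_apply, neg_apply,
          sub_apply, ContinuousLinearMap.id_apply, map_neg]
        push_cast
        rw [hW2 _ _ (hs1 k), hU.1]
        simp
      · rw [if_neg (by omega), if_neg h1, if_neg h2, add_zero]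
        simp only [ContinuousLinearMap.comp_apply, neg_apply,
          sub_apply, ContinuousLinearMap.id_apply, map_neg, neg_inj]
        have hki := hs k i (by omega)
        have hki1 := hs (k+1) i (by omega)
        push_cast at hki1 ⊢
        set y := W (s + k * T) (s + i * T) (x - P (s + i * T) x) with hy
        have y1 : P (s + k * T) y = 0 := hW3 _ _ hki x
        have y2 : U (s + i * T) (s + k * T) y = x - P (s + i * T) x := hW2 _ _ hki x
        have y3 : P (s + (k+1) * T) (U (s + (k+1) * T) (s + k * T) y) = 0 := by
          have := congrArg (fun L : X →L[ℝ] X => L y) (hcom _ _ (hs1 k))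
          simp only [ContinuousLinearMap.comp_apply] at this
          rw [← this, y1, map_zero]
        have y4 := hW1 _ _ hki1 (U (s + (k+1) * T) (s + k * T) y)
        rw [y3, sub_zero, hU.2 _ _ _ (hs1 k) hki1, y2] at y4
        exact y4
  · rintro d ⟨B, hB⟩ hrec k
    have hB0 : 0 ≤ B := (norm_nonneg _).trans (hB 0)
    have hit : ∀ N : ℕ, ∀ k : ℤ, d (k + N) = U (s + ((k+N:ℤ):ℝ) * T) (s + k * T) (d k) := by
      intro N
      induction N with
      | zero => intro k; simp [hU.1]
      | succ N ih =>
        intro k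
        have := hrec (k+N)
        rw [Nat.cast_succ, ← add_assoc, this, ih k]
        have h1 := hs k (k+N) (by omega)
        have h2 := hs1 (k+N)
        push_cast at h1 h2 ⊢
        exact hU.2 _ _ _ h1 h2 _
    have hcap : ∀ s t : ℝ, s ≤ t → ∀ x, U t s (P s x) = P t (U t s x) := fun s t h x => by
      have := congrArg (fun L : X →L[ℝ] X => L x) (hcom s t h)
      simpa using this
    have hlim : Tendsto (fun N : ℕ => M * Real.exp (-α * (N * T)) * B) atTop (nhds 0) := by
      have : Tendsto (fun N : ℕ => Real.exp (-(α*T)) ^ N) atTop (nhds 0) :=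
        tendsto_pow_atTop_nhds_zero_of_lt_one (Real.exp_pos _).le
          (by rw [Real.exp_lt_one_iff]; nlinarith)
      have := (this.const_mul M).mul_const B
      simp only [mul_zero, zero_mul] at this
      refine this.congr fun N => ?_
      rw [← Real.exp_nat_mul]
      congr 3; ring
    have hP : P (s + k * T) (d k) = 0 := by
      rw [← norm_le_zero_iff]
      refine ge_of_tendsto' hlim fun N => ?_
      have h1 := hit N (k - N)
      rw [sub_add_cancel] at h1
      have hle := hs (k-N) k (by omega)
      rw [h1, ← hcap _ _ hle]
      refine ((U (s + k * T) (s + ((k-N:ℤ):ℝ) * T)).comp (P (s + ((k-N:ℤ):ℝ) * T))).le_opNorm _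
        |>.trans ?_
      refine mul_le_mul ((hb1 _ _ hle).trans (le_of_eq ?_)) (hB _) (norm_nonneg _) (by positivity)
      congr 3; push_cast; ring
    have hQ : d k - P (s + k * T) (d k) = 0 := by
      rw [← norm_le_zero_iff]
      refine ge_of_tendsto' hlim fun N => ?_
      have hle := hs k (k+N) (by omega)
      rw [← hW1 _ _ hle (d k), map_sub, hcap _ _ hle, ← hit N k]
      refine ((W (s + k * T) (s + ((k+N:ℤ):ℝ) * T)).comp (ContinuousLinearMap.id ℝ X -
        P (s + ((k+N:ℤ):ℝ) * T))).le_opNorm _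
        |>.trans ?_
      refine mul_le_mul ((hb2 _ _ hle).trans (le_of_eq ?_)) (hB _) (norm_nonneg _) (by positivity)
      congr 3; push_cast; ring
    rw [hP, sub_zero] at hQ
    exact hQ

end AbstractRobust2



section AbstractRobust3
variable {X : Type*} [NormedAddCommGroup X] [NormedSpace ℝ X]

set_option maxHeartbeats 1000000 in
theorem robust [CompleteSpace X] {U : ℝ → ℝ → X →L[ℝ] X} (hU : IsEvoFam U) {α M : ℝ} (hα : 0 < α)
    (hM : 1 ≤ M) (hd : HasExpDichotomy U α M) {T K : ℝ} (hT : 0 < T) (hK : 1 ≤ K)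
    (hUK : ∀ s t, s ≤ t → t ≤ s + T → ‖U t s‖ ≤ K) :
    ∃ δ > 0, ∃ α₁ > 0, α₁ ≤ α ∧ ∃ M₁, M ≤ M₁ ∧ ∀ Ut : ℝ → ℝ → X →L[ℝ] X, IsEvoFam Ut →
      (∀ φ, ContinuousOn (fun q : ℝ × ℝ => Ut q.1 q.2 φ) {q : ℝ × ℝ | q.2 ≤ q.1}) →
      (∃ K' : ℝ, 1 ≤ K' ∧ ∃ ν : ℝ, ∀ s t : ℝ, s ≤ t → ‖Ut t s‖ ≤ K' * Real.exp (ν * (t - s))) →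
      (∀ s t, s ≤ t → t ≤ s + T → ‖Ut t s‖ ≤ K) →
      (∀ s, ‖(Ut (s + 2 * T) (s + T) - U (s + 2 * T) (s + T)).comp (Ut (s + T) s)‖ ≤ δ) →
      (∀ s, ‖(Ut (s + 2 * T) (s + T) - U (s + 2 * T) (s + T)).comp (U (s + T) s)‖ ≤ δ) →
      HasExpDichotomy Ut α₁ M₁ := by
  set r : ℝ := Real.exp (-(α / 2 * T)) with hr
  have hr0 : 0 < r := Real.exp_pos _
  have hr1 : r < 1 := by rw [hr, Real.exp_lt_one_iff]; nlinarith
  have hr2 : Real.exp (-(α * T)) = r^2 := by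
    rw [hr, ← Real.exp_nat_mul]; congr 1; push_cast; ring
  have hq1 : r^2 < 1 := by nlinarith
  have hM0 : 0 < M := by linarith
  have g1 := gS_pos hr0.le hr1
  have g2 := gS_pos (ρ := r^2) (by positivity) hq1
  set C : ℝ := 2 * (M * (1 + 2 * K / r)) with hC
  have hC0 : 0 < C := by positivity
  set δ : ℝ := min (1/4) (min (1 / (2 * (M * gS (r^2)))) (1 / (2 * (M / r^2 * gS r)))) with hδd
  have hδ0 : 0 < δ := by rw [hδd]; positivity
  have d1 : δ ≤ 1/4 := min_le_left _ _
  have d2 : M * gS (r^2) * δ ≤ 1/2 := by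
    have : δ ≤ 1 / (2 * (M * gS (r^2))) := (min_le_right _ _).trans (min_le_left _ _)
    rw [le_div_iff₀ (by positivity)] at this
    linarith
  have d3 : M * δ / r^2 * gS r ≤ 1/2 := by
    have : δ ≤ 1 / (2 * (M / r^2 * gS r)) := (min_le_right _ _).trans (min_le_right _ _)
    rw [le_div_iff₀ (by positivity)] at this
    calc M * δ / r^2 * gS r = δ * (2 * (M / r^2 * gS r)) / 2 := by ring
      _ ≤ _ := by linarith
  refine ⟨δ, hδ0, α / 2, by positivity, by linarith, max M (max (K * C / r) (K * C * (1 + C))),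
    le_max_left _ _, ?_⟩
  intro Ut hUt hcont hexp hUtK hc1 hc2
  obtain ⟨K', hK', ν, hexp⟩ := hexp
  -- discrete data
  let V : ℝ → ℤ → X →L[ℝ] X := fun s k => U (s + (k+1) * T) (s + k * T)
  let Vt : ℝ → ℤ → X →L[ℝ] X := fun s k => Ut (s + (k+1) * T) (s + k * T)
  have hcl : ∀ s, Close (V s) (Vt s) K δ := by
    intro s
    have ea : ∀ k : ℤ, s + (((k+1:ℤ):ℝ) + 1) * T = (s + k * T) + 2 * T := fun k => by
      push_cast; ring
    have eb : ∀ k : ℤ, s + ((k+1:ℤ):ℝ) * T = (s + k * T) + T := fun k => by push_cast; ring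
    have ec : ∀ k : ℤ, s + ((k:ℝ)+1) * T = (s + k * T) + T := fun k => by ring
    refine ⟨fun k => hUK _ _ (by nlinarith) (by linarith), fun k =>
      hUtK _ _ (by nlinarith) (by linarith), fun k => ?_, fun k => ?_⟩
    · simp only [V, Vt, ea, eb, ec]; exact hc1 _
    · simp only [V, Vt, ea, eb, ec]; exact hc2 _
  have hgr : ∀ s, ∃ G, Green (V s) G M (r^2) := fun s => by
    rw [← hr2]; exact green_of_dich hU hα hM hd hT s
  choose G hG using hgr
  choose Y hYb hYr using fun s => solveY hr0 hr1 hM0 (hG s) (hcl s) d3 (by linarith)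
  have hYb1 : ∀ s k x, ‖Y s k x‖ ≤ C * r ^ k.natAbs * ‖x‖ := fun s k x =>
    ((Y s k).le_opNorm x).trans (by gcongr; exact hYb s k)
  have hpw : ∀ k : ℤ, r ^ k.natAbs ≤ 1 := fun k => pow_le_one₀ hr0.le hr1.le
  have hYb2 : ∀ s k x, ‖Y s k x‖ ≤ C * ‖x‖ := fun s k x => (hYb1 s k x).trans (by
    have := hpw k
    have : 0 ≤ C * ‖x‖ := by positivity
    nlinarith [hpw k])
  set C' : ℝ := 2 * (M * gS (r^2) * (2 * K + 1)) with hC'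
  have hap : ∀ s (d h : ℤ → X), (∃ B, ∀ k, ‖d k‖ ≤ B) → ∀ η, (∀ k, ‖h k‖ ≤ η) →
      (∀ k, d (k+1) = Vt s k (d k) + h (k+1)) → ∀ k, ‖d k‖ ≤ C' * η := by
    intro s d h hB η hη hrec k
    have := apriori (by positivity) hq1 hM0 (hG s) (hcl s) d2 d h hB η hη hrec k
    rw [hC']; linarith
  have huniq : ∀ s x (z : ℤ → X), (∃ B, ∀ k, ‖z k‖ ≤ B) →
      (∀ k, z (k+1) = Vt s k (z k) + if k + 1 = 0 then x else 0) → ∀ k, z k = Y s k x := by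
    rintro s x z ⟨B, hB⟩ hz k
    have := hap s (fun k => z k - Y s k x) (fun _ => 0)
      ⟨B + C * ‖x‖, fun k => (norm_sub_le _ _).trans (add_le_add (hB k) (hYb2 s k x))⟩ 0
      (by simp) (fun k => by rw [hz, hYr]; simp) k
    rw [mul_zero, norm_le_zero_iff, sub_eq_zero] at this
    exact this
  have hVs : ∀ (s : ℝ) (k : ℤ), s + k * T ≤ s + (k+1) * T := fun s k => by nlinarith
  have hkle : ∀ (s : ℝ) (i k : ℤ), i ≤ k → s + i * T ≤ s + k * T := fun s i k h => by
    have : (i:ℝ) ≤ k := by exact_mod_cast h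
    nlinarith
  have hpos : ∀ s x, ∀ N : ℕ, Y s N x = Ut (s + N * T) s (Y s 0 x) := by
    intro s x N
    induction N with
    | zero => simp [hUt.1]
    | succ N ih =>
      have := hYr s N x
      rw [if_neg (by omega), add_zero, ih] at this
      push_cast at this ⊢
      rw [this]
      simp only [Vt]
      push_cast
      exact hUt.2 _ _ _ (by nlinarith [(Nat.cast_nonneg N : (0:ℝ) ≤ N)]) (by nlinarith) _
  -- backward orbit
  have hneg : ∀ s x, ∀ N : ℕ, ∀ k : ℤ, k < 0 → Y s k x =
      Ut (s + k * T) (s + ((k - N : ℤ):ℝ) * T) (Y s (k - N) x) := by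
    intro s x N
    induction N with
    | zero => intro k _; simp [hUt.1]
    | succ N ih =>
      intro k hk
      have h1 := ih k hk
      have h2 := hYr s (k - N - 1) x
      rw [sub_add_cancel, if_neg (by omega), add_zero] at h2
      rw [h1, h2]
      have e1 := hkle s (k-N-1) (k-N) (by omega)
      have e2 := hkle s (k-N) k (by omega)
      simp only [Vt]
      have e3 : s + (((k - N - 1 : ℤ):ℝ) + 1) * T = s + ((k-N:ℤ):ℝ) * T := by push_cast; ring
      rw [e3, hUt.2 _ _ _ e1 e2, show k - ((N+1 : ℕ):ℤ) = k - N - 1 by push_cast; ring]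
  have hI : ∀ s x, ∀ N : ℕ, 1 ≤ N → x - Y s 0 x =
      - Ut s (s - N * T) (Y s (-(N:ℤ)) x) := by
    intro s x N hN
    have h1 := hYr s (-1) x
    have h2 := hneg s x (N-1) (-1) (by norm_num)
    simp only [Int.reduceNeg, neg_add_cancel, if_true] at h1
    have e0 : (-1 - ((N-1:ℕ):ℤ)) = -(N:ℤ) := by omega
    rw [e0] at h2
    rw [h1, h2]
    simp only [Vt]
    have e1 := hkle s (-(N:ℤ)) (-1) (by omega)
    have e2 := hkle s (-1) 0 (by omega)
    push_cast at e1 e2 ⊢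
    rw [show s + (-1 + 1) * T = s + 0 * T by ring, hUt.2 _ _ _ e1 e2]
    rw [show s + 0 * T = s by ring, show s + -(N:ℝ) * T = s - N * T by ring]
    abel
  have hbdU : ∀ s t : ℝ, s ≤ t → ∃ B, 0 ≤ B ∧ ∀ τ, ‖Ut (t + τ) (s + τ)‖ ≤ B := fun s t h =>
    ⟨K' * Real.exp (ν * (t - s)), by positivity, fun τ => (hexp _ _ (by linarith)).trans
      (le_of_eq (by congr 3; ring))⟩
  let P : ℝ → X →L[ℝ] X := fun s => Y s 0
  let W : ℝ → ℝ → X →L[ℝ] X := fun s t =>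
    -((Ut s (t - (⌊(t - s) / T⌋₊ + 1 : ℕ) * T)).comp (Y t (-((⌊(t - s) / T⌋₊ + 1 : ℕ):ℤ))))
  have hN : ∀ s t : ℝ, s ≤ t → t - (⌊(t - s) / T⌋₊ + 1 : ℕ) * T ≤ s ∧
      s ≤ t - (⌊(t - s) / T⌋₊ + 1 : ℕ) * T + T := by
    intro s t h
    have h1 := Nat.floor_le (div_nonneg (sub_nonneg.mpr h) hT.le)
    have h2 := Nat.lt_floor_add_one ((t-s)/T)
    rw [le_div_iff₀ hT] at h1
    rw [div_lt_iff₀ hT] at h2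
    push_cast
    constructor <;> linarith
  have hPP : ∀ s x, P s (P s x) = P s x := by
    intro s x
    have := huniq s (P s x) (fun k => if 0 ≤ k then Y s k x else 0)
      ⟨C * ‖x‖, fun k => by
        split_ifs
        · exact hYb2 s k x
        · simp; positivity⟩ (fun k => by
        rcases lt_trichotomy (k+1) 0 with h | h | h
        · rw [if_neg (by omega), if_neg (by omega), if_neg (by omega)]; simp
        · rw [if_pos (by omega), if_neg (by omega), if_pos h, h]; simp [P]
        · rw [if_pos (by omega), if_pos (by omega), if_neg (by omega), hYr, if_neg (by omega)]) 0
    simp only [le_refl, if_true] at this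
    exact this.symm
  have hcom : ∀ s t : ℝ, s ≤ t → ∀ x, Ut t s (P s x) = P t (Ut t s x) := by
    intro s t h x
    obtain ⟨B, hB0, hB⟩ := hbdU s t h
    have := huniq t (Ut t s x) (fun k => Ut (t + k * T) (s + k * T) (Y s k x))
      ⟨B * (C * ‖x‖), fun k => ((Ut (t + k * T) (s + k * T)).le_opNorm _).trans
        (mul_le_mul (hB _) (hYb2 s k x) (norm_nonneg _) hB0)⟩ (fun k => by
        rw [hYr, map_add]
        congr 1
        · simp only [Vt]
          push_cast
          rw [hUt.2 _ _ _ (hVs s k) (by linarith), hUt.2 _ _ _ (by linarith) (hVs t k)]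
        · split_ifs with hk
          · have : ((k+1:ℤ):ℝ) = 0 := by exact_mod_cast hk
            rw [this]; simp
          · simp) 0
    simpa using this
  have hPW : ∀ s t : ℝ, s ≤ t → ∀ x, P s (W s t x) = 0 := by
    intro s t h x
    obtain ⟨hN1, hN2⟩ := hN s t h
    set N : ℕ := ⌊(t - s) / T⌋₊ + 1 with hNd
    obtain ⟨B, hB0, hB⟩ := hbdU (t - N * T) s hN1
    have := huniq s (W s t x) (fun k => if k < 0 then Ut (s + k * T) (t - N * T + k * T)
        (Y t (k - N) x) else 0)
      ⟨B * (C * ‖x‖), fun k => by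
        split_ifs
        · exact ((Ut (s + k * T) (t - N * T + k * T)).le_opNorm _).trans
            (mul_le_mul (hB _) (hYb2 t _ x) (norm_nonneg _) hB0)
        · simp; positivity⟩ (fun k => by
        have key : Ut (s + (k+1) * T) (s + k * T) (Ut (s + k * T) (t - N * T + k * T)
          (Y t (k - N) x)) = Ut (s + (k+1) * T) (t - N * T + (k+1) * T)
            (Ut (t - N * T + (k+1) * T) (t - N * T + k * T) (Y t (k - N) x)) := by
          rw [hUt.2 _ _ _ (by linarith) (hVs s k), hUt.2 _ _ _ (hVs _ k) (by linarith)]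
        have key2 : ∀ hk : k - N + 1 ≠ 0, Ut (t - N * T + (k+1) * T) (t - N * T + k * T)
            (Y t (k - N) x) = Y t (k + 1 - N) x := by
          intro hk
          have := hYr t (k - N) x
          rw [if_neg hk, add_zero, show k - (N:ℤ) + 1 = k + 1 - N by ring] at this
          rw [this]
          simp only [Vt]
          push_cast
          congr 2 <;> ring
        rcases lt_trichotomy (k+1) 0 with hk | hk | hk
        · rw [if_pos (by omega), if_pos (by omega), if_neg (by omega)]
          simp only [Vt]
          rw [key, key2 (by omega)]
          push_cast
          simp
        · rw [if_neg (by omega), if_pos (by omega), if_pos hk]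
          simp only [Vt]
          rw [key, key2 (by omega)]
          have : (k:ℝ) + 1 = 0 := by exact_mod_cast hk
          rw [this, hk]
          simp only [W, ← hNd]
          simp
        · rw [if_neg (by omega), if_neg (by omega), if_neg (by omega)]
          simp) 0
    simp only [lt_irrefl, if_false] at this
    exact this.symm
  have hUW : ∀ s t : ℝ, s ≤ t → ∀ x, Ut t s (W s t x) = x - P t x := by
    intro s t h x
    obtain ⟨hN1, hN2⟩ := hN s t h
    rw [show P t x = Y t 0 x from rfl, hI t x (⌊(t - s) / T⌋₊ + 1) (by omega)]
    simp only [W]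
    simp only [neg_apply, ContinuousLinearMap.comp_apply, map_neg]
    rw [hUt.2 _ _ _ hN1 h]
  have hinj : ∀ s t : ℝ, s ≤ t → ∀ x, P s x = 0 → Ut t s x = 0 → x = 0 := by
    intro s t h x h1 h2
    have hz : ∀ τ, t ≤ τ → Ut τ s x = 0 := fun τ hτ => by
      rw [← hUt.2 _ _ _ h hτ, h2, map_zero]
    have := huniq s x (fun k => if 0 ≤ k then Ut (s + k * T) s x else 0)
      ⟨K' * Real.exp (|ν| * (t - s)) * ‖x‖, fun k => by
        split_ifs with hk
        · have hle := hkle s 0 k hk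
          simp only [Int.cast_zero, zero_mul, add_zero] at hle
          rcases le_total t (s + k * T) with h3 | h3
          · rw [hz _ h3]; simp; positivity
          · refine ((Ut (s + k * T) s).le_opNorm x).trans ?_
            gcongr
            refine (hexp _ _ hle).trans ?_
            gcongr
            exact le_abs_self ν
        · simp; positivity⟩ (fun k => by
        rcases lt_trichotomy (k+1) 0 with hk | hk | hk
        · rw [if_neg (by omega), if_neg (by omega), if_neg (by omega)]; simp
        · rw [if_pos (by omega), if_neg (by omega), if_pos hk, hk]; simp [hUt.1]
        · rw [if_pos (by omega), if_pos (by omega), if_neg (by omega), add_zero]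
          simp only [Vt]
          push_cast
          have hle := hkle s 0 k (by omega)
          simp only [Int.cast_zero, zero_mul, add_zero] at hle
          rw [hUt.2 _ _ _ hle (hVs s k)]) 0
    simp only [le_refl, if_true, Int.cast_zero, zero_mul, add_zero, hUt.1] at this
    rw [show Y s 0 x = 0 from h1] at this
    simpa using this
  refine ⟨P, W, fun s => by ext x; exact hPP s x, ?_, fun x => ⟨C * ‖x‖, fun t => hYb2 t 0 x⟩,
    fun s t h => by ext x; exact hcom s t h x, ?_, ?_, ?_, ?_, ?_⟩
  · -- strong continuity
    intro x
    rw [continuous_iff_continuousAt]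
    intro t0
    rw [Metric.continuousAt_iff']
    intro ε hε
    have hC'0 : 0 < C' := by positivity
    set η := ε / (2 * C') with hη
    have hη0 : 0 < η := by positivity
    obtain ⟨N, hN⟩ : ∃ N : ℕ, 2 * K * (C * ‖x‖) * r ^ N ≤ η := by
      have : Tendsto (fun N : ℕ => 2 * K * (C * ‖x‖) * r ^ N) atTop (nhds 0) := by
        simpa using (tendsto_pow_atTop_nhds_zero_of_lt_one hr0.le hr1).const_mul
          (2 * K * (C * ‖x‖))
      exact ((this.eventually (gt_mem_nhds hη0)).mono fun N h => h.le).exists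
    have hfin : ∀ k ∈ Finset.Icc (-(N:ℤ)) N, ∀ᶠ t in nhds t0,
        ‖Vt t k (Y t0 k x) - Vt t0 k (Y t0 k x)‖ ≤ η := by
      intro k _
      have hc : Continuous (fun t => Vt t k (Y t0 k x)) := by
        have := hcont (Y t0 k x)
        exact this.comp_continuous (f := fun t : ℝ => (t + ((k:ℝ)+1) * T, t + (k:ℝ) * T)) (by fun_prop)
          (fun t => hVs t k)
      have := (hc.sub continuous_const).norm.continuousAt (x := t0)
        |>.tendsto.eventually (gt_mem_nhds (show ‖Vt t0 k (Y t0 k x) - Vt t0 k (Y t0 k x)‖ < η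
          by simpa using hη0))
      exact this.mono fun t h => h.le
    rw [← Finset.eventually_all] at hfin
    filter_upwards [hfin] with t ht
    have h1 : ∀ k, ‖Vt t (k-1) (Y t0 (k-1) x) - Vt t0 (k-1) (Y t0 (k-1) x)‖ ≤ η := by
      intro k
      generalize k - 1 = k
      by_cases hk : k ∈ Finset.Icc (-(N:ℤ)) N
      · exact ht k hk
      · have hk' : N ≤ k.natAbs := by simp at hk; omega
        rw [← sub_apply]
        refine (ContinuousLinearMap.le_opNorm _ _).trans (le_trans ?_ hN)
        have e1 : ‖Vt t k - Vt t0 k‖ ≤ 2 * K := (norm_sub_le _ _).trans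
          (by linarith [(hcl t).bVt k, (hcl t0).bVt k])
        have e2 : ‖Y t0 k x‖ ≤ C * r ^ N * ‖x‖ := (hYb1 t0 k x).trans (by
          gcongr ?_ * ?_ * _
          exact pow_le_pow_of_le_one hr0.le hr1.le hk')
        calc _ ≤ 2 * K * (C * r^N * ‖x‖) := mul_le_mul e1 e2 (norm_nonneg _) (by positivity)
          _ = _ := by ring
    have := hap t (fun k => Y t k x - Y t0 k x)
      (fun k => Vt t (k-1) (Y t0 (k-1) x) - Vt t0 (k-1) (Y t0 (k-1) x))
      ⟨C * ‖x‖ + C * ‖x‖, fun k => (norm_sub_le _ _).trans (add_le_add (hYb2 t k x) (hYb2 t0 k x))⟩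
      η h1 (fun k => by
        simp only [add_sub_cancel_right]
        rw [hYr, hYr, map_sub]
        abel) 0
    rw [dist_eq_norm]
    refine lt_of_le_of_lt this ?_
    rw [hη]
    have : C' * (ε / (2 * C')) = ε / 2 := by field_simp
    linarith
  · intro s t h x
    have := hinj s t h (W s t (Ut t s (x - P s x)) - (x - P s x)) (by
      rw [map_sub, hPW s t h, map_sub, hPP]; simp) (by
      rw [map_sub, hUW s t h, ← hcom s t h, map_sub (P s), hPP]; simp)
    exact sub_eq_zero.mp this
  · intro s t h x
    rw [hUW s t h, map_sub, hPP]; simp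
  · intro s t h x
    exact hPW s t h _
  · intro s t h
    refine ContinuousLinearMap.opNorm_le_bound _ (by positivity) fun x => ?_
    obtain ⟨e1, e2⟩ := hN s t h
    set N : ℕ := ⌊(t - s) / T⌋₊ with hNd
    push_cast at e1 e2
    rw [ContinuousLinearMap.comp_apply, ← hUt.2 s (s + N * T) t
      (by nlinarith [(Nat.cast_nonneg N : (0:ℝ) ≤ N)]) (by linarith), ← hpos s x N]
    calc ‖Ut t (s + N * T) (Y s N x)‖ ≤ K * (C * r ^ N * ‖x‖) := by
          refine (ContinuousLinearMap.le_opNorm _ _).trans (mul_le_mul (hUtK _ _ (by linarith)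
            (by linarith)) ?_ (norm_nonneg _) (by linarith))
          simpa using hYb1 s N x
      _ = (K * C / r) * (r ^ (N+1)) * ‖x‖ := by
          rw [pow_succ]; field_simp
      _ ≤ _ := by
        gcongr
        · exact (le_max_left _ _).trans (le_max_right _ _)
        · rw [hr, ← Real.exp_nat_mul, Real.exp_le_exp]
          push_cast
          have : 0 ≤ (α / 2) * (s - (t - (N + 1) * T)) := mul_nonneg (by positivity) (by linarith)
          linarith
  · intro s t h
    refine ContinuousLinearMap.opNorm_le_bound _ (by positivity) fun x => ?_
    obtain ⟨e1, e2⟩ := hN s t h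
    simp only [ContinuousLinearMap.comp_apply, W]
    set N : ℕ := ⌊(t - s) / T⌋₊ + 1 with hNd
    rw [neg_apply, norm_neg, ContinuousLinearMap.comp_apply]
    have hx : ‖(ContinuousLinearMap.id ℝ X - P t) x‖ ≤ (1 + C) * ‖x‖ := by
      rw [sub_apply]
      refine (norm_sub_le _ _).trans ?_
      have := hYb2 t 0 x
      simp only [ContinuousLinearMap.id_apply]
      linarith [show ‖P t x‖ ≤ C * ‖x‖ from this]
    calc _ ≤ K * (C * r ^ N * ((1 + C) * ‖x‖)) := by
          refine (ContinuousLinearMap.le_opNorm _ _).trans (mul_le_mul (hUtK _ _ (by linarith)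
            (by linarith)) ?_ (norm_nonneg _) (by linarith))
          refine (hYb1 t (-(N:ℤ)) _).trans ?_
          rw [Int.natAbs_neg, Int.natAbs_natCast]
          gcongr
      _ = (K * C * (1 + C)) * (r ^ N) * ‖x‖ := by ring
      _ ≤ _ := by
        gcongr
        · exact (le_max_right _ _).trans (le_max_right _ _)
        · rw [hr, ← Real.exp_nat_mul, Real.exp_le_exp]
          have : 0 ≤ (α / 2) * (s - (t - N * T)) := mul_nonneg (by positivity) (by linarith)
          linarith

end AbstractRobust3



section Calc

/-- clamp to the unit interval -/
def clx (x : ℝ) : ℝ := max 0 (min x 1)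

lemma clx_cont : Continuous clx := by unfold clx; fun_prop
lemma clx_mem (x : ℝ) : clx x ∈ Icc (0:ℝ) 1 :=
  ⟨le_max_left _ _, max_le (by norm_num) (min_le_right _ _)⟩
lemma clx_eq {x : ℝ} (h : x ∈ Icc (0:ℝ) 1) : clx x = x := by
  unfold clx; rw [min_eq_left h.2, max_eq_right h.1]

/-- continuity on the half strip -/
def CS (s : ℝ) (g : ℝ → ℝ → ℝ) : Prop :=
  ContinuousOn (fun q : ℝ × ℝ => g q.1 q.2) (Icc (0:ℝ) 1 ×ˢ Ici s)

lemma CS.add {s : ℝ} {f g : ℝ → ℝ → ℝ} (hf : CS s f) (hg : CS s g) :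
    CS s (fun x t => f x t + g x t) := ContinuousOn.add hf hg
lemma CS.sub {s : ℝ} {f g : ℝ → ℝ → ℝ} (hf : CS s f) (hg : CS s g) :
    CS s (fun x t => f x t - g x t) := ContinuousOn.sub hf hg
lemma CS.mul {s : ℝ} {f g : ℝ → ℝ → ℝ} (hf : CS s f) (hg : CS s g) :
    CS s (fun x t => f x t * g x t) := ContinuousOn.mul hf hg
lemma CS.neg {s : ℝ} {f : ℝ → ℝ → ℝ} (hf : CS s f) :
    CS s (fun x t => - f x t) := ContinuousOn.neg hf
lemma CS.const {s : ℝ} (c : ℝ) : CS s (fun _ _ => c) := continuousOn_const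
lemma CS.pow {s : ℝ} {f : ℝ → ℝ → ℝ} (hf : CS s f) (k : ℕ) :
    CS s (fun x t => f x t ^ k) := ContinuousOn.pow hf k
lemma CS.sum {s : ℝ} {ι : Type*} {S : Finset ι} {f : ι → ℝ → ℝ → ℝ} (hf : ∀ i ∈ S, CS s (f i)) :
    CS s (fun x t => ∑ i ∈ S, f i x t) := by
  unfold CS
  exact continuousOn_finsetSum S (fun i hi => hf i hi)
lemma CS.mono {s s' : ℝ} {f : ℝ → ℝ → ℝ} (hf : CS s f) (h : s ≤ s') : CS s' f :=
  ContinuousOn.mono hf (prod_mono le_rfl (Ici_subset_Ici.mpr h))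
lemma CS.congr {s : ℝ} {f g : ℝ → ℝ → ℝ} (hf : CS s f)
    (h : ∀ x ∈ Icc (0:ℝ) 1, ∀ t, s ≤ t → g x t = f x t) : CS s g :=
  ContinuousOn.congr hf (fun q hq => h _ hq.1 _ hq.2)
lemma CS.of_cont {s : ℝ} {f : ℝ → ℝ → ℝ} (hf : Continuous fun q : ℝ × ℝ => f q.1 q.2) : CS s f :=
  hf.continuousOn
lemma CS.clamp {s : ℝ} {f : ℝ → ℝ → ℝ} (hf : CS s f) :
    Continuous (fun q : ℝ × ℝ => f (clx q.1) (max q.2 s)) := by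
  refine ContinuousOn.comp_continuous (f := fun q : ℝ × ℝ => (clx q.1, max q.2 s)) hf ?_ ?_
  · exact (clx_cont.comp continuous_fst).prodMk (continuous_snd.max continuous_const)
  · intro q; exact ⟨clx_mem q.1, mem_Ici.mpr (le_max_right q.2 s)⟩
lemma CS.shift {s h : ℝ} {f : ℝ → ℝ → ℝ} (hf : CS s f) (hh : 0 ≤ h) :
    CS s (fun x t => f x (t + h)) := by
  refine ContinuousOn.comp (f := fun q : ℝ × ℝ => (q.1, q.2 + h)) hf (by fun_prop) ?_
  rintro ⟨x, t⟩ ⟨h1, h2⟩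
  exact ⟨h1, by simp only [mem_Ici] at *; linarith⟩
lemma CS.atx {s : ℝ} {f : ℝ → ℝ → ℝ} (hf : CS s f) {x : ℝ} (hx : x ∈ Icc (0:ℝ) 1) :
    ContinuousOn (fun t => f x t) (Ici s) :=
  ContinuousOn.comp (f := fun t : ℝ => (x, t)) hf (by fun_prop) (fun t ht => ⟨hx, ht⟩)
lemma CS.att {s : ℝ} {f : ℝ → ℝ → ℝ} (hf : CS s f) {t : ℝ} (ht : s ≤ t) :
    ContinuousOn (fun x => f x t) (Icc 0 1) :=
  ContinuousOn.comp (f := fun x : ℝ => (x, t)) hf (by fun_prop) (fun x hx => ⟨hx, ht⟩)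
lemma CS.integrable {s : ℝ} {f : ℝ → ℝ → ℝ} (hf : CS s f) {t : ℝ} (ht : s ≤ t) :
    IntervalIntegrable (fun x => f x t) volume 0 1 := by
  apply ContinuousOn.intervalIntegrable
  rw [uIcc_of_le zero_le_one]
  exact hf.att ht
lemma CS.intCont {s : ℝ} {f : ℝ → ℝ → ℝ} (hf : CS s f) :
    ContinuousOn (fun t => ∫ x in (0:ℝ)..1, f x t) (Ici s) := by
  have h1 : Continuous (fun t => ∫ x in (0:ℝ)..1, f (clx x) (max t s)) := by
    apply intervalIntegral.continuous_parametric_intervalIntegral_of_continuous'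
    exact hf.clamp.comp continuous_swap
  refine h1.continuousOn.congr fun t ht => ?_
  apply intervalIntegral.integral_congr
  intro x hx
  rw [uIcc_of_le zero_le_one] at hx
  simp only [clx_eq hx, max_eq_left (mem_Ici.mp ht)]
lemma CS.bdd {s : ℝ} {f : ℝ → ℝ → ℝ} (hf : CS s f) (T : ℝ) :
    ∃ C, 0 ≤ C ∧ ∀ x ∈ Icc (0:ℝ) 1, ∀ t ∈ Icc s T, |f x t| ≤ C := by
  have hc : IsCompact (Icc (0:ℝ) 1 ×ˢ Icc s T) := isCompact_Icc.prod isCompact_Icc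
  obtain ⟨C, hC⟩ := hc.exists_bound_of_continuousOn
    (ContinuousOn.mono hf (prod_mono le_rfl Icc_subset_Ici_self))
  exact ⟨max C 0, le_max_right _ _, fun x hx t ht => (hC (x, t) ⟨hx, ht⟩).trans (le_max_left _ _)⟩

/-- `C¹` on the half strip with given partial derivatives -/
structure C1S (s : ℝ) (y yx yt : ℝ → ℝ → ℝ) : Prop where
  c0 : CS s y
  cx : CS s yx
  ct : CS s yt
  dx : ∀ x ∈ Icc (0:ℝ) 1, ∀ t, s ≤ t → HasDerivWithinAt (fun z => y z t) (yx x t) (Icc 0 1) x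
  dt : ∀ x ∈ Icc (0:ℝ) 1, ∀ t, s ≤ t → HasDerivWithinAt (fun τ => y x τ) (yt x t) (Ici s) t

lemma C1S.add {s : ℝ} {f fx ft g gx gt : ℝ → ℝ → ℝ} (hf : C1S s f fx ft) (hg : C1S s g gx gt) :
    C1S s (fun x t => f x t + g x t) (fun x t => fx x t + gx x t) (fun x t => ft x t + gt x t) :=
  ⟨hf.c0.add hg.c0, hf.cx.add hg.cx, hf.ct.add hg.ct,
    fun x hx t ht => (hf.dx x hx t ht).add (hg.dx x hx t ht),
    fun x hx t ht => (hf.dt x hx t ht).add (hg.dt x hx t ht)⟩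
lemma C1S.sub {s : ℝ} {f fx ft g gx gt : ℝ → ℝ → ℝ} (hf : C1S s f fx ft) (hg : C1S s g gx gt) :
    C1S s (fun x t => f x t - g x t) (fun x t => fx x t - gx x t) (fun x t => ft x t - gt x t) :=
  ⟨hf.c0.sub hg.c0, hf.cx.sub hg.cx, hf.ct.sub hg.ct,
    fun x hx t ht => (hf.dx x hx t ht).sub (hg.dx x hx t ht),
    fun x hx t ht => (hf.dt x hx t ht).sub (hg.dt x hx t ht)⟩
lemma C1S.mul {s : ℝ} {f fx ft g gx gt : ℝ → ℝ → ℝ} (hf : C1S s f fx ft) (hg : C1S s g gx gt) :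
    C1S s (fun x t => f x t * g x t) (fun x t => fx x t * g x t + f x t * gx x t)
      (fun x t => ft x t * g x t + f x t * gt x t) :=
  ⟨hf.c0.mul hg.c0, (hf.cx.mul hg.c0).add (hf.c0.mul hg.cx),
    (hf.ct.mul hg.c0).add (hf.c0.mul hg.ct),
    fun x hx t ht => (hf.dx x hx t ht).mul (hg.dx x hx t ht),
    fun x hx t ht => (hf.dt x hx t ht).mul (hg.dt x hx t ht)⟩
lemma C1S.const {s : ℝ} (c : ℝ) : C1S s (fun _ _ => c) (fun _ _ => 0) (fun _ _ => 0) :=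
  ⟨CS.const c, CS.const 0, CS.const 0, fun x _ t _ => hasDerivWithinAt_const x _ c,
    fun x _ t _ => hasDerivWithinAt_const t _ c⟩
lemma C1S.sum {s : ℝ} {ι : Type*} {S : Finset ι} {f fx ft : ι → ℝ → ℝ → ℝ}
    (hf : ∀ i ∈ S, C1S s (f i) (fx i) (ft i)) :
    C1S s (fun x t => ∑ i ∈ S, f i x t) (fun x t => ∑ i ∈ S, fx i x t)
      (fun x t => ∑ i ∈ S, ft i x t) :=
  ⟨CS.sum fun i hi => (hf i hi).c0, CS.sum fun i hi => (hf i hi).cx,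
    CS.sum fun i hi => (hf i hi).ct,
    fun x hx t ht => HasDerivWithinAt.fun_sum fun i hi => (hf i hi).dx x hx t ht,
    fun x hx t ht => HasDerivWithinAt.fun_sum fun i hi => (hf i hi).dt x hx t ht⟩
lemma C1S.mono {s s' : ℝ} {f fx ft : ℝ → ℝ → ℝ} (hf : C1S s f fx ft) (h : s ≤ s') :
    C1S s' f fx ft :=
  ⟨hf.c0.mono h, hf.cx.mono h, hf.ct.mono h, fun x hx t ht => hf.dx x hx t (h.trans ht),
    fun x hx t ht => (hf.dt x hx t (h.trans ht)).mono (Ici_subset_Ici.mpr h)⟩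
lemma C1S.congr {s : ℝ} {f fx ft g gx gt : ℝ → ℝ → ℝ} (hf : C1S s f fx ft)
    (h0 : ∀ x ∈ Icc (0:ℝ) 1, ∀ t, s ≤ t → g x t = f x t)
    (h1 : ∀ x ∈ Icc (0:ℝ) 1, ∀ t, s ≤ t → gx x t = fx x t)
    (h2 : ∀ x ∈ Icc (0:ℝ) 1, ∀ t, s ≤ t → gt x t = ft x t) : C1S s g gx gt := by
  refine ⟨hf.c0.congr h0, hf.cx.congr h1, hf.ct.congr h2, fun x hx t ht => ?_, fun x hx t ht => ?_⟩
  · rw [h1 x hx t ht]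
    exact (hf.dx x hx t ht).congr (fun z hz => h0 z hz t ht) (h0 x hx t ht)
  · rw [h2 x hx t ht]
    exact (hf.dt x hx t ht).congr (fun τ hτ => h0 x hx τ hτ) (h0 x hx t ht)
lemma C1S.shift {s h : ℝ} {f fx ft : ℝ → ℝ → ℝ} (hf : C1S s f fx ft) (hh : 0 ≤ h) :
    C1S s (fun x t => f x (t + h)) (fun x t => fx x (t + h)) (fun x t => ft x (t + h)) := by
  refine ⟨hf.c0.shift hh, hf.cx.shift hh, hf.ct.shift hh, fun x hx t ht => hf.dx x hx _ (by linarith),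
    fun x hx t ht => ?_⟩
  have h1 := hf.dt x hx (t+h) (by linarith)
  have h2 : HasDerivWithinAt (fun τ : ℝ => τ + h) 1 (Ici s) t :=
    (hasDerivWithinAt_id t _).add_const h
  have := h1.comp t h2 (fun τ hτ => by simp only [mem_Ici] at *; linarith)
  simpa [Function.comp_def] using this
lemma C1S.dtAt {s : ℝ} {f fx ft : ℝ → ℝ → ℝ} (hf : C1S s f fx ft) {x t : ℝ}
    (hx : x ∈ Icc (0:ℝ) 1) (ht : s < t) : HasDerivAt (fun τ => f x τ) (ft x t) t :=
  (hf.dt x hx t ht.le).hasDerivAt (Ici_mem_nhds ht)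

lemma C1S.hasDerivInt {s : ℝ} {f fx ft : ℝ → ℝ → ℝ} (hf : C1S s f fx ft) {t : ℝ} (ht : s < t) :
    HasDerivAt (fun τ => ∫ x in (0:ℝ)..1, f x τ) (∫ x in (0:ℝ)..1, ft x t) t := by
  obtain ⟨C, hC0, hC⟩ := hf.ct.bdd (t+1)
  have hs : Ioo s (t+1) ∈ nhds t := Ioo_mem_nhds ht (by linarith)
  have := intervalIntegral.hasDerivAt_integral_of_dominated_loc_of_deriv_le (𝕜 := ℝ)
    (μ := volume) (a := 0) (b := 1) (F := fun τ x => f x τ) (F' := fun τ x => ft x τ)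
    (x₀ := t) (bound := fun _ => C) hs ?_ ?_ ?_ ?_ ?_ ?_
  · exact this.2
  · filter_upwards [hs] with τ hτ
    exact (hf.c0.integrable hτ.1.le).aestronglyMeasurable_restrict_uIoc
  · exact hf.c0.integrable ht.le
  · exact (hf.ct.integrable ht.le).aestronglyMeasurable_restrict_uIoc
  · refine Filter.Eventually.of_forall fun x hx τ hτ => ?_
    rw [uIoc_of_le zero_le_one] at hx
    exact hC x ⟨hx.1.le, hx.2⟩ τ ⟨hτ.1.le, hτ.2.le⟩
  · exact intervalIntegrable_const
  · refine Filter.Eventually.of_forall fun x hx τ hτ => ?_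
    rw [uIoc_of_le zero_le_one] at hx
    exact hf.dtAt ⟨hx.1.le, hx.2⟩ hτ.1

lemma C1S.ftc {s : ℝ} {f fx ft : ℝ → ℝ → ℝ} (hf : C1S s f fx ft) {t : ℝ} (ht : s ≤ t) :
    ∫ x in (0:ℝ)..1, fx x t = f 1 t - f 0 t := by
  refine intervalIntegral.integral_eq_sub_of_hasDeriv_right_of_le zero_le_one (hf.c0.att ht) ?_
    (hf.cx.integrable ht)
  intro x hx
  exact ((hf.dx x ⟨hx.1.le, hx.2.le⟩ t ht).hasDerivAt (Icc_mem_nhds hx.1 hx.2)).hasDerivWithinAt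

/-- weighted energy identity -/
lemma energy_identity {s : ℝ} {y yx yt α αx αt w wx wt : ℝ → ℝ → ℝ}
    (hy : C1S s y yx yt) (hα : C1S s α αx αt) (hw : C1S s w wx wt) :
    ContinuousOn (fun t => ∫ x in (0:ℝ)..1, w x t * y x t ^ 2) (Ici s) ∧
    ∀ t, s < t → HasDerivAt (fun t => ∫ x in (0:ℝ)..1, w x t * y x t ^ 2)
      ((∫ x in (0:ℝ)..1, ((wt x t + α x t * wx x t + αx x t * w x t) * y x t ^ 2
        + 2 * w x t * y x t * (yt x t + α x t * yx x t)))
        + (w 0 t * α 0 t * y 0 t ^ 2 - w 1 t * α 1 t * y 1 t ^ 2)) t := by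
  have h1 := hw.mul (hy.mul hy)
  have h2 := hα.mul h1
  have e : (fun t => ∫ x in (0:ℝ)..1, w x t * y x t ^ 2) =
      (fun t => ∫ x in (0:ℝ)..1, w x t * (y x t * y x t)) := by
    funext t; congr 1; funext x; ring
  rw [e]
  refine ⟨h1.c0.intCont, fun t ht => ?_⟩
  have h3 := h1.hasDerivInt ht
  have h4 := h2.ftc ht.le
  convert h3 using 1
  have h5 : (w 0 t * α 0 t * y 0 t ^ 2 - w 1 t * α 1 t * y 1 t ^ 2) =
    - (α 1 t * (w 1 t * (y 1 t * y 1 t)) - α 0 t * (w 0 t * (y 0 t * y 0 t))) := by ring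
  rw [h5, ← h4, ← sub_eq_add_neg, ← intervalIntegral.integral_sub]
  · congr 1; funext x; ring
  · have c1 := (((hw.ct.add (hα.c0.mul hw.cx)).add (hα.cx.mul hw.c0)).mul (hy.c0.pow 2)).add
      (((CS.const 2).mul hw.c0).mul hy.c0 |>.mul (hy.ct.add (hα.c0.mul hy.cx)))
    exact c1.integrable ht.le
  · exact h2.cx.integrable ht.le

/-- integrated differential inequality -/
lemma gronwall_int {s t K : ℝ} (hst : s ≤ t) {E E' q : ℝ → ℝ} (hE : ContinuousOn E (Ici s))
    (hE' : ∀ τ, s < τ → HasDerivAt E (E' τ) τ) (hq : ContinuousOn q (Ici s))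
    (hle : ∀ τ, s < τ → τ < t → E' τ ≤ K * E τ + q τ) :
    E t * Real.exp (-K * (t - s)) ≤ E s + ∫ τ in s..t, Real.exp (-K * (τ - s)) * q τ := by
  have hqc : ContinuousOn (fun τ => Real.exp (-K * (τ - s)) * q τ) (Icc s t) :=
    ContinuousOn.mul (by fun_prop) (hq.mono Icc_subset_Ici_self)
  have hqc2 : ContinuousOn (fun τ => Real.exp (-K * (τ - s)) * q τ) (uIcc s t) := by
    rwa [uIcc_of_le hst]
  have hanti : AntitoneOn (fun τ => E τ * Real.exp (-K * (τ - s)) -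
      ∫ θ in s..τ, Real.exp (-K * (θ - s)) * q θ) (Icc s t) := by
    have hd : ∀ τ ∈ interior (Icc s t), HasDerivAt (fun τ => E τ * Real.exp (-K * (τ - s)) -
      ∫ θ in s..τ, Real.exp (-K * (θ - s)) * q θ) (E' τ * Real.exp (-K * (τ - s)) +
        E τ * (Real.exp (-K * (τ - s)) * (-K * 1)) - Real.exp (-K * (τ - s)) * q τ) τ := by
      intro τ hτ
      rw [interior_Icc] at hτ
      refine ((hE' τ hτ.1).mul ?_).sub ?_
      · exact (((hasDerivAt_id τ).sub_const s).const_mul (-K)).exp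
      · refine intervalIntegral.integral_hasDerivAt_right ?_ ?_ ?_
        · apply ContinuousOn.intervalIntegrable
          rw [uIcc_of_le hτ.1.le]
          exact hqc.mono (Icc_subset_Icc le_rfl hτ.2.le)
        · exact (hqc.stronglyMeasurableAtFilter_nhdsWithin measurableSet_Icc τ).filter_mono
            (by rw [nhdsWithin_eq_nhds.mpr (Icc_mem_nhds hτ.1 hτ.2)])
        · exact hqc.continuousAt (Icc_mem_nhds hτ.1 hτ.2)
    refine antitoneOn_of_deriv_nonpos (convex_Icc s t) ?_ ?_ ?_
    · refine ContinuousOn.sub (ContinuousOn.mul (hE.mono Icc_subset_Ici_self) (by fun_prop)) ?_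
      have := intervalIntegral.continuousOn_primitive_interval' (hqc2.intervalIntegrable
        (μ := volume)) left_mem_uIcc
      rwa [uIcc_of_le hst] at this
    · exact fun τ hτ => (hd τ hτ).differentiableAt.differentiableWithinAt
    · intro τ hτ
      rw [(hd τ hτ).deriv]
      rw [interior_Icc] at hτ
      have := hle τ hτ.1 hτ.2
      have h2 := Real.exp_pos (-K * (τ - s))
      nlinarith
  have := hanti (left_mem_Icc.mpr hst) (right_mem_Icc.mpr hst) hst
  simp at this
  simp only [neg_mul]
  linarith

end Calc



section EL

/-- incoming boundary values -/
def inn {n : ℕ} (m : ℕ) (y : Fin n → ℝ → ℝ → ℝ) (j : Fin n) (t : ℝ) : ℝ :=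
  if (j : ℕ) < m then y j 0 t else y j 1 t
/-- outgoing boundary values -/
def outt {n : ℕ} (m : ℕ) (y : Fin n → ℝ → ℝ → ℝ) (j : Fin n) (t : ℝ) : ℝ :=
  if (j : ℕ) < m then y j 1 t else y j 0 t
/-- squared norm -/
def Nrm {n : ℕ} (y : Fin n → ℝ → ℝ → ℝ) (t : ℝ) : ℝ := ∑ j, ∫ x in (0:ℝ)..1, y j x t ^ 2
/-- squared norm of the outgoing traces -/
def Otr {n : ℕ} (m : ℕ) (y : Fin n → ℝ → ℝ → ℝ) (t : ℝ) : ℝ := ∑ j, outt m y j t ^ 2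

lemma Nrm_nonneg {n : ℕ} (y : Fin n → ℝ → ℝ → ℝ) (t : ℝ) : 0 ≤ Nrm y t :=
  Finset.sum_nonneg fun j _ => intervalIntegral.integral_nonneg zero_le_one fun x _ => sq_nonneg _
lemma Otr_nonneg {n : ℕ} (m : ℕ) (y : Fin n → ℝ → ℝ → ℝ) (t : ℝ) : 0 ≤ Otr m y t :=
  Finset.sum_nonneg fun j _ => sq_nonneg _

lemma outt_cont {n m : ℕ} {s : ℝ} {y : Fin n → ℝ → ℝ → ℝ} (hy : ∀ j, CS s (y j)) (j : Fin n) :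
    ContinuousOn (outt m y j) (Ici s) := by
  unfold outt
  by_cases h : (j : ℕ) < m
  · simp only [h, if_true]; exact (hy j).atx (by simp)
  · simp only [h, if_false]; exact (hy j).atx (by simp)
lemma inn_cont {n m : ℕ} {s : ℝ} {y : Fin n → ℝ → ℝ → ℝ} (hy : ∀ j, CS s (y j)) (j : Fin n) :
    ContinuousOn (inn m y j) (Ici s) := by
  unfold inn
  by_cases h : (j : ℕ) < m
  · simp only [h, if_true]; exact (hy j).atx (by simp)
  · simp only [h, if_false]; exact (hy j).atx (by simp)
lemma Otr_cont {n m : ℕ} {s : ℝ} {y : Fin n → ℝ → ℝ → ℝ} (hy : ∀ j, CS s (y j)) :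
    ContinuousOn (Otr m y) (Ici s) := by
  unfold Otr
  exact continuousOn_finsetSum _ fun j _ => (outt_cont hy j).pow 2
lemma Nrm_cont {n : ℕ} {s : ℝ} {y : Fin n → ℝ → ℝ → ℝ} (hy : ∀ j, CS s (y j)) :
    ContinuousOn (Nrm y) (Ici s) := by
  unfold Nrm
  exact continuousOn_finsetSum _ fun j _ => ((hy j).pow 2).intCont

/-- transport coefficient class -/
structure ACof {n : ℕ} (m : ℕ) (Λ A : ℝ) (a ax aT : Fin n → ℝ → ℝ → ℝ) : Prop where
  c1 : ∀ s j, C1S s (a j) (ax j) (aT j)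
  ba : ∀ j, ∀ x ∈ Icc (0:ℝ) 1, ∀ t, |a j x t| ≤ A
  bx : ∀ j, ∀ x ∈ Icc (0:ℝ) 1, ∀ t, |ax j x t| ≤ A
  bt : ∀ j, ∀ x ∈ Icc (0:ℝ) 1, ∀ t, |aT j x t| ≤ A
  pos : ∀ j : Fin n, (j : ℕ) < m → ∀ x ∈ Icc (0:ℝ) 1, ∀ t, Λ ≤ a j x t
  neg : ∀ j : Fin n, ¬ (j : ℕ) < m → ∀ x ∈ Icc (0:ℝ) 1, ∀ t, a j x t ≤ -Λ

/-- weight sign -/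
def sg {n : ℕ} (m : ℕ) (j : Fin n) : ℝ := if (j : ℕ) < m then 1 else -1
/-- weight distance to the inflow -/
def dd {n : ℕ} (m : ℕ) (j : Fin n) (x : ℝ) : ℝ := if (j : ℕ) < m then x else 1 - x

lemma dd_c1 {n : ℕ} (m : ℕ) (j : Fin n) (s : ℝ) :
    C1S s (fun x _ => dd m j x) (fun _ _ => sg m j) (fun _ _ => 0) := by
  refine ⟨CS.of_cont ?_, CS.const _, CS.const _, fun x _ t _ => ?_, fun x _ t _ => ?_⟩
  · unfold dd; split_ifs <;> fun_prop
  · unfold dd sg; split_ifs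
    · exact hasDerivWithinAt_id x _
    · exact (hasDerivWithinAt_id x _).const_sub 1
  · exact hasDerivWithinAt_const _ _ _

lemma dd_mem {n : ℕ} (m : ℕ) (j : Fin n) {x : ℝ} (hx : x ∈ Icc (0:ℝ) 1) :
    0 ≤ dd m j x ∧ dd m j x ≤ 1 := by
  unfold dd; split_ifs
  · exact hx
  · constructor <;> linarith [hx.1, hx.2]
lemma abs_sg {n : ℕ} (m : ℕ) (j : Fin n) : |sg m j| = 1 := by
  unfold sg; split_ifs <;> simp

set_option maxHeartbeats 1600000 in
lemma EL (n m : ℕ) {Λ A P B T : ℝ} (hΛ : 0 < Λ) (hA : 0 ≤ A) (hP : 0 ≤ P) (hB : 0 ≤ B)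
    (hT : 0 ≤ T) : ∃ K, 1 ≤ K ∧ ∀ a ax aT : Fin n → ℝ → ℝ → ℝ, ACof m Λ A a ax aT →
      ∀ p : Fin n → Fin n → ℝ, (∀ j k, |p j k| ≤ P) →
      ∀ (s : ℝ) (y yx yt : Fin n → ℝ → ℝ → ℝ), (∀ j, C1S s (y j) (yx j) (yt j)) →
      ∀ Φ Γ : ℝ → ℝ, ContinuousOn Φ (Ici s) → ContinuousOn Γ (Ici s) →
      (∀ t, 0 ≤ Φ t) → (∀ t, 0 ≤ Γ t) →
      (∀ t ∈ Icc s (s+T), ∑ j, ∫ x in (0:ℝ)..1, (yt j x t + a j x t * yx j x t)^2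
        ≤ B * Nrm y t + Φ t) →
      (∀ t ∈ Icc s (s+T), ∑ j, (inn m y j t - ∑ k, p j k * outt m y k t)^2 ≤ Γ t) →
      ∀ t ∈ Icc s (s+T), Nrm y t + ∫ τ in s..t, Otr m y τ ≤
        K * (Nrm y s + ∫ τ in s..t, (Φ τ + Γ τ)) := by
  set N0 : ℝ := (2*A*n^2*P^2+1)/Λ with hN0
  have hN0p : 0 ≤ N0 := by positivity
  have hN0Λ : N0 * Λ = 2*A*n^2*P^2+1 := by rw [hN0]; field_simp
  set W : ℝ := 1 + N0 with hW
  have hW1 : 1 ≤ W := by linarith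
  set K2 : ℝ := W*(2*A+1+B) with hK2
  have hK2p : 0 ≤ K2 := by positivity
  refine ⟨Real.exp (K2*T) * (W + 2*A), ?_, ?_⟩
  · have h1 : 1 ≤ Real.exp (K2*T) := Real.one_le_exp (by positivity)
    nlinarith
  intro a ax aT ha p hp s y yx yt hy Φ Γ hΦ hΓ hΦ0 hΓ0 hr hg t ht
  set w : Fin n → ℝ → ℝ → ℝ := fun j x _ => 1 + N0 * dd m j x with hw
  have hwc : ∀ j, C1S s (w j) (fun _ _ => 0 + (0 * dd m j 0 + N0 * sg m j))
      (fun _ _ => 0 + (0 * dd m j 0 + N0 * 0)) := by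
    intro j
    refine ((C1S.const 1).add ((C1S.const N0).mul (dd_c1 m j s))).congr
      (fun _ _ _ _ => rfl) (fun _ _ _ _ => by simp) (fun _ _ _ _ => by simp)
  have hen := fun j => energy_identity (hy j) (ha.c1 s j) (hwc j)
  set E : ℝ → ℝ := fun t => ∑ j, ∫ x in (0:ℝ)..1, w j x t * y j x t ^ 2 with hE
  have hEc : ContinuousOn E (Ici s) := continuousOn_finsetSum _ fun j _ => (hen j).1
  set E' : ℝ → ℝ := fun t => ∑ j, ((∫ x in (0:ℝ)..1, (((0 + (0 * dd m j 0 + N0 * 0)) + a j x t *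
      (0 + (0 * dd m j 0 + N0 * sg m j)) + ax j x t * w j x t) * y j x t ^ 2
        + 2 * w j x t * y j x t * (yt j x t + a j x t * yx j x t)))
        + (w j 0 t * a j 0 t * y j 0 t ^ 2 - w j 1 t * a j 1 t * y j 1 t ^ 2)) with hE'
  have hEd : ∀ τ, s < τ → HasDerivAt E (E' τ) τ := fun τ hτ =>
    HasDerivAt.fun_sum fun j _ => (hen j).2 τ hτ
  have hwb : ∀ j, ∀ x ∈ Icc (0:ℝ) 1, ∀ t, 1 ≤ w j x t ∧ w j x t ≤ W := by
    intro j x hx t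
    obtain ⟨h1, h2⟩ := dd_mem m j hx
    constructor
    · simp only [hw]; nlinarith
    · simp only [hw, hW]; nlinarith
  have hNE : ∀ t, s ≤ t → Nrm y t ≤ E t ∧ E t ≤ W * Nrm y t := by
    intro t ht
    constructor
    · refine Finset.sum_le_sum fun j _ => ?_
      refine intervalIntegral.integral_mono_on zero_le_one (((hy j).c0.pow 2).integrable ht)
        (((hwc j).c0.mul ((hy j).c0.pow 2)).integrable ht) fun x hx => ?_
      nlinarith [hwb j x hx t, sq_nonneg (y j x t)]
    · unfold Nrm
      rw [Finset.mul_sum]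
      refine Finset.sum_le_sum fun j _ => ?_
      rw [← intervalIntegral.integral_const_mul]
      refine intervalIntegral.integral_mono_on zero_le_one
        (((hwc j).c0.mul ((hy j).c0.pow 2)).integrable ht)
        (((CS.const W).mul ((hy j).c0.pow 2)).integrable ht) fun x hx => ?_
      nlinarith [hwb j x hx t, sq_nonneg (y j x t)]
  have hmain : ∀ τ, s < τ → τ < t → E' τ ≤ K2 * E τ + (W * Φ τ + 2*A*Γ τ - Otr m y τ) := by
    intro τ hτ hτt
    have hτm : τ ∈ Icc s (s+T) := ⟨hτ.le, hτt.le.trans ht.2⟩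
    -- bulk
    have hbulk : ∀ j, ∫ x in (0:ℝ)..1, (((0 + (0 * dd m j 0 + N0 * 0)) + a j x τ *
      (0 + (0 * dd m j 0 + N0 * sg m j)) + ax j x τ * w j x τ) * y j x τ ^ 2
        + 2 * w j x τ * y j x τ * (yt j x τ + a j x τ * yx j x τ))
        ≤ (2*A*W+W) * (∫ x in (0:ℝ)..1, y j x τ ^ 2) +
          W * ∫ x in (0:ℝ)..1, (yt j x τ + a j x τ * yx j x τ)^2 := by
      intro j
      have hrc : CS s (fun x t => yt j x t + a j x t * yx j x t) :=
        (hy j).ct.add ((ha.c1 s j).c0.mul (hy j).cx)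
      rw [← intervalIntegral.integral_const_mul, ← intervalIntegral.integral_const_mul,
        ← intervalIntegral.integral_add (((CS.const (2*A*W+W)).mul ((hy j).c0.pow 2)).integrable hτ.le)
          (((CS.const W).mul (hrc.pow 2)).integrable hτ.le)]
      have c1 := ((((hwc j).ct.add ((ha.c1 s j).c0.mul (hwc j).cx)).add ((ha.c1 s j).cx.mul (hwc j).c0)).mul
        ((hy j).c0.pow 2)).add
          (((CS.const 2).mul (hwc j).c0).mul (hy j).c0 |>.mul hrc)
      refine intervalIntegral.integral_mono_on zero_le_one (c1.integrable hτ.le)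
        ((((CS.const (2*A*W+W)).mul ((hy j).c0.pow 2)).add
          ((CS.const W).mul (hrc.pow 2))).integrable hτ.le) fun x hx => ?_
      obtain ⟨w1, w2⟩ := hwb j x hx τ
      set r := yt j x τ + a j x τ * yx j x τ
      have e1 : a j x τ * (N0 * sg m j) ≤ A * W := by
        calc a j x τ * (N0 * sg m j) ≤ |a j x τ * (N0 * sg m j)| := le_abs_self _
          _ = |a j x τ| * N0 := by rw [abs_mul, abs_mul, abs_sg, abs_of_nonneg hN0p, mul_one]
          _ ≤ A * W := mul_le_mul (ha.ba j x hx τ) (by linarith) hN0p hA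
      have e2 : ax j x τ * w j x τ ≤ A * W := by
        calc ax j x τ * w j x τ ≤ |ax j x τ| * w j x τ :=
              mul_le_mul_of_nonneg_right (le_abs_self _) (by linarith)
          _ ≤ A * W := mul_le_mul (ha.bx j x hx τ) w2 (by linarith) hA
      have e3 : 2 * w j x τ * y j x τ * r ≤ W * (y j x τ^2 + r^2) := by
        have : 2 * y j x τ * r ≤ y j x τ^2 + r^2 := by nlinarith [sq_nonneg (y j x τ - r)]
        have h4 : w j x τ * (2 * y j x τ * r) ≤ w j x τ * (y j x τ^2 + r^2) :=
          mul_le_mul_of_nonneg_left this (by linarith)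
        nlinarith [sq_nonneg (y j x τ), sq_nonneg r]
      have e4 : (a j x τ * (N0 * sg m j) + ax j x τ * w j x τ) * y j x τ^2 ≤
          (2*A*W) * y j x τ^2 := mul_le_mul_of_nonneg_right (by linarith) (sq_nonneg _)
      have e5 : ((0 + (0 * dd m j 0 + N0 * 0)) + a j x τ *
        (0 + (0 * dd m j 0 + N0 * sg m j)) + ax j x τ * w j x τ) =
        a j x τ * (N0 * sg m j) + ax j x τ * w j x τ := by ring
      rw [e5]
      nlinarith
    have hbd : ∀ j, w j 0 τ * a j 0 τ * y j 0 τ ^ 2 - w j 1 τ * a j 1 τ * y j 1 τ ^ 2 ≤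
        A * inn m y j τ ^2 - W * Λ * outt m y j τ^2 := by
      intro j
      have i0 : (0:ℝ) ∈ Icc (0:ℝ) 1 := by simp
      have i1 : (1:ℝ) ∈ Icc (0:ℝ) 1 := by simp
      by_cases h : (j:ℕ) < m
      · simp only [hw, inn, outt, dd, h, if_true]
        have h1 := ha.pos j h 1 i1 τ
        have h0 := (abs_le.mp (ha.ba j 0 i0 τ)).2
        have e1 : a j 0 τ * y j 0 τ^2 ≤ A * y j 0 τ^2 := mul_le_mul_of_nonneg_right h0 (sq_nonneg _)
        have e2 : W * Λ * y j 1 τ^2 ≤ W * a j 1 τ * y j 1 τ^2 :=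
          mul_le_mul_of_nonneg_right (mul_le_mul_of_nonneg_left h1 (by linarith)) (sq_nonneg _)
        have e3 : W = 1 + N0*1 := by rw [hW]; ring
        rw [← e3]; linarith
      · simp only [hw, inn, outt, dd, h, if_false]
        have h1 := ha.neg j h 0 i0 τ
        have h0 := (abs_le.mp (ha.ba j 1 i1 τ)).1
        have e1 : -a j 1 τ * y j 1 τ^2 ≤ A * y j 1 τ^2 := mul_le_mul_of_nonneg_right (by linarith) (sq_nonneg _)
        have e2 : W * a j 0 τ * y j 0 τ^2 ≤ W * (-Λ) * y j 0 τ^2 :=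
          mul_le_mul_of_nonneg_right (mul_le_mul_of_nonneg_left h1 (by linarith)) (sq_nonneg _)
        have e3 : W = 1 + N0*(1-0) := by rw [hW]; ring
        rw [← e3]; linarith
    have hin : ∀ j, inn m y j τ^2 ≤ 2 * (inn m y j τ - ∑ k, p j k * outt m y k τ)^2
        + 2 * (n * P^2 * Otr m y τ) := by
      intro j
      have h1 : (∑ k, p j k * outt m y k τ)^2 ≤ n * P^2 * Otr m y τ := by
        have := sq_sum_le_card_mul_sum_sq (s := (Finset.univ : Finset (Fin n)))
          (f := fun k => p j k * outt m y k τ)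
        simp only [Finset.card_univ, Fintype.card_fin] at this
        refine this.trans ?_
        rw [mul_assoc]
        refine mul_le_mul_of_nonneg_left ?_ (by positivity)
        unfold Otr
        rw [Finset.mul_sum]
        refine Finset.sum_le_sum fun k _ => ?_
        rw [mul_pow]
        refine mul_le_mul_of_nonneg_right ?_ (sq_nonneg _)
        rw [← sq_abs]
        exact pow_le_pow_left₀ (abs_nonneg _) (hp j k) 2
      nlinarith [sq_nonneg (inn m y j τ - 2 * ∑ k, p j k * outt m y k τ)]
    have hsum : E' τ ≤ (2*A*W+W) * Nrm y τ + W * (B * Nrm y τ + Φ τ) +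
        (A * (2 * Γ τ + 2 * (n * (n * P^2 * Otr m y τ))) - W*Λ*Otr m y τ) := by
      have h1 : E' τ ≤ ∑ j, (((2*A*W+W) * (∫ x in (0:ℝ)..1, y j x τ ^ 2) +
          W * ∫ x in (0:ℝ)..1, (yt j x τ + a j x τ * yx j x τ)^2) +
          (A * (2 * (inn m y j τ - ∑ k, p j k * outt m y k τ)^2
        + 2 * (n * P^2 * Otr m y τ)) - W * Λ * outt m y j τ^2)) := by
        refine Finset.sum_le_sum fun j _ => add_le_add (hbulk j) ((hbd j).trans ?_)
        exact sub_le_sub_right (mul_le_mul_of_nonneg_left (hin j) hA) _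
      refine h1.trans ?_
      simp only [Finset.sum_add_distrib, Finset.sum_sub_distrib, ← Finset.mul_sum]
      simp only [Finset.sum_const, Finset.card_univ, Fintype.card_fin, nsmul_eq_mul]
      have h2 := hr τ hτm
      have h3 := hg τ hτm
      have h4 := mul_le_mul_of_nonneg_left h2 (by linarith : 0 ≤ W)
      have h5 := mul_le_mul_of_nonneg_left h3 hA
      have h6 : ∑ j, ∫ x in (0:ℝ)..1, y j x τ ^ 2 = Nrm y τ := rfl
      have h7 : ∑ j, outt m y j τ^2 = Otr m y τ := rfl
      rw [h6, h7]
      nlinarith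
    refine hsum.trans ?_
    have h1 := (hNE τ hτ.le).1
    have h2 : (2*A*W+W+W*B) * Nrm y τ ≤ K2 * E τ := by
      have : 2*A*W+W+W*B = K2 := by rw [hK2]; ring
      rw [this]; exact mul_le_mul_of_nonneg_left h1 hK2p
    have h3 : W * Λ = Λ + (2*A*n^2*P^2+1) := by rw [hW, add_mul, hN0Λ]; ring
    have h4 := Otr_nonneg m y τ
    rw [h3]
    nlinarith [mul_nonneg hΛ.le h4]
  have hOc : ContinuousOn (Otr m y) (Ici s) := Otr_cont fun j => (hy j).c0
  have hG := gronwall_int (K := K2) ht.1 hEc hEd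
    (q := fun τ => W * Φ τ + 2*A*Γ τ - Otr m y τ)
    (((continuousOn_const.mul hΦ).add (continuousOn_const.mul hΓ)).sub hOc) hmain
  have hI : ∫ τ in s..t, Real.exp (-K2 * (τ - s)) * (W * Φ τ + 2*A*Γ τ - Otr m y τ) ≤
      ∫ τ in s..t, ((W + 2*A) * (Φ τ + Γ τ) - Real.exp (-K2*T) * Otr m y τ) := by
    refine intervalIntegral.integral_mono_on ht.1 ?_ ?_ ?_
    · apply ContinuousOn.intervalIntegrable
      rw [uIcc_of_le ht.1]
      refine ContinuousOn.mul (by fun_prop) (ContinuousOn.mono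
        (((continuousOn_const.mul hΦ).add (continuousOn_const.mul hΓ)).sub hOc) Icc_subset_Ici_self)
    · apply ContinuousOn.intervalIntegrable
      rw [uIcc_of_le ht.1]
      refine ContinuousOn.mono ?_ Icc_subset_Ici_self
      exact (continuousOn_const.mul (hΦ.add hΓ)).sub (continuousOn_const.mul hOc)
    · intro τ hτ
      have h1 : Real.exp (-K2 * (τ - s)) ≤ 1 := Real.exp_le_one_iff.mpr (by nlinarith [hτ.1])
      have h2 : Real.exp (-K2*T) ≤ Real.exp (-K2 * (τ - s)) :=
        Real.exp_le_exp.mpr (by nlinarith [hτ.2, ht.2])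
      have h3 := Real.exp_pos (-K2 * (τ - s))
      have h4 := Otr_nonneg m y τ
      have h5 : 0 ≤ W * Φ τ + 2*A*Γ τ := by
        have := hΦ0 τ; have := hΓ0 τ; positivity
      have h6 : W * Φ τ + 2*A*Γ τ ≤ (W + 2*A) * (Φ τ + Γ τ) := by
        nlinarith [mul_nonneg hA (hΦ0 τ), hΓ0 τ]
      nlinarith [mul_le_mul_of_nonneg_right h1 h5, mul_le_mul_of_nonneg_right h2 h4]
  have hI2 : ∫ τ in s..t, ((W + 2*A) * (Φ τ + Γ τ) - Real.exp (-K2*T) * Otr m y τ) =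
      (W+2*A) * (∫ τ in s..t, (Φ τ + Γ τ)) - Real.exp (-K2*T) * ∫ τ in s..t, Otr m y τ := by
    rw [intervalIntegral.integral_sub, intervalIntegral.integral_const_mul,
      intervalIntegral.integral_const_mul]
    · apply ContinuousOn.intervalIntegrable
      rw [uIcc_of_le ht.1]
      exact (continuousOn_const.mul (hΦ.add hΓ)).mono Icc_subset_Ici_self
    · apply ContinuousOn.intervalIntegrable
      rw [uIcc_of_le ht.1]
      exact (continuousOn_const.mul hOc).mono Icc_subset_Ici_self
  have h1 : Real.exp (-K2*T) ≤ Real.exp (-K2 * (t - s)) :=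
    Real.exp_le_exp.mpr (by nlinarith [ht.2])
  have h2 := (hNE t ht.1).1
  have h3 := (hNE s le_rfl).2
  have h4 := Nrm_nonneg y t
  have h5 := Real.exp_pos (-K2*T)
  have h6 : Real.exp (-K2*T) * Nrm y t ≤ E t * Real.exp (-K2 * (t - s)) := by
    rw [mul_comm]; exact mul_le_mul h2 h1 h5.le (h4.trans h2)
  have h7 : Real.exp (-K2*T) * (Nrm y t + ∫ τ in s..t, Otr m y τ) ≤
      (W+2*A) * (Nrm y s + ∫ τ in s..t, (Φ τ + Γ τ)) := by
    have := Nrm_nonneg y s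
    nlinarith [mul_nonneg hA this]
  have h8 : Real.exp (K2*T) * Real.exp (-K2*T) = 1 := by rw [← Real.exp_add]; simp
  calc Nrm y t + ∫ τ in s..t, Otr m y τ
      = Real.exp (K2*T) * (Real.exp (-K2*T) * (Nrm y t + ∫ τ in s..t, Otr m y τ)) := by
        rw [← mul_assoc, h8, one_mul]
    _ ≤ Real.exp (K2*T) * ((W+2*A) * (Nrm y s + ∫ τ in s..t, (Φ τ + Γ τ))) :=
        mul_le_mul_of_nonneg_left h7 (Real.exp_pos _).le
    _ = _ := by ring

end EL



section CC

/-- componentwise classical solutions -/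
structure Sol {n : ℕ} (m : ℕ) (p : Fin n → Fin n → ℝ) (a : Fin n → ℝ → ℝ → ℝ)
    (b : Fin n → Fin n → ℝ → ℝ → ℝ) (f : Fin n → ℝ → ℝ → ℝ) (s : ℝ)
    (u ux ut : Fin n → ℝ → ℝ → ℝ) : Prop where
  c1 : ∀ j, C1S s (u j) (ux j) (ut j)
  eq : ∀ j, ∀ x ∈ Icc (0:ℝ) 1, ∀ t, s ≤ t →
    ut j x t + a j x t * ux j x t + ∑ k, b j k x t * u k x t = f j x t
  bc : ∀ j t, s ≤ t → inn m u j t = ∑ k, p j k * outt m u k t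

lemma sum_sq_le {n : ℕ} (s : ℝ) {Bd : ℝ} (hB : 0 ≤ Bd) {b : Fin n → Fin n → ℝ → ℝ → ℝ}
    (hbc : ∀ j k, CS s (b j k)) (hb : ∀ j k, ∀ x ∈ Icc (0:ℝ) 1, ∀ t, s ≤ t → |b j k x t| ≤ Bd)
    {u f r : Fin n → ℝ → ℝ → ℝ} (hu : ∀ j, CS s (u j)) (hf : ∀ j, CS s (f j))
    (hr : ∀ j, CS s (r j)) {t : ℝ} (ht : s ≤ t)
    (h : ∀ j, ∀ x ∈ Icc (0:ℝ) 1, |r j x t| ≤ |f j x t| + ∑ k, |b j k x t * u k x t|) :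
    Nrm r t ≤ 2 * n^2 * Bd^2 * Nrm u t + 2 * Nrm f t := by
  have key : ∀ j, ∫ x in (0:ℝ)..1, r j x t ^2 ≤ 2 * n * Bd^2 * Nrm u t +
      2 * ∫ x in (0:ℝ)..1, f j x t^2 := by
    intro j
    have e1 : 2 * n * Bd^2 * Nrm u t + 2 * ∫ x in (0:ℝ)..1, f j x t^2 =
        ∫ x in (0:ℝ)..1, (2 * n * Bd^2 * (∑ k, u k x t^2) + 2 * f j x t ^2) := by
      rw [intervalIntegral.integral_add, intervalIntegral.integral_const_mul,
        intervalIntegral.integral_const_mul, intervalIntegral.integral_finsetSum]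
      · rfl
      · exact fun k _ => ((hu k).pow 2).integrable ht
      · exact ((CS.const (2 * n * Bd^2)).mul (CS.sum fun k _ => (hu k).pow 2)).integrable ht
      · exact ((CS.const 2).mul ((hf j).pow 2)).integrable ht
    rw [e1]
    refine intervalIntegral.integral_mono_on zero_le_one (((hr j).pow 2).integrable ht)
      (((((CS.const (2 * n * Bd^2)).mul (CS.sum fun k _ => (hu k).pow 2))).add
        ((CS.const 2).mul ((hf j).pow 2))).integrable ht) fun x hx => ?_
    have h1 := h j x hx
    have h2 : (∑ k, |b j k x t * u k x t|)^2 ≤ n * Bd^2 * ∑ k, u k x t^2 := by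
      have := sq_sum_le_card_mul_sum_sq (s := (Finset.univ : Finset (Fin n)))
          (f := fun k => |b j k x t * u k x t|)
      simp only [Finset.card_univ, Fintype.card_fin] at this
      refine this.trans ?_
      rw [mul_assoc]
      refine mul_le_mul_of_nonneg_left ?_ (by positivity)
      rw [Finset.mul_sum]
      refine Finset.sum_le_sum fun k _ => ?_
      rw [sq_abs, mul_pow]
      refine mul_le_mul_of_nonneg_right ?_ (sq_nonneg _)
      rw [← sq_abs]
      exact pow_le_pow_left₀ (abs_nonneg _) (hb j k x hx t ht) 2
    have h3 : r j x t^2 ≤ (|f j x t| + ∑ k, |b j k x t * u k x t|)^2 := by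
      rw [← sq_abs]; exact pow_le_pow_left₀ (abs_nonneg _) h1 2
    nlinarith [sq_nonneg (|f j x t| - ∑ k, |b j k x t * u k x t|), sq_abs (f j x t)]
  calc Nrm r t ≤ ∑ j : Fin n, (2 * n * Bd^2 * Nrm u t + 2 * ∫ x in (0:ℝ)..1, f j x t^2) :=
        Finset.sum_le_sum fun j _ => key j
    _ = _ := by
        rw [Finset.sum_add_distrib, ← Finset.mul_sum (f := fun j => ∫ x in (0:ℝ)..1, f j x t^2)]
        simp only [Finset.sum_const, Finset.card_univ, Fintype.card_fin, nsmul_eq_mul]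
        unfold Nrm; ring

/-- basic energy estimate for solutions -/
lemma EL2 (n m : ℕ) {Λ A P B T : ℝ} (hΛ : 0 < Λ) (hA : 0 ≤ A) (hP : 0 ≤ P) (hB : 0 ≤ B)
    (hT : 0 ≤ T) : ∃ K, 1 ≤ K ∧ ∀ a ax aT : Fin n → ℝ → ℝ → ℝ, ACof m Λ A a ax aT →
      ∀ p : Fin n → Fin n → ℝ, (∀ j k, |p j k| ≤ P) →
      ∀ (s : ℝ) (b : Fin n → Fin n → ℝ → ℝ → ℝ), (∀ j k, CS s (b j k)) →
      (∀ j k, ∀ x ∈ Icc (0:ℝ) 1, ∀ t, s ≤ t → |b j k x t| ≤ B) →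
      ∀ f : Fin n → ℝ → ℝ → ℝ, (∀ j, CS s (f j)) →
      ∀ (u ux ut : Fin n → ℝ → ℝ → ℝ), Sol m p a b f s u ux ut →
      ∀ t ∈ Icc s (s+T), Nrm u t + ∫ τ in s..t, Otr m u τ ≤
        K * (Nrm u s + ∫ τ in s..t, Nrm f τ) := by
  obtain ⟨K, hK, h⟩ := EL n m hΛ hA hP (by positivity : 0 ≤ 2 * (n:ℝ)^2 * B^2) hT
  refine ⟨2*K, by linarith, ?_⟩
  intro a ax aT ha p hp s b hbc hb f hf u ux ut hu t ht
  have h1 := h a ax aT ha p hp s u ux ut hu.c1 (fun t => 2 * Nrm f t) (fun _ => 0)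
    (continuousOn_const.mul (Nrm_cont hf)) continuousOn_const
    (fun t => by have := Nrm_nonneg f t; positivity) (fun _ => le_rfl) ?_ ?_ t ht
  · simp only [add_zero, intervalIntegral.integral_const_mul] at h1
    refine h1.trans ?_
    have := Nrm_nonneg u s
    nlinarith
  · intro τ hτ
    refine sum_sq_le (r := fun j x t => ut j x t + a j x t * ux j x t) s hB hbc hb
      (fun j => (hu.c1 j).c0) hf
      (fun j => (hu.c1 j).ct.add ((ha.c1 s j).c0.mul (hu.c1 j).cx)) hτ.1 ?_
    intro j x hx
    have e := hu.eq j x hx τ hτ.1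
    have e2 : ut j x τ + a j x τ * ux j x τ = f j x τ - ∑ k, b j k x τ * u k x τ := by linarith
    simp only [e2]
    exact (abs_sub _ _).trans (add_le_add le_rfl (Finset.abs_sum_le_sum_abs _ _))
  · intro τ hτ
    have : ∀ j, (inn m u j τ - ∑ k, p j k * outt m u k τ)^2 = 0 := fun j => by
      rw [hu.bc j τ hτ.1]; simp
    simp [this]

/-- paths of nonvanishing reflection coefficients -/
def Rpath {n : ℕ} (p : Fin n → Fin n → ℝ) : ℕ → Fin n → Prop
  | 0, _ => True
  | l+1, j => ∃ k, p j k ≠ 0 ∧ Rpath p l k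

lemma Rpath_tuple {n : ℕ} (p : Fin n → Fin n → ℝ) (l : ℕ) (j : Fin n) (h : Rpath p l j) :
    ∃ i : Fin (l+1) → Fin n, i 0 = j ∧ ∀ q : Fin l, p (i q.castSucc) (i q.succ) ≠ 0 := by
  induction l generalizing j with
  | zero => exact ⟨fun _ => j, rfl, fun q => q.elim0⟩
  | succ l ih =>
    obtain ⟨k, hk, hR⟩ := h
    obtain ⟨i, hi0, hi⟩ := ih k hR
    refine ⟨Fin.cons j i, rfl, fun q => ?_⟩
    induction q using Fin.cases with
    | zero =>
      simp only [Fin.castSucc_zero, Fin.cons_zero, Fin.cons_succ]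
      rw [hi0]; exact hk
    | succ q =>
      rw [← Fin.succ_castSucc, Fin.cons_succ, Fin.cons_succ]
      exact hi q

lemma exists_lev {n : ℕ} {p : Fin n → Fin n → ℝ} (h : H3cond n p) :
    ∃ lev : Fin n → ℕ, (∀ j, lev j < n) ∧ ∀ j k, p j k ≠ 0 → lev k < lev j := by
  classical
  have hn : ∀ j, ¬ Rpath p n j := by
    intro j hj
    obtain ⟨i, _, hi⟩ := Rpath_tuple p n j hj
    exact (Finset.prod_ne_zero_iff.mpr fun q _ => hi q) (h i)
  have hs : ∀ j, Rpath p (Nat.findGreatest (fun l => Rpath p l j) n) j := fun j =>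
    Nat.findGreatest_spec (P := fun l => Rpath p l j) (Nat.zero_le n) trivial
  have hlt : ∀ j, Nat.findGreatest (fun l => Rpath p l j) n < n := by
    intro j
    refine lt_of_le_of_ne (Nat.findGreatest_le n) fun he => ?_
    have := hs j
    rw [he] at this
    exact hn j this
  refine ⟨fun j => Nat.findGreatest (fun l => Rpath p l j) n, hlt, fun j k hjk => ?_⟩
  exact Nat.le_findGreatest (P := fun l => Rpath p l j) (hlt k) ⟨k, hjk, hs k⟩

/-- continuous function with vanishing square integral vanishes -/
lemma zero_of_int_zero {g : ℝ → ℝ} (hg : ContinuousOn g (Icc 0 1)) (h0 : ∀ x ∈ Icc (0:ℝ) 1, 0 ≤ g x)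
    (h : ∫ x in (0:ℝ)..1, g x ≤ 0) : ∀ x ∈ Icc (0:ℝ) 1, g x = 0 := by
  intro x hx
  by_contra hne
  have : 0 < ∫ x in (0:ℝ)..1, g x :=
    intervalIntegral.integral_pos zero_lt_one hg (fun z hz => h0 z ⟨hz.1.le, hz.2⟩)
      ⟨x, hx, lt_of_le_of_ne (h0 x hx) (Ne.symm hne)⟩
  linarith

lemma hasDerivAt_maxsq (x : ℝ) : HasDerivAt (fun x : ℝ => (max x 0)^2) (2 * max x 0) x := by
  rcases lt_trichotomy x 0 with h | h | h
  · rw [max_eq_right h.le]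
    refine (hasDerivAt_const x (0:ℝ)).congr_of_eventuallyEq ?_ |>.congr_deriv (by simp)
    filter_upwards [Iio_mem_nhds h] with y hy
    rw [max_eq_right (le_of_lt hy)]; simp
  · subst h
    simp only [max_self, mul_zero]
    rw [hasDerivAt_iff_isLittleO_nhds_zero]
    simp only [zero_add, max_self, smul_zero, sub_zero]
    refine Asymptotics.IsBigO.trans_isLittleO (g := fun h : ℝ => h^2) ?_ ?_
    · refine Asymptotics.IsBigO.of_bound 1 (Eventually.of_forall fun h => ?_)
      simp only [ne_eq, OfNat.ofNat_ne_zero, not_false_eq_true, zero_pow, sub_zero, one_mul]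
      rw [Real.norm_of_nonneg (sq_nonneg _), Real.norm_of_nonneg (sq_nonneg _), ← sq_abs h]
      exact pow_le_pow_left₀ (le_max_right _ _) (max_le (le_abs_self _) (abs_nonneg _)) 2
    · have := Asymptotics.isLittleO_pow_pow (𝕜 := ℝ) (show 1 < 2 by norm_num)
      simpa using this
  · rw [max_eq_left h.le]
    refine (hasDerivAt_pow 2 x).congr_of_eventuallyEq ?_ |>.congr_deriv (by simp)
    filter_upwards [Ioi_mem_nhds h] with y hy
    rw [max_eq_left (le_of_lt hy)]

lemma scalar_vanish {n m : ℕ} {Λ A Bd : ℝ} (hΛ : 0 < Λ) (hA : 0 ≤ A) (hB : 0 ≤ Bd)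
    {a ax aT : Fin n → ℝ → ℝ → ℝ} (ha : ACof m Λ A a ax aT) (j : Fin n) {t1 : ℝ}
    {y yx yt β : ℝ → ℝ → ℝ} (hy : C1S t1 y yx yt) (hβc : CS t1 β)
    (hβ : ∀ x ∈ Icc (0:ℝ) 1, ∀ t, t1 ≤ t → |β x t| ≤ Bd)
    (heq : ∀ x ∈ Icc (0:ℝ) 1, ∀ t, t1 ≤ t → yt x t + a j x t * yx x t + β x t * y x t = 0)
    (hin : ∀ t, t1 ≤ t → (if (j:ℕ) < m then y 0 t else y 1 t) = 0) :
    ∀ t, t1 + 1/Λ < t → ∀ x ∈ Icc (0:ℝ) 1, y x t = 0 := by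
  intro t ht
  have ht1 : t1 < t := by have : 0 < 1/Λ := by positivity
                          linarith
  set q : ℝ → ℝ → ℝ := fun x t => Λ * (t - t1) - dd m j x with hq
  have hqc : Continuous (fun z : ℝ × ℝ => q z.1 z.2) := by
    simp only [hq, dd]; split_ifs <;> fun_prop
  have hqm : Continuous (fun z : ℝ × ℝ => max (q z.1 z.2) 0) := hqc.max continuous_const
  have hw : C1S t1 (fun x t => (max (q x t) 0)^2) (fun x t => 2 * max (q x t) 0 * (- sg m j))
      (fun x t => 2 * max (q x t) 0 * Λ) := by
    refine ⟨CS.of_cont (hqm.pow 2), CS.of_cont ((continuous_const.mul hqm).mul continuous_const),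
      CS.of_cont ((continuous_const.mul hqm).mul continuous_const), fun x hx t ht => ?_,
      fun x hx t ht => ?_⟩
    · have h1 : HasDerivWithinAt (fun z => q z t) (- sg m j) (Icc 0 1) x :=
        ((dd_c1 m j t).dx x hx t le_rfl).const_sub (Λ * (t - t1))
      exact (hasDerivAt_maxsq (q x t)).comp_hasDerivWithinAt x h1
    · have h1 : HasDerivAt (fun z => q x z) Λ t := by
        have := (((hasDerivAt_id t).sub_const t1).const_mul Λ).sub_const (dd m j x)
        rw [mul_one] at this
        exact this
      exact (hasDerivAt_maxsq (q x t)).comp_hasDerivWithinAt t h1.hasDerivWithinAt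
  obtain ⟨hEc, hEd⟩ := energy_identity hy (ha.c1 t1 j) hw
  have hG := gronwall_int (K := A + 2*Bd) (q := fun _ => 0) ht1.le hEc hEd continuousOn_const ?_
  · have hE0 : ∫ x in (0:ℝ)..1, (max (q x t1) 0)^2 * y x t1^2 = 0 := by
      have : ∫ x in (0:ℝ)..1, (max (q x t1) 0)^2 * y x t1^2 = ∫ x in (0:ℝ)..1, (0:ℝ) := by
        apply intervalIntegral.integral_congr
        intro x hx
        rw [uIcc_of_le zero_le_one] at hx
        have := (dd_mem m j hx).1
        have : max (q x t1) 0 = 0 := max_eq_right (by simp only [hq]; linarith)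
        simp only [this]; ring
      rw [this]; simp
    rw [hE0] at hG
    simp only [mul_zero, intervalIntegral.integral_zero, add_zero] at hG
    have hE : ∫ x in (0:ℝ)..1, (max (q x t) 0)^2 * y x t^2 ≤ 0 := by
      by_contra hc
      have := mul_pos (not_le.mp hc) (Real.exp_pos (-(A + 2*Bd) * (t - t1)))
      linarith
    intro x hx
    have h1 := zero_of_int_zero ((hw.c0.mul (hy.c0.pow 2)).att ht1.le) (fun x _ => by positivity)
      hE x hx
    have h2 : 0 < q x t := by
      have h3 := (dd_mem m j hx).2
      have h4 : 1 < Λ * (t - t1) := by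
        have : 1/Λ < t - t1 := by linarith
        rwa [div_lt_iff₀' hΛ] at this
      simp only [hq]; linarith
    rw [max_eq_left h2.le] at h1
    have := (mul_eq_zero.mp h1).resolve_left (by positivity)
    exact pow_eq_zero_iff (two_ne_zero) |>.mp this
  · intro τ hτ _
    have hbd : (max (q 0 τ) 0)^2 * a j 0 τ * y 0 τ ^2 - (max (q 1 τ) 0)^2 * a j 1 τ * y 1 τ^2 ≤ 0 := by
      have hi := hin τ hτ.le
      by_cases h : (j:ℕ) < m
      · simp only [h, if_true] at hi
        have := ha.pos j h 1 (by simp) τ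
        have h3 : 0 ≤ a j 1 τ := by linarith
        rw [hi]
        have : 0 ≤ (max (q 1 τ) 0)^2 * a j 1 τ * y 1 τ^2 := by positivity
        linarith
      · simp only [h, if_false] at hi
        have := ha.neg j h 0 (by simp) τ
        have h3 : 0 ≤ -a j 0 τ := by linarith
        rw [hi]
        have : 0 ≤ (max (q 0 τ) 0)^2 * (-a j 0 τ) * y 0 τ^2 := by positivity
        linarith
    have hbulk : ∫ x in (0:ℝ)..1, ((2 * max (q x τ) 0 * Λ + a j x τ * (2 * max (q x τ) 0 * (- sg m j))
        + ax j x τ * (max (q x τ) 0)^2) * y x τ^2 + 2 * (max (q x τ) 0)^2 * y x τ *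
          (yt x τ + a j x τ * yx x τ)) ≤ (A + 2*Bd) * ∫ x in (0:ℝ)..1, (max (q x τ) 0)^2 * y x τ^2 := by
      rw [← intervalIntegral.integral_const_mul]
      have c1 := (((hw.ct.add ((ha.c1 t1 j).c0.mul hw.cx)).add ((ha.c1 t1 j).cx.mul hw.c0)).mul
        (hy.c0.pow 2)).add (((CS.const 2).mul hw.c0).mul hy.c0 |>.mul
          (hy.ct.add ((ha.c1 t1 j).c0.mul hy.cx)))
      refine intervalIntegral.integral_mono_on zero_le_one (c1.integrable hτ.le)
        (((CS.const (A+2*Bd)).mul (hw.c0.mul (hy.c0.pow 2))).integrable hτ.le) fun x hx => ?_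
      have e := heq x hx τ hτ.le
      have e2 : yt x τ + a j x τ * yx x τ = - (β x τ * y x τ) := by linarith
      rw [e2]
      set Q := max (q x τ) 0 with hQ
      have hQ0 : 0 ≤ Q := le_max_right _ _
      have hs : Λ - a j x τ * sg m j ≤ 0 := by
        unfold sg
        by_cases h : (j:ℕ) < m
        · simp only [h, if_true]; linarith [ha.pos j h x hx τ]
        · simp only [h, if_false]; linarith [ha.neg j h x hx τ]
      have h1 : 2 * Q * Λ + a j x τ * (2 * Q * (- sg m j)) ≤ 0 := by nlinarith
      have h2 := (abs_le.mp (ha.bx j x hx τ)).2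
      have h3 := (abs_le.mp (hβ x hx τ hτ.le)).1
      have h4 : 0 ≤ Q^2 * y x τ^2 := by positivity
      have h5 := mul_le_mul_of_nonneg_right h1 (sq_nonneg (y x τ))
      nlinarith
    linarith

/-- the decoupled system dies out in finite time -/
lemma diag_vanish {n m : ℕ} {Λ A Bd : ℝ} (hΛ : 0 < Λ) (hA : 0 ≤ A) (hB : 0 ≤ Bd)
    {a ax aT : Fin n → ℝ → ℝ → ℝ} (ha : ACof m Λ A a ax aT) {p : Fin n → Fin n → ℝ}
    (hp : H3cond n p) {s : ℝ} {b : Fin n → Fin n → ℝ → ℝ → ℝ} (hbc : ∀ j k, CS s (b j k))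
    (hb : ∀ j k, ∀ x ∈ Icc (0:ℝ) 1, ∀ t, s ≤ t → |b j k x t| ≤ Bd)
    (hoff : ∀ j k, j ≠ k → ∀ x ∈ Icc (0:ℝ) 1, ∀ t, s ≤ t → b j k x t = 0)
    {u ux ut : Fin n → ℝ → ℝ → ℝ} (hu : Sol m p a b (fun _ _ _ => 0) s u ux ut) :
    ∀ j, ∀ t, s + n/Λ < t → ∀ x ∈ Icc (0:ℝ) 1, u j x t = 0 := by
  obtain ⟨lev, hlev, hpl⟩ := exists_lev hp
  have key : ∀ l : ℕ, ∀ j, lev j = l → ∀ t, s + (l+1)/Λ < t → ∀ x ∈ Icc (0:ℝ) 1, u j x t = 0 := by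
    intro l
    induction l using Nat.strong_induction_on with
    | _ l ih =>
      intro j hj t ht
      have h0 : (l+1)/Λ = l/Λ + 1/Λ := by ring
      have hlΛ : 0 ≤ (l:ℝ)/Λ := by positivity
      set t1 : ℝ := ((s + l/Λ) + (t - 1/Λ))/2 with ht1
      have h1 : s + l/Λ < t1 := by rw [ht1]; linarith
      have h2 : t1 + 1/Λ < t := by rw [ht1]; linarith
      have hst1 : s ≤ t1 := by linarith
      refine scalar_vanish hΛ hA hB ha j ((hu.c1 j).mono hst1) ((hbc j j).mono hst1)
        (fun x hx t ht => hb j j x hx t (hst1.trans ht)) ?_ ?_ t h2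
      · intro x hx t ht
        have := hu.eq j x hx t (hst1.trans ht)
        rw [Finset.sum_eq_single j] at this
        · exact this
        · intro k _ hk
          rw [hoff j k hk.symm x hx t (hst1.trans ht), zero_mul]
        · simp
      · intro τ hτ
        have := hu.bc j τ (hst1.trans hτ)
        unfold inn at this
        rw [this]
        refine Finset.sum_eq_zero fun k _ => ?_
        by_cases hpk : p j k = 0
        · rw [hpk, zero_mul]
        · have hk := hpl j k hpk
          rw [hj] at hk
          have hz := ih (lev k) hk k rfl τ (by
            have : ((lev k : ℝ)+1)/Λ ≤ l/Λ := by
              apply div_le_div_of_nonneg_right _ hΛ.le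
              exact_mod_cast hk
            linarith)
          have : outt m u k τ = 0 := by
            unfold outt; split_ifs
            · exact hz 1 (by simp)
            · exact hz 0 (by simp)
          rw [this, mul_zero]
  intro j t ht
  refine key (lev j) j rfl t (lt_of_le_of_lt ?_ ht)
  have : ((lev j : ℝ)+1)/Λ ≤ n/Λ := by
    apply div_le_div_of_nonneg_right _ hΛ.le
    exact_mod_cast hlev j
  linarith

end CC



section D1

/-- averaged difference quotient -/
def dqt (gt : ℝ → ℝ → ℝ) (x u v : ℝ) : ℝ := ∫ r in (0:ℝ)..1, gt x (u + r * (v - u))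

lemma dqt_cont {gt : ℝ → ℝ → ℝ} (h : Continuous fun q : ℝ × ℝ => gt q.1 q.2) :
    Continuous (fun q : ℝ × ℝ × ℝ => dqt gt q.1 q.2.1 q.2.2) := by
  unfold dqt
  apply intervalIntegral.continuous_parametric_intervalIntegral_of_continuous'
  exact h.comp (f := fun z : (ℝ × ℝ × ℝ) × ℝ => (z.1.1, z.1.2.1 + z.2 * (z.1.2.2 - z.1.2.1)))
    (by fun_prop)

lemma dqt_self (gt : ℝ → ℝ → ℝ) (x u : ℝ) : dqt gt x u u = gt x u := by
  simp [dqt]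

lemma dqt_eq {g gt : ℝ → ℝ → ℝ} (h : Continuous fun q : ℝ × ℝ => gt q.1 q.2)
    (hd : ∀ x t, HasDerivAt (fun τ => g x τ) (gt x t) t) (x u v : ℝ) :
    g x v - g x u = dqt gt x u v * (v - u) := by
  have hc : Continuous fun t => gt x t := h.comp (f := fun t : ℝ => (x, t)) (by fun_prop)
  have h1 : ∀ r ∈ uIcc (0:ℝ) 1, HasDerivAt (fun r => g x (u + r * (v - u)))
      (gt x (u + r * (v - u)) * (v - u)) r := by
    intro r _
    have := (hd x (u + r * (v - u))).comp r
      (((hasDerivAt_id r).mul_const (v - u)).const_add u)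
    simpa [Function.comp_def] using this
  have h2 := intervalIntegral.integral_eq_sub_of_hasDerivAt h1
    (Continuous.intervalIntegrable (by fun_prop) _ _)
  rw [intervalIntegral.integral_mul_const] at h2
  simp only [one_mul, zero_mul, add_zero] at h2
  unfold dqt
  rw [h2]; congr 1; congr 1; ring

lemma dqt_bound {gt : ℝ → ℝ → ℝ} {L : ℝ} (hb : ∀ x t, |gt x t| ≤ L) (x u v : ℝ) :
    |dqt gt x u v| ≤ L := by
  unfold dqt
  have := intervalIntegral.norm_integral_le_of_norm_le_const (a := 0) (b := 1)
    (f := fun r => gt x (u + r * (v - u))) (C := L) (fun r _ => hb _ _)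
  simpa using this

/-- linear scalar ODE -/
lemma lin_ode {d k : ℝ → ℝ} (hk : Continuous k) (hd : ∀ x, HasDerivAt d (k x * d x) x) (x0 x : ℝ) :
    d x = d x0 * Real.exp (∫ ξ in x0..x, k ξ) := by
  have h1 : ∀ x, HasDerivAt (fun x => d x * Real.exp (-∫ ξ in x0..x, k ξ)) 0 x := by
    intro x
    have h2 : HasDerivAt (fun x => ∫ ξ in x0..x, k ξ) (k x) x :=
      intervalIntegral.integral_hasDerivAt_right (hk.intervalIntegrable _ _)
        (hk.stronglyMeasurableAtFilter _ _) hk.continuousAt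
    have := (hd x).mul (h2.neg.exp)
    refine this.congr_deriv ?_
    ring
  have h3 := is_const_of_deriv_eq_zero (fun x => (h1 x).differentiableAt) (fun x => (h1 x).deriv) x x0
  simp only [intervalIntegral.integral_same, neg_zero, Real.exp_zero, mul_one] at h3
  rw [← h3, mul_assoc, ← Real.exp_add]; simp

/-- flow data -/
structure ChFlow (c ct : ℝ → ℝ → ℝ) (L x0 : ℝ) (X E T : ℝ → ℝ → ℝ) : Prop where
  Xc : Continuous fun q : ℝ × ℝ => X q.1 q.2
  Ec : Continuous fun q : ℝ × ℝ => E q.1 q.2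
  Tc : Continuous fun q : ℝ × ℝ => T q.1 q.2
  X0 : ∀ θ, X x0 θ = θ
  E0 : ∀ θ, E x0 θ = 1
  Xd : ∀ x θ, HasDerivAt (fun z => X z θ) (c x (X x θ)) x
  Xθ : ∀ x θ, HasDerivAt (fun z => X x z) (E x θ) θ
  Elow : ∀ x θ, Real.exp (-(L * |x - x0|)) ≤ E x θ
  Eup : ∀ x θ, E x θ ≤ Real.exp (L * |x - x0|)
  TX : ∀ x θ, T x (X x θ) = θ
  XT : ∀ x t, X x (T x t) = t

lemma exists_flowcurve {c : ℝ → ℝ → ℝ} {Cb L : ℝ} (hc : Continuous fun q : ℝ × ℝ => c q.1 q.2)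
    (hCb : 0 ≤ Cb) (hb : ∀ x t, |c x t| ≤ Cb) (hL : 0 ≤ L)
    (hlip : ∀ x u v, |c x v - c x u| ≤ L * |v - u|)
    (hz : ∀ x, x ∉ Icc (-1:ℝ) 2 → ∀ t, c x t = 0) {x0 : ℝ} (hx0 : x0 ∈ Icc (0:ℝ) 1) (θ : ℝ) :
    ∃ X : ℝ → ℝ, X x0 = θ ∧ ∀ x, HasDerivAt X (c x (X x)) x := by
  have hx0' : x0 ∈ Icc (-1:ℝ) 2 := ⟨by linarith [hx0.1], by linarith [hx0.2]⟩
  have hPL : IsPicardLindelof c (⟨x0, hx0'⟩ : Icc (-1:ℝ) 2) θ ⟨Cb*3, by positivity⟩ 0 ⟨Cb, hCb⟩ ⟨L, hL⟩ := by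
    refine ⟨fun x _ => ?_, fun t _ => ?_, fun x _ t _ => hb x t, ?_⟩
    · refine LipschitzOnWith.of_dist_le_mul fun u _ v _ => ?_
      rw [Real.dist_eq, Real.dist_eq]
      have := hlip x v u
      exact this
    · exact (hc.comp (f := fun x : ℝ => (x, t)) (by fun_prop)).continuousOn
    · have : max (2 - x0) (x0 - -1) ≤ 3 := max_le (by linarith [hx0.1]) (by linarith [hx0.2])
      have h2 := mul_le_mul_of_nonneg_left this hCb
      show Cb * max (2 - x0) (x0 - -1) ≤ Cb * 3 - 0
      linarith
  obtain ⟨α, hα0, hα⟩ := hPL.exists_eq_forall_mem_Icc_hasDerivWithinAt₀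
  simp only at hα0
  have hαc : ContinuousOn α (Icc (-1) 2) := fun x hx => (hα x hx).continuousWithinAt
  -- extension
  set pr : ℝ → ℝ := fun x => max (-1) (min x 2) with hpr
  have hprc : Continuous pr := by simp only [hpr]; fun_prop
  have hprm : ∀ x, pr x ∈ Icc (-1:ℝ) 2 := fun x =>
    ⟨le_max_left _ _, max_le (by norm_num) (min_le_right _ _)⟩
  have hpre : ∀ x ∈ Icc (-1:ℝ) 2, pr x = x := fun x hx => by
    simp only [hpr]; rw [min_eq_left hx.2, max_eq_right hx.1]
  set α2 : ℝ → ℝ := fun x => α (pr x) with hα2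
  have hα2c : Continuous α2 := hαc.comp_continuous hprc hprm
  have hic : Continuous (fun ξ => c ξ (α2 ξ)) := hc.comp (continuous_id.prodMk hα2c)
  set X : ℝ → ℝ := fun x => θ + ∫ ξ in x0..x, c ξ (α2 ξ) with hX
  have hXd : ∀ x, HasDerivAt X (c x (α2 x)) x := fun x =>
    (intervalIntegral.integral_hasDerivAt_right (hic.intervalIntegrable _ _)
        (hic.stronglyMeasurableAtFilter _ _) hic.continuousAt).const_add θ
  have hXα : ∀ x ∈ Icc (-1:ℝ) 2, X x = α x := by
    intro x hx
    have h1 : ∫ ξ in x0..x, c ξ (α2 ξ) = α2 x - α2 x0 := by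
      refine intervalIntegral.integral_eq_sub_of_hasDeriv_right hα2c.continuousOn ?_
        (hic.intervalIntegrable _ _)
      intro ξ hξ
      have hξ2 : ξ ∈ Ioo (-1:ℝ) 2 :=
        ⟨lt_of_le_of_lt (le_min hx0'.1 hx.1) hξ.1, lt_of_lt_of_le hξ.2 (max_le hx0'.2 hx.2)⟩
      have hξ3 : ξ ∈ Icc (-1:ℝ) 2 := ⟨hξ2.1.le, hξ2.2.le⟩
      have h2 := (hα ξ hξ3).hasDerivAt (Icc_mem_nhds hξ2.1 hξ2.2)
      have h3 : α2 =ᶠ[nhds ξ] α := by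
        filter_upwards [Icc_mem_nhds hξ2.1 hξ2.2] with z hz
        simp only [hα2, hpre z hz]
      have h4 : α2 ξ = α ξ := by simp only [hα2, hpre ξ hξ3]
      rw [h4]
      exact (h2.congr_of_eventuallyEq h3).hasDerivWithinAt
    have h5 : X x = θ + (α2 x - α2 x0) := by simp only [hX]; rw [h1]
    have h6 : α2 x = α x := by simp only [hα2, hpre x hx]
    have h7 : α2 x0 = θ := by simp only [hα2, hpre x0 hx0', hα0]
    rw [h5, h6, h7]; ring
  refine ⟨X, by simp [hX], fun x => ?_⟩
  by_cases hx : x ∈ Icc (-1:ℝ) 2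
  · have := hXd x
    rwa [show α2 x = X x by rw [hXα x hx]; simp only [hα2, hpre x hx]] at this
  · have := hXd x
    rwa [hz x hx, ← hz x hx (X x)] at this

lemma exists_flow {c ct : ℝ → ℝ → ℝ} {Cb L : ℝ} (hc : Continuous fun q : ℝ × ℝ => c q.1 q.2)
    (hct : Continuous fun q : ℝ × ℝ => ct q.1 q.2)
    (hd : ∀ x t, HasDerivAt (fun τ => c x τ) (ct x t) t)
    (hCb : 0 ≤ Cb) (hb : ∀ x t, |c x t| ≤ Cb) (hL : 0 ≤ L) (hbt : ∀ x t, |ct x t| ≤ L)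
    (hz : ∀ x, x ∉ Icc (-1:ℝ) 2 → ∀ t, c x t = 0) {x0 : ℝ} (hx0 : x0 ∈ Icc (0:ℝ) 1) :
    ∃ X E T : ℝ → ℝ → ℝ, ChFlow c ct L x0 X E T := by
  have hlip : ∀ x u v, |c x v - c x u| ≤ L * |v - u| := by
    intro x u v
    rw [dqt_eq hct hd, abs_mul]
    exact mul_le_mul_of_nonneg_right (dqt_bound hbt _ _ _) (abs_nonneg _)
  choose X' hX0 hXd using fun θ => exists_flowcurve hc hCb hb hL hlip hz hx0 θ
  set X : ℝ → ℝ → ℝ := fun x θ => X' θ x with hX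
  have hXx : ∀ θ, Continuous fun x => X x θ := fun θ =>
    continuous_iff_continuousAt.mpr fun x => (hXd θ x).continuousAt
  have hdk := dqt_cont hct
  have hdiff : ∀ x θ θ', X x θ' - X x θ =
      (θ' - θ) * Real.exp (∫ ξ in x0..x, dqt ct ξ (X ξ θ) (X ξ θ')) := by
    intro x θ θ'
    have h1 := lin_ode (d := fun x => X x θ' - X x θ) (k := fun ξ => dqt ct ξ (X ξ θ) (X ξ θ'))
      (hdk.comp (continuous_id.prodMk ((hXx θ).prodMk (hXx θ')))) (fun x => by
        have := (hXd θ' x).sub (hXd θ x)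
        rw [dqt_eq hct hd] at this
        exact this) x0 x
    simp only [hX, hX0] at h1 ⊢
    exact h1
  have hexpb : ∀ x (k : ℝ → ℝ), (∀ ξ, |k ξ| ≤ L) → |∫ ξ in x0..x, k ξ| ≤ L * |x - x0| := by
    intro x k hk
    have := intervalIntegral.norm_integral_le_of_norm_le_const (a := x0) (b := x) (f := k) (C := L)
      (fun ξ _ => by rw [Real.norm_eq_abs]; exact hk ξ)
    rwa [Real.norm_eq_abs] at this
  have hup : ∀ x θ θ', |X x θ' - X x θ| ≤ |θ' - θ| * Real.exp (L * |x - x0|) := by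
    intro x θ θ'
    rw [hdiff, abs_mul, abs_of_pos (Real.exp_pos _)]
    refine mul_le_mul_of_nonneg_left (Real.exp_le_exp.mpr ?_) (abs_nonneg _)
    exact (abs_le.mp (hexpb x _ fun ξ => dqt_bound hbt _ _ _)).2
  have hlow : ∀ x θ θ', |θ' - θ| * Real.exp (-(L * |x - x0|)) ≤ |X x θ' - X x θ| := by
    intro x θ θ'
    rw [hdiff, abs_mul, abs_of_pos (Real.exp_pos _)]
    refine mul_le_mul_of_nonneg_left (Real.exp_le_exp.mpr ?_) (abs_nonneg _)
    exact (abs_le.mp (hexpb x _ fun ξ => dqt_bound hbt _ _ _)).1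
  have hXc : Continuous fun q : ℝ × ℝ => X q.1 q.2 := by
    rw [continuous_iff_continuousAt]
    rintro ⟨x1, θ1⟩
    rw [ContinuousAt, tendsto_iff_dist_tendsto_zero]
    have h1 : Tendsto (fun q : ℝ × ℝ => |q.2 - θ1| * Real.exp (L * |q.1 - x0|) + |X q.1 θ1 - X x1 θ1|)
        (nhds (x1, θ1)) (nhds 0) := by
      have hcc : Continuous (fun q : ℝ × ℝ => |q.2 - θ1| * Real.exp (L * |q.1 - x0|) + |X q.1 θ1 - X x1 θ1|) := by
        have := (hXx θ1).comp continuous_fst (X := ℝ × ℝ)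
        simp only [Function.comp_def] at this
        fun_prop
      have := hcc.tendsto (x1, θ1)
      simpa using this
    refine squeeze_zero (fun _ => dist_nonneg) (fun q => ?_) h1
    rw [Real.dist_eq]
    calc |X q.1 q.2 - X x1 θ1| ≤ |X q.1 q.2 - X q.1 θ1| + |X q.1 θ1 - X x1 θ1| := abs_sub_le _ _ _
      _ ≤ _ := add_le_add (hup _ _ _) le_rfl
  set E : ℝ → ℝ → ℝ := fun x θ => Real.exp (∫ ξ in x0..x, ct ξ (X ξ θ)) with hE
  have hctX : Continuous (fun z : ℝ × ℝ => ct z.2 (X z.2 z.1)) :=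
    hct.comp (continuous_snd.prodMk (hXc.comp (continuous_snd.prodMk continuous_fst)))
  have hEc : Continuous fun q : ℝ × ℝ => E q.1 q.2 := by
    simp only [hE]
    refine Real.continuous_exp.comp ?_
    refine intervalIntegral.continuous_parametric_intervalIntegral_of_continuous
      (f := fun (q : ℝ × ℝ) ξ => ct ξ (X ξ q.2)) ?_ continuous_fst
    exact hctX.comp (f := fun z : (ℝ × ℝ) × ℝ => (z.1.2, z.2)) (by fun_prop)
  have hXθ : ∀ x θ, HasDerivAt (fun z => X x z) (E x θ) θ := by
    intro x θ
    rw [hasDerivAt_iff_tendsto_slope]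
    have hcont : Continuous (fun θ' => Real.exp (∫ ξ in x0..x, dqt ct ξ (X ξ θ) (X ξ θ'))) := by
      refine Real.continuous_exp.comp ?_
      apply intervalIntegral.continuous_parametric_intervalIntegral_of_continuous'
      refine hdk.comp (f := fun z : ℝ × ℝ => (z.2, X z.2 θ, X z.2 z.1)) ?_
      exact continuous_snd.prodMk (((hXx θ).comp continuous_snd).prodMk
        (hXc.comp (continuous_snd.prodMk continuous_fst)))
    have h1 := hcont.tendsto θ
    simp only [dqt_self] at h1
    refine (h1.mono_left nhdsWithin_le_nhds).congr' ?_
    filter_upwards [self_mem_nhdsWithin] with θ' hθ'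
    have : θ' - θ ≠ 0 := sub_ne_zero.mpr hθ'
    have h8 := hdiff x θ θ'
    rw [slope_def_field, eq_div_iff this]
    rw [mul_comm]; exact h8.symm
  have hinj : ∀ x, StrictMono (X x) := by
    intro x θ θ' h
    have h1 := hdiff x θ θ'
    have h2 := Real.exp_pos (∫ ξ in x0..x, dqt ct ξ (X ξ θ) (X ξ θ'))
    have := mul_pos (sub_pos.mpr h) h2
    linarith
  have hsurj : ∀ x, Function.Surjective (X x) := by
    intro x
    have e0 := Real.exp_pos (-(L * |x - x0|))
    refine Continuous.surjective (hXc.comp (f := fun θ : ℝ => (x, θ)) (by fun_prop)) ?_ ?_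
    · refine tendsto_atTop_mono' _ (f₁ := fun θ => X x 0 + θ * Real.exp (-(L * |x - x0|))) ?_ ?_
      · filter_upwards [eventually_ge_atTop 0] with θ hθ
        have h1 := hlow x 0 θ
        rw [sub_zero, abs_of_nonneg hθ, abs_of_nonneg (sub_nonneg.mpr ((hinj x).monotone hθ))] at h1
        linarith
      · exact tendsto_atTop_add_const_left _ _ (tendsto_id.atTop_mul_const e0)
    · refine tendsto_atBot_mono' _ (f₁ := fun θ => X x 0 + θ * Real.exp (-(L * |x - x0|))) ?_ ?_
      · filter_upwards [eventually_le_atBot 0] with θ hθ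
        have h1 := hlow x 0 θ
        rw [sub_zero, abs_of_nonpos hθ, abs_of_nonpos (sub_nonpos.mpr ((hinj x).monotone hθ))] at h1
        linarith
      · exact tendsto_atBot_add_const_left _ _ (tendsto_id.atBot_mul_const e0)
  choose T hT using hsurj
  have hTX : ∀ x θ, T x (X x θ) = θ := fun x θ => (hinj x).injective (hT x _)
  refine ⟨X, E, T, hXc, hEc, ?_, fun θ => hX0 θ, fun θ => by simp [hE], fun x θ => hXd θ x, hXθ,
    fun x θ => ?_, fun x θ => ?_, hTX, hT⟩
  · rw [continuous_iff_continuousAt]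
    rintro ⟨x1, t1⟩
    rw [ContinuousAt, tendsto_iff_dist_tendsto_zero]
    have h1 : Tendsto (fun q : ℝ × ℝ => |q.2 - X q.1 (T x1 t1)| * Real.exp (L * |q.1 - x0|))
        (nhds (x1, t1)) (nhds 0) := by
      have hcc : Continuous (fun q : ℝ × ℝ => |q.2 - X q.1 (T x1 t1)| * Real.exp (L * |q.1 - x0|)) := by
        have := (hXx (T x1 t1)).comp continuous_fst (X := ℝ × ℝ)
        simp only [Function.comp_def] at this
        fun_prop
      have := hcc.tendsto (x1, t1)
      simpa [hT] using this
    refine squeeze_zero (fun _ => dist_nonneg) (fun q => ?_) h1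
    rw [Real.dist_eq]
    have h2 := hlow q.1 (T x1 t1) (T q.1 q.2)
    rw [hT] at h2
    have h3 := Real.exp_pos (L * |q.1 - x0|)
    calc |T q.1 q.2 - T x1 t1| = |T q.1 q.2 - T x1 t1| * Real.exp (-(L * |q.1 - x0|)) *
          Real.exp (L * |q.1 - x0|) := by rw [mul_assoc, ← Real.exp_add]; simp
      _ ≤ _ := mul_le_mul_of_nonneg_right h2 h3.le
  · exact Real.exp_le_exp.mpr (abs_le.mp (hexpb x _ fun ξ => hbt _ _)).1
  · exact Real.exp_le_exp.mpr (abs_le.mp (hexpb x _ fun ξ => hbt _ _)).2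

end D1



section D2

lemma param_int_deriv {G Gt : ℝ → ℝ → ℝ} (hG : Continuous fun q : ℝ × ℝ => G q.1 q.2)
    (h : Continuous fun q : ℝ × ℝ => Gt q.1 q.2)
    (hd : ∀ x t, HasDerivAt (fun τ => G x τ) (Gt x t) t) (a b θ : ℝ) :
    HasDerivAt (fun θ => ∫ ξ in a..b, G ξ θ) (∫ ξ in a..b, Gt ξ θ) θ := by
  rw [hasDerivAt_iff_tendsto_slope]
  have hdk := dqt_cont h
  have hcont : Continuous (fun θ' => ∫ ξ in a..b, dqt Gt ξ θ θ') := by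
    apply intervalIntegral.continuous_parametric_intervalIntegral_of_continuous'
    exact hdk.comp (f := fun z : ℝ × ℝ => (z.2, θ, z.1)) (by fun_prop)
  have h1 := hcont.tendsto θ
  simp only [dqt_self] at h1
  refine (h1.mono_left nhdsWithin_le_nhds).congr' ?_
  filter_upwards [self_mem_nhdsWithin] with θ' hθ'
  have hne : θ' - θ ≠ 0 := sub_ne_zero.mpr hθ'
  have hGc : ∀ θ, Continuous fun ξ => G ξ θ := fun θ => hG.comp (f := fun ξ : ℝ => (ξ, θ)) (by fun_prop)
  rw [slope_def_field, eq_div_iff hne, ← intervalIntegral.integral_sub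
    ((hGc θ').intervalIntegrable _ _) ((hGc θ).intervalIntegrable _ _),
    ← intervalIntegral.integral_mul_const]
  congr 1
  ext ξ
  exact (dqt_eq h hd ξ θ θ').symm

lemma deriv_mul_vanish {K D : ℝ → ℝ} {d x : ℝ} (hK : ContinuousAt K x) (hD0 : D x = 0)
    (hD : HasDerivAt D d x) : HasDerivAt (fun z => K z * D z) (K x * d) x := by
  rw [hasDerivAt_iff_tendsto_slope] at hD ⊢
  have h1 := (hK.tendsto.mono_left (nhdsWithin_le_nhds (s := {x}ᶜ))).mul hD
  refine h1.congr fun z => ?_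
  simp only [slope_def_field, hD0]; ring

/-- the transported time derivative -/
def trz (x0 : ℝ) (X E T : ℝ → ℝ → ℝ) (hp : ℝ → ℝ) (Ft : ℝ → ℝ → ℝ) (x t : ℝ) : ℝ :=
  (hp (T x t) + ∫ ξ in x0..x, Ft ξ (X ξ (T x t)) * E ξ (T x t)) / E x (T x t)

/-- the transported function -/
def tryy (x0 : ℝ) (X T : ℝ → ℝ → ℝ) (h : ℝ → ℝ) (F : ℝ → ℝ → ℝ) (x t : ℝ) : ℝ :=
  h (T x t) + ∫ ξ in x0..x, F ξ (X ξ (T x t))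

variable {c ct X E T : ℝ → ℝ → ℝ} {L x0 : ℝ}

lemma ChFlow.Epos (hf : ChFlow c ct L x0 X E T) (x θ : ℝ) : 0 < E x θ :=
  lt_of_lt_of_le (Real.exp_pos _) (hf.Elow x θ)

lemma ChFlow.Td (hf : ChFlow c ct L x0 X E T) (x t : ℝ) :
    HasDerivAt (fun τ => T x τ) (E x (T x t))⁻¹ t :=
  HasDerivAt.of_local_left_inverse
    (hf.Tc.comp (f := fun τ : ℝ => (x, τ)) (by fun_prop)).continuousAt (hf.Xθ x (T x t))
    (hf.Epos _ _).ne' (Eventually.of_forall fun τ => hf.XT x τ)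

lemma trz_cont (hf : ChFlow c ct L x0 X E T) {hp : ℝ → ℝ} {Ft : ℝ → ℝ → ℝ}
    (hpc : Continuous hp) (hFt : Continuous fun q : ℝ × ℝ => Ft q.1 q.2) :
    Continuous fun q : ℝ × ℝ => trz x0 X E T hp Ft q.1 q.2 := by
  unfold trz
  refine Continuous.div ?_ (hf.Ec.comp (continuous_fst.prodMk hf.Tc)) (fun q => (hf.Epos _ _).ne')
  refine (hpc.comp hf.Tc).add ?_
  refine intervalIntegral.continuous_parametric_intervalIntegral_of_continuous
      (f := fun (q : ℝ × ℝ) ξ => Ft ξ (X ξ (T q.1 q.2)) * E ξ (T q.1 q.2)) ?_ continuous_fst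
  have hT : Continuous (fun z : (ℝ × ℝ) × ℝ => T z.1.1 z.1.2) := hf.Tc.comp continuous_fst
  have h2 : Continuous (fun z : (ℝ × ℝ) × ℝ => (z.2, T z.1.1 z.1.2)) := continuous_snd.prodMk hT
  exact (hFt.comp (continuous_snd.prodMk (hf.Xc.comp h2))).mul (hf.Ec.comp h2)

lemma tryy_cont (hf : ChFlow c ct L x0 X E T) {hp : ℝ → ℝ} {Ft : ℝ → ℝ → ℝ}
    (hpc : Continuous hp) (hFt : Continuous fun q : ℝ × ℝ => Ft q.1 q.2) :
    Continuous fun q : ℝ × ℝ => tryy x0 X T hp Ft q.1 q.2 := by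
  unfold tryy
  refine (hpc.comp hf.Tc).add ?_
  refine intervalIntegral.continuous_parametric_intervalIntegral_of_continuous
      (f := fun (q : ℝ × ℝ) ξ => Ft ξ (X ξ (T q.1 q.2))) ?_ continuous_fst
  have hT : Continuous (fun z : (ℝ × ℝ) × ℝ => T z.1.1 z.1.2) := hf.Tc.comp continuous_fst
  have h2 : Continuous (fun z : (ℝ × ℝ) × ℝ => (z.2, T z.1.1 z.1.2)) := continuous_snd.prodMk hT
  exact (hFt.comp (continuous_snd.prodMk (hf.Xc.comp h2)))

lemma transport (hf : ChFlow c ct L x0 X E T) {h hp : ℝ → ℝ} {F Ft : ℝ → ℝ → ℝ}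
    (hpc : Continuous hp) (hhd : ∀ t, HasDerivAt h (hp t) t)
    (hF : Continuous fun q : ℝ × ℝ => F q.1 q.2)
    (hFt : Continuous fun q : ℝ × ℝ => Ft q.1 q.2)
    (hFd : ∀ x t, HasDerivAt (fun τ => F x τ) (Ft x t) t) :
    (∀ x t, HasDerivAt (fun τ => tryy x0 X T h F x τ) (trz x0 X E T hp Ft x t) t) ∧
    (∀ x t, HasDerivAt (fun z => tryy x0 X T h F z t) (F x t - trz x0 X E T hp Ft x t * c x t) x) := by
  have hY : ∀ x θ, HasDerivAt (fun θ => h θ + ∫ ξ in x0..x, F ξ (X ξ θ))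
      (hp θ + ∫ ξ in x0..x, Ft ξ (X ξ θ) * E ξ θ) θ := by
    intro x θ
    refine (hhd θ).add ?_
    refine param_int_deriv (G := fun ξ θ => F ξ (X ξ θ)) (Gt := fun ξ θ => Ft ξ (X ξ θ) * E ξ θ)
      (hF.comp (continuous_fst.prodMk hf.Xc)) ((hFt.comp (continuous_fst.prodMk hf.Xc)).mul hf.Ec)
      (fun ξ θ => ?_) x0 x θ
    exact (hFd ξ (X ξ θ)).comp θ (hf.Xθ ξ θ)
  have hyt : ∀ x t, HasDerivAt (fun τ => tryy x0 X T h F x τ) (trz x0 X E T hp Ft x t) t := by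
    intro x t
    have := (hY x (T x t)).comp t (hf.Td x t)
    unfold tryy trz
    rw [div_eq_mul_inv]
    exact this
  refine ⟨hyt, fun x t => ?_⟩
  set z := trz x0 X E T hp Ft with hz
  have hzc : Continuous fun q : ℝ × ℝ => z q.1 q.2 := trz_cont hf hpc hFt
  set θ := T x t with hθ
  have hXx : Continuous fun x' => X x' θ := hf.Xc.comp (f := fun x' : ℝ => (x', θ)) (by fun_prop)
  have e1 : ∀ x', tryy x0 X T h F x' t = (h θ + ∫ ξ in x0..x', F ξ (X ξ θ)) -
      dqt z x' t (X x' θ) * (X x' θ - t) := by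
    intro x'
    have := dqt_eq (g := fun x t => tryy x0 X T h F x t) hzc hyt x' t (X x' θ)
    rw [← this]
    simp only [tryy, hf.TX]; ring
  have d1 : HasDerivAt (fun x' => h θ + ∫ ξ in x0..x', F ξ (X ξ θ)) (F x t) x := by
    have hFc : Continuous fun ξ => F ξ (X ξ θ) := hF.comp (continuous_id.prodMk hXx)
    have := (intervalIntegral.integral_hasDerivAt_right (hFc.intervalIntegrable x0 x)
      (hFc.stronglyMeasurableAtFilter _ _) hFc.continuousAt).const_add (h θ)
    rwa [show X x θ = t from hf.XT x t] at this
  have d2 : HasDerivAt (fun x' => dqt z x' t (X x' θ) * (X x' θ - t)) (z x t * c x t) x := by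
    have hK : Continuous fun x' => dqt z x' t (X x' θ) :=
      (dqt_cont hzc).comp (continuous_id.prodMk (continuous_const.prodMk hXx))
    have hXt : X x θ = t := hf.XT x t
    have := deriv_mul_vanish (K := fun x' => dqt z x' t (X x' θ)) (D := fun x' => X x' θ - t)
      hK.continuousAt (by simp [hXt]) ((hf.Xd x θ).sub_const t)
    simp only [hXt, dqt_self] at this
    exact this
  have := d1.sub d2
  exact this.congr_of_eventuallyEq (Eventually.of_forall e1)

lemma tryy_x0 (hf : ChFlow c ct L x0 X E T) (h : ℝ → ℝ) (F : ℝ → ℝ → ℝ) (t : ℝ) :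
    tryy x0 X T h F x0 t = h t := by
  have : T x0 t = t := by have := hf.TX x0 t; rwa [hf.X0] at this
  simp [tryy, this]

/-- characteristics go back in time with speed bounded below -/
def BackFlow (κ x0 : ℝ) (X T : ℝ → ℝ → ℝ) : Prop :=
  ∀ x ∈ Icc (0:ℝ) 1, ∀ ξ ∈ uIcc x0 x, ∀ t, X ξ (T x t) ≤ t - κ * |x - ξ|

lemma exp_int_bound {x0 x k : ℝ} (hk : 0 < k) :
    |∫ ξ in x0..x, Real.exp (-(k * |x - ξ|))| ≤ 1 / k := by
  rcases le_total x0 x with h | h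
  · have e : ∫ ξ in x0..x, Real.exp (-(k * |x - ξ|)) = ∫ ξ in x0..x, Real.exp (k * ξ - k * x) := by
      apply intervalIntegral.integral_congr
      intro ξ hξ
      rw [uIcc_of_le h] at hξ
      simp only [abs_of_nonneg (sub_nonneg.mpr hξ.2)]; congr 1; ring
    have e2 : ∫ ξ in x0..x, Real.exp (k * ξ - k * x) = (Real.exp (k * x - k * x)/k - Real.exp (k * x0 - k * x)/k) := by
      apply intervalIntegral.integral_eq_sub_of_hasDerivAt (f := fun ξ => Real.exp (k * ξ - k * x)/k)
      · intro ξ _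
        have := ((((hasDerivAt_id ξ).const_mul k).sub_const (k * x)).exp).div_const k
        refine this.congr_deriv ?_
        simp; field_simp
      · exact (by fun_prop : Continuous fun ξ => Real.exp (k * ξ - k * x)).intervalIntegrable _ _
    rw [e, e2, sub_self, Real.exp_zero]
    have h1 : Real.exp (k * x0 - k * x) ≤ 1 := Real.exp_le_one_iff.mpr (by nlinarith)
    have h2 := Real.exp_pos (k * x0 - k * x)
    rw [← sub_div, abs_of_nonneg (div_nonneg (by linarith) hk.le)]
    exact div_le_div_of_nonneg_right (by linarith) hk.le
  · have e : ∫ ξ in x0..x, Real.exp (-(k * |x - ξ|)) = ∫ ξ in x0..x, Real.exp (k * x - k * ξ) := by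
      apply intervalIntegral.integral_congr
      intro ξ hξ
      rw [uIcc_of_ge h] at hξ
      simp only [abs_of_nonpos (sub_nonpos.mpr hξ.1)]; congr 1; ring
    have e2 : ∫ ξ in x0..x, Real.exp (k * x - k * ξ) = (-(Real.exp (k * x - k * x)/k) - -(Real.exp (k * x - k * x0)/k)) := by
      apply intervalIntegral.integral_eq_sub_of_hasDerivAt (f := fun ξ => -(Real.exp (k * x - k * ξ)/k))
      · intro ξ _
        have := (((((hasDerivAt_id ξ).const_mul k).const_sub (k * x)).exp).div_const k).neg
        refine this.congr_deriv ?_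
        simp; field_simp
      · exact (by fun_prop : Continuous fun ξ => Real.exp (k * x - k * ξ)).intervalIntegrable _ _
    rw [e, e2, sub_self, Real.exp_zero]
    have h1 : Real.exp (k * x - k * x0) ≤ 1 := Real.exp_le_one_iff.mpr (by nlinarith)
    have h2 := Real.exp_pos (k * x - k * x0)
    rw [show -(1/k) - -(Real.exp (k * x - k * x0)/k) = -((1 - Real.exp (k * x - k * x0))/k) by ring,
      abs_neg, abs_of_nonneg (div_nonneg (by linarith) hk.le)]
    exact div_le_div_of_nonneg_right (by linarith) hk.le

lemma trz_bound (hf : ChFlow c ct L x0 X E T) (hL : 0 ≤ L) (hx0 : x0 ∈ Icc (0:ℝ) 1) {κ : ℝ} (hκ : 0 < κ)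
    (hb : BackFlow κ x0 X T) {hp : ℝ → ℝ} {Ft : ℝ → ℝ → ℝ} {lam s H Q : ℝ} (hlam : 0 < lam)
    (hFt : Continuous fun q : ℝ × ℝ => Ft q.1 q.2)
    (hH : ∀ τ, |hp τ| ≤ H * Real.exp (lam * (τ - s)))
    (hQ : ∀ ξ ∈ Icc (0:ℝ) 1, ∀ τ, |Ft ξ τ| ≤ Q * Real.exp (lam * (τ - s))) :
    ∀ x ∈ Icc (0:ℝ) 1, ∀ t, |trz x0 X E T hp Ft x t| ≤
      Real.exp L * (H + Real.exp L * Q / (lam * κ)) * Real.exp (lam * (t - s)) := by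
  intro x hx t
  have hexpL : ∀ ξ ∈ Icc (0:ℝ) 1, L * |ξ - x0| ≤ L := by
    intro ξ hξ
    have : |ξ - x0| ≤ 1 := abs_le.mpr ⟨by linarith [hξ.1, hx0.2], by linarith [hξ.2, hx0.1]⟩
    nlinarith
  have hEl : ∀ ξ ∈ Icc (0:ℝ) 1, ∀ θ, Real.exp (-L) ≤ E ξ θ := fun ξ hξ θ =>
    (Real.exp_le_exp.mpr (by linarith [hexpL ξ hξ])).trans (hf.Elow ξ θ)
  have hEu : ∀ ξ ∈ Icc (0:ℝ) 1, ∀ θ, E ξ θ ≤ Real.exp L := fun ξ hξ θ =>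
    (hf.Eup ξ θ).trans (Real.exp_le_exp.mpr (hexpL ξ hξ))
  have hH0 : 0 ≤ H := by
    have := (abs_nonneg _).trans (hH s); simpa using this
  have hQ0 : 0 ≤ Q := by
    have := (abs_nonneg _).trans (hQ x hx s); simpa using this
  set θ := T x t with hθ
  have hsub : uIcc x0 x ⊆ Icc (0:ℝ) 1 := by
    rw [← uIcc_of_le zero_le_one]
    apply uIcc_subset_uIcc <;> rw [uIcc_of_le zero_le_one] <;> assumption
  have hT : θ ≤ t := by
    have := hb x hx x0 left_mem_uIcc t
    rw [hf.X0] at this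
    have h2 := mul_nonneg hκ.le (abs_nonneg (x - x0))
    linarith
  have h1 : |hp θ| ≤ H * Real.exp (lam * (t - s)) := (hH θ).trans
    (mul_le_mul_of_nonneg_left (Real.exp_le_exp.mpr (by nlinarith)) hH0)
  have h2 : |∫ ξ in x0..x, Ft ξ (X ξ θ) * E ξ θ| ≤
      Real.exp L * Q / (lam * κ) * Real.exp (lam * (t - s)) := by
    have hb1 : |∫ ξ in x0..x, Ft ξ (X ξ θ) * E ξ θ| ≤ |∫ ξ in x0..x,
        (Real.exp L * Q * Real.exp (lam * (t - s))) * Real.exp (-(lam * κ * |x - ξ|))| := by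
      refine intervalIntegral.norm_integral_le_abs_of_norm_le (f := fun ξ => Ft ξ (X ξ θ) * E ξ θ) ?_ ?_
      · refine (ae_restrict_iff' measurableSet_uIoc).mpr (Eventually.of_forall fun ξ hξ => ?_)
        have hξ1 : ξ ∈ uIcc x0 x := uIoc_subset_uIcc hξ
        have hξ2 := hsub hξ1
        have h3 := hQ ξ hξ2 (X ξ θ)
        have h4 := hb x hx ξ hξ1 t
        rw [Real.norm_eq_abs, abs_mul, abs_of_pos (hf.Epos ξ θ)]
        have h5 : Real.exp (lam * (X ξ θ - s)) ≤ Real.exp (lam * (t - s)) * Real.exp (-(lam * κ * |x - ξ|)) := by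
          rw [← Real.exp_add]; apply Real.exp_le_exp.mpr; nlinarith
        calc |Ft ξ (X ξ θ)| * E ξ θ ≤ (Q * (Real.exp (lam * (t - s)) * Real.exp (-(lam * κ * |x - ξ|)))) * Real.exp L :=
              mul_le_mul (h3.trans (mul_le_mul_of_nonneg_left h5 hQ0)) (hEu ξ hξ2 θ) (hf.Epos ξ θ).le (by positivity)
          _ = _ := by ring
      · exact Continuous.intervalIntegrable (by fun_prop) _ _
    refine hb1.trans ?_
    rw [intervalIntegral.integral_const_mul, abs_mul, abs_of_nonneg (by positivity)]
    refine (mul_le_mul_of_nonneg_left (exp_int_bound (x0 := x0) (x := x) (mul_pos hlam hκ)) (by positivity)).trans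
      (le_of_eq ?_)
    ring
  unfold trz
  rw [abs_div, abs_of_pos (hf.Epos x _), div_le_iff₀ (hf.Epos x _)]
  have h3 : |hp θ + ∫ ξ in x0..x, Ft ξ (X ξ θ) * E ξ θ| ≤
      (H + Real.exp L * Q / (lam * κ)) * Real.exp (lam * (t - s)) := by
    refine (abs_add_le _ _).trans ?_
    rw [add_mul]; exact add_le_add h1 h2
  refine h3.trans ?_
  have h4 : 1 ≤ Real.exp L * E x θ := by
    calc (1:ℝ) = Real.exp L * Real.exp (-L) := by rw [← Real.exp_add]; simp
      _ ≤ _ := mul_le_mul_of_nonneg_left (hEl x hx θ) (Real.exp_pos _).le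
  have h5 : 0 ≤ (H + Real.exp L * Q / (lam * κ)) * Real.exp (lam * (t - s)) := by positivity
  have := mul_le_mul_of_nonneg_left h4 h5
  rw [mul_one] at this
  refine this.trans (le_of_eq (by ring))

lemma back_le (hf : ChFlow c ct L x0 X E T) {κ : ℝ} (hκ : 0 < κ)
    (hb : BackFlow κ x0 X T) {x : ℝ} (hx : x ∈ Icc (0:ℝ) 1) {s t : ℝ} (ht : t ≤ s) :
    T x t ≤ s ∧ ∀ ξ ∈ uIcc x0 x, X ξ (T x t) ≤ s := by
  have h1 : ∀ ξ ∈ uIcc x0 x, X ξ (T x t) ≤ s := fun ξ hξ => by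
    have := hb x hx ξ hξ t
    have h2 := mul_nonneg hκ.le (abs_nonneg (x - ξ))
    linarith
  refine ⟨?_, h1⟩
  have := h1 x0 left_mem_uIcc
  rwa [hf.X0] at this

lemma trz_zero (hf : ChFlow c ct L x0 X E T) (hx0 : x0 ∈ Icc (0:ℝ) 1) {κ : ℝ} (hκ : 0 < κ)
    (hb : BackFlow κ x0 X T) {hp : ℝ → ℝ} {Ft : ℝ → ℝ → ℝ} {s : ℝ}
    (hH : ∀ τ ≤ s, hp τ = 0) (hQ : ∀ ξ, ∀ τ ≤ s, Ft ξ τ = 0) :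
    ∀ x ∈ Icc (0:ℝ) 1, ∀ t ≤ s, trz x0 X E T hp Ft x t = 0 := by
  intro x hx t ht
  obtain ⟨h1, h2⟩ := back_le hf hκ hb hx ht
  unfold trz
  rw [hH _ h1, intervalIntegral.integral_congr (g := fun _ => (0:ℝ))
    (fun ξ hξ => by simp only [hQ ξ _ (h2 ξ hξ), zero_mul])]
  simp

lemma tryy_zero (hf : ChFlow c ct L x0 X E T) (hx0 : x0 ∈ Icc (0:ℝ) 1) {κ : ℝ} (hκ : 0 < κ)
    (hb : BackFlow κ x0 X T) {hp : ℝ → ℝ} {Ft : ℝ → ℝ → ℝ} {s : ℝ}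
    (hH : ∀ τ ≤ s, hp τ = 0) (hQ : ∀ ξ, ∀ τ ≤ s, Ft ξ τ = 0) :
    ∀ x ∈ Icc (0:ℝ) 1, ∀ t ≤ s, tryy x0 X T hp Ft x t = 0 := by
  intro x hx t ht
  obtain ⟨h1, h2⟩ := back_le hf hκ hb hx ht
  unfold tryy
  rw [hH _ h1, intervalIntegral.integral_congr (g := fun _ => (0:ℝ))
    (fun ξ hξ => by simp only [hQ ξ _ (h2 ξ hξ)])]
  simp

lemma trz_sub (hf : ChFlow c ct L x0 X E T) {hp hp2 : ℝ → ℝ} {Ft Ft2 : ℝ → ℝ → ℝ}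
    (hFt : Continuous fun q : ℝ × ℝ => Ft q.1 q.2)
    (hFt2 : Continuous fun q : ℝ × ℝ => Ft2 q.1 q.2) (x t : ℝ) :
    trz x0 X E T hp Ft x t - trz x0 X E T hp2 Ft2 x t =
      trz x0 X E T (fun τ => hp τ - hp2 τ) (fun ξ τ => Ft ξ τ - Ft2 ξ τ) x t := by
  unfold trz
  set θ := T x t
  have hXx : Continuous fun ξ => (ξ, X ξ θ) :=
    continuous_id.prodMk (hf.Xc.comp (f := fun ξ : ℝ => (ξ, θ)) (by fun_prop))
  have hEx : Continuous fun ξ => E ξ θ := hf.Ec.comp (f := fun ξ : ℝ => (ξ, θ)) (by fun_prop)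
  have i1 : Continuous fun ξ => Ft ξ (X ξ θ) * E ξ θ := (hFt.comp hXx).mul hEx
  have i2 : Continuous fun ξ => Ft2 ξ (X ξ θ) * E ξ θ := (hFt2.comp hXx).mul hEx
  have : ∫ ξ in x0..x, (Ft ξ (X ξ θ) - Ft2 ξ (X ξ θ)) * E ξ θ =
    (∫ ξ in x0..x, Ft ξ (X ξ θ) * E ξ θ) - ∫ ξ in x0..x, Ft2 ξ (X ξ θ) * E ξ θ := by
    rw [← intervalIntegral.integral_sub (i1.intervalIntegrable _ _) (i2.intervalIntegrable _ _)]
    congr 1; ext ξ; ring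
  rw [this]; ring

/-- sign of the speed gives the back-in-time property -/
lemma backflow_of_sign (hf : ChFlow c ct L x0 X E T) {κ : ℝ} (hκ : 0 < κ)
    (h : (x0 = 0 ∧ ∀ x ∈ Icc (0:ℝ) 1, ∀ t, κ ≤ c x t) ∨ (x0 = 1 ∧ ∀ x ∈ Icc (0:ℝ) 1, ∀ t, c x t ≤ -κ)) :
    BackFlow κ x0 X T := by
  intro x hx ξ hξ t
  have hXt := hf.XT x t
  set θ := T x t
  have hcont : ContinuousOn (fun z => X z θ) (Icc (0:ℝ) 1) :=
    fun z _ => (hf.Xd z θ).continuousAt.continuousWithinAt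
  have hdiff : DifferentiableOn ℝ (fun z => X z θ) (interior (Icc (0:ℝ) 1)) :=
    fun z _ => (hf.Xd z θ).differentiableAt.differentiableWithinAt
  rcases h with ⟨h0, h⟩ | ⟨h0, h⟩
  · rw [h0, uIcc_of_le hx.1] at hξ
    have := Convex.mul_sub_le_image_sub_of_le_deriv (convex_Icc (0:ℝ) 1) hcont hdiff (C := κ)
      (fun z hz => by rw [(hf.Xd z θ).deriv]; exact h z (interior_subset hz) _) ξ ⟨hξ.1, hξ.2.trans hx.2⟩
      x hx hξ.2
    rw [abs_of_nonneg (sub_nonneg.mpr hξ.2)]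
    linarith
  · rw [h0, uIcc_of_ge hx.2] at hξ
    have := Convex.image_sub_le_mul_sub_of_deriv_le (convex_Icc (0:ℝ) 1) hcont hdiff (C := -κ)
      (fun z hz => by rw [(hf.Xd z θ).deriv]; exact h z (interior_subset hz) _) x hx ξ ⟨hx.1.trans hξ.1, hξ.2⟩
      hξ.1
    rw [abs_of_nonpos (sub_nonpos.mpr hξ.1)]
    linarith

end D2



section D3

structure FP {n : ℕ} (p : Fin n → Fin n → ℝ) (L κ B P C s : ℝ) (x0 : Fin n → ℝ)
    (c ct X E T : Fin n → ℝ → ℝ → ℝ) (β βt : Fin n → Fin n → ℝ → ℝ → ℝ)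
    (f ft : Fin n → ℝ → ℝ → ℝ) (g gp : Fin n → ℝ → ℝ) : Prop where
  L0 : 0 ≤ L
  κ0 : 0 < κ
  B0 : 0 ≤ B
  P0 : 0 ≤ P
  C0 : 0 ≤ C
  pb : ∀ j k, |p j k| ≤ P
  xm : ∀ j, x0 j ∈ Icc (0:ℝ) 1
  fl : ∀ j, ChFlow (c j) (ct j) L (x0 j) (X j) (E j) (T j)
  bk : ∀ j, BackFlow κ (x0 j) (X j) (T j)
  βc : ∀ j k, Continuous fun q : ℝ × ℝ => β j k q.1 q.2
  βtc : ∀ j k, Continuous fun q : ℝ × ℝ => βt j k q.1 q.2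
  βd : ∀ j k x t, HasDerivAt (fun τ => β j k x τ) (βt j k x t) t
  βb : ∀ j k x t, |β j k x t| ≤ B
  βtb : ∀ j k x t, |βt j k x t| ≤ B
  fc : ∀ j, Continuous fun q : ℝ × ℝ => f j q.1 q.2
  ftc : ∀ j, Continuous fun q : ℝ × ℝ => ft j q.1 q.2
  fd : ∀ j x t, HasDerivAt (fun τ => f j x τ) (ft j x t) t
  ftb : ∀ j x t, |ft j x t| ≤ C
  fz : ∀ j x, ∀ t ≤ s, f j x t = 0
  ftz : ∀ j x, ∀ t ≤ s, ft j x t = 0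
  gd : ∀ j t, HasDerivAt (g j) (gp j t) t
  gpc : ∀ j, Continuous (gp j)
  gpb : ∀ j t, |gp j t| ≤ C
  gz : ∀ j, ∀ t ≤ s, g j t = 0
  gpz : ∀ j, ∀ t ≤ s, gp j t = 0

variable {n : ℕ}

def JJ (s : ℝ) (z : Fin n → ℝ → ℝ → ℝ) (k : Fin n) (x t : ℝ) : ℝ := ∫ τ in s..t, z k x τ

def Hl (p : Fin n → Fin n → ℝ) (x0 : Fin n → ℝ) (z : Fin n → ℝ → ℝ → ℝ) (j : Fin n) (t : ℝ) : ℝ :=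
  ∑ k, p j k * z k (1 - x0 k) t

def Fl (s : ℝ) (β βt : Fin n → Fin n → ℝ → ℝ → ℝ) (z : Fin n → ℝ → ℝ → ℝ) (j : Fin n) (x t : ℝ) : ℝ :=
  -∑ k, (βt j k x t * JJ s z k x t + β j k x t * z k x t)

lemma JJ_cont {s : ℝ} {z : Fin n → ℝ → ℝ → ℝ} (hz : ∀ k, Continuous fun q : ℝ × ℝ => z k q.1 q.2) (k : Fin n) :
    Continuous fun q : ℝ × ℝ => JJ s z k q.1 q.2 := by
  unfold JJ
  refine intervalIntegral.continuous_parametric_intervalIntegral_of_continuous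
      (f := fun (q : ℝ × ℝ) τ => z k q.1 τ) ?_ continuous_snd
  exact (hz k).comp (f := fun w : (ℝ × ℝ) × ℝ => (w.1.1, w.2)) (by fun_prop)

lemma JJ_deriv {s : ℝ} {z : Fin n → ℝ → ℝ → ℝ} (hz : ∀ k, Continuous fun q : ℝ × ℝ => z k q.1 q.2) (k : Fin n)
    (x t : ℝ) : HasDerivAt (fun τ => JJ s z k x τ) (z k x t) t := by
  have hc : Continuous fun τ => z k x τ := (hz k).comp (f := fun τ : ℝ => (x, τ)) (by fun_prop)
  exact intervalIntegral.integral_hasDerivAt_right (hc.intervalIntegrable _ _)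
    (hc.stronglyMeasurableAtFilter _ _) hc.continuousAt

lemma JJ_zero {s : ℝ} {z : Fin n → ℝ → ℝ → ℝ} (h : ∀ k x, ∀ t ≤ s, z k x t = 0) (k : Fin n) (x : ℝ) {t : ℝ}
    (ht : t ≤ s) : JJ s z k x t = 0 := by
  unfold JJ
  rw [intervalIntegral.integral_congr (g := fun _ => (0:ℝ))
    (fun ξ hξ => by rw [uIcc_of_ge ht] at hξ; exact h k x ξ hξ.2)]
  simp

lemma JJ_sub {s : ℝ} {z w : Fin n → ℝ → ℝ → ℝ} (hz : ∀ k, Continuous fun q : ℝ × ℝ => z k q.1 q.2)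
    (hw : ∀ k, Continuous fun q : ℝ × ℝ => w k q.1 q.2) (k : Fin n) (x t : ℝ) :
    JJ s (fun k x t => z k x t - w k x t) k x t = JJ s z k x t - JJ s w k x t := by
  have hc : Continuous fun τ => z k x τ := (hz k).comp (f := fun τ : ℝ => (x, τ)) (by fun_prop)
  have hc2 : Continuous fun τ => w k x τ := (hw k).comp (f := fun τ : ℝ => (x, τ)) (by fun_prop)
  exact intervalIntegral.integral_sub (hc.intervalIntegrable _ _) (hc2.intervalIntegrable _ _)

lemma JJ_bound {s lam D : ℝ} (hlam : 1 ≤ lam) {z : Fin n → ℝ → ℝ → ℝ}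
    (h : ∀ k x, ∀ t ≤ s, z k x t = 0) (k : Fin n) (x : ℝ)
    (hb : ∀ t, |z k x t| ≤ D * Real.exp (lam * (t - s))) (t : ℝ) :
    |JJ s z k x t| ≤ D * Real.exp (lam * (t - s)) := by
  have hD : 0 ≤ D := by have := (abs_nonneg _).trans (hb s); simpa using this
  rcases le_total t s with ht | ht
  · rw [JJ_zero h k x ht, abs_zero]; positivity
  · unfold JJ
    have h1 : |∫ τ in s..t, z k x τ| ≤ |∫ τ in s..t, D * Real.exp (lam * (t - s)) * Real.exp (-(1 * |t - τ|))| := by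
      refine intervalIntegral.norm_integral_le_abs_of_norm_le (f := fun ξ => z k x ξ) ?_ ?_
      · refine (ae_restrict_iff' measurableSet_uIoc).mpr (Eventually.of_forall fun τ hτ => ?_)
        rw [uIoc_of_le ht] at hτ
        refine (hb τ).trans ?_
        rw [mul_assoc, ← Real.exp_add, abs_of_nonneg (by linarith [hτ.2])]
        refine mul_le_mul_of_nonneg_left (Real.exp_le_exp.mpr ?_) hD
        nlinarith [hτ.2]
      · exact Continuous.intervalIntegrable (by fun_prop) _ _
    refine h1.trans ?_
    rw [intervalIntegral.integral_const_mul, abs_mul, abs_of_nonneg (by positivity)]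
    have := mul_le_mul_of_nonneg_left (exp_int_bound (x0 := s) (x := t) one_pos)
      (show 0 ≤ D * Real.exp (lam * (t - s)) by positivity)
    linarith

lemma Hl_cont {p : Fin n → Fin n → ℝ} {x0 : Fin n → ℝ} {z : Fin n → ℝ → ℝ → ℝ}
    (hz : ∀ k, Continuous fun q : ℝ × ℝ => z k q.1 q.2) (j : Fin n) : Continuous (Hl p x0 z j) := by
  unfold Hl
  refine continuous_finsetSum _ fun k _ => continuous_const.mul ?_
  exact (hz k).comp (f := fun τ : ℝ => (1 - x0 k, τ)) (by fun_prop)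

lemma Fl_cont {s : ℝ} {β βt : Fin n → Fin n → ℝ → ℝ → ℝ} {z : Fin n → ℝ → ℝ → ℝ}
    (hz : ∀ k, Continuous fun q : ℝ × ℝ => z k q.1 q.2)
    (hβ : ∀ j k, Continuous fun q : ℝ × ℝ => β j k q.1 q.2)
    (hβt : ∀ j k, Continuous fun q : ℝ × ℝ => βt j k q.1 q.2) (j : Fin n) :
    Continuous fun q : ℝ × ℝ => Fl s β βt z j q.1 q.2 := by
  unfold Fl
  exact (continuous_finsetSum _ fun k _ => ((hβt j k).mul (JJ_cont hz k)).add ((hβ j k).mul (hz k))).neg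

variable {p : Fin n → Fin n → ℝ} {L κ B P C s : ℝ} {x0 : Fin n → ℝ}
    {c ct X E T : Fin n → ℝ → ℝ → ℝ} {β βt : Fin n → Fin n → ℝ → ℝ → ℝ}
    {f ft : Fin n → ℝ → ℝ → ℝ} {g gp : Fin n → ℝ → ℝ}

set_option maxHeartbeats 1600000 in
lemma FP.lin_bound (h : FP p L κ B P C s x0 c ct X E T β βt f ft g gp)
    {lev : Fin n → ℕ} (hlev : ∀ j, lev j < n) (hlp : ∀ j k, p j k ≠ 0 → lev k < lev j) :
    ∃ R lam : ℝ, 1 ≤ R ∧ 1 ≤ lam ∧ ∀ z : Fin n → ℝ → ℝ → ℝ, 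
      (∀ k, Continuous fun q : ℝ × ℝ => z k q.1 q.2) → (∀ k x, ∀ t ≤ s, z k x t = 0) →
      ∀ D, 0 ≤ D → (∀ k x t, |z k x t| ≤ R ^ lev k * D * Real.exp (lam * (t - s))) →
      ∀ j, ∀ x ∈ Icc (0:ℝ) 1, ∀ t, |trz (x0 j) (X j) (E j) (T j) (Hl p x0 z j) (Fl s β βt z j) x t| ≤
        R ^ lev j * (D / 4) * Real.exp (lam * (t - s)) := by
  have hL0 := h.L0; have hκ := h.κ0; have hB := h.B0; have hP := h.P0
  set eL := Real.exp L with heL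
  have eL0 : 0 < eL := Real.exp_pos L
  set R : ℝ := 8 * eL * (n * P) + 1 with hR
  have hR1 : 1 ≤ R := by
    have : 0 ≤ 8 * eL * (n * P) := by positivity
    linarith
  have hR0 : 0 < R := by linarith
  set lam : ℝ := 16 * eL * eL * (n * B * R ^ n) / κ + 1 with hlam
  have hlam1 : 1 ≤ lam := by
    have : 0 ≤ 16 * eL * eL * (n * B * R ^ n) / κ := by positivity
    linarith
  refine ⟨R, lam, hR1, hlam1, fun z hz hz0 D hD hb j x hx t => ?_⟩
  have hlam0 : 0 < lam := by linarith
  have hH : ∀ τ, |Hl p x0 z j τ| ≤ (n * P * (R ^ lev j / R * D)) * Real.exp (lam * (τ - s)) := by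
    intro τ
    have h1 : ∀ k, |p j k * z k (1 - x0 k) τ| ≤ P * (R ^ lev j / R * D) * Real.exp (lam * (τ - s)) := by
      intro k
      rw [abs_mul]
      by_cases hp : p j k = 0
      · rw [hp]; simp; positivity
      · have hR2 : R ^ lev k ≤ R ^ lev j / R := by
          rw [le_div_iff₀ hR0, ← pow_succ]
          exact pow_le_pow_right₀ hR1 (hlp j k hp)
        calc |p j k| * |z k (1 - x0 k) τ| ≤ P * (R ^ lev k * D * Real.exp (lam * (τ - s))) :=
              mul_le_mul (h.pb j k) (hb k _ τ) (abs_nonneg _) hP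
          _ ≤ P * (R ^ lev j / R * D * Real.exp (lam * (τ - s))) := by gcongr
          _ = _ := by ring
    calc |Hl p x0 z j τ| ≤ ∑ k, |p j k * z k (1 - x0 k) τ| := Finset.abs_sum_le_sum_abs _ _
      _ ≤ ∑ _k : Fin n, P * (R ^ lev j / R * D) * Real.exp (lam * (τ - s)) := Finset.sum_le_sum fun k _ => h1 k
      _ = _ := by simp; ring
  have hF : ∀ ξ ∈ Icc (0:ℝ) 1, ∀ τ, |Fl s β βt z j ξ τ| ≤ (n * (2 * B * (R ^ n * D))) * Real.exp (lam * (τ - s)) := by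
    intro ξ hξ τ
    have h1 : ∀ k, |βt j k ξ τ * JJ s z k ξ τ + β j k ξ τ * z k ξ τ| ≤
        2 * B * (R ^ n * D) * Real.exp (lam * (τ - s)) := by
      intro k
      have hR2 : R ^ lev k ≤ R ^ n := pow_le_pow_right₀ hR1 (hlev k).le
      have e0 := Real.exp_pos (lam * (τ - s))
      have b1 : |z k ξ τ| ≤ R ^ n * D * Real.exp (lam * (τ - s)) := (hb k ξ τ).trans (by gcongr)
      have b2 : |JJ s z k ξ τ| ≤ R ^ n * D * Real.exp (lam * (τ - s)) :=
        (JJ_bound hlam1 hz0 k ξ (hb k ξ) τ).trans (by gcongr)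
      refine (abs_add_le _ _).trans ?_
      rw [abs_mul, abs_mul]
      have b3 := mul_le_mul (h.βtb j k ξ τ) b2 (abs_nonneg _) hB
      have b4 := mul_le_mul (h.βb j k ξ τ) b1 (abs_nonneg _) hB
      linarith
    calc |Fl s β βt z j ξ τ| ≤ ∑ k, |βt j k ξ τ * JJ s z k ξ τ + β j k ξ τ * z k ξ τ| :=
          by unfold Fl; rw [abs_neg]; exact Finset.abs_sum_le_sum_abs _ _
      _ ≤ ∑ _k : Fin n, 2 * B * (R ^ n * D) * Real.exp (lam * (τ - s)) := Finset.sum_le_sum fun k _ => h1 k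
      _ = _ := by simp; ring
  have key := trz_bound (h.fl j) hL0 (h.xm j) hκ (h.bk j) hlam0 (Fl_cont hz h.βc h.βtc j) hH hF x hx t
  refine key.trans ?_
  refine mul_le_mul_of_nonneg_right ?_ (Real.exp_pos _).le
  rw [← heL]
  have hμ : 1 ≤ R ^ lev j := one_le_pow₀ hR1
  have k1 : eL * (n * P * (R ^ lev j / R * D)) ≤ R ^ lev j * D / 8 := by
    have : eL * (n * P) / R ≤ 1 / 8 := by
      rw [div_le_iff₀ hR0]; linarith
    calc eL * (n * P * (R ^ lev j / R * D)) = (eL * (n * P) / R) * (R ^ lev j * D) := by ring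
      _ ≤ 1 / 8 * (R ^ lev j * D) := mul_le_mul_of_nonneg_right this (by positivity)
      _ = _ := by ring
  have k2 : eL * (eL * (n * (2 * B * (R ^ n * D))) / (lam * κ)) ≤ R ^ lev j * D / 8 := by
    have h3 : eL * eL * (n * (2 * B * R ^ n)) / (lam * κ) ≤ 1 / 8 := by
      rw [div_le_iff₀ (by positivity)]
      have : lam * κ = 16 * eL * eL * (n * B * R ^ n) + κ := by
        rw [hlam]; field_simp
      rw [this]; linarith
    calc eL * (eL * (n * (2 * B * (R ^ n * D))) / (lam * κ)) = eL * eL * (n * (2 * B * R ^ n)) / (lam * κ) * D := by ring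
      _ ≤ 1 / 8 * D := mul_le_mul_of_nonneg_right h3 hD
      _ ≤ _ := by nlinarith
  rw [mul_add]; linarith

/-- unknown from the weighted bounded function -/
def zz (s lam R : ℝ) (lev : Fin n → ℕ) (Z : BoundedContinuousFunction (ℝ × ℝ) (Fin n → ℝ))
    (k : Fin n) (x t : ℝ) : ℝ :=
  R ^ lev k * Real.exp (lam * (t - s)) * (Z (x, max t s) k - Z (x, s) k)

lemma zz_cont (s lam R : ℝ) (lev : Fin n → ℕ) (Z : BoundedContinuousFunction (ℝ × ℝ) (Fin n → ℝ)) (k : Fin n) :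
    Continuous fun q : ℝ × ℝ => zz s lam R lev Z k q.1 q.2 := by
  unfold zz
  have h1 : Continuous fun q : ℝ × ℝ => Z (q.1, max q.2 s) k :=
    (continuous_apply k).comp (Z.continuous.comp (by fun_prop))
  have h2 : Continuous fun q : ℝ × ℝ => Z (q.1, s) k :=
    (continuous_apply k).comp (Z.continuous.comp (by fun_prop))
  have h3 : Continuous fun q : ℝ × ℝ => R ^ lev k * Real.exp (lam * (q.2 - s)) := by fun_prop
  exact h3.mul (h1.sub h2)

lemma zz_zero (s lam R : ℝ) (lev : Fin n → ℕ) (Z : BoundedContinuousFunction (ℝ × ℝ) (Fin n → ℝ)) (k : Fin n)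
    (x : ℝ) {t : ℝ} (ht : t ≤ s) : zz s lam R lev Z k x t = 0 := by
  simp [zz, max_eq_right ht]

lemma zz_diff {s lam R : ℝ} (hR : 1 ≤ R) (lev : Fin n → ℕ) (Z W : BoundedContinuousFunction (ℝ × ℝ) (Fin n → ℝ)) (k : Fin n)
    (x t : ℝ) : |zz s lam R lev Z k x t - zz s lam R lev W k x t| ≤
      R ^ lev k * (2 * dist Z W) * Real.exp (lam * (t - s)) := by
  have h : ∀ q, |Z q k - W q k| ≤ dist Z W := fun q => by
    rw [← Real.dist_eq]
    exact (dist_le_pi_dist (Z q) (W q) k).trans (BoundedContinuousFunction.dist_coe_le_dist q)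
  have e : zz s lam R lev Z k x t - zz s lam R lev W k x t = R ^ lev k * Real.exp (lam * (t - s)) *
      ((Z (x, max t s) k - W (x, max t s) k) - (Z (x, s) k - W (x, s) k)) := by unfold zz; ring
  have hp : 0 ≤ R ^ lev k * Real.exp (lam * (t - s)) := by positivity
  rw [e, abs_mul, abs_of_nonneg hp]
  have := mul_le_mul_of_nonneg_left ((abs_sub _ _).trans (add_le_add (h (x, max t s)) (h (x, s)))) hp
  linarith

set_option maxHeartbeats 3200000 in
theorem FP.solve (h : FP p L κ B P C s x0 c ct X E T β βt f ft g gp) (hH3 : H3cond n p) :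
    ∃ y z : Fin n → ℝ → ℝ → ℝ, (∀ j, Continuous fun q : ℝ × ℝ => y j q.1 q.2) ∧
      (∀ j, Continuous fun q : ℝ × ℝ => z j q.1 q.2) ∧
      (∀ j, ∀ x ∈ Icc (0:ℝ) 1, ∀ t, HasDerivAt (fun τ => y j x τ) (z j x t) t) ∧
      (∀ j, ∀ x ∈ Icc (0:ℝ) 1, ∀ t, HasDerivAt (fun ξ => y j ξ t)
        (f j x t - (∑ k, β j k x t * y k x t) - z j x t * c j x t) x) ∧
      (∀ j, ∀ x ∈ Icc (0:ℝ) 1, ∀ t ≤ s, y j x t = 0) ∧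
      (∀ j t, y j (x0 j) t = g j t + ∑ k, p j k * y k (1 - x0 k) t) := by
  obtain ⟨lev, hlev, hlp⟩ := exists_lev hH3
  obtain ⟨R, lam, hR, hlam, hlin⟩ := h.lin_bound hlev hlp
  have hR0 : 0 < R := by linarith
  have hlam0 : 0 < lam := by linarith
  set ZZ := zz s lam R lev with hZZ
  have zc := zz_cont s lam R lev
  set Hp : BoundedContinuousFunction (ℝ × ℝ) (Fin n → ℝ) → Fin n → ℝ → ℝ :=
    fun Z j t => gp j t + Hl p x0 (ZZ Z) j t with hHp
  set FT : BoundedContinuousFunction (ℝ × ℝ) (Fin n → ℝ) → Fin n → ℝ → ℝ → ℝ :=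
    fun Z j x t => ft j x t + Fl s β βt (ZZ Z) j x t with hFT
  have Hpc : ∀ Z j, Continuous (Hp Z j) := fun Z j => (h.gpc j).add (Hl_cont (zc Z) j)
  have FTc : ∀ Z j, Continuous fun q : ℝ × ℝ => FT Z j q.1 q.2 := fun Z j =>
    (h.ftc j).add (Fl_cont (zc Z) h.βc h.βtc j)
  set TR : BoundedContinuousFunction (ℝ × ℝ) (Fin n → ℝ) → Fin n → ℝ → ℝ → ℝ :=
    fun Z j x t => trz (x0 j) (X j) (E j) (T j) (Hp Z j) (FT Z j) x t with hTR
  have TRc : ∀ Z j, Continuous fun q : ℝ × ℝ => TR Z j q.1 q.2 := fun Z j =>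
    trz_cont (h.fl j) (Hpc Z j) (FTc Z j)
  -- difference estimate
  have hdiff : ∀ Z W j, ∀ x ∈ Icc (0:ℝ) 1, ∀ t, |TR Z j x t - TR W j x t| ≤
      R ^ lev j * (dist Z W / 2) * Real.exp (lam * (t - s)) := by
    intro Z W j x hx t
    set z : Fin n → ℝ → ℝ → ℝ := fun k x t => ZZ Z k x t - ZZ W k x t with hz
    have hz2 : ∀ k, Continuous fun q : ℝ × ℝ => z k q.1 q.2 := fun k => (zc Z k).sub (zc W k)
    have h1 := hlin z hz2
      (fun k x t ht => by simp only [hz, hZZ, zz_zero s lam R lev _ k x ht, sub_self])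
      (2 * dist Z W) (by positivity) (fun k x t => zz_diff hR lev Z W k x t) j x hx t
    have e : TR Z j x t - TR W j x t = trz (x0 j) (X j) (E j) (T j) (Hl p x0 z j) (Fl s β βt z j) x t := by
      simp only [hTR]
      rw [trz_sub (h.fl j) (FTc Z j) (FTc W j)]
      congr 1
      · ext τ
        simp only [hHp, Hl, hz, add_sub_add_left_eq_sub, ← Finset.sum_sub_distrib, ← mul_sub]
      · ext ξ τ
        simp only [hFT, Fl]
        rw [add_sub_add_left_eq_sub, neg_sub_neg, ← Finset.sum_sub_distrib, ← Finset.sum_neg_distrib]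
        refine Finset.sum_congr rfl fun k _ => ?_
        rw [show JJ s z k ξ τ = _ from JJ_sub (zc Z) (zc W) k ξ τ]
        simp only [hz, hZZ]; ring
    rw [e]
    refine h1.trans (le_of_eq ?_)
    ring
  have hzero : ∀ j x t, TR 0 j x t = trz (x0 j) (X j) (E j) (T j) (gp j) (ft j) x t := by
    intro j x t
    have z0 : ∀ k x t, ZZ 0 k x t = 0 := by intro k x t; simp [hZZ, zz]
    simp only [hTR]
    congr 1
    · ext τ; simp [hHp, Hl, z0]
    · ext ξ τ; simp [hFT, Fl, z0, JJ]
  set C1 := Real.exp L * (C + Real.exp L * C / (lam * κ)) with hC1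
  have hex : ∀ t, ¬ t ≤ s → 1 ≤ Real.exp (lam * (t - s)) := by
    intro t ht
    push Not at ht
    exact Real.one_le_exp (mul_nonneg hlam0.le (by linarith))
  have hbnd0 : ∀ j, ∀ x ∈ Icc (0:ℝ) 1, ∀ t, |TR 0 j x t| ≤ C1 * Real.exp (lam * (t - s)) := by
    intro j x hx t
    rw [hzero]
    refine trz_bound (h.fl j) h.L0 (h.xm j) h.κ0 (h.bk j) hlam0 (h.ftc j) ?_ ?_ x hx t
    · intro τ
      by_cases hτ : τ ≤ s
      · rw [h.gpz j τ hτ, abs_zero]; have := h.C0; positivity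
      · have := mul_le_mul_of_nonneg_left (hex τ hτ) h.C0
        linarith [h.gpb j τ]
    · intro ξ _ τ
      by_cases hτ : τ ≤ s
      · rw [h.ftz j ξ τ hτ, abs_zero]; have := h.C0; positivity
      · have := mul_le_mul_of_nonneg_left (hex τ hτ) h.C0
        linarith [h.ftb j ξ τ]
  have hC10 : 0 ≤ C1 := by have := h.C0; have := h.κ0; positivity
  have hμ : ∀ j, 1 ≤ R ^ lev j := fun j => one_le_pow₀ hR
  set KF : BoundedContinuousFunction (ℝ × ℝ) (Fin n → ℝ) → (ℝ × ℝ) → (Fin n → ℝ) :=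
    fun Z q j => Real.exp (-(lam * (q.2 - s))) * (R ^ lev j)⁻¹ * TR Z j (clx q.1) q.2 with hKF
  have KFc : ∀ Z, Continuous (KF Z) := by
    intro Z
    refine continuous_pi fun j => ?_
    have h1 : Continuous fun q : ℝ × ℝ => TR Z j (clx q.1) q.2 :=
      (TRc Z j).comp (f := fun q : ℝ × ℝ => (clx q.1, q.2)) ((clx_cont.comp continuous_fst).prodMk continuous_snd)
    have h2 : Continuous fun q : ℝ × ℝ => Real.exp (-(lam * (q.2 - s))) * (R ^ lev j)⁻¹ := by fun_prop
    exact h2.mul h1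
  have KFd : ∀ Z W q j, |KF Z q j - KF W q j| ≤ dist Z W / 2 := by
    intro Z W q j
    simp only [hKF]
    rw [← mul_sub, abs_mul, abs_of_nonneg (by positivity)]
    refine (mul_le_mul_of_nonneg_left (hdiff Z W j (clx q.1) (clx_mem _) q.2) (by positivity)).trans (le_of_eq ?_)
    have : R ^ lev j ≠ 0 := by positivity
    rw [Real.exp_neg]
    have := (Real.exp_pos (lam * (q.2 - s))).ne'
    field_simp
  have KFb0 : ∀ q j, |KF 0 q j| ≤ C1 := by
    intro q j
    simp only [hKF]
    rw [abs_mul, abs_of_nonneg (by positivity)]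
    refine (mul_le_mul_of_nonneg_left (hbnd0 j (clx q.1) (clx_mem _) q.2) (by positivity)).trans ?_
    have h3 : (R ^ lev j)⁻¹ ≤ 1 := inv_le_one_of_one_le₀ (hμ j)
    rw [Real.exp_neg]
    have := (Real.exp_pos (lam * (q.2 - s))).ne'
    rw [show (Real.exp (lam * (q.2 - s)))⁻¹ * (R ^ lev j)⁻¹ * (C1 * Real.exp (lam * (q.2 - s))) = (R ^ lev j)⁻¹ * C1 by
      field_simp]
    nlinarith
  have KFb : ∀ Z q, ‖KF Z q‖ ≤ C1 + dist Z 0 / 2 := by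
    intro Z q
    rw [pi_norm_le_iff_of_nonneg (by positivity)]
    intro j
    have h1 := KFd Z 0 q j
    have h2 := KFb0 q j
    rw [Real.norm_eq_abs]
    calc |KF Z q j| = |(KF Z q j - KF 0 q j) + KF 0 q j| := by ring_nf
      _ ≤ _ := (abs_add_le _ _).trans (by linarith)
  set K : BoundedContinuousFunction (ℝ × ℝ) (Fin n → ℝ) → BoundedContinuousFunction (ℝ × ℝ) (Fin n → ℝ) :=
    fun Z => BoundedContinuousFunction.ofNormedAddCommGroup (KF Z) (KFc Z) _ (KFb Z) with hK
  have Kapp : ∀ Z q, K Z q = KF Z q := fun Z q => rfl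
  have hcontr : ContractingWith (1/2) K := by
    refine ⟨by rw [← NNReal.coe_lt_coe]; norm_num, LipschitzWith.of_dist_le_mul fun Z W => ?_⟩
    have h0 : 0 ≤ dist Z W / 2 := by positivity
    have : dist (K Z) (K W) ≤ dist Z W / 2 := by
      rw [BoundedContinuousFunction.dist_le h0]
      intro q
      rw [Kapp, Kapp, dist_pi_le_iff h0]
      intro j
      rw [Real.dist_eq]
      exact KFd Z W q j
    refine this.trans (le_of_eq ?_)
    push_cast; ring
  set Z := ContractingWith.fixedPoint K hcontr with hZ
  have hfix : K Z = Z := hcontr.fixedPoint_isFixedPt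
  have TR0 : ∀ j, ∀ x ∈ Icc (0:ℝ) 1, ∀ t ≤ s, TR Z j x t = 0 := by
    intro j
    refine trz_zero (h.fl j) (h.xm j) h.κ0 (h.bk j) ?_ ?_
    · intro τ hτ
      simp only [hHp, Hl, h.gpz j τ hτ, hZZ, zz_zero s lam R lev Z _ _ hτ, mul_zero, Finset.sum_const_zero, add_zero]
    · intro ξ τ hτ
      have := fun k => JJ_zero (z := zz s lam R lev Z) (fun k x t ht => zz_zero s lam R lev Z k x ht) k ξ hτ
      simp only [hFT, Fl, h.ftz j ξ τ hτ, hZZ, zz_zero s lam R lev Z _ _ hτ, this, mul_zero, add_zero,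
        Finset.sum_const_zero, neg_zero]
  have hZval : ∀ j, ∀ x ∈ Icc (0:ℝ) 1, ∀ t, Z (x, t) j = Real.exp (-(lam * (t - s))) * (R ^ lev j)⁻¹ * TR Z j x t := by
    intro j x hx t
    have h1 : Z (x, t) = KF Z (x, t) := by rw [← Kapp, hfix]
    rw [h1]; simp only [hKF, clx_eq hx]
  have hzTR : ∀ j, ∀ x ∈ Icc (0:ℝ) 1, ∀ t, ZZ Z j x t = TR Z j x t := by
    intro j x hx t
    rcases le_total t s with ht | ht
    · rw [TR0 j x hx t ht]; exact zz_zero s lam R lev Z j x ht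
    · simp only [hZZ, zz, max_eq_left ht]
      rw [hZval j x hx t, hZval j x hx s, TR0 j x hx s le_rfl, Real.exp_neg]
      have := (Real.exp_pos (lam * (t - s))).ne'
      have : R ^ lev j ≠ 0 := by positivity
      field_simp; ring
  -- transported functions
  set z := ZZ Z with hzdef
  have hzc : ∀ k, Continuous fun q : ℝ × ℝ => z k q.1 q.2 := zc Z
  have hz0 : ∀ k x, ∀ t ≤ s, z k x t = 0 := fun k x t ht => zz_zero s lam R lev Z k x ht
  set F : Fin n → ℝ → ℝ → ℝ := fun j x t => f j x t - ∑ k, β j k x t * JJ s z k x t with hF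
  set hh : Fin n → ℝ → ℝ := fun j t => g j t + ∑ k, p j k * JJ s z k (1 - x0 k) t with hhh
  have Fc : ∀ j, Continuous fun q : ℝ × ℝ => F j q.1 q.2 := fun j =>
    (h.fc j).sub (continuous_finsetSum _ fun k _ => (h.βc j k).mul (JJ_cont hzc k))
  have Fd : ∀ j x t, HasDerivAt (fun τ => F j x τ) (FT Z j x t) t := by
    intro j x t
    have := (h.fd j x t).sub (HasDerivAt.fun_sum (u := Finset.univ) fun k _ => (h.βd j k x t).mul (JJ_deriv (s := s) hzc k x t))
    refine this.congr_deriv ?_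
    simp only [hFT, Fl, hzdef]; ring
  have hhd : ∀ j t, HasDerivAt (hh j) (Hp Z j t) t := by
    intro j t
    exact (h.gd j t).add (HasDerivAt.fun_sum (u := Finset.univ) fun k _ => (JJ_deriv (s := s) hzc k (1 - x0 k) t).const_mul (p j k))
  set y : Fin n → ℝ → ℝ → ℝ := fun j => tryy (x0 j) (X j) (T j) (hh j) (F j) with hy
  have htr := fun j => transport (h.fl j) (Hpc Z j) (hhd j) (Fc j) (FTc Z j) (Fd j)
  have hhc : ∀ j, Continuous (hh j) := fun j => continuous_iff_continuousAt.mpr fun t => (hhd j t).continuousAt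
  have y0 : ∀ j, ∀ x ∈ Icc (0:ℝ) 1, ∀ t ≤ s, y j x t = 0 := by
    intro j
    refine tryy_zero (h.fl j) (h.xm j) h.κ0 (h.bk j) ?_ ?_
    · intro τ hτ
      simp only [hhh, h.gz j τ hτ, JJ_zero hz0 _ _ hτ, mul_zero, Finset.sum_const_zero, add_zero]
    · intro ξ τ hτ
      simp only [hF, h.fz j ξ τ hτ, JJ_zero hz0 _ _ hτ, mul_zero, Finset.sum_const_zero, sub_zero]
  have yd : ∀ j, ∀ x ∈ Icc (0:ℝ) 1, ∀ t, HasDerivAt (fun τ => y j x τ) (z j x t) t := by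
    intro j x hx t
    rw [hzTR j x hx t]; exact (htr j).1 x t
  have yJ : ∀ j, ∀ x ∈ Icc (0:ℝ) 1, ∀ t, JJ s z j x t = y j x t := by
    intro j x hx t
    have hc : Continuous fun τ => z j x τ := (hzc j).comp (f := fun τ : ℝ => (x, τ)) (by fun_prop)
    have := intervalIntegral.integral_eq_sub_of_hasDerivAt (a := s) (b := t) (fun τ _ => yd j x hx τ)
      (hc.intervalIntegrable _ _)
    unfold JJ
    rw [this, y0 j x hx s le_rfl, sub_zero]
  refine ⟨y, z, fun j => tryy_cont (h.fl j) (hhc j) (Fc j), hzc, yd, ?_, y0, ?_⟩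
  · intro j x hx t
    refine ((htr j).2 x t).congr_deriv ?_
    rw [hzTR j x hx t]
    simp only [hF]
    rw [Finset.sum_congr rfl fun k _ => by rw [yJ k x hx t]]
  · intro j t
    simp only [hy]
    rw [tryy_x0 (h.fl j)]
    simp only [hhh]
    congr 1
    refine Finset.sum_congr rfl fun k _ => ?_
    rw [yJ k (1 - x0 k) ⟨by linarith [(h.xm k).2], by linarith [(h.xm k).1]⟩ t]

end D3



section D4

/-- bounded and continuous on the plane -/
def CBd (f : ℝ → ℝ → ℝ) : Prop :=
  (Continuous fun q : ℝ × ℝ => f q.1 q.2) ∧ ∃ C, ∀ x t, |f x t| ≤ C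

lemma CBd.add {f g : ℝ → ℝ → ℝ} (hf : CBd f) (hg : CBd g) : CBd fun x t => f x t + g x t := by
  obtain ⟨hf, C, hC⟩ := hf; obtain ⟨hg, D, hD⟩ := hg
  exact ⟨hf.add hg, C + D, fun x t => (abs_add_le _ _).trans (add_le_add (hC x t) (hD x t))⟩
lemma CBd.neg {f : ℝ → ℝ → ℝ} (hf : CBd f) : CBd fun x t => - f x t := by
  obtain ⟨hf, C, hC⟩ := hf
  exact ⟨hf.neg, C, fun x t => by rw [abs_neg]; exact hC x t⟩
lemma CBd.sub {f g : ℝ → ℝ → ℝ} (hf : CBd f) (hg : CBd g) : CBd fun x t => f x t - g x t := by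
  simp only [sub_eq_add_neg]; exact hf.add hg.neg
lemma CBd.mul {f g : ℝ → ℝ → ℝ} (hf : CBd f) (hg : CBd g) : CBd fun x t => f x t * g x t := by
  obtain ⟨hf, C, hC⟩ := hf; obtain ⟨hg, D, hD⟩ := hg
  exact ⟨hf.mul hg, C * D, fun x t => by
    rw [abs_mul]; exact mul_le_mul (hC x t) (hD x t) (abs_nonneg _) ((abs_nonneg _).trans (hC x t))⟩
lemma CBd.const (c : ℝ) : CBd fun _ _ => c := ⟨continuous_const, |c|, fun _ _ => le_rfl⟩
lemma CBd.sum {ι : Type*} {S : Finset ι} {f : ι → ℝ → ℝ → ℝ} (hf : ∀ i ∈ S, CBd (f i)) :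
    CBd fun x t => ∑ i ∈ S, f i x t := by
  classical
  induction S using Finset.induction_on with
  | empty => simpa using CBd.const 0
  | insert a S ha ih =>
    simp only [Finset.sum_insert ha]
    exact (hf a (Finset.mem_insert_self _ _)).add (ih fun i hi => hf i (Finset.mem_insert_of_mem hi))
lemma CBd.inv {f : ℝ → ℝ → ℝ} (hf : CBd f) {Λ : ℝ} (hΛ : 0 < Λ) (h : ∀ x t, Λ ≤ |f x t|) :
    CBd fun x t => (f x t)⁻¹ := by
  refine ⟨hf.1.inv₀ fun q hq => ?_, Λ⁻¹, fun x t => ?_⟩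
  · have := h q.1 q.2; rw [hq, abs_zero] at this; linarith
  · rw [abs_inv]; exact inv_anti₀ hΛ (h x t)
lemma CBd.uniform {ι : Type*} [Fintype ι] {f : ι → ℝ → ℝ → ℝ} (hf : ∀ i, CBd (f i)) :
    ∃ C, 0 ≤ C ∧ ∀ i x t, |f i x t| ≤ C := by
  choose hc C hC using hf
  have h0 : ∀ i, 0 ≤ C i := fun i => (abs_nonneg _).trans (hC i 0 0)
  exact ⟨∑ i, C i, Finset.sum_nonneg fun i _ => h0 i, fun i x t =>
    (hC i x t).trans (Finset.single_le_sum (f := C) (fun i _ => h0 i) (Finset.mem_univ i))⟩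
lemma CBd.ofx {h : ℝ → ℝ} (hh : ContinuousOn h (Icc 0 1)) : CBd fun x _ => h (clx x) := by
  refine ⟨(hh.comp_continuous clx_cont clx_mem).comp continuous_fst, ?_⟩
  obtain ⟨C, hC⟩ := isCompact_Icc.exists_bound_of_continuousOn hh
  exact ⟨C, fun x t => hC _ (clx_mem x)⟩
lemma CBd.ofshift {h : ℝ → ℝ} (hh : Continuous h) (s ε : ℝ) (hε : |ε| ≤ 1) :
    CBd fun x t => h (clx x + ε * Real.sin (t - s)) := by
  refine ⟨hh.comp (((clx_cont.comp continuous_fst)).add (by fun_prop)), ?_⟩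
  obtain ⟨C, hC⟩ := (isCompact_Icc (a := (-1:ℝ)) (b := 2)).exists_bound_of_continuousOn hh.continuousOn
  refine ⟨C, fun x t => hC _ ?_⟩
  have h1 : |ε * Real.sin (t - s)| ≤ 1 := by
    rw [abs_mul]; exact mul_le_one₀ hε (abs_nonneg _) (Real.abs_sin_le_one _)
  have h2 := abs_le.mp h1
  have h3 := clx_mem x
  exact ⟨by linarith [h3.1], by linarith [h3.2]⟩
lemma CBd.sin (s : ℝ) : CBd fun _ t => Real.sin (t - s) :=
  ⟨by fun_prop, 1, fun x t => Real.abs_sin_le_one _⟩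
lemma CBd.cos (s : ℝ) : CBd fun _ t => Real.cos (t - s) :=
  ⟨by fun_prop, 1, fun x t => Real.abs_cos_le_one _⟩

lemma CBd.cs {f : ℝ → ℝ → ℝ} (hf : CBd fun x t => f (clx x) t) (s : ℝ) : CS s f :=
  (CS.of_cont (f := fun x t => f (clx x) t) hf.1).congr fun x hx t _ => by simp only [clx_eq hx]

lemma cont_clamp_all {f : ℝ → ℝ → ℝ} (h : ∀ s, CS s f) : Continuous fun q : ℝ × ℝ => f (clx q.1) q.2 := by
  rw [continuous_iff_continuousAt]
  rintro ⟨x, t⟩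
  refine ((h (t - 1)).clamp.continuousAt (x := (x, t))).congr ?_
  have : {q : ℝ × ℝ | t - 1 < q.2} ∈ nhds (x, t) :=
    (isOpen_lt continuous_const continuous_snd).mem_nhds (by simp)
  filter_upwards [this] with q hq
  rw [max_eq_left (le_of_lt hq)]

/-- forward cut of a function vanishing at time `s` together with its derivative -/
lemma forward_cut {G Gt : ℝ → ℝ → ℝ} (s : ℝ) (hGt : CBd Gt)
    (hd : ∀ x t, s ≤ t → HasDerivWithinAt (fun τ => G x τ) (Gt x t) (Ici s) t)
    (h0 : ∀ x, G x s = 0) (h1 : ∀ x, Gt x s = 0) :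
    ∃ f ft : ℝ → ℝ → ℝ, (Continuous fun q : ℝ × ℝ => f q.1 q.2) ∧ CBd ft ∧
      (∀ x t, HasDerivAt (fun τ => f x τ) (ft x t) t) ∧ (∀ x, ∀ t ≤ s, f x t = 0) ∧
      (∀ x, ∀ t ≤ s, ft x t = 0) ∧ ∀ x t, s ≤ t → f x t = G x t := by
  have hc : Continuous fun q : ℝ × ℝ => Gt q.1 (max q.2 s) :=
    hGt.1.comp (f := fun q : ℝ × ℝ => (q.1, max q.2 s)) (by fun_prop)
  have hc1 : ∀ x, Continuous fun τ => Gt x (max τ s) := fun x =>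
    hc.comp (f := fun τ : ℝ => (x, τ)) (by fun_prop)
  refine ⟨fun x t => ∫ τ in s..t, Gt x (max τ s), fun x t => Gt x (max t s), ?_, ⟨hc, ?_⟩, ?_, ?_, ?_, ?_⟩
  · refine intervalIntegral.continuous_parametric_intervalIntegral_of_continuous
      (f := fun (q : ℝ × ℝ) τ => Gt q.1 (max τ s)) ?_ continuous_snd
    exact hc.comp (f := fun w : (ℝ × ℝ) × ℝ => (w.1.1, w.2)) (by fun_prop)
  · obtain ⟨C, hC⟩ := hGt.2
    exact ⟨C, fun x t => hC _ _⟩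
  · intro x t
    exact intervalIntegral.integral_hasDerivAt_right ((hc1 x).intervalIntegrable _ _)
      ((hc1 x).stronglyMeasurableAtFilter _ _) (hc1 x).continuousAt
  · intro x t ht
    show ∫ τ in s..t, Gt x (max τ s) = 0
    rw [intervalIntegral.integral_congr (g := fun _ => (0:ℝ))
      (fun ξ hξ => by rw [uIcc_of_ge ht] at hξ; simp only [max_eq_right hξ.2, h1])]
    simp
  · intro x t ht
    simp only [max_eq_right ht, h1]
  · intro x t ht
    show ∫ τ in s..t, Gt x (max τ s) = G x t
    have := intervalIntegral.integral_eq_sub_of_hasDeriv_right_of_le (f := fun τ => G x τ)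
      (f' := fun τ => Gt x (max τ s)) ht
      (fun τ hτ => ((hd x τ hτ.1).continuousWithinAt).mono Icc_subset_Ici_self)
      (fun τ hτ => by
        rw [max_eq_left hτ.1.le]
        exact ((hd x τ hτ.1.le).hasDerivAt (Ici_mem_nhds hτ.1)).hasDerivWithinAt)
      ((hc1 x).intervalIntegrable _ _)
    rw [this, h0, sub_zero]

/-- scalar lift -/
lemma exists_lift {ψ ψ1 r r1 ρ : ℝ → ℝ} (hψ : ContinuousOn ψ (Icc 0 1)) (hψ1 : ContinuousOn ψ1 (Icc 0 1))
    (hr : ContinuousOn r (Icc 0 1)) (hr1 : ContinuousOn r1 (Icc 0 1)) (hρ : ContinuousOn ρ (Icc 0 1))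
    (dψ : ∀ x ∈ Icc (0:ℝ) 1, HasDerivWithinAt ψ (ψ1 x) (Icc 0 1) x)
    (dr : ∀ x ∈ Icc (0:ℝ) 1, HasDerivWithinAt r (r1 x) (Icc 0 1) x) (s : ℝ) :
    ∃ Φ Φx Φt Φxt Φtt : ℝ → ℝ → ℝ, CBd (fun x t => Φ (clx x) t) ∧ CBd (fun x t => Φx (clx x) t) ∧
      CBd (fun x t => Φt (clx x) t) ∧ CBd (fun x t => Φxt (clx x) t) ∧ CBd (fun x t => Φtt (clx x) t) ∧
      (∀ x ∈ Icc (0:ℝ) 1, ∀ t, HasDerivWithinAt (fun z => Φ z t) (Φx x t) (Icc 0 1) x) ∧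
      (∀ x t, HasDerivAt (fun τ => Φ x τ) (Φt x t) t) ∧
      (∀ x t, HasDerivAt (fun τ => Φx x τ) (Φxt x t) t) ∧
      (∀ x t, HasDerivAt (fun τ => Φt x τ) (Φtt x t) t) ∧
      ∀ x ∈ Icc (0:ℝ) 1, Φ x s = ψ x ∧ Φx x s = ψ1 x ∧ Φt x s = r x ∧ Φxt x s = r1 x ∧ Φtt x s = ρ x := by
  set ρb : ℝ → ℝ := fun x => ρ (clx x) with hρb
  have ρc : Continuous ρb := hρ.comp_continuous clx_cont clx_mem
  set R1 : ℝ → ℝ := fun x => ∫ ξ in (0:ℝ)..x, ρb ξ with hR1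
  have dR1 : ∀ x, HasDerivAt R1 (ρb x) x := fun x =>
    intervalIntegral.integral_hasDerivAt_right (ρc.intervalIntegrable _ _)
      (ρc.stronglyMeasurableAtFilter _ _) ρc.continuousAt
  have R1c : Continuous R1 := continuous_iff_continuousAt.mpr fun x => (dR1 x).continuousAt
  set R2 : ℝ → ℝ := fun x => ∫ ξ in (0:ℝ)..x, R1 ξ with hR2
  have dR2 : ∀ x, HasDerivAt R2 (R1 x) x := fun x =>
    intervalIntegral.integral_hasDerivAt_right (R1c.intervalIntegrable _ _)
      (R1c.stronglyMeasurableAtFilter _ _) R1c.continuousAt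
  have R2c : Continuous R2 := continuous_iff_continuousAt.mpr fun x => (dR2 x).continuousAt
  have sp : ∀ {h : ℝ → ℝ}, Continuous h → CBd fun x t => h (clx x + Real.sin (t - s)) := by
    intro h hh; have := CBd.ofshift hh s 1 (by simp); simpa using this
  have sm : ∀ {h : ℝ → ℝ}, Continuous h → CBd fun x t => h (clx x - Real.sin (t - s)) := by
    intro h hh; have := CBd.ofshift hh s (-1) (by simp); simpa [← sub_eq_add_neg] using this
  have dsin : ∀ t, HasDerivAt (fun τ => Real.sin (τ - s)) (Real.cos (t - s)) t := by
    intro t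
    have := ((hasDerivAt_id t).sub_const s).sin
    simpa using this
  have dcos : ∀ t, HasDerivAt (fun τ => Real.cos (τ - s)) (-Real.sin (t - s)) t := by
    intro t
    have := ((hasDerivAt_id t).sub_const s).cos
    simpa using this
  have tp : ∀ {h h' : ℝ → ℝ}, (∀ x, HasDerivAt h (h' x) x) → ∀ x t,
      HasDerivAt (fun τ => h (x + Real.sin (τ - s))) (h' (x + Real.sin (t - s)) * Real.cos (t - s)) t := by
    intro h h' hh x t
    exact (hh (x + Real.sin (t - s))).comp t ((dsin t).const_add x)
  have tm : ∀ {h h' : ℝ → ℝ}, (∀ x, HasDerivAt h (h' x) x) → ∀ x t,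
      HasDerivAt (fun τ => h (x - Real.sin (τ - s))) (h' (x - Real.sin (t - s)) * -Real.cos (t - s)) t := by
    intro h h' hh x t
    exact (hh (x - Real.sin (t - s))).comp t ((dsin t).const_sub x)
  have c2 := CBd.const (2:ℝ)⁻¹
  have c3 := CBd.const (2:ℝ)
  refine ⟨fun x t => ψ x + Real.sin (t - s) * r x + 2⁻¹ * (R2 (x + Real.sin (t - s)) - 2 * R2 x + R2 (x - Real.sin (t - s))),
    fun x t => ψ1 x + Real.sin (t - s) * r1 x + 2⁻¹ * (R1 (x + Real.sin (t - s)) - 2 * R1 x + R1 (x - Real.sin (t - s))),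
    fun x t => Real.cos (t - s) * (r x + 2⁻¹ * (R1 (x + Real.sin (t - s)) - R1 (x - Real.sin (t - s)))),
    fun x t => Real.cos (t - s) * (r1 x + 2⁻¹ * (ρb (x + Real.sin (t - s)) - ρb (x - Real.sin (t - s)))),
    fun x t => -Real.sin (t - s) * (r x + 2⁻¹ * (R1 (x + Real.sin (t - s)) - R1 (x - Real.sin (t - s)))) +
      Real.cos (t - s) * (Real.cos (t - s) * (2⁻¹ * (ρb (x + Real.sin (t - s)) + ρb (x - Real.sin (t - s))))),
    ?_, ?_, ?_, ?_, ?_, ?_, ?_, ?_, ?_, ?_⟩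
  · exact ((CBd.ofx hψ).add ((CBd.sin s).mul (CBd.ofx hr))).add
      (c2.mul (((sp R2c).sub (c3.mul (CBd.ofx R2c.continuousOn))).add (sm R2c)))
  · exact ((CBd.ofx hψ1).add ((CBd.sin s).mul (CBd.ofx hr1))).add
      (c2.mul (((sp R1c).sub (c3.mul (CBd.ofx R1c.continuousOn))).add (sm R1c)))
  · exact (CBd.cos s).mul ((CBd.ofx hr).add (c2.mul ((sp R1c).sub (sm R1c))))
  · exact (CBd.cos s).mul ((CBd.ofx hr1).add (c2.mul ((sp ρc).sub (sm ρc))))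
  · exact ((CBd.sin s).neg.mul ((CBd.ofx hr).add (c2.mul ((sp R1c).sub (sm R1c))))).add
      ((CBd.cos s).mul ((CBd.cos s).mul (c2.mul ((sp ρc).add (sm ρc)))))
  · intro x hx t
    have d1 : HasDerivAt (fun z => R2 (z + Real.sin (t - s))) (R1 (x + Real.sin (t - s))) x := by
      have := (dR2 (x + Real.sin (t - s))).comp x ((hasDerivAt_id x).add_const _)
      simpa [Function.comp_def] using this
    have d2 : HasDerivAt (fun z => R2 (z - Real.sin (t - s))) (R1 (x - Real.sin (t - s))) x := by
      have := (dR2 (x - Real.sin (t - s))).comp x ((hasDerivAt_id x).sub_const _)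
      simpa [Function.comp_def] using this
    exact ((dψ x hx).add ((dr x hx).const_mul _)).add
      ((((d1.sub ((dR2 x).const_mul 2)).add d2).const_mul _).hasDerivWithinAt)
  · intro x t
    have := (((dsin t).mul_const (r x)).const_add (ψ x)).add
      ((((tp dR2 x t).sub_const (2 * R2 x)).add (tm dR2 x t)).const_mul 2⁻¹)
    refine this.congr_deriv ?_
    ring
  · intro x t
    have := (((dsin t).mul_const (r1 x)).const_add (ψ1 x)).add
      ((((tp dR1 x t).sub_const (2 * R1 x)).add (tm dR1 x t)).const_mul 2⁻¹)
    refine this.congr_deriv ?_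
    ring
  · intro x t
    have := (dcos t).mul ((((tp dR1 x t).fun_sub (tm dR1 x t)).const_mul 2⁻¹).const_add (r x))
    refine this.congr_deriv ?_
    ring
  · intro x hx
    have e : ρb x = ρ x := by simp only [hρb, clx_eq hx]
    simp only [sub_self, Real.sin_zero, Real.cos_zero, add_zero, sub_zero, e]
    refine ⟨by ring, by ring, by ring, by ring, by ring⟩

end D4



section D5

/-- `C¹` with bounds on the whole strip -/
structure BK1 (C : ℝ) (f fx ft : ℝ → ℝ → ℝ) : Prop where
  c1 : ∀ s, C1S s f fx ft
  b0 : ∀ x ∈ Icc (0:ℝ) 1, ∀ t, |f x t| ≤ C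
  bx : ∀ x ∈ Icc (0:ℝ) 1, ∀ t, |fx x t| ≤ C
  bt : ∀ x ∈ Icc (0:ℝ) 1, ∀ t, |ft x t| ≤ C

lemma ACof.bk {n m : ℕ} {Λ A : ℝ} {a ax aT : Fin n → ℝ → ℝ → ℝ} (h : ACof m Λ A a ax aT) (j : Fin n) :
    BK1 A (a j) (ax j) (aT j) := ⟨fun s => h.c1 s j, h.ba j, h.bx j, h.bt j⟩

lemma BK1.cb0 {C : ℝ} {f fx ft : ℝ → ℝ → ℝ} (h : BK1 C f fx ft) : CBd fun x t => f (clx x) t :=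
  ⟨cont_clamp_all fun s => (h.c1 s).c0, C, fun x t => h.b0 _ (clx_mem x) t⟩
lemma BK1.cbt {C : ℝ} {f fx ft : ℝ → ℝ → ℝ} (h : BK1 C f fx ft) : CBd fun x t => ft (clx x) t :=
  ⟨cont_clamp_all fun s => (h.c1 s).ct, C, fun x t => h.bt _ (clx_mem x) t⟩
lemma BK1.dt {C : ℝ} {f fx ft : ℝ → ℝ → ℝ} (h : BK1 C f fx ft) {x : ℝ} (hx : x ∈ Icc (0:ℝ) 1) (t : ℝ) :
    HasDerivAt (fun τ => f x τ) (ft x t) t :=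
  ((h.c1 (t - 1)).dt x hx t (by linarith)).hasDerivAt (Ici_mem_nhds (by linarith))
lemma BK1.dx {C : ℝ} {f fx ft : ℝ → ℝ → ℝ} (h : BK1 C f fx ft) {x : ℝ} (hx : x ∈ Icc (0:ℝ) 1) (t : ℝ) :
    HasDerivWithinAt (fun z => f z t) (fx x t) (Icc 0 1) x := (h.c1 t).dx x hx t le_rfl

lemma ACof.abs_ge {n m : ℕ} {Λ A : ℝ} {a ax aT : Fin n → ℝ → ℝ → ℝ} (h : ACof m Λ A a ax aT) (j : Fin n)
    {x : ℝ} (hx : x ∈ Icc (0:ℝ) 1) (t : ℝ) : Λ ≤ |a j x t| := by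
  by_cases hj : (j : ℕ) < m
  · exact (h.pos j hj x hx t).trans (le_abs_self _)
  · have := h.neg j hj x hx t
    exact le_trans (by linarith) (neg_le_abs _)

def chi (x : ℝ) : ℝ := max 0 (1 - |x - clx x|)
lemma chi_cont : Continuous chi := by
  unfold chi; exact continuous_const.max (continuous_const.sub ((continuous_id.sub clx_cont).abs))
lemma chi_one {x : ℝ} (hx : x ∈ Icc (0:ℝ) 1) : chi x = 1 := by simp [chi, clx_eq hx]
lemma chi_bd : CBd fun x _ => chi x := by
  refine ⟨chi_cont.comp continuous_fst, 1, fun x t => ?_⟩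
  have : 0 ≤ chi x := le_max_left _ _
  rw [abs_of_nonneg this]
  exact max_le zero_le_one (by linarith [abs_nonneg (x - clx x)])
lemma chi_zero {x : ℝ} (hx : x ∉ Icc (-1:ℝ) 2) : chi x = 0 := by
  unfold chi
  apply max_eq_left
  have h := clx_mem x
  rw [mem_Icc, not_and_or, not_le, not_le] at hx
  rcases hx with hx | hx
  · have := neg_le_abs (x - clx x); linarith [h.1]
  · have := le_abs_self (x - clx x); linarith [h.2]

set_option maxHeartbeats 1600000 in
theorem exists_sol {n m : ℕ} {Λ A Bd : ℝ} (hΛ : 0 < Λ) {p : Fin n → Fin n → ℝ} (hH3 : H3cond n p)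
    {a ax aT : Fin n → ℝ → ℝ → ℝ} (ha : ACof m Λ A a ax aT)
    {b bx bT : Fin n → Fin n → ℝ → ℝ → ℝ} (hb : ∀ j k, BK1 Bd (b j k) (bx j k) (bT j k)) (s : ℝ)
    {ψ ψ1 ψ2 : Fin n → ℝ → ℝ}
    (d1 : ∀ j, ∀ x ∈ Icc (0:ℝ) 1, HasDerivWithinAt (ψ j) (ψ1 j x) (Icc 0 1) x)
    (d2 : ∀ j, ∀ x ∈ Icc (0:ℝ) 1, HasDerivWithinAt (ψ1 j) (ψ2 j x) (Icc 0 1) x)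
    (c2 : ∀ j, ContinuousOn (ψ2 j) (Icc 0 1))
    (z0 : ∀ j, ψ j 0 = 0) (z1 : ∀ j, ψ j 1 = 0) (z2 : ∀ j, ψ1 j 0 = 0) (z3 : ∀ j, ψ1 j 1 = 0) :
    ∃ u ux ut, Sol m p a b (fun _ _ _ => 0) s u ux ut ∧ ∀ j, ∀ x ∈ Icc (0:ℝ) 1, u j x s = ψ j x := by
  have c0 : ∀ j, ContinuousOn (ψ j) (Icc 0 1) := fun j x hx => (d1 j x hx).continuousWithinAt
  have c1 : ∀ j, ContinuousOn (ψ1 j) (Icc 0 1) := fun j x hx => (d2 j x hx).continuousWithinAt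
  have aK := fun j => ha.bk j
  have csat : ∀ {f : ℝ → ℝ → ℝ}, CS s f → ContinuousOn (fun x => f x s) (Icc 0 1) := fun h => h.att le_rfl
  -- initial derivatives
  set r : Fin n → ℝ → ℝ := fun j x => -(a j x s * ψ1 j x) - ∑ k, b j k x s * ψ k x with hr
  set r1 : Fin n → ℝ → ℝ := fun j x => -(ax j x s * ψ1 j x + a j x s * ψ2 j x) -
    ∑ k, (bx j k x s * ψ k x + b j k x s * ψ1 k x) with hr1
  set ρ : Fin n → ℝ → ℝ := fun j x => -(aT j x s * ψ1 j x + a j x s * r1 j x +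
    ∑ k, (bT j k x s * ψ k x + b j k x s * r k x)) with hρ
  have ac := fun j => csat ((aK j).c1 s).c0
  have axc := fun j => csat ((aK j).c1 s).cx
  have atc := fun j => csat ((aK j).c1 s).ct
  have bc := fun j k => csat ((hb j k).c1 s).c0
  have bxc := fun j k => csat ((hb j k).c1 s).cx
  have btc := fun j k => csat ((hb j k).c1 s).ct
  have rc : ∀ j, ContinuousOn (r j) (Icc 0 1) := fun j =>
    (((ac j).mul (c1 j)).neg).sub (continuousOn_finsetSum _ fun k _ => (bc j k).mul (c0 k))
  have r1c : ∀ j, ContinuousOn (r1 j) (Icc 0 1) := fun j =>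
    ((((axc j).mul (c1 j)).add ((ac j).mul (c2 j))).neg).sub
      (continuousOn_finsetSum _ fun k _ => ((bxc j k).mul (c0 k)).add ((bc j k).mul (c1 k)))
  have ρc : ∀ j, ContinuousOn (ρ j) (Icc 0 1) := fun j =>
    ((((atc j).mul (c1 j)).add ((ac j).mul (r1c j))).add
      (continuousOn_finsetSum _ fun k _ => ((btc j k).mul (c0 k)).add ((bc j k).mul (rc k)))).neg
  have dr : ∀ j, ∀ x ∈ Icc (0:ℝ) 1, HasDerivWithinAt (r j) (r1 j x) (Icc 0 1) x := fun j x hx =>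
    ((((aK j).dx hx s).mul (d2 j x hx)).neg).sub
      (HasDerivWithinAt.fun_sum fun k _ => ((hb j k).dx hx s).mul (d1 k x hx))
  choose Φ Φx Φt Φxt Φtt hΦ hΦx hΦt hΦxt hΦtt dΦx dΦt dΦxt dΦtt hΦs using fun j =>
    exists_lift (c0 j) (c1 j) (rc j) (r1c j) (ρc j) (d1 j) (dr j) s
  -- residual
  set G : Fin n → ℝ → ℝ → ℝ := fun j x t => -(Φt j x t + a j x t * Φx j x t + ∑ k, b j k x t * Φ k x t) with hG
  set Gt : Fin n → ℝ → ℝ → ℝ := fun j x t => -(Φtt j x t + (aT j x t * Φx j x t + a j x t * Φxt j x t) +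
    ∑ k, (bT j k x t * Φ k x t + b j k x t * Φt k x t)) with hGt
  have Gd : ∀ j, ∀ x ∈ Icc (0:ℝ) 1, ∀ t, HasDerivAt (fun τ => G j x τ) (Gt j x t) t := fun j x hx t =>
    (((dΦtt j x t).add (((aK j).dt hx t).mul (dΦxt j x t))).add
      (HasDerivAt.fun_sum fun k _ => ((hb j k).dt hx t).mul (dΦt k x t))).neg
  have Gs : ∀ j, ∀ x ∈ Icc (0:ℝ) 1, G j x s = 0 := by
    intro j x hx
    have e : ∀ k, Φ k x s = ψ k x := fun k => (hΦs k x hx).1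
    simp only [hG, e, (hΦs j x hx).2.1, (hΦs j x hx).2.2.1, hr]
    ring
  have Gts : ∀ j, ∀ x ∈ Icc (0:ℝ) 1, Gt j x s = 0 := by
    intro j x hx
    have e : ∀ k, Φ k x s = ψ k x := fun k => (hΦs k x hx).1
    have e2 : ∀ k, Φt k x s = r k x := fun k => (hΦs k x hx).2.2.1
    simp only [hGt, e, e2, (hΦs j x hx).2.1, (hΦs j x hx).2.2.2.1, (hΦs j x hx).2.2.2.2, hρ]
    ring
  have Gb : ∀ j, CBd fun x t => G j (clx x) t := fun j =>
    (((hΦt j).add ((aK j).cb0.mul (hΦx j))).add (CBd.sum fun k _ => (hb j k).cb0.mul (hΦ k))).neg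
  have Gtb : ∀ j, CBd fun x t => Gt j (clx x) t := fun j =>
    (((hΦtt j).add (((aK j).cbt.mul (hΦx j)).add ((aK j).cb0.mul (hΦxt j)))).add
      (CBd.sum fun k _ => ((hb j k).cbt.mul (hΦ k)).add ((hb j k).cb0.mul (hΦt k)))).neg
  -- inverse speed
  have ane : ∀ j x t, a j (clx x) t ≠ 0 := fun j x t h0 => by
    have := ha.abs_ge j (clx_mem x) t
    rw [h0, abs_zero] at this; linarith
  set ia : Fin n → ℝ → ℝ → ℝ := fun j x t => (a j (clx x) t)⁻¹ with hia
  set iat : Fin n → ℝ → ℝ → ℝ := fun j x t => -(aT j (clx x) t * ((a j (clx x) t)⁻¹ * (a j (clx x) t)⁻¹)) with hiat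
  have iab : ∀ j, CBd (ia j) := fun j => (aK j).cb0.inv hΛ fun x t => ha.abs_ge j (clx_mem x) t
  have iatb : ∀ j, CBd (iat j) := fun j => ((aK j).cbt.mul ((iab j).mul (iab j))).neg
  have iad : ∀ j x t, HasDerivAt (fun τ => ia j x τ) (iat j x t) t := fun j x t => by
    refine (((aK j).dt (clx_mem x) t).fun_inv (ane j x t)).congr_deriv ?_
    simp only [hiat]; field_simp
  -- forcing
  have hf := fun j => forward_cut (G := fun x t => G j (clx x) t * ia j x t)
    (Gt := fun x t => Gt j (clx x) t * ia j x t + G j (clx x) t * iat j x t) s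
    (((Gtb j).mul (iab j)).add ((Gb j).mul (iatb j)))
    (fun x t _ => ((Gd j _ (clx_mem x) t).mul (iad j x t)).hasDerivWithinAt)
    (fun x => by simp only [Gs j _ (clx_mem x), zero_mul])
    (fun x => by simp only [Gs j _ (clx_mem x), Gts j _ (clx_mem x), zero_mul, add_zero])
  choose f ft fc ftb fd fz ftz feq using hf
  -- inflow inhomogeneity
  set x0 : Fin n → ℝ := fun j => if (j : ℕ) < m then 0 else 1 with hx0
  have x0m : ∀ j, x0 j ∈ Icc (0:ℝ) 1 := fun j => by
    simp only [hx0]; split_ifs <;> simp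
  have x1m : ∀ j, 1 - x0 j ∈ Icc (0:ℝ) 1 := fun j => by
    have := x0m j; exact ⟨by linarith [this.2], by linarith [this.1]⟩
  have x0c : ∀ j, x0 j = 0 ∨ x0 j = 1 := fun j => by
    simp only [hx0]; split_ifs <;> simp
  have ψe : ∀ k x, (x = 0 ∨ x = 1) → ψ k x = 0 := by
    rintro k x (h | h)
    · rw [h, z0]
    · rw [h, z1]
  have re : ∀ k x, (x = 0 ∨ x = 1) → r k x = 0 := by
    intro k x h
    have e1 : ψ1 k x = 0 := by
      rcases h with h | h
      · rw [h, z2]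
      · rw [h, z3]
    simp only [hr, e1, ψe _ x h, mul_zero, Finset.sum_const_zero, neg_zero, sub_zero]
  have x1c : ∀ j, 1 - x0 j = 0 ∨ 1 - x0 j = 1 := fun j => by
    rcases x0c j with h | h <;> rw [h] <;> simp
  have atpt : ∀ {h : ℝ → ℝ → ℝ}, CBd (fun x t => h (clx x) t) → ∀ x ∈ Icc (0:ℝ) 1, CBd fun _ t => h x t := by
    intro h hh x hx
    obtain ⟨h1, C, h2⟩ := hh
    refine ⟨?_, C, fun _ t => ?_⟩
    · have := h1.comp (f := fun q : ℝ × ℝ => (x, q.2)) (by fun_prop)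
      simpa only [Function.comp_def, clx_eq hx] using this
    · have := h2 x t; simpa only [clx_eq hx] using this
  have hg := fun j => forward_cut
    (G := fun _ t => (∑ k, p j k * Φ k (1 - x0 k) t) - Φ j (x0 j) t)
    (Gt := fun _ t => (∑ k, p j k * Φt k (1 - x0 k) t) - Φt j (x0 j) t) s
    ((CBd.sum fun k _ => (CBd.const (p j k)).mul (atpt (hΦt k) _ (x1m k))).sub (atpt (hΦt j) _ (x0m j)))
    (fun x t _ => ((HasDerivAt.fun_sum fun k _ => (dΦt k _ t).const_mul (p j k)).sub
      (dΦt j _ t)).hasDerivWithinAt)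
    (fun x => by
      have e : ∀ k, Φ k (1 - x0 k) s = 0 := fun k => by rw [(hΦs k _ (x1m k)).1, ψe _ _ (x1c k)]
      have e' : Φ j (x0 j) s = 0 := by rw [(hΦs j _ (x0m j)).1, ψe _ _ (x0c j)]
      simp only [e, e', mul_zero, Finset.sum_const_zero, sub_zero])
    (fun x => by
      have e : ∀ k, Φt k (1 - x0 k) s = 0 := fun k => by rw [(hΦs k _ (x1m k)).2.2.1, re _ _ (x1c k)]
      have e' : Φt j (x0 j) s = 0 := by rw [(hΦs j _ (x0m j)).2.2.1, re _ _ (x0c j)]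
      simp only [e, e', mul_zero, Finset.sum_const_zero, sub_zero])
  choose g gp gc gpb gd gz gpz geq using hg
  -- zeroth order
  have bb : ∀ j k, CBd fun x t => b j k (clx x) t * ia j x t := fun j k => (hb j k).cb0.mul (iab j)
  have btb : ∀ j k, CBd fun x t => bT j k (clx x) t * ia j x t + b j k (clx x) t * iat j x t := fun j k =>
    ((hb j k).cbt.mul (iab j)).add ((hb j k).cb0.mul (iatb j))
  have cb : ∀ j, CBd fun x t => chi x * ia j x t := fun j => chi_bd.mul (iab j)
  have ctb : ∀ j, CBd fun x t => chi x * iat j x t := fun j => chi_bd.mul (iatb j)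
  obtain ⟨Cb, Cb0, hCb⟩ := CBd.uniform cb
  obtain ⟨L, L0, hL⟩ := CBd.uniform ctb
  obtain ⟨B1, B10, hB1⟩ := CBd.uniform (ι := Fin n × Fin n) fun i => bb i.1 i.2
  obtain ⟨B2, B20, hB2⟩ := CBd.uniform (ι := Fin n × Fin n) fun i => btb i.1 i.2
  obtain ⟨C1, C10, hC1⟩ := CBd.uniform ftb
  obtain ⟨C2, C20, hC2⟩ := CBd.uniform gpb
  obtain ⟨P, P0, hP⟩ := CBd.uniform (ι := Fin n × Fin n) fun i => CBd.const (p i.1 i.2)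
  have hflow := fun j => exists_flow (cb j).1 (ctb j).1 (fun x t => (iad j x t).const_mul (chi x)) Cb0
    (hCb j) L0 (hL j) (fun x hx t => by simp only [chi_zero hx, zero_mul]) (x0m j)
  choose X E T hfl using hflow
  have hAA : ∀ j : Fin n, 0 ≤ A := fun j => (abs_nonneg _).trans (ha.ba j 0 (by simp) 0)
  have hκ : ∀ j : Fin n, (0:ℝ) < 1 / (A + 1) := fun j => by have := hAA j; positivity
  have hbk : ∀ j, BackFlow (1/(A+1)) (x0 j) (X j) (T j) := by
    intro j
    refine backflow_of_sign (hfl j) (hκ j) ?_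
    have hA := hAA j
    by_cases hj : (j : ℕ) < m
    · left
      refine ⟨by simp only [hx0, if_pos hj], fun x hx t => ?_⟩
      simp only [chi_one hx, one_mul, hia, clx_eq hx]
      have h1 := ha.pos j hj x hx t
      have h2 := (abs_le.mp (ha.ba j x hx t)).2
      rw [one_div]
      exact inv_anti₀ (by linarith) (by linarith)
    · right
      refine ⟨by simp only [hx0, if_neg hj], fun x hx t => ?_⟩
      simp only [chi_one hx, one_mul, hia, clx_eq hx]
      have h1 := ha.neg j hj x hx t
      have h2 := (abs_le.mp (ha.ba j x hx t)).1
      rw [one_div, le_neg, ← inv_neg]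
      exact inv_anti₀ (by linarith) (by linarith)
  by_cases hn : IsEmpty (Fin n)
  · exact ⟨fun j => isEmptyElim j, fun j => isEmptyElim j, fun j => isEmptyElim j,
      ⟨fun j => isEmptyElim j, fun j => isEmptyElim j, fun j => isEmptyElim j⟩, fun j => isEmptyElim j⟩
  rw [not_isEmpty_iff] at hn
  obtain ⟨j0⟩ := hn
  have hFP : FP p L (1/(A+1)) (B1 + B2) P (C1 + C2) s x0 (fun j x t => chi x * ia j x t)
      (fun j x t => chi x * iat j x t) X E T (fun j k x t => b j k (clx x) t * ia j x t)
      (fun j k x t => bT j k (clx x) t * ia j x t + b j k (clx x) t * iat j x t) f ft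
      (fun j => g j 0) (fun j => gp j 0) :=
    { L0 := L0, κ0 := hκ j0, B0 := by linarith, P0 := P0, C0 := by linarith
      pb := fun j k => hP (j, k) 0 0
      xm := x0m, fl := hfl, bk := hbk
      βc := fun j k => (bb j k).1
      βtc := fun j k => (btb j k).1
      βd := fun j k x t => ((hb j k).dt (clx_mem x) t).mul (iad j x t)
      βb := fun j k x t => (hB1 (j, k) x t).trans (by linarith)
      βtb := fun j k x t => (hB2 (j, k) x t).trans (by linarith)
      fc := fc
      ftc := fun j => (ftb j).1
      fd := fd
      ftb := fun j x t => (hC1 j x t).trans (by linarith)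
      fz := fz, ftz := ftz
      gd := fun j t => gd j 0 t
      gpc := fun j => (gpb j).1.comp (f := fun t : ℝ => ((0:ℝ), t)) (by fun_prop)
      gpb := fun j t => (hC2 j 0 t).trans (by linarith)
      gz := fun j t ht => gz j 0 t ht
      gpz := fun j t ht => gpz j 0 t ht }
  obtain ⟨y, z, yc, zc, dyt, dyx, y0, ybc⟩ := hFP.solve hH3
  refine ⟨fun j x t => Φ j x t + y j x t, fun j x t => Φx j x t + ((f j x t -
      ∑ k, b j k (clx x) t * ia j x t * y k x t) - z j x t * (chi x * ia j x t)),
    fun j x t => Φt j x t + z j x t, ⟨?_, ?_, ?_⟩, ?_⟩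
  · intro j
    refine ⟨((hΦ j).cs s).add (CS.of_cont (yc j)), ((hΦx j).cs s).add (CS.of_cont ?_),
      ((hΦt j).cs s).add (CS.of_cont (zc j)), ?_, ?_⟩
    · exact ((fc j).sub (continuous_finsetSum _ fun k _ => (bb j k).1.mul (yc k))).sub ((zc j).mul (cb j).1)
    · intro x hx t ht
      exact (dΦx j x hx t).add (dyx j x hx t).hasDerivWithinAt
    · intro x hx t ht
      exact ((dΦt j x t).add (dyt j x hx t)).hasDerivWithinAt
  · intro j x hx t ht
    have h0 : a j x t ≠ 0 := by have := ane j x t; rwa [clx_eq hx] at this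
    simp only [feq j x t ht, chi_one hx, hia, clx_eq hx, hG, mul_add, Finset.sum_add_distrib]
    have e : ∑ k, b j k x t * (a j x t)⁻¹ * y k x t = (a j x t)⁻¹ * ∑ k, b j k x t * y k x t := by
      rw [Finset.mul_sum]; exact Finset.sum_congr rfl fun k _ => by ring
    rw [e]
    field_simp
    ring
  · intro j t ht
    have e1 : ∀ (w : Fin n → ℝ → ℝ → ℝ) j, inn m w j t = w j (x0 j) t := fun w j => by
      simp only [inn, hx0]; split_ifs <;> rfl
    have e2 : ∀ (w : Fin n → ℝ → ℝ → ℝ) j, outt m w j t = w j (1 - x0 j) t := fun w j => by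
      simp only [outt, hx0]; split_ifs <;> simp
    simp only [e1, e2, ybc j t, geq j 0 t ht, mul_add, Finset.sum_add_distrib]
    ring
  · intro j x hx
    simp only [(hΦs j x hx).1, y0 j x hx s le_rfl, add_zero]

end D5



section E1

lemma BK1.mono {C D : ℝ} {f fx ft : ℝ → ℝ → ℝ} (h : BK1 C f fx ft) (hCD : C ≤ D) : BK1 D f fx ft :=
  ⟨h.c1, fun x hx t => (h.b0 x hx t).trans hCD, fun x hx t => (h.bx x hx t).trans hCD,
    fun x hx t => (h.bt x hx t).trans hCD⟩

lemma BK1.zero {C : ℝ} (hC : 0 ≤ C) : BK1 C (fun _ _ => 0) (fun _ _ => 0) (fun _ _ => 0) :=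
  ⟨fun s => C1S.const 0, fun _ _ _ => by simpa, fun _ _ _ => by simpa, fun _ _ _ => by simpa⟩

lemma BK1.sub {C D : ℝ} {f fx ft g gx gt : ℝ → ℝ → ℝ} (hf : BK1 C f fx ft) (hg : BK1 D g gx gt) :
    BK1 (C + D) (fun x t => f x t - g x t) (fun x t => fx x t - gx x t) (fun x t => ft x t - gt x t) :=
  ⟨fun s => (hf.c1 s).sub (hg.c1 s),
    fun x hx t => (abs_sub _ _).trans (add_le_add (hf.b0 x hx t) (hg.b0 x hx t)),
    fun x hx t => (abs_sub _ _).trans (add_le_add (hf.bx x hx t) (hg.bx x hx t)),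
    fun x hx t => (abs_sub _ _).trans (add_le_add (hf.bt x hx t) (hg.bt x hx t))⟩

lemma BK1.add {C D : ℝ} {f fx ft g gx gt : ℝ → ℝ → ℝ} (hf : BK1 C f fx ft) (hg : BK1 D g gx gt) :
    BK1 (C + D) (fun x t => f x t + g x t) (fun x t => fx x t + gx x t) (fun x t => ft x t + gt x t) :=
  ⟨fun s => (hf.c1 s).add (hg.c1 s),
    fun x hx t => (abs_add_le _ _).trans (add_le_add (hf.b0 x hx t) (hg.b0 x hx t)),
    fun x hx t => (abs_add_le _ _).trans (add_le_add (hf.bx x hx t) (hg.bx x hx t)),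
    fun x hx t => (abs_add_le _ _).trans (add_le_add (hf.bt x hx t) (hg.bt x hx t))⟩

lemma mul_bd {u v C D : ℝ} (hu : |u| ≤ C) (hv : |v| ≤ D) : |u * v| ≤ C * D := by
  rw [abs_mul]; exact mul_le_mul hu hv (abs_nonneg _) ((abs_nonneg _).trans hu)

lemma BK1.mul {C D : ℝ} (hC : 0 ≤ C) (hD : 0 ≤ D) {f fx ft g gx gt : ℝ → ℝ → ℝ} (hf : BK1 C f fx ft)
    (hg : BK1 D g gx gt) :
    BK1 (2 * (C * D)) (fun x t => f x t * g x t) (fun x t => fx x t * g x t + f x t * gx x t)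
      (fun x t => ft x t * g x t + f x t * gt x t) := by
  have h0 : 0 ≤ C * D := by positivity
  refine ⟨fun s => (hf.c1 s).mul (hg.c1 s), fun x hx t => ?_, fun x hx t => ?_, fun x hx t => ?_⟩
  · have := mul_bd (hf.b0 x hx t) (hg.b0 x hx t); linarith
  · have := mul_bd (hf.bx x hx t) (hg.b0 x hx t)
    have := mul_bd (hf.b0 x hx t) (hg.bx x hx t)
    have := abs_add_le (fx x t * g x t) (f x t * gx x t)
    linarith
  · have := mul_bd (hf.bt x hx t) (hg.b0 x hx t)
    have := mul_bd (hf.b0 x hx t) (hg.bt x hx t)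
    have := abs_add_le (ft x t * g x t) (f x t * gt x t)
    linarith

lemma C1S.inv {s : ℝ} {f fx ft : ℝ → ℝ → ℝ} (hf : C1S s f fx ft)
    (h : ∀ x ∈ Icc (0:ℝ) 1, ∀ t, s ≤ t → f x t ≠ 0) :
    C1S s (fun x t => (f x t)⁻¹) (fun x t => -fx x t * ((f x t)⁻¹ * (f x t)⁻¹))
      (fun x t => -ft x t * ((f x t)⁻¹ * (f x t)⁻¹)) := by
  have hi : CS s (fun x t => (f x t)⁻¹) := ContinuousOn.inv₀ hf.c0 fun q hq => h q.1 hq.1 q.2 hq.2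
  refine ⟨hi, hf.cx.neg.mul (hi.mul hi), hf.ct.neg.mul (hi.mul hi), fun x hx t ht => ?_, fun x hx t ht => ?_⟩
  · refine ((hf.dx x hx t ht).fun_inv (h x hx t ht)).congr_deriv ?_
    have := h x hx t ht
    field_simp
  · refine ((hf.dt x hx t ht).fun_inv (h x hx t ht)).congr_deriv ?_
    have := h x hx t ht
    field_simp

lemma BK1.inv {C Λ : ℝ} (hΛ : 0 < Λ) (hC : 0 ≤ C) {f fx ft : ℝ → ℝ → ℝ} (hf : BK1 C f fx ft)
    (h : ∀ x ∈ Icc (0:ℝ) 1, ∀ t, Λ ≤ |f x t|) :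
    BK1 (Λ⁻¹ + C * (Λ⁻¹ * Λ⁻¹)) (fun x t => (f x t)⁻¹) (fun x t => -fx x t * ((f x t)⁻¹ * (f x t)⁻¹))
      (fun x t => -ft x t * ((f x t)⁻¹ * (f x t)⁻¹)) := by
  have hne : ∀ x ∈ Icc (0:ℝ) 1, ∀ t, f x t ≠ 0 := fun x hx t h0 => by
    have := h x hx t; rw [h0, abs_zero] at this; linarith
  have hb : ∀ x ∈ Icc (0:ℝ) 1, ∀ t, |(f x t)⁻¹| ≤ Λ⁻¹ := fun x hx t => by
    rw [abs_inv]; exact inv_anti₀ hΛ (h x hx t)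
  have p1 : 0 < Λ⁻¹ := by positivity
  have p2 : 0 ≤ C * (Λ⁻¹ * Λ⁻¹) := by positivity
  refine ⟨fun s => (hf.c1 s).inv fun x hx t _ => hne x hx t, fun x hx t => ?_, fun x hx t => ?_, fun x hx t => ?_⟩
  · have := hb x hx t; linarith
  · have := mul_bd (u := - fx x t) (C := C) (by rw [abs_neg]; exact hf.bx x hx t) (mul_bd (hb x hx t) (hb x hx t)); linarith
  · have := mul_bd (u := - ft x t) (C := C) (by rw [abs_neg]; exact hf.bt x hx t) (mul_bd (hb x hx t) (hb x hx t)); linarith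

/-- coefficient class -/
structure Cls {n : ℕ} (m : ℕ) (Λ A : ℝ) (a ax aT : Fin n → ℝ → ℝ → ℝ)
    (b bx bT : Fin n → Fin n → ℝ → ℝ → ℝ) : Prop where
  ac : ACof m Λ A a ax aT
  sep : ∀ j k, j ≠ k → ∀ x ∈ Icc (0:ℝ) 1, ∀ t, Λ ≤ |a j x t - a k x t|
  bk : ∀ j k, BK1 A (b j k) (bx j k) (bT j k)

def dgl {n : ℕ} (b : Fin n → Fin n → ℝ → ℝ → ℝ) (j k : Fin n) (x t : ℝ) : ℝ := if j = k then b j k x t else 0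
def off {n : ℕ} (b : Fin n → Fin n → ℝ → ℝ → ℝ) (j k : Fin n) (x t : ℝ) : ℝ := if j = k then 0 else b j k x t
def Qf {n : ℕ} (a : Fin n → ℝ → ℝ → ℝ) (b : Fin n → Fin n → ℝ → ℝ → ℝ) (j k : Fin n) (x t : ℝ) : ℝ :=
  if j = k then 0 else b j k x t * (a k x t * (a k x t - a j x t)⁻¹)

lemma Cls.off_bk {n m : ℕ} {Λ A : ℝ} (hA : 0 ≤ A) {a ax aT : Fin n → ℝ → ℝ → ℝ}
    {b bx bT : Fin n → Fin n → ℝ → ℝ → ℝ} (h : Cls m Λ A a ax aT b bx bT) (j k : Fin n) :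
    BK1 A (off b j k) (off bx j k) (off bT j k) := by
  unfold off
  by_cases hjk : j = k
  · simp only [hjk, if_true]; exact BK1.zero hA
  · simp only [hjk, if_false]; exact h.bk j k

lemma Cls.dgl_bk {n m : ℕ} {Λ A : ℝ} (hA : 0 ≤ A) {a ax aT : Fin n → ℝ → ℝ → ℝ}
    {b bx bT : Fin n → Fin n → ℝ → ℝ → ℝ} (h : Cls m Λ A a ax aT b bx bT) (j k : Fin n) :
    BK1 A (dgl b j k) (dgl bx j k) (dgl bT j k) := by
  unfold dgl
  by_cases hjk : j = k
  · simp only [hjk, if_true]; exact h.bk k k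
  · simp only [hjk, if_false]; exact BK1.zero hA

lemma Q_exists {Λ A : ℝ} (hΛ : 0 < Λ) (hA : 0 ≤ A) : ∃ C, 0 ≤ C ∧ ∀ {n m : ℕ} (a ax aT : Fin n → ℝ → ℝ → ℝ)
    (b bx bT : Fin n → Fin n → ℝ → ℝ → ℝ), Cls m Λ A a ax aT b bx bT → 
    ∃ Qx QT : Fin n → Fin n → ℝ → ℝ → ℝ, ∀ j k, BK1 C (Qf a b j k) (Qx j k) (QT j k) := by
  set C1 : ℝ := Λ⁻¹ + (A + A) * (Λ⁻¹ * Λ⁻¹) with hC1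
  have h1 : 0 ≤ C1 := by positivity
  refine ⟨2 * (A * (2 * (A * C1))), by positivity, ?_⟩
  intro n m a ax aT b bx bT h
  have : ∀ j k, ∃ Qx QT : ℝ → ℝ → ℝ, BK1 (2 * (A * (2 * (A * C1)))) (Qf a b j k) Qx QT := by
    intro j k
    unfold Qf
    by_cases hjk : j = k
    · simp only [hjk, if_true]; exact ⟨_, _, BK1.zero (by positivity)⟩
    · simp only [hjk, if_false]
      exact ⟨_, _, (h.bk j k).mul hA (by positivity) ((h.ac.bk k).mul hA h1
        (((h.ac.bk k).sub (h.ac.bk j)).inv hΛ (by positivity) (h.sep k j (Ne.symm hjk))))⟩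
  choose Qx QT hQ using this
  exact ⟨Qx, QT, hQ⟩

/-- forward difference quotient -/
def dlt (h : ℝ) (y : ℝ → ℝ → ℝ) (x t : ℝ) : ℝ := h⁻¹ * (y x (t + h) - y x t)

lemma CS.dlt {s h : ℝ} {y : ℝ → ℝ → ℝ} (hy : CS s y) (hh : 0 ≤ h) : CS s (dlt h y) :=
  (CS.const h⁻¹).mul ((hy.shift hh).sub hy)
lemma C1S.dlt {s h : ℝ} {y yx yt : ℝ → ℝ → ℝ} (hy : C1S s y yx yt) (hh : 0 ≤ h) :
    C1S s (dlt h y) (_root_.dlt h yx) (_root_.dlt h yt) := by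
  refine ((C1S.const h⁻¹).mul ((hy.shift hh).sub hy)).congr (fun _ _ _ _ => rfl) ?_ ?_
  · intro x hx t ht; simp [_root_.dlt]
  · intro x hx t ht; simp [_root_.dlt]

lemma shift_unif {s : ℝ} {y : ℝ → ℝ → ℝ} (hy : CS s y) (T : ℝ) {ε : ℝ} (hε : 0 < ε) :
    ∃ h0, 0 < h0 ∧ h0 ≤ 1 ∧ ∀ h, 0 ≤ h → h ≤ h0 → ∀ x ∈ Icc (0:ℝ) 1, ∀ t ∈ Icc s (s+T),
      |y x (t + h) - y x t| ≤ ε := by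
  have hc : IsCompact (Icc (0:ℝ) 1 ×ˢ Icc s (s+T+1)) := isCompact_Icc.prod isCompact_Icc
  have hu := hc.uniformContinuousOn_of_continuous
    (ContinuousOn.mono hy (prod_mono le_rfl Icc_subset_Ici_self))
  rw [Metric.uniformContinuousOn_iff] at hu
  obtain ⟨d, hd, hu⟩ := hu ε hε
  refine ⟨min 1 (d/2), by positivity, min_le_left _ _, fun h hh0 hh x hx t ht => ?_⟩
  have h1 : h ≤ 1 := hh.trans (min_le_left _ _)
  have h2 : h ≤ d/2 := hh.trans (min_le_right _ _)
  have := hu (x, t+h) ⟨hx, by show s ≤ t + h; linarith [ht.1], by show t + h ≤ _; linarith [ht.2]⟩ (x, t)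
    ⟨hx, ht.1, by show t ≤ _; linarith [ht.2]⟩ (by
      rw [Prod.dist_eq]; simp [Real.dist_eq, abs_of_nonneg hh0]; exact ⟨hd, by linarith⟩)
  rw [Real.dist_eq] at this
  exact this.le

lemma dlt_unif {s : ℝ} {y yx yt : ℝ → ℝ → ℝ} (hy : C1S s y yx yt) (T : ℝ) {ε : ℝ} (hε : 0 < ε) :
    ∃ h0, 0 < h0 ∧ h0 ≤ 1 ∧ ∀ h, 0 < h → h ≤ h0 → ∀ x ∈ Icc (0:ℝ) 1, ∀ t ∈ Icc s (s+T),
      |dlt h y x t - yt x t| ≤ ε := by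
  obtain ⟨h0, hp, h01, hu⟩ := shift_unif hy.ct T hε
  refine ⟨h0, hp, h01, fun h hh0 hh x hx t ht => ?_⟩
  have key := Convex.norm_image_sub_le_of_norm_hasDerivWithin_le (s := Icc t (t+h)) (x := t) (y := t + h)
    (f := fun τ => y x τ - τ * yt x t) (f' := fun τ => yt x τ - 1 * yt x t) (C := ε)
    (fun τ hτ => (((hy.dt x hx τ (ht.1.trans hτ.1)).mono
      (fun z hz => ht.1.trans hz.1)).sub ((hasDerivWithinAt_id τ _).mul_const _)))
    (fun τ hτ => by
      have := hu (τ - t) (by linarith [hτ.1]) (by linarith [hτ.2]) x hx t ht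
      simpa using this)
    (convex_Icc _ _) (by simp [hh0.le]) (by simp [hh0.le])
  simp only [add_sub_cancel_left, Real.norm_eq_abs, abs_of_pos hh0] at key
  have e : dlt h y x t - yt x t = h⁻¹ * (y x (t+h) - (t+h) * yt x t - (y x t - t * yt x t)) := by
    unfold dlt; field_simp; ring
  rw [e, abs_mul, abs_of_pos (inv_pos.mpr hh0)]
  calc _ ≤ h⁻¹ * (ε * h) := mul_le_mul_of_nonneg_left key (by positivity)
    _ = ε := by field_simp

def SS {n : ℕ} (y : Fin n → ℝ → ℝ → ℝ) (x t : ℝ) : ℝ := ∑ k, y k x t ^ 2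
lemma SS_nonneg {n : ℕ} (y : Fin n → ℝ → ℝ → ℝ) (x t : ℝ) : 0 ≤ SS y x t := Finset.sum_nonneg fun _ _ => sq_nonneg _
lemma SS_single {n : ℕ} (y : Fin n → ℝ → ℝ → ℝ) (j : Fin n) (x t : ℝ) : y j x t ^2 ≤ SS y x t :=
  Finset.single_le_sum (f := fun k => y k x t ^2) (fun _ _ => sq_nonneg _) (Finset.mem_univ j)
lemma SS_cs {n : ℕ} {s : ℝ} {y : Fin n → ℝ → ℝ → ℝ} (hy : ∀ j, CS s (y j)) : CS s (SS y) :=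
  CS.sum fun k _ => (hy k).pow 2

lemma Nrm_eq {n : ℕ} {s : ℝ} {y : Fin n → ℝ → ℝ → ℝ} (hy : ∀ j, CS s (y j)) {t : ℝ} (ht : s ≤ t) :
    Nrm y t = ∫ x in (0:ℝ)..1, SS y x t := by
  unfold Nrm SS
  rw [intervalIntegral.integral_finsetSum]
  exact fun k _ => ((hy k).pow 2).integrable ht

lemma lin_sq {n : ℕ} {c y : Fin n → ℝ} {C : ℝ} (hc : ∀ k, |c k| ≤ C) :
    (∑ k, c k * y k)^2 ≤ n * C^2 * ∑ k, y k^2 := by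
  refine (Finset.sum_mul_sq_le_sq_mul_sq _ _ _).trans ?_
  refine mul_le_mul_of_nonneg_right ?_ (Finset.sum_nonneg fun _ _ => sq_nonneg _)
  calc ∑ k, c k^2 ≤ ∑ k : Fin n, C^2 := Finset.sum_le_sum fun k _ => by
        rw [← sq_abs]; exact pow_le_pow_left₀ (abs_nonneg _) (hc k) 2
    _ = n * C^2 := by simp

lemma Nrm_le3 {n : ℕ} {s : ℝ} {r y1 y2 y3 : Fin n → ℝ → ℝ → ℝ} (hr : ∀ j, CS s (r j))
    (h1 : ∀ j, CS s (y1 j)) (h2 : ∀ j, CS s (y2 j)) (h3 : ∀ j, CS s (y3 j)) {t C e : ℝ} (ht : s ≤ t)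
    (h : ∀ j, ∀ x ∈ Icc (0:ℝ) 1, r j x t ^2 ≤ C * (SS y1 x t + SS y2 x t + SS y3 x t + e)) :
    Nrm r t ≤ n * C * (Nrm y1 t + Nrm y2 t + Nrm y3 t + e) := by
  rw [Nrm_eq hr ht, Nrm_eq h1 ht, Nrm_eq h2 ht, Nrm_eq h3 ht]
  have i1 := (SS_cs h1).integrable ht
  have i2 := (SS_cs h2).integrable ht
  have i3 := (SS_cs h3).integrable ht
  have e1 : n * C * ((∫ x in (0:ℝ)..1, SS y1 x t) + (∫ x in (0:ℝ)..1, SS y2 x t) + (∫ x in (0:ℝ)..1, SS y3 x t) + e) =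
      ∫ x in (0:ℝ)..1, n * C * (SS y1 x t + SS y2 x t + SS y3 x t + e) := by
    rw [intervalIntegral.integral_const_mul, intervalIntegral.integral_add ((i1.add i2).add i3) (by simp),
      intervalIntegral.integral_add (i1.add i2) i3, intervalIntegral.integral_add i1 i2]
    simp
  rw [e1]
  refine intervalIntegral.integral_mono_on zero_le_one ((SS_cs hr).integrable ht)
    ((((i1.add i2).add i3).add (by simp)).const_mul _) fun x hx => ?_
  calc SS r x t ≤ ∑ k : Fin n, C * (SS y1 x t + SS y2 x t + SS y3 x t + e) :=
        Finset.sum_le_sum fun k _ => h k x hx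
    _ = _ := by simp; ring

end E1



section E2

lemma dlt_ev {s : ℝ} {y yx yt : ℝ → ℝ → ℝ} (hy : C1S s y yx yt) (T : ℝ) {ε : ℝ} (hε : 0 < ε) :
    ∀ᶠ h in nhdsWithin (0:ℝ) (Ioi 0), ∀ x ∈ Icc (0:ℝ) 1, ∀ t ∈ Icc s (s+T), |dlt h y x t - yt x t| ≤ ε := by
  obtain ⟨h0, hp, _, hu⟩ := dlt_unif hy T hε
  filter_upwards [Ioc_mem_nhdsGT hp] with h hh
  exact hu h hh.1 hh.2

lemma shift_ev {s : ℝ} {y : ℝ → ℝ → ℝ} (hy : CS s y) (T : ℝ) {ε : ℝ} (hε : 0 < ε) :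
    ∀ᶠ h in nhdsWithin (0:ℝ) (Ioi 0), ∀ x ∈ Icc (0:ℝ) 1, ∀ t ∈ Icc s (s+T), |y x (t + h) - y x t| ≤ ε := by
  obtain ⟨h0, hp, _, hu⟩ := shift_unif hy T hε
  filter_upwards [Ioc_mem_nhdsGT hp] with h hh
  exact hu h hh.1.le hh.2

lemma Nrm_zero {n : ℕ} (t : ℝ) : Nrm (fun (_ : Fin n) _ _ => (0:ℝ)) t = 0 := by simp [Nrm]
lemma SS_zero {n : ℕ} (x t : ℝ) : SS (fun (_ : Fin n) _ _ => (0:ℝ)) x t = 0 := by simp [SS]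

lemma int_le_const {s t T c : ℝ} {f : ℝ → ℝ} (hf : ContinuousOn f (Ici s)) (ht : t ∈ Icc s (s+T)) (hc : 0 ≤ c)
    (h : ∀ τ ∈ Icc s t, f τ ≤ c) : ∫ τ in s..t, f τ ≤ T * c := by
  calc ∫ τ in s..t, f τ ≤ ∫ τ in s..t, c := intervalIntegral.integral_mono_on ht.1
        ((hf.mono (by rw [uIcc_of_le ht.1]; exact Icc_subset_Ici_self)).intervalIntegrable)
        (by simp) h
    _ = (t - s) * c := by simp
    _ ≤ T * c := mul_le_mul_of_nonneg_right (by linarith [ht.2]) hc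

/-- basic bounds on the diagonal part and the remainder -/
lemma basic_bounds (n m : ℕ) {Λ A P T : ℝ} (hΛ : 0 < Λ) (hA : 0 ≤ A) (hP : 0 ≤ P) (hT : 0 ≤ T) :
    ∃ K, 1 ≤ K ∧ ∀ (a ax aT : Fin n → ℝ → ℝ → ℝ) (b bx bT : Fin n → Fin n → ℝ → ℝ → ℝ),
      Cls m Λ A a ax aT b bx bT → ∀ p : Fin n → Fin n → ℝ, (∀ j k, |p j k| ≤ P) →
      ∀ (s : ℝ) (σ σx σt ω ωx ωt : Fin n → ℝ → ℝ → ℝ),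
      Sol m p a (dgl b) (fun _ _ _ => 0) s σ σx σt →
      Sol m p a b (fun j x t => -∑ k, off b j k x t * σ k x t) s ω ωx ωt →
      ∀ t ∈ Icc s (s+T), Nrm σ t ≤ K * Nrm σ s ∧ (∫ τ in s..t, Otr m σ τ) ≤ K * Nrm σ s ∧
        Nrm ω t ≤ K * (Nrm ω s + Nrm σ s) := by
  obtain ⟨K1, hK1, h1⟩ := EL2 n m hΛ hA hP hA hT
  refine ⟨K1 * (1 + T * (n * (n * A^2) * K1)), ?_, ?_⟩
  · have : 0 ≤ T * (n * (n * A^2) * K1) := by positivity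
    nlinarith
  intro a ax aT b bx bT h p hp s σ σx σt ω ωx ωt hσ hω t ht
  have q0 : 0 ≤ T * (n * (n * A^2) * K1) := by positivity
  have hN := Nrm_nonneg σ s
  have hNω := Nrm_nonneg ω s
  have bnd : ∀ τ ∈ Icc s (s+T), Nrm σ τ + ∫ τ in s..τ, Otr m σ τ ≤ K1 * Nrm σ s := by
    intro τ hτ
    have := h1 a ax aT h.ac p hp s (dgl b) (fun j k => ((h.dgl_bk hA j k).c1 s).c0)
      (fun j k x hx t _ => (h.dgl_bk hA j k).b0 x hx t) _ (fun _ => CS.const 0) σ σx σt hσ τ hτ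
    simpa [Nrm_zero] using this
  have hO : ∀ τ ∈ Icc s (s+T), 0 ≤ ∫ τ in s..τ, Otr m σ τ := fun τ hτ =>
    intervalIntegral.integral_nonneg hτ.1 fun _ _ => Otr_nonneg _ _ _
  have hle : K1 * Nrm σ s ≤ K1 * (1 + T * (n * (n * A^2) * K1)) * Nrm σ s := by
    have : 0 ≤ K1 * (T * (n * (n * A^2) * K1)) * Nrm σ s := by positivity
    nlinarith
  refine ⟨by linarith [bnd t ht, hO t ht], by linarith [bnd t ht, Nrm_nonneg σ t], ?_⟩
  have fc : ∀ j, CS s (fun x t => -∑ k, off b j k x t * σ k x t) := fun j =>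
    (CS.sum fun k _ => ((h.off_bk hA j k).c1 s).c0.mul (hσ.c1 k).c0).neg
  have h2 := h1 a ax aT h.ac p hp s b (fun j k => ((h.bk j k).c1 s).c0)
      (fun j k x hx t _ => (h.bk j k).b0 x hx t) _ fc ω ωx ωt hω t ht
  have hOω : 0 ≤ ∫ τ in s..t, Otr m ω τ :=
    intervalIntegral.integral_nonneg ht.1 fun _ _ => Otr_nonneg _ _ _
  have h3 : ∫ τ in s..t, Nrm (fun j x t => -∑ k, off b j k x t * σ k x t) τ ≤
      T * (n * (n * A^2) * (K1 * Nrm σ s)) := by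
    refine int_le_const (Nrm_cont fc) ht (by positivity) fun τ hτ => ?_
    have hτ' : τ ∈ Icc s (s+T) := ⟨hτ.1, hτ.2.trans ht.2⟩
    have h4 := Nrm_le3 (C := n * A^2) (e := 0) fc (fun j => (hσ.c1 j).c0) (fun _ => CS.const 0) (fun _ => CS.const 0) hτ.1
      (fun j x hx => by
        simp only [SS_zero, add_zero, neg_sq]
        exact lin_sq fun k => (h.off_bk hA j k).b0 x hx τ)
    simp only [Nrm_zero, add_zero] at h4
    refine h4.trans (mul_le_mul_of_nonneg_left ?_ (by positivity))
    linarith [bnd τ hτ', hO τ hτ']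
  have h5 : Nrm ω t ≤ K1 * (Nrm ω s + T * (n * (n * A^2) * (K1 * Nrm σ s))) := by
    have : K1 * (Nrm ω s + ∫ τ in s..t, Nrm (fun j x t => -∑ k, off b j k x t * σ k x t) τ) ≤
      K1 * (Nrm ω s + T * (n * (n * A^2) * (K1 * Nrm σ s))) := by gcongr
    linarith
  refine h5.trans ?_
  have e1 : 0 ≤ K1 * Nrm σ s := by positivity
  have e2 : 0 ≤ K1 * (T * (n * (n * A^2) * K1)) * Nrm ω s := by positivity
  nlinarith

/-- values of a solution at the end points are controlled by outgoing traces -/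
lemma end_bound {n m : ℕ} {P : ℝ} {p : Fin n → Fin n → ℝ} (hp : ∀ j k, |p j k| ≤ P) {σ : Fin n → ℝ → ℝ → ℝ} {t : ℝ}
    (bc : ∀ j, inn m σ j t = ∑ k, p j k * outt m σ k t) {x : ℝ} (hx : x = 0 ∨ x = 1) :
    SS σ x t ≤ n * (1 + n * P^2) * Otr m σ t := by
  have hO := Otr_nonneg m σ t
  have h1 : ∀ j, outt m σ j t ^2 ≤ Otr m σ t := fun j =>
    Finset.single_le_sum (f := fun k => outt m σ k t ^2) (fun _ _ => sq_nonneg _) (Finset.mem_univ j)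
  have h2 : ∀ j, inn m σ j t ^2 ≤ n * P^2 * Otr m σ t := fun j => by
    rw [bc j]; exact lin_sq (hp j)
  have h3 : ∀ j, σ j x t ^2 ≤ (1 + n * P^2) * Otr m σ t := by
    intro j
    have e : σ j x t = outt m σ j t ∨ σ j x t = inn m σ j t := by
      unfold outt inn
      rcases hx with rfl | rfl <;> by_cases hj : (j : ℕ) < m <;> simp [hj]
    have p1 : 0 ≤ n * P^2 * Otr m σ t := by positivity
    rcases e with e | e <;> rw [e]
    · have := h1 j; linarith
    · have := h2 j; linarith
  calc SS σ x t ≤ ∑ j : Fin n, (1 + n * P^2) * Otr m σ t := Finset.sum_le_sum fun j _ => h3 j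
    _ = _ := by simp; ring

lemma sq6 (a b c d e f : ℝ) : (a+b+c+d+e+f)^2 ≤ 6*(a^2+b^2+c^2+d^2+e^2+f^2) := by
  nlinarith [sq_nonneg (a-b), sq_nonneg (a-c), sq_nonneg (a-d), sq_nonneg (a-e), sq_nonneg (a-f),
    sq_nonneg (b-c), sq_nonneg (b-d), sq_nonneg (b-e), sq_nonneg (b-f), sq_nonneg (c-d), sq_nonneg (c-e),
    sq_nonneg (c-f), sq_nonneg (d-e), sq_nonneg (d-f), sq_nonneg (e-f)]

lemma fin6 {c1 c2 c3 S1 S2 S3 X1 X2 X3 X4 X5 X6 : ℝ} (g1 : 0 ≤ c1) (g2 : 0 ≤ c2) (g3 : 0 ≤ c3)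
    (p1 : 0 ≤ S1) (p2 : 0 ≤ S2) (p3 : 0 ≤ S3) (b1 : X1 ≤ c1 * S1) (b2 : X2 ≤ c1 * c2 * S2) (b3 : X3 ≤ c1 * c2 * S3)
    (b4 : X4 ≤ c2 * S2) (b5 : X5 ≤ c2 * S1) (b6 : X6 ≤ c3 * S3) :
    6 * (X1+X2+X3+X4+X5+X6) ≤ 6 * (c1 + c2 + c1 * c2 + c3) * (S1+S2+S3) := by
  have g4 : 0 ≤ c1 * c2 := by positivity
  have e : (c1 + c2 + c1 * c2 + c3) * (S1+S2+S3) = c1*S1+c1*S2+c1*S3+c2*S1+c2*S2+c2*S3+c1*c2*S1+c1*c2*S2+c1*c2*S3+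
    c3*S1+c3*S2+c3*S3 := by ring
  rw [mul_assoc, e]
  linarith [mul_nonneg g1 p1, mul_nonneg g1 p2, mul_nonneg g1 p3, mul_nonneg g2 p1, mul_nonneg g2 p2, mul_nonneg g2 p3,
    mul_nonneg g3 p1, mul_nonneg g3 p2, mul_nonneg g3 p3, mul_nonneg g4 p1, mul_nonneg g4 p2, mul_nonneg g4 p3]

set_option maxHeartbeats 1600000 in
/-- the pointwise bound of the limit residual -/
lemma resid_bound {n : ℕ} {Λ A CQ : ℝ} (hΛ : 0 < Λ) (hA : 0 ≤ A) (hQ : 0 ≤ CQ) (j : Fin n)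
    {a aT : Fin n → ℝ} {b bT QT Qx : Fin n → Fin n → ℝ} {σ σx σt ω ωx ωt : Fin n → ℝ}
    (ha : ∀ k, |a k| ≤ A) (haT : ∀ k, |aT k| ≤ A) (haΛ : ∀ k, Λ ≤ |a k|) (hsep : ∀ j k, j ≠ k → Λ ≤ |a j - a k|)
    (hb : ∀ j k, |b j k| ≤ A) (hbT : ∀ j k, |bT j k| ≤ A)
    {Q o oT : Fin n → Fin n → ℝ} (hQd : ∀ j k, Q j k = if j = k then 0 else b j k * (a k * (a k - a j)⁻¹))
    (hod : ∀ j k, o j k = if j = k then 0 else b j k) (hoT : ∀ j k, |oT j k| ≤ A)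
    (hQb : ∀ j k, |Q j k| ≤ CQ) (hQT : ∀ j k, |QT j k| ≤ CQ) (hQx : ∀ j k, |Qx j k| ≤ CQ)
    (eσ : ∀ k, σt k + a k * σx k + b k k * σ k = 0)
    (eω : ωt j + a j * ωx j + ∑ k, b j k * ω k = -∑ k, o j k * σ k) :
    (-(aT j * ωx j) - ∑ k, (bT j k * ω k + b j k * ωt k + (oT j k * σ k + o j k * σt k)) +
      ∑ k, (QT j k * σ k + Q j k * σt k + a j * (Qx j k * σ k + Q j k * σx k)))^2 ≤
    6 * ((A*Λ⁻¹)^2 + n * A^2 + (A*Λ⁻¹)^2 * (n * A^2) + n * (A + CQ + A * CQ + CQ * A * A * Λ⁻¹)^2) *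
      (∑ k, ωt k^2 + ∑ k, ω k^2 + ∑ k, σ k^2) := by
  have hane : ∀ k, a k ≠ 0 := fun k h0 => by have := haΛ k; rw [h0, abs_zero] at this; linarith
  have hia : ∀ k, |(a k)⁻¹| ≤ Λ⁻¹ := fun k => by rw [abs_inv]; exact inv_anti₀ hΛ (haΛ k)
  set th := aT j * (a j)⁻¹ with hth
  have hthb : |th| ≤ A * Λ⁻¹ := mul_bd (haT j) (hia j)
  set γ : Fin n → ℝ := fun k => -oT j k + QT j k + a j * Qx j k - Q j k * a j * b k k * (a k)⁻¹ with hγ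
  have hob : ∀ k, |o j k| ≤ A := fun k => by
    rw [hod]; split_ifs
    · simpa
    · exact hb j k
  have hγb : ∀ k, |γ k| ≤ A + CQ + A * CQ + CQ * A * A * Λ⁻¹ := fun k => by
    have e1 := mul_bd (mul_bd (mul_bd (hQb j k) (ha j)) (hb k k)) (hia k)
    have e2 := mul_bd (ha j) (hQx j k)
    have e3 := hoT j k
    have e4 := hQT j k
    simp only [hγ]
    rw [abs_le] at *
    constructor <;> linarith
  have hk : ∀ k, -(o j k * σt k) + (Q j k * σt k + a j * (Q j k * σx k)) =
      -(Q j k * a j * b k k * (a k)⁻¹ * σ k) := by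
    intro k
    rw [hod, hQd]
    by_cases hjk : j = k
    · simp [hjk]
    · simp only [hjk, if_false]
      have hs : a k - a j ≠ 0 := fun h0 => by
        have := hsep k j (Ne.symm hjk); rw [h0, abs_zero] at this; linarith
      have h1 := hane k
      have e : σx k = -(σt k + b k k * σ k) * (a k)⁻¹ := by
        have := eσ k
        field_simp
        linarith
      rw [e]
      field_simp
      ring
  have hx : -(aT j * ωx j) = th * ωt j + th * (∑ k, b j k * ω k) + th * (∑ k, o j k * σ k) := by
    have h1 := hane j
    have e : ωx j = -(ωt j + (∑ k, b j k * ω k) + ∑ k, o j k * σ k) * (a j)⁻¹ := by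
      field_simp; linarith
    rw [e, hth]; ring
  have main : (-(aT j * ωx j) - ∑ k, (bT j k * ω k + b j k * ωt k + (oT j k * σ k + o j k * σt k)) +
      ∑ k, (QT j k * σ k + Q j k * σt k + a j * (Qx j k * σ k + Q j k * σx k))) =
      th * ωt j + th * (∑ k, b j k * ω k) + th * (∑ k, o j k * σ k) + (-∑ k, bT j k * ω k) +
        (-∑ k, b j k * ωt k) + ∑ k, γ k * σ k := by
    rw [hx]
    have : - ∑ k, (bT j k * ω k + b j k * ωt k + (oT j k * σ k + o j k * σt k)) +
      ∑ k, (QT j k * σ k + Q j k * σt k + a j * (Qx j k * σ k + Q j k * σx k)) =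
      (-∑ k, bT j k * ω k) + (-∑ k, b j k * ωt k) + ∑ k, γ k * σ k := by
      rw [← Finset.sum_neg_distrib, ← Finset.sum_neg_distrib, ← Finset.sum_neg_distrib, ← Finset.sum_add_distrib,
        ← Finset.sum_add_distrib, ← Finset.sum_add_distrib]
      refine Finset.sum_congr rfl fun k _ => ?_
      simp only [hγ]
      linear_combination hk k
    linear_combination this
  rw [main]
  set S1 := ∑ k, ωt k^2 with hS1
  set S2 := ∑ k, ω k^2 with hS2
  set S3 := ∑ k, σ k^2 with hS3
  have p1 : 0 ≤ S1 := Finset.sum_nonneg fun _ _ => sq_nonneg _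
  have p2 : 0 ≤ S2 := Finset.sum_nonneg fun _ _ => sq_nonneg _
  have p3 : 0 ≤ S3 := Finset.sum_nonneg fun _ _ => sq_nonneg _
  have t0 : th^2 ≤ (A*Λ⁻¹)^2 := by rw [← sq_abs]; exact pow_le_pow_left₀ (abs_nonneg _) hthb 2
  have b1 : (th * ωt j)^2 ≤ (A*Λ⁻¹)^2 * S1 := by
    rw [mul_pow]
    exact mul_le_mul t0 (Finset.single_le_sum (f := fun k => ωt k^2) (fun _ _ => sq_nonneg _) (Finset.mem_univ j))
      (sq_nonneg _) (sq_nonneg _)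
  have b2 : (th * (∑ k, b j k * ω k))^2 ≤ (A*Λ⁻¹)^2 * (n * A^2) * S2 := by
    rw [mul_pow, mul_assoc]
    exact mul_le_mul t0 (lin_sq (hb j)) (sq_nonneg _) (sq_nonneg _)
  have b3 : (th * (∑ k, o j k * σ k))^2 ≤ (A*Λ⁻¹)^2 * (n * A^2) * S3 := by
    rw [mul_pow, mul_assoc]
    exact mul_le_mul t0 (lin_sq hob) (sq_nonneg _) (sq_nonneg _)
  have b4 : (-∑ k, bT j k * ω k)^2 ≤ n * A^2 * S2 := by rw [neg_sq]; exact lin_sq (hbT j)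
  have b5 : (-∑ k, b j k * ωt k)^2 ≤ n * A^2 * S1 := by rw [neg_sq]; exact lin_sq (hb j)
  have b6 := lin_sq (y := σ) hγb
  refine (sq6 _ _ _ _ _ _).trans ?_
  exact fin6 (sq_nonneg _) (by positivity) (by positivity) p1 p2 p3 b1 b2 b3 b4 b5 b6

end E2



section E3

set_option maxHeartbeats 1600000 in
lemma diff_ev {s T A : ℝ} (hA : 0 ≤ A) {a ax aT y yx yt F Fx FT : ℝ → ℝ → ℝ} (ha : C1S s a ax aT)
    (haT : ∀ x ∈ Icc (0:ℝ) 1, ∀ t, |aT x t| ≤ A) (hy : C1S s y yx yt) (hF : C1S s F Fx FT)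
    (eq : ∀ x ∈ Icc (0:ℝ) 1, ∀ t, s ≤ t → yt x t + a x t * yx x t = - F x t) {ε : ℝ} (hε : 0 < ε) :
    ∀ᶠ h in nhdsWithin (0:ℝ) (Ioi 0), ∀ x ∈ Icc (0:ℝ) 1, ∀ t ∈ Icc s (s+T), |dlt h y x t - yt x t| ≤ ε ∧
      |dlt h yt x t + a x t * dlt h yx x t - (-(aT x t * yx x t) - FT x t)| ≤ 3 * ε := by
  obtain ⟨W, hW, hWb⟩ := hy.cx.bdd (s+T+1)
  have hε1 : 0 < ε / (W + 1) := by positivity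
  have hε2 : 0 < ε / (A + 1) := by positivity
  filter_upwards [dlt_ev hy T hε, dlt_ev hF T hε, dlt_ev ha T hε1, shift_ev hy.cx T hε2,
    Ioc_mem_nhdsGT (zero_lt_one (α := ℝ))] with h h1 h2 h3 h4 hh x hx t ht
  refine ⟨h1 x hx t ht, ?_⟩
  have hh0 : h ≠ 0 := hh.1.ne'
  have e1 := eq x hx t ht.1
  have e2 := eq x hx (t+h) (by linarith [ht.1, hh.1])
  have key : dlt h yt x t + a x t * dlt h yx x t - (-(aT x t * yx x t) - FT x t) =
      -((dlt h a x t - aT x t) * yx x (t+h)) - aT x t * (yx x (t+h) - yx x t) - (dlt h F x t - FT x t) := by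
    have f1 : yt x t = - F x t - a x t * yx x t := by linarith
    have f2 : yt x (t+h) = - F x (t+h) - a x (t+h) * yx x (t+h) := by linarith
    simp only [dlt, f1, f2]
    ring
  rw [key]
  have w1 : |(dlt h a x t - aT x t) * yx x (t+h)| ≤ ε / (W+1) * W :=
    mul_bd (h3 x hx t ht) (hWb x hx (t+h) ⟨by linarith [ht.1, hh.1], by linarith [ht.2, hh.2]⟩)
  have w2 : |aT x t * (yx x (t+h) - yx x t)| ≤ A * (ε / (A+1)) := mul_bd (haT x hx t) (h4 x hx t ht)
  have w3 := h2 x hx t ht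
  have v1 : ε / (W+1) * W ≤ ε := by
    rw [div_mul_eq_mul_div, div_le_iff₀ (by positivity)]; nlinarith
  have v2 : A * (ε / (A+1)) ≤ ε := by
    rw [mul_div_assoc', div_le_iff₀ (by positivity)]; nlinarith
  rw [abs_le] at *
  constructor <;> linarith

lemma sq_split {R e v : ℝ} (ε : ℝ) (h : |v - R| ≤ 3 * ε) : v^2 ≤ 2 * R^2 + 18 * ε^2 := by
  have : (v-R)^2 ≤ (3*ε)^2 := by rw [← sq_abs]; exact pow_le_pow_left₀ (abs_nonneg _) h 2
  nlinarith [sq_nonneg (v - 2*R)]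

lemma Qs_sq {n : ℕ} {CQ : ℝ} {Q : Fin n → Fin n → ℝ} (hQ : ∀ j k, |Q j k| ≤ CQ) (σ : Fin n → ℝ) :
    ∑ j, (∑ k, Q j k * σ k)^2 ≤ n * (n * CQ^2) * ∑ k, σ k^2 := by
  calc ∑ j, (∑ k, Q j k * σ k)^2 ≤ ∑ j : Fin n, n * CQ^2 * ∑ k, σ k^2 := Finset.sum_le_sum fun j _ => lin_sq (hQ j)
    _ = _ := by simp; ring

lemma sum_recover {n : ℕ} {CQ ε : ℝ} {Q : Fin n → Fin n → ℝ} (hQ : ∀ j k, |Q j k| ≤ CQ) (σ d y : Fin n → ℝ)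
    (h : ∀ k, |d k - y k| ≤ ε) :
    ∑ j, y j^2 ≤ 3 * (∑ j, (d j + ∑ k, Q j k * σ k)^2 + n * (n * CQ^2) * ∑ k, σ k^2 + n * ε^2) := by
  have h1 := Qs_sq hQ σ
  have h2 : ∀ j, y j^2 ≤ 3 * ((d j + ∑ k, Q j k * σ k)^2 + (∑ k, Q j k * σ k)^2 + ε^2) := by
    intro j
    have : (d j - y j)^2 ≤ ε^2 := by rw [← sq_abs]; exact pow_le_pow_left₀ (abs_nonneg _) (h j) 2
    set q := ∑ k, Q j k * σ k
    set z := d j + q with hz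
    have e : d j = z - q := by rw [hz]; ring
    have : (z - q - y j)^2 ≤ ε^2 := by rw [← e]; exact this
    nlinarith [sq_nonneg (z + q), sq_nonneg (z + (z - q - y j)), sq_nonneg (q - (z - q - y j))]
  calc ∑ j, y j^2 ≤ ∑ j, 3 * ((d j + ∑ k, Q j k * σ k)^2 + (∑ k, Q j k * σ k)^2 + ε^2) := Finset.sum_le_sum fun j _ => h2 j
    _ = 3 * (∑ j, (d j + ∑ k, Q j k * σ k)^2 + ∑ j, (∑ k, Q j k * σ k)^2 + n * ε^2) := by
        rw [← Finset.mul_sum, Finset.sum_add_distrib, Finset.sum_add_distrib]; simp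
    _ ≤ _ := by linarith

lemma comb2 {C1 c S Sz Sω Sσ e v2 R2 N : ℝ} (hC : 0 ≤ C1) (hc : 0 ≤ c) (hN : 0 ≤ N) (hSz : 0 ≤ Sz) (hω : 0 ≤ Sω) (hσ : 0 ≤ Sσ)
    (he : 0 ≤ e) (h1 : v2 ≤ 2 * R2 + 18 * e) (h2 : R2 ≤ C1 * (S + Sω + Sσ)) (h3 : S ≤ 3 * (Sz + c * Sσ + N * e)) :
    v2 ≤ (2 * C1 * (4 + 3 * c + 3 * N) + 18) * (Sz + Sω + Sσ + e) := by
  have h4 : C1 * (S + Sω + Sσ) ≤ C1 * (3 * (Sz + c * Sσ + N * e) + Sω + Sσ) := by gcongr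
  have h5 : 3 * (Sz + c * Sσ + N * e) + Sω + Sσ ≤ (4 + 3 * c + 3 * N) * (Sz + Sω + Sσ + e) := by
    have := mul_nonneg hc hSz
    have := mul_nonneg hc hω
    have := mul_nonneg hc hσ
    have := mul_nonneg hc he
    have := mul_nonneg hN hSz
    have := mul_nonneg hN hω
    have := mul_nonneg hN hσ
    have := mul_nonneg hN he
    nlinarith
  have h6 := mul_le_mul_of_nonneg_left h5 hC
  nlinarith

/-- boundary estimate for the corrected difference quotient -/
lemma bdry_est {n m : ℕ} {P CQ : ℝ} (hP : 0 ≤ P) {p : Fin n → Fin n → ℝ} (hp : ∀ j k, |p j k| ≤ P)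
    {Q : Fin n → Fin n → ℝ → ℝ → ℝ} {t : ℝ} (hQ : ∀ j k, ∀ x ∈ Icc (0:ℝ) 1, |Q j k x t| ≤ CQ)
    {σ d : Fin n → ℝ → ℝ → ℝ} (bσ : ∀ j, inn m σ j t = ∑ k, p j k * outt m σ k t)
    (bd : ∀ j, inn m d j t = ∑ k, p j k * outt m d k t) :
    ∑ j, (inn m (fun j x t => d j x t + ∑ k, Q j k x t * σ k x t) j t -
      ∑ k, p j k * outt m (fun j x t => d j x t + ∑ k, Q j k x t * σ k x t) k t)^2 ≤
    n * (2 * (n * CQ^2 * (n * (1 + n * P^2))) * (1 + n * P^2 * n)) * Otr m σ t := by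
  set g : Fin n → ℝ → ℝ → ℝ := fun j x t => ∑ k, Q j k x t * σ k x t with hg
  set D := n * CQ^2 * (n * (1 + n * P^2)) with hD
  have hD0 : 0 ≤ D := by positivity
  have hO := Otr_nonneg m σ t
  have gb : ∀ j x, (x = 0 ∨ x = 1) → g j x t^2 ≤ D * Otr m σ t := by
    intro j x hx
    have h1 : g j x t ^2 ≤ n * CQ^2 * SS σ x t := lin_sq fun k => hQ j k x (by rcases hx with rfl | rfl <;> simp)
    have h2 := end_bound hp bσ hx
    calc g j x t ^2 ≤ n * CQ^2 * SS σ x t := h1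
      _ ≤ n * CQ^2 * (n * (1 + n * P^2) * Otr m σ t) := by gcongr
      _ = _ := by rw [hD]; ring
  have gi : ∀ j, inn m g j t^2 ≤ D * Otr m σ t := by
    intro j; unfold inn; split_ifs
    · exact gb j 0 (Or.inl rfl)
    · exact gb j 1 (Or.inr rfl)
  have go : ∀ j, outt m g j t^2 ≤ D * Otr m σ t := by
    intro j; unfold outt; split_ifs
    · exact gb j 1 (Or.inr rfl)
    · exact gb j 0 (Or.inl rfl)
  have ei : ∀ j, inn m (fun j x t => d j x t + g j x t) j t = inn m d j t + inn m g j t := by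
    intro j; unfold inn; split_ifs <;> rfl
  have eo : ∀ j, outt m (fun j x t => d j x t + g j x t) j t = outt m d j t + outt m g j t := by
    intro j; unfold outt; split_ifs <;> rfl
  have hj : ∀ j, (inn m (fun j x t => d j x t + g j x t) j t -
      ∑ k, p j k * outt m (fun j x t => d j x t + g j x t) k t)^2 ≤ 2 * D * (1 + n * P^2 * n) * Otr m σ t := by
    intro j
    rw [ei]
    simp only [eo, mul_add, Finset.sum_add_distrib, bd j]
    have h1 := lin_sq (y := fun k => outt m g k t) (hp j)
    have h2 : ∑ k, outt m g k t^2 ≤ n * (D * Otr m σ t) := by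
      calc ∑ k, outt m g k t^2 ≤ ∑ k : Fin n, D * Otr m σ t := Finset.sum_le_sum fun k _ => go k
        _ = _ := by simp
    have h3 : (∑ k, p j k * outt m g k t)^2 ≤ n * P^2 * (n * (D * Otr m σ t)) := h1.trans (by gcongr)
    have h4 := gi j
    nlinarith [sq_nonneg (inn m g j t + ∑ k, p j k * outt m g k t)]
  calc _ ≤ ∑ j : Fin n, 2 * D * (1 + n * P^2 * n) * Otr m σ t := Finset.sum_le_sum fun j _ => hj j
    _ = _ := by simp; ring

end E3



section E4

/-- the corrected time derivative -/
def zet {n : ℕ} (a : Fin n → ℝ → ℝ → ℝ) (b : Fin n → Fin n → ℝ → ℝ → ℝ) (d σ : Fin n → ℝ → ℝ → ℝ) (j : Fin n) (x t : ℝ) : ℝ :=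
  d j x t + ∑ k, Qf a b j k x t * σ k x t

lemma Nrm_close {n : ℕ} {s t ε : ℝ} {y z : Fin n → ℝ → ℝ → ℝ} (hy : ∀ j, CS s (y j)) (hz : ∀ j, CS s (z j)) (ht : s ≤ t)
    (h : ∀ j, ∀ x ∈ Icc (0:ℝ) 1, |z j x t - y j x t| ≤ ε) : Nrm z t ≤ n * 2 * (Nrm y t + ε^2) := by
  have := Nrm_le3 (C := 2) (e := ε^2) hz hy (fun _ => CS.const 0) (fun _ => CS.const 0) ht (fun j x hx => by
    simp only [SS_zero, add_zero]
    have h1 := SS_single y j x t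
    have : (z j x t - y j x t)^2 ≤ ε^2 := by rw [← sq_abs]; exact pow_le_pow_left₀ (abs_nonneg _) (h j x hx) 2
    nlinarith [sq_nonneg (z j x t - 2 * y j x t)])
  simpa [Nrm_zero] using this

lemma arith4 {K Z W S e : ℝ} (hK : 1 ≤ K) (hZ : 0 ≤ Z) (hW : 0 ≤ W) (hS : 0 ≤ S) (he : 0 ≤ e) :
    K * (W + S) + K * S + e ≤ (2 * K + 1) * (Z + W + S + e) := by
  have h1 : 0 ≤ K * W := by positivity
  have h2 : 0 ≤ K * Z := by positivity
  have h3 : 0 ≤ K * e := by positivity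
  linarith

set_option maxHeartbeats 3200000 in
lemma smooth1 (n m : ℕ) {Λ A P T : ℝ} (hΛ : 0 < Λ) (hA : 0 ≤ A) (hP : 0 ≤ P) (hT : 0 ≤ T) :
    ∃ K, 1 ≤ K ∧ ∀ (a ax aT : Fin n → ℝ → ℝ → ℝ) (b bx bT : Fin n → Fin n → ℝ → ℝ → ℝ),
      Cls m Λ A a ax aT b bx bT → ∀ p : Fin n → Fin n → ℝ, (∀ j k, |p j k| ≤ P) →
      ∀ (s : ℝ) (σ σx σt ω ωx ωt : Fin n → ℝ → ℝ → ℝ),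
      Sol m p a (dgl b) (fun _ _ _ => 0) s σ σx σt →
      Sol m p a b (fun j x t => -∑ k, off b j k x t * σ k x t) s ω ωx ωt →
      ∀ t ∈ Icc s (s+T), Nrm (zet a b ωt σ) t ≤ K * (Nrm (zet a b ωt σ) s + Nrm ω s + Nrm σ s) := by
  obtain ⟨CQ, hCQ, hQ⟩ := Q_exists hΛ hA
  obtain ⟨Kb, hKb, hbas⟩ := basic_bounds n m hΛ hA hP hT
  set C1 : ℝ := 6 * ((A*Λ⁻¹)^2 + n * A^2 + (A*Λ⁻¹)^2 * (n * A^2) + n * (A + CQ + A * CQ + CQ * A * A * Λ⁻¹)^2) with hC1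
  have hC10 : 0 ≤ C1 := by positivity
  set c : ℝ := n * (n * CQ^2) with hc
  have hc0 : 0 ≤ c := by positivity
  set C2 : ℝ := 2 * C1 * (4 + 3 * c + 3 * n) + 18 with hC2
  have hC20 : 0 ≤ C2 := by positivity
  set C3 : ℝ := n * (2 * (n * CQ^2 * (n * (1 + n * P^2))) * (1 + n * P^2 * n)) with hC3
  have hC30 : 0 ≤ C3 := by positivity
  obtain ⟨Ke, hKe, hEL⟩ := EL n m (B := n * C2) hΛ hA hP (by positivity) hT
  set L : ℝ := n * 2 * (Ke * (n * 2 + (T * (n * C2 * (2 * Kb + 1)) + C3 * Kb)) + 1) with hL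
  have hL0 : 0 ≤ L := by positivity
  refine ⟨1 + L, by linarith, ?_⟩
  intro a ax aT b bx bT h p hp s σ σx σt ω ωx ωt hσ hω t ht
  obtain ⟨Qx, QT, hQ'⟩ := hQ a ax aT b bx bT h
  have nz : ∀ t, 0 ≤ Nrm (zet a b ωt σ) t := fun t => Nrm_nonneg _ _
  have nσ : ∀ t, 0 ≤ Nrm σ t := fun t => Nrm_nonneg _ _
  have nω : ∀ t, 0 ≤ Nrm ω t := fun t => Nrm_nonneg _ _
  suffices H : ∀ ε : ℝ, 0 < ε → Nrm (zet a b ωt σ) t ≤ L * (Nrm (zet a b ωt σ) s + Nrm ω s + Nrm σ s + ε^2) by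
    have hlim : Tendsto (fun ε : ℝ => L * (Nrm (zet a b ωt σ) s + Nrm ω s + Nrm σ s + ε^2)) (nhdsWithin 0 (Ioi 0))
        (nhds (L * (Nrm (zet a b ωt σ) s + Nrm ω s + Nrm σ s + 0^2))) := by
      apply Tendsto.mono_left _ nhdsWithin_le_nhds
      exact Continuous.tendsto (by fun_prop) 0
    have := ge_of_tendsto hlim (eventually_nhdsWithin_of_forall fun ε hε => H ε hε)
    rw [zero_pow two_ne_zero, add_zero] at this
    exact this.trans (mul_le_mul_of_nonneg_right (by linarith) (by linarith [nz s, nσ s, nω s]))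
  intro ε hε
  have hFc : ∀ j, C1S s (fun x t => ∑ k, (b j k x t * ω k x t + off b j k x t * σ k x t)) _ _ := fun j =>
    C1S.sum fun k _ => (((h.bk j k).c1 s).mul (hω.c1 k)).add (((h.off_bk hA j k).c1 s).mul (hσ.c1 k))
  have hFe : ∀ j, ∀ x ∈ Icc (0:ℝ) 1, ∀ t, s ≤ t → ωt j x t + a j x t * ωx j x t =
      - ∑ k, (b j k x t * ω k x t + off b j k x t * σ k x t) := by
    intro j x hx t ht
    have := hω.eq j x hx t ht
    rw [Finset.sum_add_distrib]; linarith
  have hev := Filter.eventually_all.mpr fun j => diff_ev (T := T) hA (h.ac.c1 s j) (h.ac.bt j) (hω.c1 j) (hFc j) (hFe j) hε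
  obtain ⟨hh, hcl, hh0⟩ := (hev.and (self_mem_nhdsWithin)).exists
  have hhp : 0 < hh := hh0
  set d : Fin n → ℝ → ℝ → ℝ := fun j => dlt hh (ω j) with hd
  have hz : ∀ j, C1S s (zet a b d σ j) (fun x t => dlt hh (ωx j) x t + ∑ k, (Qx j k x t * σ k x t + Qf a b j k x t * σx k x t))
      (fun x t => dlt hh (ωt j) x t + ∑ k, (QT j k x t * σ k x t + Qf a b j k x t * σt k x t)) := fun j =>
    ((hω.c1 j).dlt hhp.le).add (C1S.sum fun k _ => ((hQ' j k).c1 s).mul (hσ.c1 k))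
  have hz0 : ∀ j, CS s (zet a b ωt σ j) := fun j =>
    (hω.c1 j).ct.add (CS.sum fun k _ => ((hQ' j k).c1 s).c0.mul (hσ.c1 k).c0)
  have cl2 : ∀ t ∈ Icc s (s+T), ∀ j, ∀ x ∈ Icc (0:ℝ) 1, |zet a b d σ j x t - zet a b ωt σ j x t| ≤ ε := by
    intro t ht j x hx
    have := (hcl j x hx t ht).1
    simp only [zet, hd]
    rw [add_sub_add_right_eq_sub]; exact this
  have k1 := Nrm_close (fun j => (hz j).c0) hz0 ht.1 (fun j x hx => by rw [abs_sub_comm]; exact cl2 t ht j x hx)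
  have k2 := Nrm_close hz0 (fun j => (hz j).c0) le_rfl (fun j x hx => cl2 s ⟨le_rfl, by linarith⟩ j x hx)
  have bas := hbas a ax aT b bx bT h p hp s σ σx σt ω ωx ωt hσ hω
  have cσ : ∀ j, CS s (σ j) := fun j => (hσ.c1 j).c0
  have cω : ∀ j, CS s (ω j) := fun j => (hω.c1 j).c0
  set Φ : ℝ → ℝ := fun t => n * C2 * (Nrm ω t + Nrm σ t + ε^2) with hΦ
  set Γ : ℝ → ℝ := fun t => C3 * Otr m σ t with hΓ
  have hΦc : ContinuousOn Φ (Ici s) :=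
    continuousOn_const.mul (((Nrm_cont cω).add (Nrm_cont cσ)).add continuousOn_const)
  have hΓc : ContinuousOn Γ (Ici s) := continuousOn_const.mul (Otr_cont cσ)
  have hel := hEL a ax aT h.ac p hp s _ _ _ hz Φ Γ hΦc hΓc
    (fun t => mul_nonneg (by positivity) (by linarith [nω t, nσ t, sq_nonneg ε]))
    (fun t => mul_nonneg hC30 (Otr_nonneg _ _ _))
    (by
      intro τ hτ
      have cr : ∀ j, CS s (fun x t => dlt hh (ωt j) x t + ∑ k, (QT j k x t * σ k x t + Qf a b j k x t * σt k x t) +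
          a j x t * (dlt hh (ωx j) x t + ∑ k, (Qx j k x t * σ k x t + Qf a b j k x t * σx k x t))) := fun j =>
        (hz j).ct.add ((h.ac.c1 s j).c0.mul (hz j).cx)
      have r1 := Nrm_le3 (C := C2) (e := ε^2) cr (fun j => (hz j).c0) cω cσ hτ.1 (fun j x hx => by
        have hne : ∀ k, Λ ≤ |a k x τ| := fun k => h.ac.abs_ge k hx τ
        have rb := resid_bound (n := n) hΛ hA hCQ j (a := fun k => a k x τ) (aT := fun k => aT k x τ)
          (b := fun j k => b j k x τ) (bT := fun j k => bT j k x τ) (QT := fun j k => QT j k x τ) (Qx := fun j k => Qx j k x τ)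
          (σ := fun k => σ k x τ) (σx := fun k => σx k x τ) (σt := fun k => σt k x τ)
          (ω := fun k => ω k x τ) (ωx := fun k => ωx k x τ) (ωt := fun k => ωt k x τ)
          (fun k => h.ac.ba k x hx τ) (fun k => h.ac.bt k x hx τ) hne (fun j k hjk => h.sep j k hjk x hx τ)
          (fun j k => (h.bk j k).b0 x hx τ) (fun j k => (h.bk j k).bt x hx τ)
          (Q := fun j k => Qf a b j k x τ) (o := fun j k => off b j k x τ) (oT := fun j k => off bT j k x τ)
          (fun j k => rfl) (fun j k => rfl) (fun j k => (h.off_bk hA j k).bt x hx τ)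
          (fun j k => (hQ' j k).b0 x hx τ) (fun j k => (hQ' j k).bt x hx τ) (fun j k => (hQ' j k).bx x hx τ)
          (fun k => by
            have := hσ.eq k x hx τ hτ.1
            simpa [dgl] using this)
          (hω.eq j x hx τ hτ.1)
        have sr := sum_recover (n := n) (ε := ε) (Q := fun j k => Qf a b j k x τ) (fun j k => (hQ' j k).b0 x hx τ)
          (fun k => σ k x τ) (fun k => dlt hh (ω k) x τ) (fun k => ωt k x τ) (fun k => (hcl k x hx τ hτ).1)
        have dd2 := (hcl j x hx τ hτ).2
        refine comb2 hC10 hc0 (Nat.cast_nonneg n) (SS_nonneg _ _ _) (SS_nonneg _ _ _) (SS_nonneg _ _ _) (sq_nonneg ε) (sq_split (e := 0) ε ?_) rb sr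
        refine le_trans (le_of_eq ?_) dd2
        congr 1
        simp only [mul_add, Finset.mul_sum, Finset.sum_add_distrib]
        ring)
      have e : Nrm (fun j x t => dlt hh (ωt j) x t + ∑ k, (QT j k x t * σ k x t + Qf a b j k x t * σt k x t) +
          a j x t * (dlt hh (ωx j) x t + ∑ k, (Qx j k x t * σ k x t + Qf a b j k x t * σx k x t))) τ =
        ∑ j, ∫ x in (0:ℝ)..1, (dlt hh (ωt j) x τ + ∑ k, (QT j k x τ * σ k x τ + Qf a b j k x τ * σt k x τ) +
          a j x τ * (dlt hh (ωx j) x τ + ∑ k, (Qx j k x τ * σ k x τ + Qf a b j k x τ * σx k x τ)))^2 := rfl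
      rw [← e]
      refine r1.trans (le_of_eq ?_)
      simp only [hΦ]; ring)
    (by
      intro τ hτ
      refine bdry_est hP hp (fun j k x hx => (hQ' j k).b0 x hx τ) (fun j => hσ.bc j τ hτ.1) (fun j => ?_)
      have b1 := hω.bc j τ hτ.1
      have b2 := hω.bc j (τ + hh) (by linarith [hτ.1])
      have ei : ∀ j, inn m d j τ = hh⁻¹ * (inn m ω j (τ+hh) - inn m ω j τ) := by
        intro j; unfold inn; split_ifs <;> rfl
      have eo : ∀ j, outt m d j τ = hh⁻¹ * (outt m ω j (τ+hh) - outt m ω j τ) := by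
        intro j; unfold outt; split_ifs <;> rfl
      rw [ei, b1, b2, ← Finset.sum_sub_distrib, Finset.mul_sum]
      refine Finset.sum_congr rfl fun k _ => ?_
      rw [eo]; ring)
    t ht
  have hOz : 0 ≤ ∫ τ in s..t, Otr m (fun j => zet a b d σ j) τ :=
    intervalIntegral.integral_nonneg ht.1 fun _ _ => Otr_nonneg _ _ _
  have hsub : uIcc s t ⊆ Ici s := by rw [uIcc_of_le ht.1]; exact Icc_subset_Ici_self
  have hIntBd : ∫ τ in s..t, (Φ τ + Γ τ) ≤ T * (n * C2 * (Kb * (Nrm ω s + Nrm σ s) + Kb * Nrm σ s + ε^2)) + C3 * (Kb * Nrm σ s) := by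
    rw [intervalIntegral.integral_add (hΦc.mono hsub).intervalIntegrable (hΓc.mono hsub).intervalIntegrable]
    have n2 := nσ s
    have n3 := nω s
    refine add_le_add ?_ ?_
    · refine int_le_const hΦc ht (by positivity) fun τ hτ => ?_
      have := bas τ ⟨hτ.1, hτ.2.trans ht.2⟩
      exact mul_le_mul_of_nonneg_left (by linarith [this.1, this.2.2]) (by positivity)
    · simp only [hΓ]
      rw [intervalIntegral.integral_const_mul]
      exact mul_le_mul_of_nonneg_left (bas t ht).2.1 hC30
  set Z := Nrm (zet a b ωt σ) s
  set Wn := Nrm ω s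
  set Sn := Nrm σ s
  have z0 : 0 ≤ Z := nz s
  have w0 : 0 ≤ Wn := nω s
  have s0 : 0 ≤ Sn := nσ s
  set X := Z + Wn + Sn + ε^2 with hX
  have x0 : 0 ≤ X := by positivity
  have i2 : T * (n * C2 * (Kb * (Wn + Sn) + Kb * Sn + ε^2)) + C3 * (Kb * Sn) ≤
      (T * (n * C2 * (2 * Kb + 1)) + C3 * Kb) * X := by
    have q1 : Kb * (Wn + Sn) + Kb * Sn + ε^2 ≤ (2 * Kb + 1) * X := by
      exact arith4 hKb z0 w0 s0 (sq_nonneg ε)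
    have q2 : Sn ≤ X := by rw [hX]; linarith [sq_nonneg ε]
    calc _ ≤ T * (n * C2 * ((2 * Kb + 1) * X)) + C3 * (Kb * X) := by gcongr
      _ = _ := by ring
  have k3 : Nrm (zet a b d σ) t ≤ Ke * (n * 2 * X + (T * (n * C2 * (2 * Kb + 1)) + C3 * Kb) * X) := by
    have k2' : Nrm (zet a b d σ) s ≤ n * 2 * X := k2.trans (by rw [hX]; gcongr; linarith)
    have : Ke * (Nrm (zet a b d σ) s + ∫ τ in s..t, (Φ τ + Γ τ)) ≤ Ke * (n * 2 * X + (T * (n * C2 * (2 * Kb + 1)) + C3 * Kb) * X) := by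
      gcongr
      exact hIntBd.trans i2
    linarith
  calc Nrm (zet a b ωt σ) t ≤ n * 2 * (Nrm (zet a b d σ) t + ε^2) := k1
    _ ≤ n * 2 * (Ke * (n * 2 * X + (T * (n * C2 * (2 * Kb + 1)) + C3 * Kb) * X) + X) := by
        gcongr
        rw [hX]; linarith
    _ = L * X := by rw [hL]; ring

end E4



section E5

lemma pt_inv {n : ℕ} {Λ A a v w : ℝ} {b y : Fin n → ℝ} (hΛ : 0 < Λ) (haΛ : Λ ≤ |a|) (hb : ∀ k, |b k| ≤ A)
    (eq : v + a * w + ∑ k, b k * y k = 0) :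
    w^2 ≤ (Λ⁻¹)^2 * (2 * (1 + n * A^2)) * (v^2 + ∑ k, y k^2) := by
  have h1 := lin_sq (y := y) hb
  have ha : a ≠ 0 := by intro h0; rw [h0, abs_zero] at haΛ; linarith
  have hia : |a⁻¹| ≤ Λ⁻¹ := by rw [abs_inv]; exact inv_anti₀ hΛ haΛ
  have hw : w = a⁻¹ * -(v + ∑ k, b k * y k) := by field_simp; linarith
  have hi2 : (a⁻¹)^2 ≤ (Λ⁻¹)^2 := by rw [← sq_abs]; exact pow_le_pow_left₀ (abs_nonneg _) hia 2
  rw [hw, mul_pow, mul_assoc]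
  refine mul_le_mul hi2 ?_ (sq_nonneg _) (sq_nonneg _)
  set S := ∑ k, b k * y k
  have p : 0 ≤ ∑ k, y k^2 := Finset.sum_nonneg fun _ _ => sq_nonneg _
  have q : 0 ≤ n * A^2 * v^2 := by positivity
  nlinarith [sq_nonneg (v - S)]

lemma pt_fwd {n : ℕ} {A a v w : ℝ} {b y : Fin n → ℝ} (ha : |a| ≤ A) (hb : ∀ k, |b k| ≤ A)
    (eq : v + a * w + ∑ k, b k * y k = 0) :
    v^2 ≤ 2 * (A^2 + n * A^2) * (w^2 + ∑ k, y k^2) := by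
  have h1 := lin_sq (y := y) hb
  have ha2 : a^2 ≤ A^2 := by rw [← sq_abs]; exact pow_le_pow_left₀ (abs_nonneg _) ha 2
  set S := ∑ k, b k * y k
  have hv : v = -(a * w + S) := by linarith
  have p : 0 ≤ ∑ k, y k^2 := Finset.sum_nonneg fun _ _ => sq_nonneg _
  have q : 0 ≤ n * A^2 * w^2 := by positivity
  have q2 : 0 ≤ A^2 * ∑ k, y k^2 := by positivity
  have q3 : (a*w)^2 ≤ A^2 * w^2 := by rw [mul_pow]; exact mul_le_mul_of_nonneg_right ha2 (sq_nonneg _)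
  rw [hv]
  nlinarith [sq_nonneg (a * w - S)]

lemma Nrm_le2 {n : ℕ} {s : ℝ} {r y1 y2 : Fin n → ℝ → ℝ → ℝ} (hr : ∀ j, CS s (r j))
    (h1 : ∀ j, CS s (y1 j)) (h2 : ∀ j, CS s (y2 j)) {t C : ℝ} (ht : s ≤ t) (hC : 0 ≤ C)
    (h : ∀ j, ∀ x ∈ Icc (0:ℝ) 1, r j x t ^2 ≤ C * (y1 j x t^2 + ∑ k, y2 k x t^2)) :
    Nrm r t ≤ n * C * (Nrm y1 t + Nrm y2 t) := by
  have := Nrm_le3 (C := C) (e := 0) hr h1 h2 (fun _ => CS.const 0) ht (fun j x hx => by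
    simp only [SS_zero, add_zero]
    refine (h j x hx).trans (mul_le_mul_of_nonneg_left ?_ hC)
    exact add_le_add (SS_single y1 j x t) le_rfl)
  simpa [Nrm_zero] using this

lemma Sol.zero {n m : ℕ} {p : Fin n → Fin n → ℝ} {a : Fin n → ℝ → ℝ → ℝ} {b : Fin n → Fin n → ℝ → ℝ → ℝ} {s : ℝ} :
    Sol m p a b (fun _ _ _ => 0) s (fun _ _ _ => 0) (fun _ _ _ => 0) (fun _ _ _ => 0) :=
  ⟨fun j => C1S.const 0, fun j x hx t ht => by simp, fun j t ht => by simp [inn, outt]⟩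

/-- propagation of `H¹` bounds -/
lemma h1_bound (n m : ℕ) {Λ A P T : ℝ} (hΛ : 0 < Λ) (hA : 0 ≤ A) (hP : 0 ≤ P) (hT : 0 ≤ T) :
    ∃ K, 1 ≤ K ∧ ∀ (a ax aT : Fin n → ℝ → ℝ → ℝ) (b bx bT : Fin n → Fin n → ℝ → ℝ → ℝ),
      Cls m Λ A a ax aT b bx bT → ∀ p : Fin n → Fin n → ℝ, (∀ j k, |p j k| ≤ P) →
      ∀ (s : ℝ) (u ux ut : Fin n → ℝ → ℝ → ℝ), Sol m p a b (fun _ _ _ => 0) s u ux ut →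
      ∀ t ∈ Icc s (s+T), Nrm u t + Nrm ux t ≤ K * (Nrm u s + Nrm ux s) := by
  obtain ⟨K1, hK1, H1⟩ := smooth1 n m hΛ hA hP hT
  obtain ⟨K2, hK2, H2⟩ := basic_bounds n m hΛ hA hP hT
  set c1 : ℝ := n * ((Λ⁻¹)^2 * (2 * (1 + n * A^2))) with hc1
  set c2 : ℝ := n * (2 * (A^2 + n * A^2)) with hc2
  have g1 : 0 ≤ c1 := by positivity
  have g2 : 0 ≤ c2 := by positivity
  refine ⟨K2 + c1 * (K1 * (c2 + 1) + K2), ?_, ?_⟩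
  · have : 0 ≤ c1 * (K1 * (c2 + 1) + K2) := by positivity
    linarith
  intro a ax aT b bx bT h p hp s u ux ut hu t ht
  have hu' : Sol m p a b (fun j x t => -∑ k, off b j k x t * (fun (_ : Fin n) (_ _ : ℝ) => (0:ℝ)) k x t) s u ux ut := by
    refine ⟨hu.c1, fun j x hx t ht => ?_, hu.bc⟩
    rw [hu.eq j x hx t ht]; simp
  have q1 := H1 a ax aT b bx bT h p hp s _ _ _ u ux ut Sol.zero hu' t ht
  have q2 := (H2 a ax aT b bx bT h p hp s _ _ _ u ux ut Sol.zero hu' t ht).2.2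
  have e : zet a b ut (fun (_ : Fin n) (_ _ : ℝ) => (0:ℝ)) = ut := by
    funext j x t; simp [zet]
  rw [e, Nrm_zero, add_zero] at q1
  rw [Nrm_zero, add_zero] at q2
  have c0 : ∀ j, CS s (u j) := fun j => (hu.c1 j).c0
  have cx : ∀ j, CS s (ux j) := fun j => (hu.c1 j).cx
  have ct : ∀ j, CS s (ut j) := fun j => (hu.c1 j).ct
  have q3 : Nrm ux t ≤ c1 * (Nrm ut t + Nrm u t) := Nrm_le2 cx ct c0 ht.1 (by positivity) fun j x hx =>
    pt_inv hΛ (h.ac.abs_ge j hx t) (fun k => (h.bk j k).b0 x hx t) (hu.eq j x hx t ht.1)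
  have q4 : Nrm ut s ≤ c2 * (Nrm ux s + Nrm u s) := Nrm_le2 ct cx c0 le_rfl (by positivity) fun j x hx =>
    pt_fwd (h.ac.ba j x hx s) (fun k => (h.bk j k).b0 x hx s) (hu.eq j x hx s le_rfl)
  have n1 := Nrm_nonneg ux s
  have n2 := Nrm_nonneg u s
  set X := Nrm u s + Nrm ux s with hX
  have q5 : Nrm ut t ≤ K1 * (c2 + 1) * X := by
    rw [mul_assoc]
    refine q1.trans (mul_le_mul_of_nonneg_left ?_ (by linarith))
    rw [add_comm (Nrm ux s), ← hX] at q4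
    linarith
  have q6 : Nrm u t ≤ K2 * X := q2.trans (mul_le_mul_of_nonneg_left (by linarith) (by linarith))
  have q7 : Nrm ux t ≤ c1 * (K1 * (c2+1) * X + K2 * X) := q3.trans (mul_le_mul_of_nonneg_left (by linarith) g1)
  linarith

lemma deriv0_on {f : ℝ → ℝ} {f' x : ℝ} (hx : x ∈ Icc (0:ℝ) 1) (hd : HasDerivWithinAt f f' (Icc 0 1) x)
    (h0 : ∀ z ∈ Icc (0:ℝ) 1, f z = 0) : f' = 0 := by
  have h2 : HasDerivWithinAt f 0 (Icc 0 1) x :=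
    (hasDerivWithinAt_const x (Icc (0:ℝ) 1) (0:ℝ)).congr h0 (h0 x hx)
  exact (uniqueDiffOn_Icc zero_lt_one x hx).eq_deriv _ hd h2

/-- the smoothing estimate -/
lemma smoothing (n m : ℕ) {Λ A P T : ℝ} (hΛ : 0 < Λ) (hA : 0 ≤ A) (hP : 0 ≤ P) (hT : n / Λ < T) :
    ∃ K, 1 ≤ K ∧ ∀ (a ax aT : Fin n → ℝ → ℝ → ℝ) (b bx bT : Fin n → Fin n → ℝ → ℝ → ℝ),
      Cls m Λ A a ax aT b bx bT → ∀ p : Fin n → Fin n → ℝ, (∀ j k, |p j k| ≤ P) → H3cond n p →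
      ∀ (s : ℝ) (u ux ut σ σx σt : Fin n → ℝ → ℝ → ℝ), Sol m p a b (fun _ _ _ => 0) s u ux ut →
      Sol m p a (dgl b) (fun _ _ _ => 0) s σ σx σt → (∀ j, ∀ x ∈ Icc (0:ℝ) 1, u j x s = σ j x s) →
      Nrm u (s+T) + Nrm ux (s+T) ≤ K * Nrm u s := by
  have hT0 : 0 ≤ T := le_trans (by positivity) hT.le
  obtain ⟨K1, hK1, H1⟩ := smooth1 n m hΛ hA hP hT0
  obtain ⟨K2, hK2, H2⟩ := basic_bounds n m hΛ hA hP hT0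
  obtain ⟨CQ, hCQ, hQ⟩ := Q_exists hΛ hA
  set c1 : ℝ := n * ((Λ⁻¹)^2 * (2 * (1 + n * A^2))) with hc1
  set c2 : ℝ := n * (n * (A + CQ)^2) with hc2
  have g1 : 0 ≤ c1 := by positivity
  have g2 : 0 ≤ c2 := by positivity
  refine ⟨K2 + c1 * (K1 * (c2 + 1) + K2), ?_, ?_⟩
  · have : 0 ≤ c1 * (K1 * (c2 + 1) + K2) := by positivity
    linarith
  intro a ax aT b bx bT h p hp hH3 s u ux ut σ σx σt hu hσ h0
  obtain ⟨Qx, QT, hQ'⟩ := hQ a ax aT b bx bT h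
  set ω : Fin n → ℝ → ℝ → ℝ := fun j x t => u j x t - σ j x t with hω
  set ωx : Fin n → ℝ → ℝ → ℝ := fun j x t => ux j x t - σx j x t with hωx
  set ωt : Fin n → ℝ → ℝ → ℝ := fun j x t => ut j x t - σt j x t with hωt
  have hbs : ∀ j k x t, b j k x t = dgl b j k x t + off b j k x t := by
    intro j k x t; unfold dgl off; split_ifs <;> simp
  have hS : Sol m p a b (fun j x t => -∑ k, off b j k x t * σ k x t) s ω ωx ωt := by
    refine ⟨fun j => (hu.c1 j).sub (hσ.c1 j), fun j x hx t ht => ?_, fun j t ht => ?_⟩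
    · have e1 := hu.eq j x hx t ht
      have e2 := hσ.eq j x hx t ht
      have e3 : ∑ k, b j k x t * ω k x t = ∑ k, b j k x t * u k x t - ∑ k, dgl b j k x t * σ k x t
          - ∑ k, off b j k x t * σ k x t := by
        rw [← Finset.sum_sub_distrib, ← Finset.sum_sub_distrib]
        refine Finset.sum_congr rfl fun k _ => ?_
        simp only [hω]
        linear_combination (-σ k x t) * hbs j k x t
      rw [e3]; simp only [hωx, hωt]; linear_combination e1 - e2
    · have e1 := hu.bc j t ht
      have e2 := hσ.bc j t ht
      have ei : ∀ j, inn m ω j t = inn m u j t - inn m σ j t := by intro j; unfold inn; split_ifs <;> rfl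
      have eo : ∀ j, outt m ω j t = outt m u j t - outt m σ j t := by intro j; unfold outt; split_ifs <;> rfl
      rw [ei, e1, e2, ← Finset.sum_sub_distrib]
      refine Finset.sum_congr rfl fun k _ => ?_
      rw [eo]; ring
  have hts : s + T ∈ Icc s (s+T) := ⟨by linarith, le_rfl⟩
  have q1 := H1 a ax aT b bx bT h p hp s σ σx σt ω ωx ωt hσ hS _ hts
  have q2 := (H2 a ax aT b bx bT h p hp s σ σx σt ω ωx ωt hσ hS _ hts).2.2
  have ω0 : ∀ j, ∀ x ∈ Icc (0:ℝ) 1, ω j x s = 0 := fun j x hx => by simp only [hω]; rw [h0 j x hx, sub_self]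
  have ωx0 : ∀ j, ∀ x ∈ Icc (0:ℝ) 1, ωx j x s = 0 := fun j x hx => deriv0_on hx ((hS.c1 j).dx x hx s le_rfl) (ω0 j)
  have Nu : Nrm u s = Nrm σ s := by
    unfold Nrm
    refine Finset.sum_congr rfl fun j _ => intervalIntegral.integral_congr fun x hx => ?_
    rw [uIcc_of_le zero_le_one] at hx
    simp only [h0 j x hx]
  have Nω : Nrm ω s = 0 := by
    unfold Nrm
    refine Finset.sum_eq_zero fun j _ => ?_
    rw [intervalIntegral.integral_congr (g := fun _ => (0:ℝ)) fun x hx => ?_]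
    · simp
    · rw [uIcc_of_le zero_le_one] at hx
      simp only [ω0 j x hx]; simp
  have cz : ∀ j, CS s (zet a b ωt σ j) := fun j =>
    (hS.c1 j).ct.add (CS.sum fun k _ => ((hQ' j k).c1 s).c0.mul (hσ.c1 k).c0)
  have q4 : Nrm (zet a b ωt σ) s ≤ c2 * Nrm σ s := by
    have := Nrm_le2 (C := n * (A + CQ)^2) cz (fun _ => CS.const 0) (fun j => (hσ.c1 j).c0) le_rfl (by positivity) (fun j x hx => by
      have e1 := hS.eq j x hx s le_rfl
      have e2 : ∑ k, b j k x s * ω k x s = 0 := Finset.sum_eq_zero fun k _ => by rw [ω0 k x hx, mul_zero]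
      rw [ωx0 j x hx, e2, mul_zero, add_zero, add_zero] at e1
      have e3 : zet a b ωt σ j x s = ∑ k, (Qf a b j k x s - off b j k x s) * σ k x s := by
        unfold zet; rw [e1, ← Finset.sum_neg_distrib, ← Finset.sum_add_distrib]
        exact Finset.sum_congr rfl fun k _ => by ring
      rw [e3]
      refine (lin_sq (C := A + CQ) fun k => ?_).trans (le_of_eq (by ring))
      have i1 := (hQ' j k).b0 x hx s
      have i2 := (h.off_bk hA j k).b0 x hx s
      exact (abs_sub _ _).trans (by linarith))
    simpa [Nrm_zero] using this
  have σ0 : ∀ j, ∀ x ∈ Icc (0:ℝ) 1, σ j x (s+T) = 0 := fun j x hx =>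
    diag_vanish hΛ hA hA h.ac hH3 (fun j k => ((h.dgl_bk hA j k).c1 s).c0)
      (fun j k x hx t _ => (h.dgl_bk hA j k).b0 x hx t) (fun j k hjk x hx t _ => if_neg hjk) hσ j (s+T) (by linarith) x hx
  have σx0 : ∀ j, ∀ x ∈ Icc (0:ℝ) 1, σx j x (s+T) = 0 := fun j x hx =>
    deriv0_on hx ((hσ.c1 j).dx x hx _ hts.1) (σ0 j)
  have q3 : Nrm ωx (s+T) ≤ c1 * (Nrm (zet a b ωt σ) (s+T) + Nrm ω (s+T)) :=
    Nrm_le2 (fun j => (hS.c1 j).cx) cz (fun j => (hS.c1 j).c0) hts.1 (by positivity) fun j x hx => by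
      refine pt_inv (a := a j x (s+T)) (b := fun k => b j k x (s+T)) (y := fun k => ω k x (s+T)) hΛ (h.ac.abs_ge j hx _) (fun k => (h.bk j k).b0 x hx _) ?_
      have e1 := hS.eq j x hx _ hts.1
      have z1 : ∑ k, off b j k x (s+T) * σ k x (s+T) = 0 := Finset.sum_eq_zero fun k _ => by rw [σ0 k x hx, mul_zero]
      have z2 : ∑ k, Qf a b j k x (s+T) * σ k x (s+T) = 0 := Finset.sum_eq_zero fun k _ => by rw [σ0 k x hx, mul_zero]
      rw [z1] at e1
      unfold zet; rw [z2]; linarith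
  have Eu : Nrm u (s+T) = Nrm ω (s+T) := by
    unfold Nrm
    refine Finset.sum_congr rfl fun j _ => intervalIntegral.integral_congr fun x hx => ?_
    rw [uIcc_of_le zero_le_one] at hx
    simp only [hω, σ0 j x hx, sub_zero]
  have Eux : Nrm ux (s+T) = Nrm ωx (s+T) := by
    unfold Nrm
    refine Finset.sum_congr rfl fun j _ => intervalIntegral.integral_congr fun x hx => ?_
    rw [uIcc_of_le zero_le_one] at hx
    simp only [hωx, σx0 j x hx, sub_zero]
  rw [Eu, Eux, Nu]
  rw [Nω, zero_add] at q2
  rw [Nω, add_zero] at q1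
  have n1 := Nrm_nonneg σ s
  set X := Nrm σ s with hX
  have q5 : Nrm (zet a b ωt σ) (s+T) ≤ K1 * (c2 + 1) * X := by
    rw [mul_assoc]
    exact q1.trans (mul_le_mul_of_nonneg_left (by linarith) (by linarith))
  have q7 : Nrm ωx (s+T) ≤ c1 * (K1 * (c2+1) * X + K2 * X) := q3.trans (mul_le_mul_of_nonneg_left (by linarith) g1)
  linarith

end E5



section F1

lemma Sol.diff {n m : ℕ} {p : Fin n → Fin n → ℝ} {a a' : Fin n → ℝ → ℝ → ℝ} {b b' : Fin n → Fin n → ℝ → ℝ → ℝ} {s : ℝ}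
    {u ux ut v vx vt : Fin n → ℝ → ℝ → ℝ} (hu : Sol m p a b (fun _ _ _ => 0) s u ux ut)
    (hv : Sol m p a' b' (fun _ _ _ => 0) s v vx vt) :
    Sol m p a' b' (fun j x t => -((a' j x t - a j x t) * ux j x t + ∑ k, (b' j k x t - b j k x t) * u k x t)) s
      (fun j x t => v j x t - u j x t) (fun j x t => vx j x t - ux j x t) (fun j x t => vt j x t - ut j x t) := by
  refine ⟨fun j => (hv.c1 j).sub (hu.c1 j), fun j x hx t ht => ?_, fun j t ht => ?_⟩
  · have e1 := hu.eq j x hx t ht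
    have e2 := hv.eq j x hx t ht
    simp only [mul_sub, sub_mul, Finset.sum_sub_distrib]
    linear_combination e2 - e1
  · have e1 := hu.bc j t ht
    have e2 := hv.bc j t ht
    have ei : ∀ j, inn m (fun j x t => v j x t - u j x t) j t = inn m v j t - inn m u j t := by
      intro j; unfold inn; split_ifs <;> rfl
    have eo : ∀ j, outt m (fun j x t => v j x t - u j x t) j t = outt m v j t - outt m u j t := by
      intro j; unfold outt; split_ifs <;> rfl
    rw [ei, e1, e2, ← Finset.sum_sub_distrib]
    refine Finset.sum_congr rfl fun k _ => ?_
    rw [eo]; ring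

lemma Nrm_eq_zero {n : ℕ} {s : ℝ} {y : Fin n → ℝ → ℝ → ℝ} (h : ∀ j, ∀ x ∈ Icc (0:ℝ) 1, y j x s = 0) : Nrm y s = 0 := by
  unfold Nrm
  refine Finset.sum_eq_zero fun j _ => ?_
  rw [intervalIntegral.integral_congr (g := fun _ => (0:ℝ)) fun x hx => ?_]
  · simp
  · rw [uIcc_of_le zero_le_one] at hx
    simp only [h j x hx]; simp

/-- comparison with loss of a derivative -/
lemma compare1 (n m : ℕ) {Λ A P T : ℝ} (hΛ : 0 < Λ) (hA : 0 ≤ A) (hP : 0 ≤ P) (hT : 0 ≤ T) :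
    ∃ K, 1 ≤ K ∧ ∀ (a ax aT : Fin n → ℝ → ℝ → ℝ) (b bx bT : Fin n → Fin n → ℝ → ℝ → ℝ),
      Cls m Λ A a ax aT b bx bT → ∀ (a' ax' aT' : Fin n → ℝ → ℝ → ℝ) (b' : Fin n → Fin n → ℝ → ℝ → ℝ),
      ACof m Λ A a' ax' aT' → ∀ p : Fin n → Fin n → ℝ, (∀ j k, |p j k| ≤ P) →
      ∀ s : ℝ, (∀ j k, CS s (b' j k)) → (∀ j k, ∀ x ∈ Icc (0:ℝ) 1, ∀ t, |b' j k x t| ≤ A) →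
      ∀ ε, 0 ≤ ε → (∀ j, ∀ x ∈ Icc (0:ℝ) 1, ∀ t, |a' j x t - a j x t| ≤ ε) →
      (∀ j k, ∀ x ∈ Icc (0:ℝ) 1, ∀ t, |b' j k x t - b j k x t| ≤ ε) →
      ∀ u ux ut v vx vt : Fin n → ℝ → ℝ → ℝ, Sol m p a b (fun _ _ _ => 0) s u ux ut →
      Sol m p a' b' (fun _ _ _ => 0) s v vx vt → (∀ j, ∀ x ∈ Icc (0:ℝ) 1, v j x s = u j x s) →
      ∀ t ∈ Icc s (s+T), Nrm (fun j x t => v j x t - u j x t) t ≤ K * ε^2 * (Nrm u s + Nrm ux s) := by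
  obtain ⟨K1, hK1, H1⟩ := h1_bound n m hΛ hA hP hT
  obtain ⟨K2, hK2, H2⟩ := EL2 n m hΛ hA hP hA hT
  refine ⟨1 + K2 * (T * (n * (2 * (1 + n)) * K1)), ?_, ?_⟩
  · have : 0 ≤ K2 * (T * (n * (2 * (1 + n)) * K1)) := by positivity
    linarith
  intro a ax aT b bx bT h a' ax' aT' b' h' p hp s hb'c hb' ε hε hae hbe u ux ut v vx vt hu hv h0 t ht
  have hd := hu.diff hv
  have c0 : ∀ j, CS s (u j) := fun j => (hu.c1 j).c0
  have cx : ∀ j, CS s (ux j) := fun j => (hu.c1 j).cx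
  have fc : ∀ j, CS s (fun x t => -((a' j x t - a j x t) * ux j x t + ∑ k, (b' j k x t - b j k x t) * u k x t)) := fun j =>
    ((((h'.c1 s j).c0.sub (h.ac.c1 s j).c0).mul (cx j)).add
      (CS.sum fun k _ => ((hb'c j k).sub ((h.bk j k).c1 s).c0).mul (c0 k))).neg
  have e1 := H2 a' ax' aT' h' p hp s b' hb'c (fun j k x hx t _ => hb' j k x hx t) _ fc _ _ _ hd t ht
  have hz : Nrm (fun j x t => v j x t - u j x t) s = 0 := Nrm_eq_zero (fun j x hx => by
    show v j x s - u j x s = 0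
    rw [h0 j x hx, sub_self])
  rw [hz, zero_add] at e1
  have n1 := Nrm_nonneg u s
  have n2 := Nrm_nonneg ux s
  set X := Nrm u s + Nrm ux s with hX
  have x0 : 0 ≤ X := by positivity
  have e2 : ∫ τ in s..t, Nrm (fun j x t => -((a' j x t - a j x t) * ux j x t + ∑ k, (b' j k x t - b j k x t) * u k x t)) τ ≤
      T * (n * (2 * (1 + n) * ε^2) * (K1 * X)) := by
    refine int_le_const (Nrm_cont fc) ht (by positivity) fun τ hτ => ?_
    have hτ' : τ ∈ Icc s (s+T) := ⟨hτ.1, hτ.2.trans ht.2⟩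
    have e3 := Nrm_le2 (C := 2 * (1 + n) * ε^2) fc cx c0 hτ.1 (by positivity) (fun j x hx => by
      refine (pt_fwd (n := n) (A := ε) (a := a' j x τ - a j x τ) (w := ux j x τ) (b := fun k => b' j k x τ - b j k x τ)
        (y := fun k => u k x τ) (hae j x hx τ) (fun k => hbe j k x hx τ) (by ring)).trans (le_of_eq ?_)
      ring)
    refine e3.trans (mul_le_mul_of_nonneg_left ?_ (by positivity))
    have := H1 a ax aT b bx bT h p hp s u ux ut hu τ hτ'
    linarith
  have e3 : 0 ≤ ∫ τ in s..t, Otr m (fun j x t => v j x t - u j x t) τ :=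
    intervalIntegral.integral_nonneg ht.1 fun _ _ => Otr_nonneg _ _ _
  have e4 := mul_le_mul_of_nonneg_left e2 (by linarith : 0 ≤ K2)
  have e5 : K2 * (T * (n * (2 * (1 + n) * ε^2) * (K1 * X))) = K2 * (T * (n * (2 * (1 + n)) * K1)) * ε^2 * X := by ring
  have e6 : 0 ≤ ε^2 * X := by positivity
  linarith

/-- comparison of zeroth order perturbations -/
lemma compare2 (n m : ℕ) {Λ A P T : ℝ} (hΛ : 0 < Λ) (hA : 0 ≤ A) (hP : 0 ≤ P) (hT : 0 ≤ T) :
    ∃ K, 1 ≤ K ∧ ∀ (a ax aT : Fin n → ℝ → ℝ → ℝ) (b b' : Fin n → Fin n → ℝ → ℝ → ℝ),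
      ACof m Λ A a ax aT → ∀ p : Fin n → Fin n → ℝ, (∀ j k, |p j k| ≤ P) →
      ∀ s : ℝ, (∀ j k, CS s (b j k)) → (∀ j k, ∀ x ∈ Icc (0:ℝ) 1, ∀ t, |b j k x t| ≤ A) →
      (∀ j k, CS s (b' j k)) → (∀ j k, ∀ x ∈ Icc (0:ℝ) 1, ∀ t, |b' j k x t| ≤ A) →
      ∀ ε, 0 ≤ ε → (∀ j k, ∀ x ∈ Icc (0:ℝ) 1, ∀ t, |b' j k x t - b j k x t| ≤ ε) →
      ∀ u ux ut v vx vt : Fin n → ℝ → ℝ → ℝ, Sol m p a b (fun _ _ _ => 0) s u ux ut →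
      Sol m p a b' (fun _ _ _ => 0) s v vx vt → (∀ j, ∀ x ∈ Icc (0:ℝ) 1, v j x s = u j x s) →
      ∀ t ∈ Icc s (s+T), Nrm (fun j x t => v j x t - u j x t) t ≤ K * ε^2 * Nrm u s := by
  obtain ⟨K2, hK2, H2⟩ := EL2 n m hΛ hA hP hA hT
  refine ⟨1 + K2 * (T * (n * (2 * (1 + n)) * K2)), ?_, ?_⟩
  · have : 0 ≤ K2 * (T * (n * (2 * (1 + n)) * K2)) := by positivity
    linarith
  intro a ax aT b b' h p hp s hbc hb hb'c hb' ε hε hbe u ux ut v vx vt hu hv h0 t ht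
  have hd := hu.diff hv
  have c0 : ∀ j, CS s (u j) := fun j => (hu.c1 j).c0
  have cx : ∀ j, CS s (ux j) := fun j => (hu.c1 j).cx
  have fc : ∀ j, CS s (fun x t => -((a j x t - a j x t) * ux j x t + ∑ k, (b' j k x t - b j k x t) * u k x t)) := fun j =>
    ((((h.c1 s j).c0.sub (h.c1 s j).c0).mul (cx j)).add
      (CS.sum fun k _ => ((hb'c j k).sub (hbc j k)).mul (c0 k))).neg
  have e1 := H2 a ax aT h p hp s b' hb'c (fun j k x hx t _ => hb' j k x hx t) _ fc _ _ _ hd t ht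
  have hz : Nrm (fun j x t => v j x t - u j x t) s = 0 := Nrm_eq_zero (fun j x hx => by
    show v j x s - u j x s = 0
    rw [h0 j x hx, sub_self])
  rw [hz, zero_add] at e1
  have x0 := Nrm_nonneg u s
  set X := Nrm u s with hX
  have e2 : ∫ τ in s..t, Nrm (fun j x t => -((a j x t - a j x t) * ux j x t + ∑ k, (b' j k x t - b j k x t) * u k x t)) τ ≤
      T * (n * (2 * (1 + n) * ε^2) * (K2 * X)) := by
    refine int_le_const (Nrm_cont fc) ht (by positivity) fun τ hτ => ?_
    have hτ' : τ ∈ Icc s (s+T) := ⟨hτ.1, hτ.2.trans ht.2⟩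
    have e3 := Nrm_le2 (C := 2 * (1 + n) * ε^2) fc (fun _ => CS.const 0) c0 hτ.1 (by positivity) (fun j x hx => by
      refine (pt_fwd (n := n) (A := ε) (a := 0) (w := 0) (b := fun k => b' j k x τ - b j k x τ)
        (y := fun k => u k x τ) (by simpa) (fun k => hbe j k x hx τ) (by ring)).trans (le_of_eq ?_)
      ring)
    refine e3.trans (mul_le_mul_of_nonneg_left ?_ (by positivity))
    have q := H2 a ax aT h p hp s b hbc (fun j k x hx t _ => hb j k x hx t) _ (fun _ => CS.const 0) u ux ut hu τ hτ'
    have q3 : 0 ≤ ∫ τ in s..τ, Otr m u τ := intervalIntegral.integral_nonneg hτ.1 fun _ _ => Otr_nonneg _ _ _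
    simp only [Nrm_zero, intervalIntegral.integral_zero, add_zero] at q
    rw [Nrm_zero]
    linarith
  have e3 : 0 ≤ ∫ τ in s..t, Otr m (fun j x t => v j x t - u j x t) τ :=
    intervalIntegral.integral_nonneg ht.1 fun _ _ => Otr_nonneg _ _ _
  have e4 := mul_le_mul_of_nonneg_left e2 (by linarith : 0 ≤ K2)
  have e5 : K2 * (T * (n * (2 * (1 + n) * ε^2) * (K2 * X))) = K2 * (T * (n * (2 * (1 + n)) * K2)) * ε^2 * X := by ring
  have e6 : 0 ≤ ε^2 * X := by positivity
  linarith

end F1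




/-- smooth cutoff -/
lemma cutoff_exists {η : ℝ} (h0 : 0 < η) (h1 : η < 1/4) :
    ∃ χ : ℝ → ℝ, ContDiff ℝ 2 χ ∧ tsupport χ ⊆ Ioo 0 1 ∧ (∀ x, 0 ≤ χ x) ∧ (∀ x, χ x ≤ 1) ∧
      (∀ x ∈ Icc (2*η) (1 - 2*η), χ x = 1) ∧ ∃ C, 0 ≤ C ∧ ∀ x, |deriv χ x| ≤ C := by
  let f : ContDiffBump (1/2 : ℝ) := ⟨1/2 - 2*η, 1/2 - η, by linarith, by linarith⟩
  have hc : ContDiff ℝ 2 f := f.contDiff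
  have hd : Continuous (deriv f) := hc.continuous_deriv (by norm_num)
  obtain ⟨C, hC⟩ := (f.hasCompactSupport.deriv).exists_bound_of_continuous hd
  refine ⟨f, hc, ?_, fun x => f.nonneg, fun x => f.le_one, ?_, |C|, abs_nonneg _, fun x => (hC x).trans (le_abs_self _)⟩
  · rw [f.tsupport_eq, Real.closedBall_eq_Icc]
    intro x hx
    have e : f.rOut = 1/2 - η := rfl
    rw [e] at hx
    exact ⟨by linarith [hx.1], by linarith [hx.2]⟩
  · intro x hx
    apply f.one_of_mem_closedBall
    rw [Real.closedBall_eq_Icc]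
    have e : f.rIn = 1/2 - 2*η := rfl
    rw [e]
    exact ⟨by linarith [hx.1], by linarith [hx.2]⟩

lemma cut_close {χ g : ℝ → ℝ} {η S : ℝ} (h0 : 0 < η) (h1 : η < 1/4) (hχ : Continuous χ)
    (hp : ∀ x, 0 ≤ χ x) (hl : ∀ x, χ x ≤ 1) (he : ∀ x ∈ Icc (2*η) (1 - 2*η), χ x = 1)
    (hg : ContinuousOn g (Icc 0 1)) (hS : ∀ x ∈ Icc (0:ℝ) 1, g x ≤ S) (hg0 : ∀ x ∈ Icc (0:ℝ) 1, 0 ≤ g x) :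
    ∫ x in (0:ℝ)..1, (1 - χ x)^2 * g x ≤ 4*η*S := by
  have c : ContinuousOn (fun x => (1 - χ x)^2 * g x) (Icc 0 1) :=
    ((continuous_const.sub hχ).pow 2).continuousOn.mul hg
  have ii : ∀ u v : ℝ, 0 ≤ u → u ≤ v → v ≤ 1 → IntervalIntegrable (fun x => (1 - χ x)^2 * g x) volume u v := by
    intro u v hu huv hv
    apply ContinuousOn.intervalIntegrable
    rw [uIcc_of_le huv]
    exact c.mono (Icc_subset_Icc hu hv)
  have bd : ∀ x ∈ Icc (0:ℝ) 1, (1 - χ x)^2 * g x ≤ S := by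
    intro x hx
    have a1 := hp x
    have a2 := hl x
    have a3 : (1 - χ x)^2 ≤ 1 := by nlinarith
    have := mul_le_mul_of_nonneg_right a3 (hg0 x hx)
    linarith [hS x hx]
  rw [← intervalIntegral.integral_add_adjacent_intervals (ii 0 (2*η) le_rfl (by linarith) (by linarith))
    (ii (2*η) 1 (by linarith) (by linarith) le_rfl),
    ← intervalIntegral.integral_add_adjacent_intervals (ii (2*η) (1-2*η) (by linarith) (by linarith) (by linarith))
    (ii (1-2*η) 1 (by linarith) (by linarith) le_rfl)]
  have e1 : ∫ x in (0:ℝ)..(2*η), (1 - χ x)^2 * g x ≤ 2*η*S := by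
    calc _ ≤ ∫ x in (0:ℝ)..(2*η), S := by
          apply intervalIntegral.integral_mono_on (by linarith) (ii 0 (2*η) le_rfl (by linarith) (by linarith)) (by simp)
          intro x hx
          exact bd x ⟨hx.1, by linarith [hx.2]⟩
      _ = 2*η*S := by simp
  have e3 : ∫ x in (1-2*η)..1, (1 - χ x)^2 * g x ≤ 2*η*S := by
    calc _ ≤ ∫ x in (1-2*η)..1, S := by
          apply intervalIntegral.integral_mono_on (by linarith) (ii (1-2*η) 1 (by linarith) (by linarith) le_rfl) (by simp)
          intro x hx
          exact bd x ⟨by linarith [hx.1], hx.2⟩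
      _ = 2*η*S := by simp
  have e2 : ∫ x in (2*η)..(1-2*η), (1 - χ x)^2 * g x = 0 := by
    rw [intervalIntegral.integral_congr (g := fun _ => (0:ℝ)) fun x hx => ?_]
    · simp
    · rw [uIcc_of_le (by linarith)] at hx
      simp [he x hx]
  rw [e2]; linarith

lemma sup_sq {y y' : ℝ → ℝ} (hd : ∀ x ∈ Icc (0:ℝ) 1, HasDerivWithinAt y (y' x) (Icc 0 1) x)
    (hc : ContinuousOn y' (Icc 0 1)) {N : ℝ} (h1 : ∫ x in (0:ℝ)..1, y x^2 ≤ N) (h2 : ∫ x in (0:ℝ)..1, y' x^2 ≤ N) :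
    ∀ x ∈ Icc (0:ℝ) 1, y x^2 ≤ 3*N := by
  intro x hx
  have cy : ContinuousOn y (Icc 0 1) := fun x hx => (hd x hx).continuousWithinAt
  have u01 : uIcc (0:ℝ) 1 = Icc 0 1 := uIcc_of_le zero_le_one
  have i1 : IntervalIntegrable (fun x => y x^2) volume 0 1 := (u01 ▸ cy.pow 2).intervalIntegrable
  have i2 : IntervalIntegrable (fun x => y' x^2) volume 0 1 := (u01 ▸ hc.pow 2).intervalIntegrable
  have key : ∀ z ∈ Icc (0:ℝ) 1, y x^2 ≤ y z^2 + 2*N := by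
    intro z hz
    have sub : uIcc z x ⊆ Icc 0 1 := by
      rw [uIcc]; exact Icc_subset_Icc (le_inf hz.1 hx.1) (sup_le hz.2 hx.2)
    have ftc : ∫ w in z..x, 2 * y w * y' w = y x^2 - y z^2 := by
      apply intervalIntegral.integral_eq_sub_of_hasDeriv_right (f := fun w => y w^2)
      · exact (cy.pow 2).mono sub
      · intro w hw
        have hw' : w ∈ Ioo (0:ℝ) 1 := by
          refine ⟨lt_of_le_of_lt (le_inf hz.1 hx.1) hw.1, lt_of_lt_of_le hw.2 (sup_le hz.2 hx.2)⟩
        have := ((hd w ⟨hw'.1.le, hw'.2.le⟩).hasDerivAt (Icc_mem_nhds hw'.1 hw'.2))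
        have h3 := (this.mul this).hasDerivWithinAt (s := Ioi w)
        have e1 : (fun w => y w^2) = y * y := funext fun w => by simp [sq]
        have e2 : 2 * y w * y' w = y' w * y w + y w * y' w := by ring
        rw [e1, e2]
        exact h3
      · exact ((((continuousOn_const.mul cy).mul hc)).mono sub).intervalIntegrable
    have le : ∫ w in z..x, 2 * y w * y' w ≤ ∫ w in (0:ℝ)..1, (y w^2 + y' w^2) := by
      have ci : ContinuousOn (fun w => |2 * y w * y' w|) (Icc 0 1) := ((continuousOn_const.mul cy).mul hc).abs
      calc _ ≤ |∫ w in z..x, 2 * y w * y' w| := le_abs_self _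
        _ ≤ abs (∫ w in z..x, |2 * y w * y' w|) := by
            simpa using intervalIntegral.norm_integral_le_abs_integral_norm (f := fun w => 2 * y w * y' w) (a := z) (b := x) (μ := volume)
        _ ≤ abs (∫ w in (0:ℝ)..1, |2 * y w * y' w|) := by
            refine intervalIntegral.abs_integral_mono_interval ?_ (ae_of_all _ fun w => abs_nonneg _) ?_
            · rw [uIoc_of_le zero_le_one, uIoc]
              exact Ioc_subset_Ioc (le_inf hz.1 hx.1) (sup_le hz.2 hx.2)
            · exact (u01 ▸ ci).intervalIntegrable
        _ = ∫ w in (0:ℝ)..1, |2 * y w * y' w| := abs_of_nonneg (intervalIntegral.integral_nonneg zero_le_one fun w _ => abs_nonneg _)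
        _ ≤ _ := by
            apply intervalIntegral.integral_mono_on zero_le_one (u01 ▸ ci).intervalIntegrable (i1.add i2)
            intro w _
            rw [abs_le]; constructor <;> nlinarith [sq_nonneg (y w + y' w), sq_nonneg (y w - y' w)]
    rw [intervalIntegral.integral_add i1 i2, ftc] at le
    linarith
  have := intervalIntegral.integral_mono_on (a := 0) (b := 1) (f := fun _ => y x^2) (g := fun z => y z^2 + 2*N) (μ := volume) zero_le_one (by simp) (i1.add (by simp)) key
  rw [intervalIntegral.integral_add i1 (by simp)] at this
  simp at this
  linarith

/-- polynomial approximation in C1 -/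
lemma poly_approx {y y' : ℝ → ℝ} (hd : ∀ x ∈ Icc (0:ℝ) 1, HasDerivWithinAt y (y' x) (Icc 0 1) x)
    (hc : ContinuousOn y' (Icc 0 1)) {κ : ℝ} (hκ : 0 < κ) :
    ∃ Y Y' : ℝ → ℝ, ContDiff ℝ 2 Y ∧ (∀ x, HasDerivAt Y (Y' x) x) ∧ Continuous Y' ∧
      ∀ x ∈ Icc (0:ℝ) 1, |Y x - y x| ≤ κ ∧ |Y' x - y' x| ≤ κ := by
  obtain ⟨q, hq⟩ := exists_polynomial_near_of_continuousOn 0 1 y' hc κ hκ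
  have qc : Continuous (fun x => q.eval x) := q.continuous
  have hY : ∀ x, HasDerivAt (fun x => y 0 + ∫ z in (0:ℝ)..x, q.eval z) (q.eval x) x := fun x =>
    (intervalIntegral.integral_hasDerivAt_right (qc.intervalIntegrable _ _) (qc.stronglyMeasurableAtFilter _ _) qc.continuousAt).const_add _
  refine ⟨fun x => y 0 + ∫ z in (0:ℝ)..x, q.eval z, fun x => q.eval x, ?_, hY, qc, ?_⟩
  · have : (2 : WithTop ℕ∞) = 1 + 1 := by norm_num
    rw [this, contDiff_succ_iff_deriv]
    refine ⟨fun x => (hY x).differentiableAt, by simp, ?_⟩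
    have : deriv (fun x => y 0 + ∫ z in (0:ℝ)..x, q.eval z) = fun x => q.eval x := funext fun x => (hY x).deriv
    rw [this]
    have h := q.contDiff_aeval (𝕜 := ℝ) 1
    simpa [Polynomial.coe_aeval_eq_eval] using h
  · intro x hx
    refine ⟨?_, (hq x hx).le⟩
    have ci : ∀ x ∈ Icc (0:ℝ) 1, IntervalIntegrable y' volume 0 x := fun x hx => by
      apply ContinuousOn.intervalIntegrable
      rw [uIcc_of_le hx.1]
      exact hc.mono (Icc_subset_Icc_right hx.2)
    have ftc : ∫ z in (0:ℝ)..x, y' z = y x - y 0 := by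
      apply intervalIntegral.integral_eq_sub_of_hasDerivAt_of_le hx.1
      · exact fun z hz => (hd z ⟨hz.1, hz.2.trans hx.2⟩).continuousWithinAt.mono (Icc_subset_Icc_right hx.2)
      · intro z hz
        exact (hd z ⟨hz.1.le, hz.2.le.trans hx.2⟩).hasDerivAt (Icc_mem_nhds hz.1 (hz.2.trans_le hx.2))
      · exact ci x hx
    have e : (y 0 + ∫ z in (0:ℝ)..x, q.eval z) - y x = ∫ z in (0:ℝ)..x, (q.eval z - y' z) := by
      rw [intervalIntegral.integral_sub (qc.intervalIntegrable _ _) (ci x hx), ftc]; ring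
    rw [e]
    have := intervalIntegral.norm_integral_le_of_norm_le_const (a := 0) (b := x) (C := κ) (f := fun z => q.eval z - y' z) (fun z hz => by
      rw [uIoc_of_le hx.1] at hz
      exact (hq z ⟨hz.1.le, hz.2.trans hx.2⟩).le)
    rw [Real.norm_eq_abs, sub_zero, abs_of_nonneg hx.1] at this
    nlinarith [hx.2]

lemma arith_a {c Y y κ : ℝ} (h0 : 0 ≤ c) (h1 : c ≤ 1) (h : |Y - y| ≤ κ) :
    (c*Y - y)^2 ≤ 2*κ^2 + 2*((1-c)^2*y^2) := by
  have e : (Y-y)^2 ≤ κ^2 := sq_le_sq' (by linarith [abs_le.1 h]) (by linarith [abs_le.1 h])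
  have e2 : c^2*(Y-y)^2 ≤ 1*κ^2 := mul_le_mul (by nlinarith) e (sq_nonneg _) (by norm_num)
  nlinarith [sq_nonneg (c*(Y-y) + (1-c)*y)]

lemma arith_b {Y y κ : ℝ} (h : |Y - y| ≤ κ) : Y^2 ≤ 2*κ^2 + 2*y^2 := by
  have e : (Y-y)^2 ≤ κ^2 := sq_le_sq' (by linarith [abs_le.1 h]) (by linarith [abs_le.1 h])
  nlinarith [sq_nonneg (Y-2*y)]

lemma arith_c {c d C Y Z : ℝ} (h0 : 0 ≤ c) (h1 : c ≤ 1) (hd : |d| ≤ C) :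
    (d*Y + c*Z)^2 ≤ 2*C^2*Y^2 + 2*Z^2 := by
  have e : d^2 ≤ C^2 := sq_le_sq' (by linarith [abs_le.1 hd]) (by linarith [abs_le.1 hd])
  have e1 := mul_le_mul_of_nonneg_right e (sq_nonneg Y)
  have e2 : c^2*Z^2 ≤ 1*Z^2 := mul_le_mul_of_nonneg_right (by nlinarith) (sq_nonneg _)
  nlinarith [sq_nonneg (d*Y - c*Z)]

lemma approx1 {ρ : ℝ} (hρ : 0 < ρ) : ∃ C, 1 ≤ C ∧ ∀ y y' : ℝ → ℝ,
    (∀ x ∈ Icc (0:ℝ) 1, HasDerivWithinAt y (y' x) (Icc 0 1) x) → ContinuousOn y' (Icc 0 1) →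
    ∀ N, 0 < N → ∫ x in (0:ℝ)..1, y x^2 ≤ N → ∫ x in (0:ℝ)..1, y' x^2 ≤ N →
    ∃ ψ : ℝ → ℝ, ContDiff ℝ 2 ψ ∧ tsupport ψ ⊆ Ioo 0 1 ∧ ∫ x in (0:ℝ)..1, (ψ x - y x)^2 ≤ ρ * N ∧
      ∫ x in (0:ℝ)..1, ψ x^2 ≤ C * N ∧ ∫ x in (0:ℝ)..1, deriv ψ x^2 ≤ C * N := by
  set η := min (1/8) (ρ/48) with hη
  have η0 : 0 < η := by rw [hη]; positivity
  have η1 : η ≤ 1/8 := min_le_left _ _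
  have η2 : η ≤ ρ/48 := min_le_right _ _
  obtain ⟨χ, χc, χs, χp, χl, χe, D, hD0, hD⟩ := cutoff_exists η0 (by linarith)
  set k := min 1 (ρ/4) with hk
  have k0 : 0 < k := by rw [hk]; positivity
  have k1 : k ≤ 1 := min_le_left _ _
  have k2 : k ≤ ρ/4 := min_le_right _ _
  have kk : k^2 ≤ k := by nlinarith
  refine ⟨8*(D^2+1), by nlinarith [sq_nonneg D], ?_⟩
  intro y y' hd hc N hN h1 h2
  have hs := sup_sq hd hc h1 h2
  have hκ : 0 < k * Real.sqrt N := by positivity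
  have hκ2 : (k * Real.sqrt N)^2 = k^2 * N := by rw [mul_pow, Real.sq_sqrt hN.le]
  obtain ⟨Y, Y', Yc, Yd, Y'c, hY⟩ := poly_approx hd hc hκ
  set κ := k * Real.sqrt N
  have cy : ContinuousOn y (Icc 0 1) := fun x hx => (hd x hx).continuousWithinAt
  have u01 : uIcc (0:ℝ) 1 = Icc 0 1 := uIcc_of_le zero_le_one
  have i1 : IntervalIntegrable (fun x => y x^2) volume 0 1 := (u01 ▸ cy.pow 2).intervalIntegrable
  have i2 : IntervalIntegrable (fun x => y' x^2) volume 0 1 := (u01 ▸ hc.pow 2).intervalIntegrable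
  have hd' : ∀ x, HasDerivAt (fun x => χ x * Y x) (deriv χ x * Y x + χ x * Y' x) x := fun x =>
    ((χc.differentiable (by norm_num)) x).hasDerivAt.mul (Yd x)
  have dχ : Continuous (deriv χ) := χc.continuous_deriv (by norm_num)
  have Ycc := Yc.continuous
  have χcc := χc.continuous
  have ic : IntervalIntegrable (fun x => (1 - χ x)^2 * y x^2) volume 0 1 := by
    apply ContinuousOn.intervalIntegrable
    rw [u01]
    exact ((continuous_const.sub χcc).pow 2).continuousOn.mul (cy.pow 2)
  have iY : ∫ x in (0:ℝ)..1, Y x^2 ≤ 4 * N := by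
    calc _ ≤ ∫ x in (0:ℝ)..1, (2*κ^2 + 2 * y x^2) := by
          apply intervalIntegral.integral_mono_on zero_le_one ((Ycc.pow 2).intervalIntegrable _ _) (IntervalIntegrable.add (by simp) (i1.const_mul 2))
          intro x hx
          exact arith_b (hY x hx).1
      _ = 2*κ^2 + 2 * ∫ x in (0:ℝ)..1, y x^2 := by
          rw [intervalIntegral.integral_add (by simp) (i1.const_mul 2), intervalIntegral.integral_const_mul]; simp
      _ ≤ 4*N := by rw [hκ2]; nlinarith
  have iY' : ∫ x in (0:ℝ)..1, Y' x^2 ≤ 4 * N := by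
    calc _ ≤ ∫ x in (0:ℝ)..1, (2*κ^2 + 2 * y' x^2) := by
          apply intervalIntegral.integral_mono_on zero_le_one ((Y'c.pow 2).intervalIntegrable _ _) (IntervalIntegrable.add (by simp) (i2.const_mul 2))
          intro x hx
          exact arith_b (hY x hx).2
      _ = 2*κ^2 + 2 * ∫ x in (0:ℝ)..1, y' x^2 := by
          rw [intervalIntegral.integral_add (by simp) (i2.const_mul 2), intervalIntegral.integral_const_mul]; simp
      _ ≤ 4*N := by rw [hκ2]; nlinarith
  refine ⟨fun x => χ x * Y x, χc.mul Yc, (closure_mono (Function.support_mul_subset_left _ _)).trans χs, ?_, ?_, ?_⟩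
  · have cc : ∫ x in (0:ℝ)..1, (1 - χ x)^2 * y x^2 ≤ 4*η*(3*N) := cut_close η0 (by linarith) χcc χp χl χe (cy.pow 2) hs (fun x _ => sq_nonneg _)
    calc _ ≤ ∫ x in (0:ℝ)..1, (2*κ^2 + 2 * ((1 - χ x)^2 * y x^2)) := by
          apply intervalIntegral.integral_mono_on zero_le_one ?_ (IntervalIntegrable.add (by simp) (ic.const_mul 2))
          · intro x hx
            exact arith_a (χp x) (χl x) (hY x hx).1
          · apply ContinuousOn.intervalIntegrable
            rw [u01]
            exact (((χcc.mul Ycc).continuousOn).sub cy).pow 2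
      _ = 2*κ^2 + 2 * ∫ x in (0:ℝ)..1, (1 - χ x)^2 * y x^2 := by
          rw [intervalIntegral.integral_add (by simp) (ic.const_mul 2), intervalIntegral.integral_const_mul]; simp
      _ ≤ 2*(k^2*N) + 2*(4*η*(3*N)) := by rw [hκ2]; linarith
      _ ≤ ρ * N := by
          have : 2*k^2 + 24*η ≤ ρ := by linarith
          nlinarith
  · calc _ ≤ ∫ x in (0:ℝ)..1, Y x^2 := by
          apply intervalIntegral.integral_mono_on zero_le_one (((χcc.mul Ycc).pow 2).intervalIntegrable _ _) ((Ycc.pow 2).intervalIntegrable _ _)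
          intro x hx
          show (χ x * Y x)^2 ≤ Y x^2
          rw [mul_pow]
          have a1 := χp x
          have a2 := χl x
          have a3 : (χ x)^2 ≤ 1 := by nlinarith
          have := mul_le_mul_of_nonneg_right a3 (sq_nonneg (Y x))
          linarith
      _ ≤ 4 * N := iY
      _ ≤ _ := by nlinarith [sq_nonneg D]
  · have ed : deriv (fun x => χ x * Y x) = fun x => deriv χ x * Y x + χ x * Y' x := funext fun x => (hd' x).deriv
    rw [ed]
    have j1 : IntervalIntegrable (fun x => Y x^2) volume 0 1 := (Ycc.pow 2).intervalIntegrable _ _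
    have j2 : IntervalIntegrable (fun x => Y' x^2) volume 0 1 := (Y'c.pow 2).intervalIntegrable _ _
    calc _ ≤ ∫ x in (0:ℝ)..1, (2*D^2*Y x^2 + 2 * Y' x^2) := by
          apply intervalIntegral.integral_mono_on zero_le_one ((((dχ.mul Ycc).add (χcc.mul Y'c)).pow 2).intervalIntegrable _ _) ((j1.const_mul _).add (j2.const_mul _))
          intro x hx
          exact arith_c (χp x) (χl x) (hD x)
      _ = 2*D^2*(∫ x in (0:ℝ)..1, Y x^2) + 2 * ∫ x in (0:ℝ)..1, Y' x^2 := by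
          rw [intervalIntegral.integral_add (j1.const_mul _) (j2.const_mul _), intervalIntegral.integral_const_mul, intervalIntegral.integral_const_mul]
      _ ≤ 2*D^2*(4*N) + 2 * (4*N) := by gcongr
      _ = _ := by ring




/-- vector valued function from components -/
def vec {n : ℕ} (y : Fin n → ℝ → ℝ) (x : ℝ) : Vn n := WithLp.toLp 2 (fun j => y j x)

lemma vec_apply {n : ℕ} (y : Fin n → ℝ → ℝ) (x : ℝ) (j : Fin n) : vec y x j = y j x := rfl

structure RepL {n : ℕ} (F : L2 n) (y : Fin n → ℝ → ℝ) : Prop where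
  c : ∀ j, ContinuousOn (y j) (Icc 0 1)
  ae : ∀ᵐ x ∂μ01, F x = vec y x

lemma vec_contOn {n : ℕ} {y : Fin n → ℝ → ℝ} {S : Set ℝ} (h : ∀ j, ContinuousOn (y j) S) : ContinuousOn (vec y) S :=
  (PiLp.continuous_toLp 2 _).comp_continuousOn (continuousOn_pi.2 h)

lemma vec_memLp {n : ℕ} {y : Fin n → ℝ → ℝ} (h : ∀ j, ContinuousOn (y j) (Icc 0 1)) : MemLp (vec y) 2 μ01 := by
  have hc := vec_contOn h
  obtain ⟨C, hC⟩ := isCompact_Icc.exists_bound_of_continuousOn hc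
  refine MemLp.of_bound ((hc.mono Ioo_subset_Icc_self).aestronglyMeasurable measurableSet_Ioo) C ?_
  filter_upwards [ae_restrict_mem measurableSet_Ioo] with x hx
  exact hC x (Ioo_subset_Icc_self hx)

lemma RepL.exists {n : ℕ} {y : Fin n → ℝ → ℝ} (h : ∀ j, ContinuousOn (y j) (Icc 0 1)) : ∃ F : L2 n, RepL F y :=
  ⟨(vec_memLp h).toLp _, h, MemLp.coeFn_toLp _⟩

lemma RepL.sub {n : ℕ} {F G : L2 n} {y z : Fin n → ℝ → ℝ} (hF : RepL F y) (hG : RepL G z) :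
    RepL (F - G) (fun j x => y j x - z j x) := by
  refine ⟨fun j => (hF.c j).sub (hG.c j), ?_⟩
  filter_upwards [hF.ae, hG.ae, Lp.coeFn_sub F G] with x h1 h2 h3
  rw [h3, Pi.sub_apply, h1, h2]
  rfl

lemma RepL.congr {n : ℕ} {F : L2 n} {y z : Fin n → ℝ → ℝ} (hF : RepL F y)
    (h : ∀ j, ∀ x ∈ Icc (0:ℝ) 1, z j x = y j x) : RepL F z := by
  refine ⟨fun j => (hF.c j).congr (h j), ?_⟩
  filter_upwards [hF.ae, ae_restrict_mem measurableSet_Ioo] with x h1 hx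
  rw [h1]
  ext j
  exact (h j x (Ioo_subset_Icc_self hx)).symm

lemma RepL.norm_sq {n : ℕ} {F : L2 n} {y : Fin n → ℝ → ℝ} (hF : RepL F y) :
    ‖F‖^2 = ∑ j, ∫ x in (0:ℝ)..1, y j x^2 := by
  have e1 : ‖F‖^2 = inner ℝ F F := (real_inner_self_eq_norm_sq F).symm
  rw [e1, MeasureTheory.L2.inner_def]
  have e2 : ∀ᵐ x ∂μ01, inner ℝ (F x) (F x) = ∑ j, y j x^2 := by
    filter_upwards [hF.ae] with x hx
    rw [hx, real_inner_self_eq_norm_sq, EuclideanSpace.real_norm_sq_eq]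
    rfl
  rw [integral_congr_ae e2, integral_finsetSum]
  · refine Finset.sum_congr rfl fun j _ => ?_
    rw [intervalIntegral.integral_of_le zero_le_one, integral_Ioc_eq_integral_Ioo]
  · intro j _
    have : IntegrableOn (fun x => y j x^2) (Icc 0 1) volume := ((hF.c j).pow 2).integrableOn_Icc
    exact this.mono_set Ioo_subset_Icc_self

/-- test data -/
structure Tst {n : ℕ} (ψ : Fin n → ℝ → ℝ) : Prop where
  c : ∀ j, ContDiff ℝ 2 (ψ j)
  s : ∀ j, tsupport (ψ j) ⊆ Ioo 0 1

lemma Tst.vec_contDiff {n : ℕ} {ψ : Fin n → ℝ → ℝ} (h : Tst ψ) : ContDiff ℝ 1 (vec ψ) := by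
  rw [contDiff_euclidean]
  intro j
  exact (h.c j).of_le (by norm_num)

lemma Tst.vec_supp {n : ℕ} {ψ : Fin n → ℝ → ℝ} (h : Tst ψ) : tsupport (vec ψ) ⊆ Ioo 0 1 := by
  have h1 : Function.support (vec ψ) ⊆ ⋃ j, tsupport (ψ j) := by
    intro x hx
    by_contra hh
    apply hx
    ext j
    have : x ∉ tsupport (ψ j) := fun h => hh (mem_iUnion.2 ⟨j, h⟩)
    show ψ j x = 0
    exact image_eq_zero_of_notMem_tsupport this
  have h2 : IsClosed (⋃ j, tsupport (ψ j)) := isClosed_iUnion_of_finite fun j => isClosed_tsupport _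
  exact (closure_minimal h1 h2).trans (iUnion_subset h.s)

lemma tst_zero {ψ : ℝ → ℝ} (h : tsupport ψ ⊆ Ioo 0 1) {x : ℝ} (hx : x ∉ Ioo (0:ℝ) 1) : ψ x = 0 :=
  image_eq_zero_of_notMem_tsupport fun h' => hx (h h')

lemma tst_dzero {ψ : ℝ → ℝ} (h : tsupport ψ ⊆ Ioo 0 1) {x : ℝ} (hx : x ∉ Ioo (0:ℝ) 1) : deriv ψ x = 0 :=
  tst_zero ((tsupport_deriv_subset (𝕜 := ℝ)).trans h) hx

/-- from `Sol` to `IsLinSol` -/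
lemma Sol.toLin {n m : ℕ} {p : Fin n → Fin n → ℝ} {a : Fin n → ℝ → ℝ → ℝ} {b : Fin n → Fin n → ℝ → ℝ → ℝ} {s : ℝ}
    {u ux ut : Fin n → ℝ → ℝ → ℝ} (h : Sol m p a b (fun _ _ _ => 0) s u ux ut) {ψ : Fin n → ℝ → ℝ}
    (h0 : ∀ j, ∀ x ∈ Icc (0:ℝ) 1, u j x s = ψ j x) :
    IsLinSol n m p (fun x t j => a j x t) (fun x t j k => b j k x t) (fun _ _ _ => 0) s (vec ψ)
      (fun x t => vec (fun j x => u j x t) x) (fun x t => vec (fun j x => ux j x t) x) (fun x t => vec (fun j x => ut j x t) x) := by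
  have cc : ∀ w : Fin n → ℝ → ℝ → ℝ, (∀ j, CS s (w j)) →
      ContinuousOn (fun q : ℝ × ℝ => vec (fun j x => w j x q.2) q.1) (Icc 0 1 ×ˢ Ici s) := fun w hw =>
    (PiLp.continuous_toLp 2 _).comp_continuousOn (continuousOn_pi.2 fun j => hw j)
  refine ⟨cc u fun j => (h.c1 j).c0, cc ux fun j => (h.c1 j).cx, cc ut fun j => (h.c1 j).ct, ?_, ?_, ?_, ?_⟩
  · intro x hx t ht j
    exact ⟨(h.c1 j).dx x hx t ht, (h.c1 j).dt x hx t ht⟩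
  · intro x hx t ht j
    exact h.eq j x hx t ht
  · intro t ht j
    have e := h.bc j t ht
    have e2 : ∑ k : Fin n, p j k * outt m u k t = ∑ k : Fin n, if m ≤ (k : ℕ) then p j k * vec (fun j x => u j x t) 0 k else p j k * vec (fun j x => u j x t) 1 k := by
      refine Finset.sum_congr rfl fun k _ => ?_
      simp only [vec_apply, outt]
      by_cases hk : (k : ℕ) < m
      · rw [if_pos hk, if_neg (by omega)]
      · rw [if_neg hk, if_pos (by omega)]
    rw [e2] at e
    constructor
    · intro hj
      rw [inn, if_pos hj] at e
      exact e
    · intro hj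
      rw [inn, if_neg (by omega)] at e
      exact e
  · intro x hx
    ext j
    exact h0 j x hx

lemma gen_rep {n m : ℕ} {p : Fin n → Fin n → ℝ} {a : Fin n → ℝ → ℝ → ℝ} {b : Fin n → Fin n → ℝ → ℝ → ℝ} {s : ℝ}
    {U : ℝ → ℝ → L2 n →L[ℝ] L2 n} (hU : GeneratedBy n m p (fun x t j => a j x t) (fun x t j k => b j k x t) U)
    {u ux ut : Fin n → ℝ → ℝ → ℝ} (h : Sol m p a b (fun _ _ _ => 0) s u ux ut) {ψ : Fin n → ℝ → ℝ} (hψ : Tst ψ)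
    (h0 : ∀ j, ∀ x ∈ Icc (0:ℝ) 1, u j x s = ψ j x) {Φ : L2 n} (hΦ : RepL Φ ψ) {t : ℝ} (ht : s ≤ t) :
    RepL (U t s Φ) (fun j x => u j x t) :=
  ⟨fun j => (h.c1 j).c0.att ht, hU.2.2.2 s (vec ψ) hψ.vec_contDiff hψ.vec_supp Φ hΦ.ae _ _ _ (h.toLin h0) t ht⟩

lemma Tst.exists_sol {n m : ℕ} {p : Fin n → Fin n → ℝ} {a ax aT : Fin n → ℝ → ℝ → ℝ} {b bx bT : Fin n → Fin n → ℝ → ℝ → ℝ}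
    {Λ A Bd : ℝ} (hΛ : 0 < Λ) (hH3 : H3cond n p) (ha : ACof m Λ A a ax aT) (hb : ∀ j k, BK1 Bd (b j k) (bx j k) (bT j k)) (s : ℝ)
    {ψ : Fin n → ℝ → ℝ} (hψ : Tst ψ) :
    ∃ u ux ut, Sol m p a b (fun _ _ _ => 0) s u ux ut ∧ ∀ j, ∀ x ∈ Icc (0:ℝ) 1, u j x s = ψ j x := by
  have c1 : ∀ j, ContDiff ℝ 1 (deriv (ψ j)) := fun j => by
    have : ContDiff ℝ (1 + 1) (ψ j) := by have := hψ.c j; norm_num; exact this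
    exact (contDiff_succ_iff_deriv.1 this).2.2
  refine _root_.exists_sol hΛ hH3 ha hb s (ψ1 := fun j => deriv (ψ j)) (ψ2 := fun j => deriv (deriv (ψ j))) ?_ ?_ ?_ ?_ ?_ ?_ ?_
  · intro j x hx
    exact (((hψ.c j).differentiable (by norm_num)) x).hasDerivAt.hasDerivWithinAt
  · intro j x hx
    exact (((c1 j).differentiable (by norm_num)) x).hasDerivAt.hasDerivWithinAt
  · intro j
    exact ((c1 j).continuous_deriv (by norm_num)).continuousOn
  · exact fun j => tst_zero (hψ.s j) (by simp)
  · exact fun j => tst_zero (hψ.s j) (by simp)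
  · exact fun j => tst_dzero (hψ.s j) (by simp)
  · exact fun j => tst_dzero (hψ.s j) (by simp)

lemma Tst.contOn {n : ℕ} {ψ : Fin n → ℝ → ℝ} (h : Tst ψ) (j : Fin n) : ContinuousOn (ψ j) (Icc 0 1) :=
  (h.c j).continuous.continuousOn

/-- density of test data -/
lemma tst_dense {n : ℕ} (F : L2 n) {ε : ℝ} (hε : 0 < ε) : ∃ Φ ψ, Tst ψ ∧ RepL Φ ψ ∧ ‖F - Φ‖ ≤ ε := by
  have hd := Lp.dense_hasCompactSupport_contDiff (E := ℝ) (F := Vn n) (μ := μ01) (p := 2) (by norm_num)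
  obtain ⟨G, ⟨g, gae, gs, gc⟩, hG⟩ := Metric.mem_closure_iff.1 (hd F) (ε/2) (half_pos hε)
  rw [dist_eq_norm] at hG
  obtain ⟨C, hC⟩ := gs.exists_bound_of_continuous gc.continuous
  have gj : ∀ j, ContDiff ℝ 2 (fun x => g x j) := fun j => (contDiff_infty.1 (contDiff_euclidean.1 gc j) 2)
  have gS : ∀ j x, (g x j)^2 ≤ C^2 := fun j x => by
    have h1 : ‖g x j‖ ≤ ‖g x‖ := PiLp.norm_apply_le _ _
    have h2 := h1.trans (hC x)
    rw [Real.norm_eq_abs] at h2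
    exact sq_le_sq' (by linarith [abs_le.1 h2]) (by linarith [abs_le.1 h2])
  have rG : RepL G (fun j x => g x j) := ⟨fun j => (gj j).continuous.continuousOn, gae.trans (ae_of_all _ fun x => rfl)⟩
  set η := min (1/8) ((ε/2)^2 / (4*(n+1)*(C^2+1))) with hη
  have η0 : 0 < η := by rw [hη]; positivity
  have η1 : η ≤ 1/8 := min_le_left _ _
  have η2 : η * (4*(n+1)*(C^2+1)) ≤ (ε/2)^2 := by
    rw [← le_div_iff₀ (by positivity)]; exact min_le_right _ _
  obtain ⟨χ, χc, χs, χp, χl, χe, -⟩ := cutoff_exists η0 (by linarith)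
  have hψ : Tst (fun (j : Fin n) x => χ x * g x j) :=
    ⟨fun j => χc.mul (gj j), fun j => (closure_mono (Function.support_mul_subset_left _ _)).trans χs⟩
  obtain ⟨Φ, hΦ⟩ := RepL.exists (fun j => hψ.contOn j)
  refine ⟨Φ, _, hψ, hΦ, ?_⟩
  have e := (rG.sub hΦ).norm_sq
  have e2 : ∑ j, ∫ x in (0:ℝ)..1, (g x j - χ x * g x j)^2 ≤ ∑ j : Fin n, 4*η*C^2 := by
    refine Finset.sum_le_sum fun j _ => ?_
    have := cut_close (g := fun x => g x j^2) η0 (by linarith) χc.continuous χp χl χe ((gj j).continuous.pow 2).continuousOn (fun x _ => gS j x) (fun x _ => sq_nonneg _)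
    refine le_trans (le_of_eq ?_) this
    congr 1; ext x; ring
  rw [Finset.sum_const, Finset.card_univ, Fintype.card_fin, nsmul_eq_mul] at e2
  have e3 : (n:ℝ) * (4*η*C^2) ≤ η * (4*(n+1)*(C^2+1)) := by
    have : 0 ≤ η * (4 * (n + C^2 + 1)) := by positivity
    nlinarith
  have e4 : ‖G - Φ‖ ≤ ε/2 := (pow_le_pow_iff_left₀ (norm_nonneg _) (by linarith) two_ne_zero).1 (by linarith)
  calc ‖F - Φ‖ = ‖(F - G) + (G - Φ)‖ := by congr 1; abel
    _ ≤ ‖F - G‖ + ‖G - Φ‖ := norm_add_le _ _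
    _ ≤ ε := by linarith

lemma opN_le {n : ℕ} (L : L2 n →L[ℝ] L2 n) {C : ℝ} (hC : 0 ≤ C)
    (h : ∀ Φ ψ, Tst ψ → RepL Φ ψ → ‖L Φ‖ ≤ C * ‖Φ‖) : ‖L‖ ≤ C := by
  refine L.opNorm_le_bound hC fun F => ?_
  have hcl : IsClosed {F : L2 n | ‖L F‖ ≤ C * ‖F‖} :=
    isClosed_le (L.continuous.norm) (continuous_const.mul continuous_norm)
  have : F ∈ closure {F : L2 n | ‖L F‖ ≤ C * ‖F‖} := by
    rw [Metric.mem_closure_iff]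
    intro ε hε
    obtain ⟨Φ, ψ, h1, h2, h3⟩ := tst_dense F (half_pos hε)
    refine ⟨Φ, h Φ ψ h1 h2, ?_⟩
    rw [dist_eq_norm]
    linarith
  rwa [hcl.closure_eq] at this




def dX (g : ℝ → ℝ → ℝ) (x t : ℝ) : ℝ := fderivWithin ℝ (fun q : ℝ × ℝ => g q.1 q.2) strip (x, t) (1, 0)
def dT (g : ℝ → ℝ → ℝ) (x t : ℝ) : ℝ := fderivWithin ℝ (fun q : ℝ × ℝ => g q.1 q.2) strip (x, t) (0, 1)

lemma strip_ud : UniqueDiffOn ℝ strip := (uniqueDiffOn_Icc zero_lt_one).prod uniqueDiffOn_univ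

lemma clm_le (L : ℝ × ℝ →L[ℝ] ℝ) (v : ℝ × ℝ) (hv : ‖v‖ ≤ 1) : |L v| ≤ ‖L‖ := by
  have := L.le_opNorm v
  rw [Real.norm_eq_abs] at this
  exact this.trans (mul_le_of_le_one_right (norm_nonneg _) hv)

lemma bk_of {g : ℝ → ℝ → ℝ} {C : ℝ} (hc : ContDiffOn ℝ 1 (fun q : ℝ × ℝ => g q.1 q.2) strip)
    (hb : ∀ i : ℕ, i ≤ 1 → ∀ q ∈ strip, ‖iteratedFDerivWithin ℝ i (fun q : ℝ × ℝ => g q.1 q.2) strip q‖ ≤ C) :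
    BK1 C g (dX g) (dT g) := by
  have hms : ∀ x ∈ Icc (0:ℝ) 1, ∀ t : ℝ, ((x, t) : ℝ × ℝ) ∈ strip := fun x hx t => ⟨hx, mem_univ _⟩
  have hsub : ∀ s, (Icc (0:ℝ) 1 ×ˢ Ici s) ⊆ strip := fun s q hq => ⟨hq.1, mem_univ _⟩
  have hfc : ContinuousOn (fderivWithin ℝ (fun q : ℝ × ℝ => g q.1 q.2) strip) strip := hc.continuousOn_fderivWithin strip_ud (by norm_num)
  have hev : ∀ v : ℝ × ℝ, ContinuousOn (fun q : ℝ × ℝ => fderivWithin ℝ (fun q : ℝ × ℝ => g q.1 q.2) strip q v) strip := fun v =>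
    hfc.clm_apply continuousOn_const
  have hF : ∀ x ∈ Icc (0:ℝ) 1, ∀ t : ℝ, HasFDerivWithinAt (fun q : ℝ × ℝ => g q.1 q.2)
      (fderivWithin ℝ (fun q : ℝ × ℝ => g q.1 q.2) strip (x, t)) strip (x, t) := fun x hx t =>
    ((hc.differentiableOn (by norm_num)) _ (hms x hx t)).hasFDerivWithinAt
  have hn : ∀ x ∈ Icc (0:ℝ) 1, ∀ t : ℝ, ‖fderivWithin ℝ (fun q : ℝ × ℝ => g q.1 q.2) strip (x, t)‖ ≤ C := fun x hx t => by
    have := hb 1 le_rfl _ (hms x hx t)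
    rwa [norm_iteratedFDerivWithin_one _ (strip_ud _ (hms x hx t))] at this
  refine ⟨fun s => ⟨hc.continuousOn.mono (hsub s), (hev _).mono (hsub s), (hev _).mono (hsub s), ?_, ?_⟩, ?_, ?_, ?_⟩
  · intro x hx t ht
    have h1 : HasDerivWithinAt (fun z : ℝ => ((z, t) : ℝ × ℝ)) (1, 0) (Icc 0 1) x :=
      (hasDerivWithinAt_id _ _).prodMk (hasDerivWithinAt_const _ _ _)
    exact (hF x hx t).comp_hasDerivWithinAt x h1 (fun z hz => hms z hz t)
  · intro x hx t ht
    have h1 : HasDerivWithinAt (fun z : ℝ => ((x, z) : ℝ × ℝ)) (0, 1) (Ici s) t :=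
      (hasDerivWithinAt_const _ _ _).prodMk (hasDerivWithinAt_id _ _)
    exact (hF x hx t).comp_hasDerivWithinAt t h1 (fun z hz => hms x hx z)
  · intro x hx t
    have := hb 0 zero_le_one _ (hms x hx t)
    rwa [norm_iteratedFDerivWithin_zero] at this
  · intro x hx t
    exact (clm_le _ _ (by simp [Prod.norm_def])).trans (hn x hx t)
  · intro x hx t
    exact (clm_le _ _ (by simp [Prod.norm_def])).trans (hn x hx t)

lemma Nrm_rep {n : ℕ} {F : L2 n} {u : Fin n → ℝ → ℝ → ℝ} {t : ℝ} (h : RepL F (fun j x => u j x t)) : Nrm u t = ‖F‖^2 := h.norm_sq.symm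

/-- uniform bound of the evolution operators -/
lemma op_bound (n m : ℕ) {Λ A P T : ℝ} (hΛ : 0 < Λ) (hA : 0 ≤ A) (hP : 0 ≤ P) (hT : 0 ≤ T) :
    ∃ K, 1 ≤ K ∧ ∀ (a ax aT : Fin n → ℝ → ℝ → ℝ) (b bx bT : Fin n → Fin n → ℝ → ℝ → ℝ), ACof m Λ A a ax aT →
      ∀ Bd, (∀ j k, BK1 Bd (b j k) (bx j k) (bT j k)) → (∀ j k, ∀ x ∈ Icc (0:ℝ) 1, ∀ t, |b j k x t| ≤ A) →
      ∀ p : Fin n → Fin n → ℝ, (∀ j k, |p j k| ≤ P) → H3cond n p →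
      ∀ U : ℝ → ℝ → L2 n →L[ℝ] L2 n, GeneratedBy n m p (fun x t j => a j x t) (fun x t j k => b j k x t) U →
      ∀ s t, s ≤ t → t ≤ s + T → ‖U t s‖ ≤ K := by
  obtain ⟨K, hK, H⟩ := EL2 n m hΛ hA hP hA hT
  refine ⟨K, hK, ?_⟩
  intro a ax aT b bx bT ha Bd hb hbA p hp hH3 U hU s t hst htT
  refine opN_le _ (by linarith) fun Φ ψ hψ hΦ => ?_
  obtain ⟨u, ux, ut, hu, hu0⟩ := hψ.exists_sol hΛ hH3 ha hb s
  have r := gen_rep hU hu hψ hu0 hΦ hst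
  have r0 : RepL Φ (fun j x => u j x s) := hΦ.congr hu0
  have e := H a ax aT ha p hp s b (fun j k => ((hb j k).c1 s).c0) (fun j k x hx t _ => hbA j k x hx t) _ (fun j => CS.const 0) u ux ut hu t ⟨hst, htT⟩
  have ez : ∀ τ : ℝ, Nrm (n := n) (fun _ _ _ => (0:ℝ)) τ = 0 := fun τ => Nrm_eq_zero (fun _ _ _ => rfl)
  have e0 : 0 ≤ ∫ τ in s..t, Otr m u τ := intervalIntegral.integral_nonneg hst fun τ _ => Otr_nonneg m u τ
  simp only [ez, intervalIntegral.integral_zero, add_zero] at e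
  rw [Nrm_rep r, Nrm_rep r0] at e
  have e1 : ‖U t s Φ‖^2 ≤ (K * ‖Φ‖)^2 := by
    have : K * ‖Φ‖^2 ≤ K^2 * ‖Φ‖^2 := mul_le_mul_of_nonneg_right (by nlinarith) (sq_nonneg _)
    rw [mul_pow]; linarith
  exact (pow_le_pow_iff_left₀ (norm_nonneg _) (by positivity) two_ne_zero).1 e1

lemma ux_eq {n m : ℕ} {p : Fin n → Fin n → ℝ} {a : Fin n → ℝ → ℝ → ℝ} {b : Fin n → Fin n → ℝ → ℝ → ℝ} {f : Fin n → ℝ → ℝ → ℝ} {s : ℝ}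
    {u ux ut : Fin n → ℝ → ℝ → ℝ} (h : Sol m p a b f s u ux ut) {ψ : Fin n → ℝ → ℝ} (hψ : Tst ψ)
    (h0 : ∀ j, ∀ x ∈ Icc (0:ℝ) 1, u j x s = ψ j x) (j : Fin n) {x : ℝ} (hx : x ∈ Icc (0:ℝ) 1) :
    ux j x s = deriv (ψ j) x := by
  have h1 := (h.c1 j).dx x hx s le_rfl
  have h2 : HasDerivWithinAt (ψ j) (deriv (ψ j) x) (Icc 0 1) x := (((hψ.c j).differentiable (by norm_num)) x).hasDerivAt.hasDerivWithinAt
  have h3 := h2.congr (f₁ := fun z => u j z s) (fun z hz => h0 j z hz) (h0 j x hx)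
  exact (uniqueDiffOn_Icc zero_lt_one x hx).eq_deriv _ h1 h3

/-- difference of the evolution operators on smooth data -/
lemma diff_H1 (n m : ℕ) {Λ A P T : ℝ} (hΛ : 0 < Λ) (hA : 0 ≤ A) (hP : 0 ≤ P) (hT : 0 ≤ T) :
    ∃ K, 1 ≤ K ∧ ∀ (a ax aT : Fin n → ℝ → ℝ → ℝ) (b bx bT : Fin n → Fin n → ℝ → ℝ → ℝ),
      Cls m Λ A a ax aT b bx bT → ∀ (a' ax' aT' : Fin n → ℝ → ℝ → ℝ) (b' bx' bT' : Fin n → Fin n → ℝ → ℝ → ℝ),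
      ACof m Λ A a' ax' aT' → ∀ Bd, (∀ j k, BK1 Bd (b' j k) (bx' j k) (bT' j k)) →
      (∀ j k, ∀ x ∈ Icc (0:ℝ) 1, ∀ t, |b' j k x t| ≤ A) →
      ∀ p : Fin n → Fin n → ℝ, (∀ j k, |p j k| ≤ P) → H3cond n p →
      ∀ ε, 0 ≤ ε → (∀ j, ∀ x ∈ Icc (0:ℝ) 1, ∀ t, |a' j x t - a j x t| ≤ ε) →
      (∀ j k, ∀ x ∈ Icc (0:ℝ) 1, ∀ t, |b' j k x t - b j k x t| ≤ ε) →
      ∀ U U' : ℝ → ℝ → L2 n →L[ℝ] L2 n, GeneratedBy n m p (fun x t j => a j x t) (fun x t j k => b j k x t) U →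
      GeneratedBy n m p (fun x t j => a' j x t) (fun x t j k => b' j k x t) U' →
      ∀ s t, s ≤ t → t ≤ s + T → ∀ Φ ψ, Tst ψ → RepL Φ ψ →
      ‖U' t s Φ - U t s Φ‖^2 ≤ K * ε^2 * ((∑ j, ∫ x in (0:ℝ)..1, ψ j x^2) + ∑ j, ∫ x in (0:ℝ)..1, deriv (ψ j) x^2) := by
  obtain ⟨K, hK, H⟩ := compare1 n m hΛ hA hP hT
  refine ⟨K, hK, ?_⟩
  intro a ax aT b bx bT h a' ax' aT' b' bx' bT' h' Bd hb' hbA p hp hH3 ε hε hae hbe U U' hU hU' s t hst htT Φ ψ hψ hΦ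
  obtain ⟨u, ux, ut, hu, hu0⟩ := hψ.exists_sol hΛ hH3 h.ac h.bk s
  obtain ⟨v, vx, vt, hv, hv0⟩ := hψ.exists_sol hΛ hH3 h' hb' s
  have r := gen_rep hU hu hψ hu0 hΦ hst
  have r' := gen_rep hU' hv hψ hv0 hΦ hst
  have e := H a ax aT b bx bT h a' ax' aT' b' h' p hp s (fun j k => ((hb' j k).c1 s).c0) hbA ε hε hae hbe u ux ut v vx vt hu hv
    (fun j x hx => by rw [hu0 j x hx, hv0 j x hx]) t ⟨hst, htT⟩
  have e1 : Nrm u s = ∑ j, ∫ x in (0:ℝ)..1, ψ j x^2 := by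
    refine Finset.sum_congr rfl fun j _ => intervalIntegral.integral_congr fun x hx => ?_
    rw [uIcc_of_le zero_le_one] at hx
    show u j x s^2 = _
    rw [hu0 j x hx]
  have e2 : Nrm ux s = ∑ j, ∫ x in (0:ℝ)..1, deriv (ψ j) x^2 := by
    refine Finset.sum_congr rfl fun j _ => intervalIntegral.integral_congr fun x hx => ?_
    rw [uIcc_of_le zero_le_one] at hx
    show ux j x s^2 = _
    rw [ux_eq hu hψ hu0 j hx]
  rw [e1, e2] at e
  rw [(r'.sub r).norm_sq]
  exact e

/-- regularisation after time T up to a small error -/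
lemma regul (n m : ℕ) {Λ A P T : ℝ} (hΛ : 0 < Λ) (hA : 0 ≤ A) (hP : 0 ≤ P) (hT : n / Λ < T) :
    ∃ K, 1 ≤ K ∧ ∀ (a ax aT : Fin n → ℝ → ℝ → ℝ) (b bx bT : Fin n → Fin n → ℝ → ℝ → ℝ),
      Cls m Λ A a ax aT b bx bT → ∀ (b' bx' bT' : Fin n → Fin n → ℝ → ℝ → ℝ),
      ∀ Bd, (∀ j k, BK1 Bd (b' j k) (bx' j k) (bT' j k)) →
      (∀ j k, ∀ x ∈ Icc (0:ℝ) 1, ∀ t, |b' j k x t| ≤ A) →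
      ∀ p : Fin n → Fin n → ℝ, (∀ j k, |p j k| ≤ P) → H3cond n p →
      ∀ ε, 0 ≤ ε → (∀ j k, ∀ x ∈ Icc (0:ℝ) 1, ∀ t, |b' j k x t - b j k x t| ≤ ε) →
      ∀ V : ℝ → ℝ → L2 n →L[ℝ] L2 n, GeneratedBy n m p (fun x t j => a j x t) (fun x t j k => b' j k x t) V →
      ∀ s Φ ψ, Tst ψ → RepL Φ ψ → ∃ Y y, ∃ y' : Fin n → ℝ → ℝ, RepL Y y ∧
      ‖V (s+T) s Φ - Y‖^2 ≤ K * ε^2 * ‖Φ‖^2 ∧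
      (∀ j, ∀ x ∈ Icc (0:ℝ) 1, HasDerivWithinAt (y j) (y' j x) (Icc 0 1) x) ∧ (∀ j, ContinuousOn (y' j) (Icc 0 1)) ∧
      (∀ j, ∫ x in (0:ℝ)..1, y j x^2 ≤ K * ‖Φ‖^2) ∧ (∀ j, ∫ x in (0:ℝ)..1, y' j x^2 ≤ K * ‖Φ‖^2) := by
  have hT0 : 0 ≤ T := le_trans (by positivity) hT.le
  obtain ⟨K1, hK1, H1⟩ := compare2 n m hΛ hA hP hT0
  obtain ⟨K2, hK2, H2⟩ := smoothing n m hΛ hA hP hT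
  refine ⟨K1 + K2, by linarith, ?_⟩
  intro a ax aT b bx bT h b' bx' bT' Bd hb' hbA p hp hH3 ε hε hbe V hV s Φ ψ hψ hΦ
  obtain ⟨u, ux, ut, hu, hu0⟩ := hψ.exists_sol hΛ hH3 h.ac h.bk s
  obtain ⟨v, vx, vt, hv, hv0⟩ := hψ.exists_sol hΛ hH3 h.ac hb' s
  obtain ⟨σ, σx, σt, hσ, hσ0⟩ := hψ.exists_sol hΛ hH3 h.ac (fun j k => h.dgl_bk hA j k) s
  have r := gen_rep hV hv hψ hv0 hΦ (by linarith : s ≤ s + T)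
  have r0 : RepL Φ (fun j x => u j x s) := hΦ.congr hu0
  have e1 := H1 a ax aT b b' h.ac p hp s (fun j k => ((h.bk j k).c1 s).c0) (fun j k => (h.bk j k).b0) (fun j k => ((hb' j k).c1 s).c0) hbA ε hε hbe
    u ux ut v vx vt hu hv (fun j x hx => by rw [hu0 j x hx, hv0 j x hx]) (s+T) ⟨by linarith, le_rfl⟩
  have e2 := H2 a ax aT b bx bT h p hp hH3 s u ux ut σ σx σt hu hσ (fun j x hx => by rw [hu0 j x hx, hσ0 j x hx])
  rw [Nrm_rep r0] at e1 e2
  have hs : s ≤ s + T := by linarith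
  obtain ⟨Y, hY⟩ := RepL.exists (y := fun j x => u j x (s+T)) (fun j => (hu.c1 j).c0.att hs)
  have q0 := sq_nonneg ‖Φ‖
  have q1 : 0 ≤ K1 * ‖Φ‖^2 := by positivity
  have n1 := Nrm_nonneg u (s+T)
  have n2 := Nrm_nonneg ux (s+T)
  refine ⟨Y, _, fun j x => ux j x (s+T), hY, ?_, fun j x hx => (hu.c1 j).dx x hx _ hs, fun j => (hu.c1 j).cx.att hs, ?_, ?_⟩
  · rw [(r.sub hY).norm_sq]
    refine le_trans e1 ?_
    have : 0 ≤ K2 * (ε^2 * ‖Φ‖^2) := by positivity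
    linarith
  · intro j
    have : ∫ x in (0:ℝ)..1, u j x (s+T)^2 ≤ Nrm u (s+T) :=
      Finset.single_le_sum (f := fun j => ∫ x in (0:ℝ)..1, u j x (s+T)^2) (fun i _ => intervalIntegral.integral_nonneg zero_le_one fun x _ => sq_nonneg _) (Finset.mem_univ j)
    linarith
  · intro j
    have : ∫ x in (0:ℝ)..1, ux j x (s+T)^2 ≤ Nrm ux (s+T) :=
      Finset.single_le_sum (f := fun j => ∫ x in (0:ℝ)..1, ux j x (s+T)^2) (fun i _ => intervalIntegral.integral_nonneg zero_le_one fun x _ => sq_nonneg _) (Finset.mem_univ j)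
    linarith




lemma sq_le_aux {x f q c e : ℝ} (hx : 0 ≤ x) (hf : 0 ≤ f) (hc : 0 ≤ c) (he : 0 ≤ e) (h : x^2 ≤ q * f^2)
    (h2 : c^2 * q ≤ e^2) : c * x ≤ e * f := by
  refine (pow_le_pow_iff_left₀ (by positivity) (by positivity) two_ne_zero).1 ?_
  rw [mul_pow, mul_pow]
  calc c^2 * x^2 ≤ c^2 * (q * f^2) := mul_le_mul_of_nonneg_left h (sq_nonneg _)
    _ = (c^2 * q) * f^2 := by ring
    _ ≤ e^2 * f^2 := mul_le_mul_of_nonneg_right h2 (sq_nonneg _)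

/-- vector approximation by test data -/
lemma approxV (n : ℕ) {ρ : ℝ} (hρ : 0 < ρ) : ∃ C, 1 ≤ C ∧ ∀ (Y : L2 n) (y y' : Fin n → ℝ → ℝ), RepL Y y →
    (∀ j, ∀ x ∈ Icc (0:ℝ) 1, HasDerivWithinAt (y j) (y' j x) (Icc 0 1) x) → (∀ j, ContinuousOn (y' j) (Icc 0 1)) →
    ∀ N, 0 < N → (∀ j, ∫ x in (0:ℝ)..1, y j x^2 ≤ N) → (∀ j, ∫ x in (0:ℝ)..1, y' j x^2 ≤ N) →
    ∃ Ψ ψ, Tst ψ ∧ RepL Ψ ψ ∧ ‖Y - Ψ‖^2 ≤ n * (ρ * N) ∧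
      (∑ j, ∫ x in (0:ℝ)..1, ψ j x^2) + (∑ j, ∫ x in (0:ℝ)..1, deriv (ψ j) x^2) ≤ 2 * n * (C * N) := by
  obtain ⟨C, hC, H⟩ := approx1 hρ
  refine ⟨C, hC, ?_⟩
  intro Y y y' hY hd hc N hN h1 h2
  choose ψ p1 p2 p3 p4 p5 using fun j => H (y j) (y' j) (hd j) (hc j) N hN (h1 j) (h2 j)
  have hψ : Tst ψ := ⟨p1, p2⟩
  obtain ⟨Ψ, hΨ⟩ := RepL.exists (fun j => hψ.contOn j)
  refine ⟨Ψ, ψ, hψ, hΨ, ?_, ?_⟩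
  · rw [norm_sub_rev, (hΨ.sub hY).norm_sq]
    calc _ ≤ ∑ j : Fin n, ρ * N := Finset.sum_le_sum fun j _ => p3 j
      _ = _ := by simp
  · have e1 : ∑ j, ∫ x in (0:ℝ)..1, ψ j x^2 ≤ ∑ j : Fin n, C * N := Finset.sum_le_sum fun j _ => p4 j
    have e2 : ∑ j, ∫ x in (0:ℝ)..1, deriv (ψ j) x^2 ≤ ∑ j : Fin n, C * N := Finset.sum_le_sum fun j _ => p5 j
    rw [Finset.sum_const, Finset.card_univ, Fintype.card_fin, nsmul_eq_mul] at e1 e2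
    linarith

lemma eps_aux {ε c d : ℝ} (h0 : 0 ≤ ε) (h1 : ε ≤ 1) (hc : 0 < c) (h : ε ≤ d / c) : c * ε^2 ≤ d := by
  rw [le_div_iff₀ hc] at h
  have e : ε^2 ≤ ε := by nlinarith
  have := mul_le_mul_of_nonneg_left e hc.le
  linarith

lemma core (n m : ℕ) {Λ A P T δ : ℝ} (hΛ : 0 < Λ) (hA : 0 ≤ A) (hP : 0 ≤ P) (hT : n / Λ < T) (hδ : 0 < δ) :
    ∃ ε₁, 0 < ε₁ ∧ ∀ ε, 0 ≤ ε → ε ≤ ε₁ →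
      ∀ (a ax aT : Fin n → ℝ → ℝ → ℝ) (b bx bT : Fin n → Fin n → ℝ → ℝ → ℝ), Cls m Λ A a ax aT b bx bT →
      ∀ (a' ax' aT' : Fin n → ℝ → ℝ → ℝ) (b' bx' bT' : Fin n → Fin n → ℝ → ℝ → ℝ), Cls m Λ A a' ax' aT' b bx bT →
      ∀ Bd, (∀ j k, BK1 Bd (b' j k) (bx' j k) (bT' j k)) → (∀ j k, ∀ x ∈ Icc (0:ℝ) 1, ∀ t, |b' j k x t| ≤ A) →
      ∀ p : Fin n → Fin n → ℝ, (∀ j k, |p j k| ≤ P) → H3cond n p →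
      (∀ j, ∀ x ∈ Icc (0:ℝ) 1, ∀ t, |a' j x t - a j x t| ≤ ε) →
      (∀ j k, ∀ x ∈ Icc (0:ℝ) 1, ∀ t, |b' j k x t - b j k x t| ≤ ε) →
      ∀ U U' : ℝ → ℝ → L2 n →L[ℝ] L2 n, GeneratedBy n m p (fun x t j => a j x t) (fun x t j k => b j k x t) U →
      GeneratedBy n m p (fun x t j => a' j x t) (fun x t j k => b' j k x t) U' →
      (∀ s, ‖(U' (s + 2 * T) (s + T) - U (s + 2 * T) (s + T)).comp (U' (s + T) s)‖ ≤ δ) ∧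
      (∀ s, ‖(U' (s + 2 * T) (s + T) - U (s + 2 * T) (s + T)).comp (U (s + T) s)‖ ≤ δ) := by
  have hT0 : 0 ≤ T := le_trans (by positivity) hT.le
  obtain ⟨K0, hK0, H0⟩ := op_bound n m hΛ hA hP hT0
  obtain ⟨K3, hK3, H3⟩ := diff_H1 n m hΛ hA hP hT0
  obtain ⟨K, hK, H⟩ := regul n m hΛ hA hP hT
  have k0 : 0 < K0 := by linarith
  have k3 : 0 < K3 := by linarith
  have k : 0 < K := by linarith
  have hρ : 0 < (δ/3)^2 / ((2*K0)^2 * (n+1) * K) := by positivity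
  obtain ⟨C, hC, HC⟩ := approxV n hρ
  set ρ := (δ/3)^2 / ((2*K0)^2 * (n+1) * K) with hρd
  have kc : 0 < C := by linarith
  refine ⟨min 1 (min ((δ/3)^2 / ((2*K0)^2 * K)) ((δ/3)^2 / (K3 * (2 * (n+1) * (C * K))))), by positivity, ?_⟩
  intro ε hε0 hε a ax aT b bx bT h a' ax' aT' b' bx' bT' h' Bd hb' hbA p hp hH3 hae hbe U U' hU hU'
  have hε1 : ε ≤ 1 := hε.trans (min_le_left _ _)
  have q1 : (2*K0)^2 * K * ε^2 ≤ (δ/3)^2 :=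
    eps_aux hε0 hε1 (by positivity) (hε.trans ((min_le_right _ _).trans (min_le_left _ _)))
  have q2 : K3 * (2 * (n+1) * (C * K)) * ε^2 ≤ (δ/3)^2 :=
    eps_aux hε0 hε1 (by positivity) (hε.trans ((min_le_right _ _).trans (min_le_right _ _)))
  have q3 : (2*K0)^2 * (n * (ρ * K)) ≤ (δ/3)^2 := by
    have e : ρ * ((2*K0)^2 * (n+1) * K) = (δ/3)^2 := by rw [hρd]; field_simp
    have : 0 ≤ ρ * ((2*K0)^2 * K) := by positivity
    rw [← e]; linarith
  have step : ∀ (V : ℝ → ℝ → L2 n →L[ℝ] L2 n) (s : ℝ), (∀ Φ ψ, Tst ψ → RepL Φ ψ → ∃ Y y, ∃ y' : Fin n → ℝ → ℝ, RepL Y y ∧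
      ‖V (s+T) s Φ - Y‖^2 ≤ K * ε^2 * ‖Φ‖^2 ∧
      (∀ j, ∀ x ∈ Icc (0:ℝ) 1, HasDerivWithinAt (y j) (y' j x) (Icc 0 1) x) ∧ (∀ j, ContinuousOn (y' j) (Icc 0 1)) ∧
      (∀ j, ∫ x in (0:ℝ)..1, y j x^2 ≤ K * ‖Φ‖^2) ∧ (∀ j, ∫ x in (0:ℝ)..1, y' j x^2 ≤ K * ‖Φ‖^2)) →
      ‖(U' (s + 2 * T) (s + T) - U (s + 2 * T) (s + T)).comp (V (s + T) s)‖ ≤ δ := by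
    intro V s hV
    refine opN_le _ hδ.le fun Φ ψ hψ hΦ => ?_
    by_cases hz : Φ = 0
    · rw [hz]; simp
    have hpos : 0 < ‖Φ‖ := norm_pos_iff.2 hz
    obtain ⟨Y, y, y', hY, e1, hd, hc, i1, i2⟩ := hV Φ ψ hψ hΦ
    obtain ⟨Ψ, ψ', hψ', hΨ, e2, e3⟩ := HC Y y y' hY hd hc (K * ‖Φ‖^2) (by positivity) i1 i2
    have o1 : ‖U (s + 2*T) (s + T)‖ ≤ K0 := H0 a ax aT b bx bT h.ac A h.bk (fun j k => (h.bk j k).b0) p hp hH3 U hU _ _ (by linarith) (by linarith)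
    have o2 : ‖U' (s + 2*T) (s + T)‖ ≤ K0 := H0 a' ax' aT' b' bx' bT' h'.ac Bd hb' hbA p hp hH3 U' hU' _ _ (by linarith) (by linarith)
    have e4 := H3 a ax aT b bx bT h a' ax' aT' b' bx' bT' h'.ac Bd hb' hbA p hp hH3 ε hε0 hae hbe U U' hU hU' (s+T) (s+2*T) (by linarith) (by linarith) Ψ ψ' hψ' hΨ
    set D := U' (s + 2 * T) (s + T) - U (s + 2 * T) (s + T) with hD
    have oD : ‖D‖ ≤ 2*K0 := (norm_sub_le _ _).trans (by linarith)
    have f1 : 2*K0 * ‖V (s+T) s Φ - Y‖ ≤ δ/3 * ‖Φ‖ :=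
      sq_le_aux (norm_nonneg _) hpos.le (by positivity) (by positivity) e1 (by linarith)
    have f2 : 2*K0 * ‖Y - Ψ‖ ≤ δ/3 * ‖Φ‖ :=
      sq_le_aux (q := n * (ρ * K)) (norm_nonneg _) hpos.le (by positivity) (by positivity) (by linarith) q3
    have f3 : 1 * ‖D Ψ‖ ≤ δ/3 * ‖Φ‖ := by
      refine sq_le_aux (q := K3 * (2 * (n+1) * (C * K)) * ε^2) (norm_nonneg _) hpos.le (by positivity) (by positivity) ?_ (by linarith)
      have : D Ψ = U' (s + 2 * T) (s + T) Ψ - U (s + 2 * T) (s + T) Ψ := rfl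
      rw [this]
      refine e4.trans ?_
      have g1 : K3 * ε^2 * ((∑ j, ∫ x in (0:ℝ)..1, ψ' j x^2) + ∑ j, ∫ x in (0:ℝ)..1, deriv (ψ' j) x^2) ≤ K3 * ε^2 * (2 * n * (C * (K * ‖Φ‖^2))) :=
        mul_le_mul_of_nonneg_left e3 (by positivity)
      have g2 : 0 ≤ K3 * ε^2 * (2 * (C * (K * ‖Φ‖^2))) := by positivity
      refine g1.trans ?_
      linarith
    have g1 : ‖D (V (s+T) s Φ - Y)‖ ≤ 2*K0 * ‖V (s+T) s Φ - Y‖ := (D.le_opNorm _).trans (mul_le_mul_of_nonneg_right oD (norm_nonneg _))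
    have g2 : ‖D (Y - Ψ)‖ ≤ 2*K0 * ‖Y - Ψ‖ := (D.le_opNorm _).trans (mul_le_mul_of_nonneg_right oD (norm_nonneg _))
    have dec : D.comp (V (s+T) s) Φ = D (V (s+T) s Φ - Y) + D (Y - Ψ) + D Ψ := by
      rw [← map_add, ← map_add]; simp
    rw [dec]
    refine (norm_add₃_le).trans ?_
    linarith
  refine ⟨fun s => step U' s ?_, fun s => step U s ?_⟩
  · exact H a' ax' aT' b bx bT h' b' bx' bT' Bd hb' hbA p hp hH3 ε hε0 hbe U' hU' s
  · refine H a ax aT b bx bT h b bx bT A h.bk (fun j k => (h.bk j k).b0) p hp hH3 ε hε0 ?_ U hU s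
    intro j k x hx t
    rw [sub_self, abs_zero]; exact hε0


/- STATEMENT 4: robustness of the exponential dichotomy of the evolution family
generated by the linear hyperbolic problem under small `BC¹`-perturbations of
`a` and small `BC`-perturbations of `b`. -/
theorem stmt_4 (n m : ℕ) (hn : 1 ≤ n) (hmn : m ≤ n)
    (p : Fin n → Fin n → ℝ) (hH3 : H3cond n p)
    (a : ℝ → ℝ → Fin n → ℝ) (b : ℝ → ℝ → Fin n → Fin n → ℝ)
    -- `a`, `b` have bounded continuous partial derivatives up to first order
    (hab : ∃ C : ℝ, ∀ j : Fin n, BCle 1 (fun x t => a x t j) C ∧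
      ∀ k : Fin n, BCle 1 (fun x t => b x t j k) C)
    (Λ₀ : ℝ) (hΛ₀ : 0 < Λ₀) (hLam : LamCond n m Λ₀ a)
    (U : ℝ → ℝ → L2 n →L[ℝ] L2 n) (hU : GeneratedBy n m p a b U)
    (α M : ℝ) (hα : 0 < α) (hM : 1 ≤ M)
    (hdich : HasExpDichotomy U α M) :
    ∃ ε₀ : ℝ, 0 < ε₀ ∧ ∃ α₁ : ℝ, 0 < α₁ ∧ α₁ ≤ α ∧ ∃ M₁ : ℝ, M ≤ M₁ ∧
      ∀ atil : ℝ → ℝ → Fin n → ℝ, ∀ btil : ℝ → ℝ → Fin n → Fin n → ℝ,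
        -- the entries of the perturbations have bounded continuous partial
        -- derivatives up to second order
        (∃ C : ℝ, ∀ j : Fin n, BCle 2 (fun x t => atil x t j) C ∧
          ∀ k : Fin n, BCle 2 (fun x t => btil x t j k) C) →
        -- `‖ã‖_{BC¹} ≤ ε₀`
        (∀ j : Fin n, ∀ i : ℕ, i ≤ 1 → ∀ q ∈ strip,
          ‖iteratedFDerivWithin ℝ i (fun q : ℝ × ℝ => atil q.1 q.2 j) strip q‖ ≤ ε₀) →
        -- `‖b̃‖_{BC} ≤ ε₀`
        (∀ j k : Fin n, ∀ q ∈ strip, |btil q.1 q.2 j k| ≤ ε₀) →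
        ∀ Utld : ℝ → ℝ → L2 n →L[ℝ] L2 n,
          GeneratedBy n m p (fun x t j => a x t j + atil x t j)
            (fun x t j k => b x t j k + btil x t j k) Utld →
          HasExpDichotomy Utld α₁ M₁ := by
  classical
  obtain ⟨C, hC⟩ := hab
  set A : ℝ := |C| + 1 with hAdef
  have hA : 0 ≤ A := by positivity
  have hCA : C ≤ A := by have := le_abs_self C; linarith
  set Λ : ℝ := Λ₀ / 2 with hΛdef
  have hΛ : 0 < Λ := by positivity
  set P : ℝ := ∑ j, ∑ k, |p j k| with hPdef
  have hP : 0 ≤ P := Finset.sum_nonneg fun j _ => Finset.sum_nonneg fun k _ => abs_nonneg _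
  have hpP : ∀ j k, |p j k| ≤ P := fun j k =>
    (Finset.single_le_sum (f := fun k => |p j k|) (fun k _ => abs_nonneg _) (Finset.mem_univ k)).trans
      (Finset.single_le_sum (f := fun j => ∑ k, |p j k|)
        (fun j _ => Finset.sum_nonneg fun k _ => abs_nonneg _) (Finset.mem_univ j))
  set T : ℝ := n / Λ + 1 with hTdef
  have hT0 : (0:ℝ) ≤ n / Λ := by positivity
  have hT : 0 < T := by positivity
  have hTn : n / Λ < T := by rw [hTdef]; linarith
  have ka : ∀ j, BK1 C (fun x t => a x t j) (dX fun x t => a x t j) (dT fun x t => a x t j) :=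
    fun j => bk_of (hC j).1.1 (hC j).1.2
  have kb : ∀ j k, BK1 C (fun x t => b x t j k) (dX fun x t => b x t j k) (dT fun x t => b x t j k) :=
    fun j k => bk_of ((hC j).2 k).1 ((hC j).2 k).2
  have hcls : Cls m Λ A (fun j x t => a x t j) (fun j => dX fun x t => a x t j) (fun j => dT fun x t => a x t j)
      (fun j k x t => b x t j k) (fun j k => dX fun x t => b x t j k) (fun j k => dT fun x t => b x t j k) := by
    refine ⟨⟨fun s j => (ka j).c1 s, fun j => ((ka j).mono hCA).b0, fun j => ((ka j).mono hCA).bx,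
      fun j => ((ka j).mono hCA).bt, ?_, ?_⟩, ?_, fun j k => (kb j k).mono hCA⟩
    · intro j hj x hx t
      have := ((hLam x hx t).1 j).1 hj
      show Λ ≤ a x t j
      linarith
    · intro j hj x hx t
      have := ((hLam x hx t).1 j).2 (not_lt.mp hj)
      show a x t j ≤ -Λ
      linarith
    · intro j k hjk x hx t
      have := (hLam x hx t).2 j k hjk
      show Λ ≤ |a x t j - a x t k|
      linarith
  obtain ⟨K, hK, HK⟩ := op_bound n m hΛ hA hP hT.le
  have hUK := HK _ _ _ _ _ _ hcls.ac A hcls.bk (fun j k => (hcls.bk j k).b0) p hpP hH3 U hU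
  obtain ⟨δ, hδ, α₁, hα₁, hαα, M₁, hMM, HR⟩ := robust hU.1 hα hM hdich hT hK hUK
  obtain ⟨ε₁, hε₁, HC⟩ := core n m hΛ hA hP hTn hδ
  have he : 0 < min ε₁ (min 1 (Λ₀ / 4)) := by positivity
  refine ⟨min ε₁ (min 1 (Λ₀ / 4)), he, α₁, hα₁, hαα, M₁, hMM, ?_⟩
  generalize hε : min ε₁ (min 1 (Λ₀ / 4)) = ε₀ at he
  have e1 : ε₀ ≤ ε₁ := hε ▸ min_le_left _ _
  have e2 : ε₀ ≤ 1 := hε ▸ (min_le_right _ _).trans (min_le_left _ _)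
  have e3 : ε₀ ≤ Λ₀ / 4 := hε ▸ (min_le_right _ _).trans (min_le_right _ _)
  intro atil btil ⟨Ct, hCt⟩ hat hbt Ut hUt
  have kat : ∀ j, BK1 ε₀ (fun x t => atil x t j) (dX fun x t => atil x t j) (dT fun x t => atil x t j) :=
    fun j => bk_of ((hCt j).1.1.of_le (by norm_num)) (hat j)
  have kbt : ∀ j k, BK1 Ct (fun x t => btil x t j k) (dX fun x t => btil x t j k) (dT fun x t => btil x t j k) :=
    fun j k => bk_of (((hCt j).2 k).1.of_le (by norm_num)) (fun i hi => ((hCt j).2 k).2 i (by omega))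
  have ka2 := fun j => ((ka j).add (kat j)).mono
    (show C + ε₀ ≤ A by have := le_abs_self C; linarith)
  have kb2 := fun j k => (kb j k).add (kbt j k)
  have hb2 : ∀ j k, ∀ x ∈ Icc (0:ℝ) 1, ∀ t, |btil x t j k| ≤ ε₀ :=
    fun j k x hx t => hbt j k (x, t) ⟨hx, mem_univ _⟩
  have ha2 : ∀ j, ∀ x ∈ Icc (0:ℝ) 1, ∀ t, |atil x t j| ≤ ε₀ := fun j => (kat j).b0
  have hcls2 : Cls m Λ A (fun j x t => a x t j + atil x t j)
      (fun j x t => dX (fun x t => a x t j) x t + dX (fun x t => atil x t j) x t)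
      (fun j x t => dT (fun x t => a x t j) x t + dT (fun x t => atil x t j) x t)
      (fun j k x t => b x t j k) (fun j k => dX fun x t => b x t j k) (fun j k => dT fun x t => b x t j k) := by
    refine ⟨⟨fun s j => (ka2 j).c1 s, fun j => (ka2 j).b0, fun j => (ka2 j).bx,
      fun j => (ka2 j).bt, ?_, ?_⟩, ?_, fun j k => (kb j k).mono hCA⟩
    · intro j hj x hx t
      have := ((hLam x hx t).1 j).1 hj
      have h2 := abs_le.mp (ha2 j x hx t)
      show Λ ≤ a x t j + atil x t j
      linarith [h2.1]
    · intro j hj x hx t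
      have := ((hLam x hx t).1 j).2 (not_lt.mp hj)
      have h2 := abs_le.mp (ha2 j x hx t)
      show a x t j + atil x t j ≤ -Λ
      linarith [h2.2]
    · intro j k hjk x hx t
      have h1 := (hLam x hx t).2 j k hjk
      have h2 := ha2 j x hx t
      have h3 := ha2 k x hx t
      have h4 : |a x t j - a x t k| ≤ |a x t j + atil x t j - (a x t k + atil x t k)| + |atil x t k - atil x t j| := by
        refine le_trans (le_of_eq ?_) (abs_add_le _ _)
        congr 1; ring
      have h5 := abs_sub (atil x t k) (atil x t j)
      show Λ ≤ |a x t j + atil x t j - (a x t k + atil x t k)|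
      linarith
  have hbA : ∀ j k, ∀ x ∈ Icc (0:ℝ) 1, ∀ t, |b x t j k + btil x t j k| ≤ A := by
    intro j k x hx t
    have h1 : |b x t j k| ≤ C := (kb j k).b0 x hx t
    have h2 := hb2 j k x hx t
    have h3 := abs_add_le (b x t j k) (btil x t j k)
    have := le_abs_self C
    linarith
  have HH := HC ε₀ he.le e1 _ _ _ _ _ _ hcls _ _ _
    (fun j k x t => b x t j k + btil x t j k)
    (fun j k x t => dX (fun x t => b x t j k) x t + dX (fun x t => btil x t j k) x t)
    (fun j k x t => dT (fun x t => b x t j k) x t + dT (fun x t => btil x t j k) x t) hcls2 (C + Ct) kb2 hbA p hpP hH3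
    (fun j x hx t => by
      have : a x t j + atil x t j - a x t j = atil x t j := by ring
      show |a x t j + atil x t j - a x t j| ≤ ε₀
      rw [this]; exact ha2 j x hx t)
    (fun j k x hx t => by
      have : b x t j k + btil x t j k - b x t j k = btil x t j k := by ring
      show |b x t j k + btil x t j k - b x t j k| ≤ ε₀
      rw [this]; exact hb2 j k x hx t)
    U Ut hU hUt
  have hUtK := HK _ _ _
    (fun j k x t => b x t j k + btil x t j k)
    (fun j k x t => dX (fun x t => b x t j k) x t + dX (fun x t => btil x t j k) x t)
    (fun j k x t => dT (fun x t => b x t j k) x t + dT (fun x t => btil x t j k) x t) hcls2.ac (C + Ct) kb2 hbA p hpP hH3 Ut hUt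
  exact HR Ut hUt.1 hUt.2.1 hUt.2.2.1 hUtK HH.1 HH.2
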